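/- There exist real constants c_8(C_16) > 0, c_12(C_16), c_14(C_16), c_15(C_16) such that #F_ℚ(C_16; X) = c_8(C_16) X^{1/8} + c_12(C_16) X^{1/12} + c_14(C_16) X^{1/14} + c_15(C_16) X^{1/15} + O(X^{1/16} (log X)^{17}) as X → ∞. -/

import Mathlib

open scoped Classical

/-- The absolute value of the discriminant of a finite intermediate field of
`AlgebraicClosure ℚ / ℚ` (junk value `0` if the field is not finite over `ℚ`). -/
noncomputable def absDisc (L : IntermediateField ℚ (AlgebraicClosure ℚ)) : ℕ :=
  if h : FiniteDimensional ℚ L then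
    letI := h
    letI : NumberField L := ⟨⟩
    (NumberField.discr L).natAbs
  else 0

/-- `#F_ℚ(G; X)`: the number of field extensions `L/ℚ` inside a fixed algebraic
closure of `ℚ` that are Galois over `ℚ` with `Gal(L/ℚ) ≅ G` and `|disc(L/ℚ)| ≤ X`. -/
noncomputable def galoisCount (G : Type) [Group G] (X : ℝ) : ℕ :=
  Nat.card {L : IntermediateField ℚ (AlgebraicClosure ℚ) //
    FiniteDimensional ℚ L ∧ IsGalois ℚ L ∧ Nonempty ((L ≃ₐ[ℚ] L) ≃* G) ∧
      (absDisc L : ℝ) ≤ X}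

noncomputable section

open scoped Real
open Real (cos exp_le_exp exp_one_lt_d9 exp_pos le_log_iff_exp_le log log_le_log log_mul
  log_nonneg log_pow mul_rpow norm_eq_abs norm_of_nonneg one_le_rpow pi_gt_three pi_pos rpow_add
  rpow_le_rpow rpow_le_rpow_of_exponent_le rpow_le_rpow_of_nonpos rpow_mul rpow_natCast rpow_neg
  rpow_one sin sqrt_eq_rpow sqrt_pos)
open Complex (I abs_re_le_norm add_re cpow_one exp exp_add mul_re neg_re norm_I norm_conj norm_exp
  norm_exp_ofReal_mul_I norm_real ofReal_im ofReal_mul ofReal_natCast ofReal_re ofReal_sin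
  ofReal_zero sub_re)
open intervalIntegral (integral_mono_on integral_symm)
open LSeries (term term_of_ne_zero)
open IntermediateField (fixedField fixedField_antitone fixingSubgroupEquiv fixingSubgroup_sup
  restrictNormalHom_ker)
open Ideal (absNorm add_mem liesOver_span_iff span)
open DirichletCharacter (norm_le_one)
open Nat (card_eq_fintype_card cast_nonneg primeCounting prime_iff_prime_int prime_two)
open Subgroup (card_top eq_top_iff' index_top zpowers)
open Fintype (mem_piFinset ofFinite piFinset)
open Finset (prod_coe_sort sum_sub_distrib)
open Module (finrank_pos)

section ExponentialSums

open Finset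

/-- The additive character `x ↦ exp (2πix)`. -/
def addE (x : ℝ) : ℂ := exp (((2 * π * x : ℝ) : ℂ) * I)

lemma norm_addE (x : ℝ) : ‖addE x‖ = 1 := norm_exp_ofReal_mul_I _

lemma addE_add (x y : ℝ) : addE (x + y) = addE x * addE y := by
  unfold addE
  rw [← exp_add]
  congr 1
  push_cast
  ring

lemma addE_sub_int (x : ℝ) (k : ℤ) : addE (x - k) = addE x := by
  unfold addE
  rw [Complex.exp_eq_exp_iff_exists_int]
  exact ⟨-k, by push_cast; ring⟩

lemma conj_addE (x : ℝ) : (starRingEnd ℂ) (addE x) = addE (-x) := by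
  unfold addE
  rw [← Complex.exp_conj]
  congr 1
  simp [Complex.conj_ofNat]

lemma addE_sub_one (d : ℝ) : addE d - 1 = 2 * sin (π * d) * I *
      (cos (π * d) + sin (π * d) * I) := by
  have h : addE d = (cos (π * d) + sin (π * d) * I) ^ 2 := by
    unfold addE
    rw [Complex.ofReal_cos, ofReal_sin, ← Complex.exp_mul_I, ← Complex.exp_nat_mul]
    congr 1
    push_cast
    ring
  have h2 : (cos (π * d) : ℂ) ^ 2 + (sin (π * d) : ℂ) ^ 2 = 1 := by bound
  rw [h]
  linear_combination h2 - (sin (π * d) : ℂ) ^ 2 * Complex.I_sq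

/-- `1 / (exp (2πid) - 1)` in terms of the cotangent. -/
lemma inv_addE_sub_one {d : ℝ} (hd : sin (π * d) ≠ 0) : (addE d - 1)⁻¹ = -(1 / 2 : ℂ) -
      ((cos (π * d) / sin (π * d) : ℝ) : ℂ) * I / 2 := by
  have hs : (sin (π * d) : ℂ) ≠ 0 := by exact_mod_cast hd
  have h2 : (cos (π * d) : ℂ) ^ 2 + (sin (π * d) : ℂ) ^ 2 = 1 := by bound
  apply inv_eq_of_mul_eq_one_right
  rw [addE_sub_one]
  push_cast
  push_cast at h2 hs
  field_simp
  linear_combination h2 - Complex.cos (π * d) ^ 2 * Complex.I_sq -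
    Complex.sin (π * d) ^ 2 * Complex.I_sq -
    I * Complex.cos (π * d) * Complex.sin (π * d) * Complex.I_sq

lemma norm_addE_sub_one (d : ℝ) : ‖addE d - 1‖ = 2 * |sin (π * d)| := by
  have e := norm_exp_ofReal_mul_I (π * d)
  rw [addE_sub_one, Complex.ofReal_cos, ofReal_sin, ← Complex.exp_mul_I, norm_mul,
    norm_mul, norm_mul, e, norm_I, ← ofReal_sin, norm_real]
  simp

lemma two_mul_le_sin_pi_mul {θ d : ℝ} (hθ : 0 ≤ θ) (h1 : θ ≤ d) (h2 : d ≤ 1 - θ) :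
    2 * θ ≤ sin (π * d) := by
  have key : ∀ y : ℝ, θ ≤ y → y ≤ 1 / 2 → 2 * θ ≤ sin (π * y) := by
    intro y hy hy2
    have := Real.mul_le_sin (x := π * y) (by bound) (by nlinarith [pi_pos])
    have e : 2 / π * (π * y) = 2 * y := by field_simp
    linarith
  rcases le_total d (1 / 2) with h | h
  · grind
  · have := key (1 - d) (by linarith) (by linarith)
    rwa [mul_sub, mul_one, Real.sin_pi_sub] at this

lemma cot_antitone_aux {x y : ℝ} (hx : 0 < sin (π * x))
    (hy : 0 < sin (π * y)) (hxy : x ≤ y) (hyx : y - x ≤ 1) :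
    cos (π * y) / sin (π * y) ≤ cos (π * x) / sin (π * x) := by
  rw [div_le_div_iff₀ hy hx]
  have := Real.sin_nonneg_of_nonneg_of_le_pi (x := π * y - π * x) (by bound) (by nlinarith [pi_pos])
  rw [Real.sin_sub] at this
  linarith

/-- **Kusmin–Landau inequality.** -/
lemma kusmin_landau {θ : ℝ} (hθ : 0 < θ) (x : ℕ → ℝ) (N : ℕ)
    (h1 : ∀ n < N, θ ≤ x (n + 1) - x n) (h2 : ∀ n < N, x (n + 1) - x n ≤ 1 - θ)
    (hm : ∀ n, n + 1 < N → x (n + 1) - x n ≤ x (n + 2) - x (n + 1)) :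
    ‖∑ n ∈ range N, addE (x n)‖ ≤ 1 / θ := by
  rcases Nat.eq_zero_or_pos N with rfl | hN
  · simp [hθ.le]
  set d : ℕ → ℝ := fun n => x (n + 1) - x n with hd
  set κ : ℕ → ℝ := fun n => cos (π * d n) / sin (π * d n) with hκ
  set c : ℕ → ℂ := fun n => (addE (d n) - 1)⁻¹ with hc
  have hsin : ∀ n < N, 2 * θ ≤ sin (π * d n) := fun n hn =>
    two_mul_le_sin_pi_mul hθ.le (h1 n hn) (h2 n hn)
  have hspos : ∀ n < N, 0 < sin (π * d n) := fun n hn => by grind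
  have hcn : ∀ n < N, c n = -(1 / 2 : ℂ) - (κ n : ℂ) * I / 2 := fun n hn =>
    inv_addE_sub_one (hspos n hn).ne'
  have hE : ∀ n < N, addE (x n) = c n * (addE (x (n + 1)) - addE (x n)) := by
    intro n hn
    have hne : addE (d n) - 1 ≠ 0 := by
      intro h0
      have := norm_addE_sub_one (d n)
      rw [h0, abs_of_pos (hspos n hn), norm_zero] at this
      grind
    have : addE (x (n + 1)) = addE (d n) * addE (x n) := by rw [← addE_add]; grind
    grind
  have hκa : ∀ n, n + 1 < N → κ (n + 1) ≤ κ n := fun n hn =>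
    cot_antitone_aux (hspos n (by omega)) (hspos _ hn) (hm n hn) (by grind)
  have key : ∀ M, M + 1 ≤ N → ‖∑ n ∈ range (M + 1), addE (x n) - c M * addE (x (M + 1))
      + c 0 * addE (x 0)‖ ≤ (κ 0 - κ M) / 2 := by
    intro M
    induction M with
    | zero =>
      intro _
      have := hE 0 hN
      have e : ∑ n ∈ range (0 + 1), addE (x n) - c 0 * addE (x (0 + 1)) + c 0 * addE (x 0) = 0 := by
        rw [zero_add, sum_range_one]; grind
      rw [e]; simp
    | succ M ih =>
      intro hM
      have ih := ih (by omega)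
      rw [sum_range_succ]
      have e : ∑ n ∈ range (M + 1), addE (x n) + addE (x (M + 1))
          - c (M + 1) * addE (x (M + 1 + 1)) + c 0 * addE (x 0) =
          (∑ n ∈ range (M + 1), addE (x n) - c M * addE (x (M + 1)) + c 0 * addE (x 0))
          + (c M - c (M + 1)) * addE (x (M + 1)) := by
        grind
      have e2 : ‖c M - c (M + 1)‖ = (κ M - κ (M + 1)) / 2 := by
        rw [hcn M (by omega), hcn (M + 1) (by omega)]
        have : -(1 / 2 : ℂ) - (κ M : ℂ) * I / 2 - (-(1 / 2 : ℂ) - (κ (M + 1) : ℂ) * I / 2) =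
          -(((κ M - κ (M + 1)) / 2 : ℝ) : ℂ) * I := by push_cast; ring
        rw [this, norm_mul, norm_neg, norm_I, mul_one, norm_real, norm_of_nonneg (by grind)]
      rw [e]
      refine (norm_add_le _ _).trans ?_
      rw [norm_mul, norm_addE, mul_one, e2]
      linarith
  obtain ⟨M, rfl⟩ : ∃ M, N = M + 1 := ⟨N - 1, by omega⟩
  have hκb : ∀ n < M + 1, |κ n| ≤ 1 / (2 * θ) := by
    intro n hn
    rw [hκ, abs_div, abs_of_pos (hspos n hn)]
    exact div_le_div₀ zero_le_one (Real.abs_cos_le_one _) (by linarith) (hsin n hn)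
  have hcb : ∀ n < M + 1, ‖c n‖ ≤ 1 / (4 * θ) := by
    intro n hn
    simp only [hc]
    rw [norm_inv, norm_addE_sub_one, abs_of_pos (hspos n hn)]
    rw [one_div]
    apply inv_anti₀ (by bound)
    grind
  have hk := key M le_rfl
  have e : ∑ n ∈ range (M + 1), addE (x n) =
    (∑ n ∈ range (M + 1), addE (x n) - c M * addE (x (M + 1)) + c 0 * addE (x 0))
    + c M * addE (x (M + 1)) - c 0 * addE (x 0) := by ring
  rw [e]
  refine (norm_sub_le _ _).trans ((add_le_add_left (norm_add_le _ _) _).trans ?_)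
  rw [norm_mul, norm_mul, norm_addE, norm_addE, mul_one, mul_one]
  have a1 := abs_le.1 (hκb 0 (by omega))
  have a2 := abs_le.1 (hκb M (by omega))
  have a3 := hcb 0 (by omega)
  have a4 := hcb M (by omega)
  have e1 : 1 / (2 * θ) = (1 / θ) / 2 := by ring
  have e2 : 1 / (4 * θ) = (1 / θ) / 4 := by ring
  grind

lemma exists_eq_Ico_of_convex (S : Finset ℕ)
    (hS : ∀ a ∈ S, ∀ b ∈ S, ∀ c, a ≤ c → c ≤ b → c ∈ S) : ∃ a M, S = Ico a (a + M) := by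
  rcases S.eq_empty_or_nonempty with rfl | hne
  · exact ⟨0, 0, by simp⟩
  · refine ⟨S.min' hne, S.max' hne - S.min' hne + 1, ?_⟩
    have h := S.min'_le_max' hne
    ext c
    rw [mem_Ico]
    constructor
    · intro hc
      have := S.min'_le c hc
      have := S.le_max' c hc
      omega
    · rintro ⟨h1, h2⟩
      exact hS _ (S.min'_mem hne) _ (S.max'_mem hne) _ h1 (by omega)

/-- Van der Corput's second derivative test, for sequences with second differences of
constant order of magnitude `l`. -/
lemma van_der_corput_two {A l : ℝ} (hA : 1 ≤ A) (hl : 0 < l) (x : ℕ → ℝ) (N : ℕ)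
    (h1 : ∀ n, n + 1 < N → l ≤ x (n + 2) - 2 * x (n + 1) + x n)
    (h2 : ∀ n, n + 1 < N → x (n + 2) - 2 * x (n + 1) + x n ≤ A * l) :
    ‖∑ n ∈ range N, addE (x n)‖ ≤ 10 * A * (N * √l + 1 / √l) := by
  have hs : 0 < √l := sqrt_pos.2 hl
  have hsq : √l * √l = l := Real.mul_self_sqrt hl.le
  rcases Nat.eq_zero_or_pos N with rfl | hN
  · simp only [range_zero, sum_empty, norm_zero]; positivity
  rcases le_or_gt (1 / 4) l with hl4 | hl4
  · have h3 : (1 : ℝ) / 2 ≤ √l := by apply Real.le_sqrt_of_sq_le; linarith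
    calc ‖∑ n ∈ range N, addE (x n)‖ ≤ ∑ n ∈ range N, ‖addE (x n)‖ := norm_sum_le _ _
      _ = N := by simp [norm_addE]
      _ ≤ 10 * 1 * (N * (1 / 2) + 0) := by grind
      _ ≤ _ := by gcongr; bound
  set d : ℕ → ℝ := fun n => x (n + 1) - x n with hd
  have hd1 : ∀ n, n + 1 < N → l ≤ d (n + 1) - d n := fun n hn => by grind
  have hd2 : ∀ n, n + 1 < N → d (n + 1) - d n ≤ A * l := fun n hn => by grind
  have grow1 : ∀ a k, a + k < N → l * k ≤ d (a + k) - d a := by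
    intro a k
    induction k with
    | zero => simp
    | succ k ih =>
      grind
  have grow2 : ∀ a k, a + k < N → d (a + k) - d a ≤ A * l * k := by
    intro a k
    induction k with
    | zero => simp
    | succ k ih =>
      grind
  have mono : ∀ a b, a ≤ b → b < N → d a ≤ d b := by
    intro a b hab hb
    obtain ⟨k, rfl⟩ := Nat.exists_eq_add_of_le hab
    have := grow1 a k hb
    have : 0 ≤ l * k := by bound
    linarith
  have short : ∀ S : Finset ℕ, (∀ n ∈ S, n < N) →
      (∀ a ∈ S, ∀ b ∈ S, d b - d a ≤ √l) → ‖∑ n ∈ S, addE (x n)‖ ≤ 1 / √l + 1 := by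
    intro S hSN hS
    rcases S.eq_empty_or_nonempty with rfl | hne
    · simp; bound
    have h := S.min'_le_max' hne
    have hsub : S ⊆ Icc (S.min' hne) (S.max' hne) := fun n hn =>
      mem_Icc.2 ⟨S.min'_le n hn, S.le_max' n hn⟩
    have hc := card_le_card hsub
    rw [Nat.card_Icc] at hc
    obtain ⟨k, hk⟩ := Nat.exists_eq_add_of_le h
    have g := grow1 (S.min' hne) k (by rw [← hk]; exact hSN _ (S.max'_mem hne))
    rw [← hk] at g
    have g2 := hS _ (S.min'_mem hne) _ (S.max'_mem hne)
    have hkk : (k : ℝ) ≤ 1 / √l := by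
      rw [le_div_iff₀ hs]
      have : l * k ≤ √l := g.trans g2
      rw [← hsq] at this
      nlinarith
    calc ‖∑ n ∈ S, addE (x n)‖ ≤ ∑ n ∈ S, ‖addE (x n)‖ := norm_sum_le _ _
      _ = S.card := by simp [norm_addE]
      _ ≤ ((k + 1 : ℕ) : ℝ) := by exact_mod_cast (by omega)
      _ ≤ _ := by grind
  have hfib : ∀ k : ℤ, ‖∑ n ∈ range N with ⌊d n⌋ = k, addE (x n)‖ ≤ 4 / √l := by
    intro k
    set S := (range N).filter (fun n => ⌊d n⌋ = k) with hS
    have hSm : ∀ n ∈ S, n < N ∧ (k : ℝ) ≤ d n ∧ d n < k + 1 := by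
      intro n hn
      rw [hS, mem_filter, mem_range] at hn
      bound
    have e1 := sum_filter_add_sum_filter_not S (fun n => d n < k + √l) (fun n => addE (x n))
    have e2 := sum_filter_add_sum_filter_not (S.filter (fun n => ¬ d n < k + √l))
      (fun n => k + 1 - √l < d n) (fun n => addE (x n))
    rw [← e1, ← e2]
    have b1 : ‖∑ n ∈ S with d n < k + √l, addE (x n)‖ ≤ 1 / √l + 1 := by
      apply short
      · grind
      grind
    have b2 : ‖∑ n ∈ (S.filter (fun n => ¬ d n < k + √l)) with k + 1 - √l < d n, addE (x n)‖
        ≤ 1 / √l + 1 := by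
      apply short
      · grind
      grind
    have b3 : ‖∑ n ∈ (S.filter (fun n => ¬ d n < k + √l)) with ¬ (k + 1 - √l < d n),
        addE (x n)‖ ≤ 1 / √l := by
      set R := (S.filter (fun n => ¬ d n < k + √l)).filter (fun n => ¬ (k + 1 - √l < d n)) with hR
      have hRm : ∀ n, n ∈ R ↔ n < N ∧ k + √l ≤ d n ∧ d n ≤ k + 1 - √l := by
        intro n
        rw [hR, mem_filter, mem_filter, hS, mem_filter, mem_range, Int.floor_eq_iff, not_lt, not_lt]
        constructor
        · grind
        · rintro ⟨h1, h2, h3⟩; exact ⟨⟨⟨h1, by linarith, by linarith⟩, h2⟩, h3⟩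
      obtain ⟨a, M, hRI⟩ := exists_eq_Ico_of_convex R (by
        intro a ha b hb c hac hcb
        rw [hRm] at ha hb ⊢
        have := mono a c hac (by omega)
        have := mono c b hcb (by omega)
        exact ⟨by omega, by linarith, by linarith⟩)
      have hmem : ∀ n < M, a + n < N ∧ k + √l ≤ d (a + n) ∧ d (a + n) ≤ k + 1 - √l := by
        intro n hn
        rw [← hRm, hRI, mem_Ico]; omega
      rw [hRI, sum_Ico_eq_sum_range]
      simp only [Nat.add_sub_cancel_left]
      have := kusmin_landau hs (fun n => x (a + n) - k * n) M (fun n hn => by grind)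
        (fun n hn => by grind)
        (fun n hn => by grind)
      refine le_of_eq_of_le ?_ this
      congr 1
      apply sum_congr rfl
      intro n _
      have := addE_sub_int (x (a + n)) (k * n)
      push_cast at this
      grind
    have hs1 : √l ≤ 1 / 2 := Real.sqrt_le_iff.2 ⟨by norm_num, by linarith⟩
    have h1l : 2 ≤ 1 / √l := by rw [le_div_iff₀ hs]; linarith
    have e4 : 4 / √l = 4 * (1 / √l) := by ring
    have := norm_add_le (∑ n ∈ S with d n < k + √l, addE (x n))
      (∑ n ∈ (S.filter (fun n => ¬ d n < k + √l)) with k + 1 - √l < d n, addE (x n) +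
       ∑ n ∈ (S.filter (fun n => ¬ d n < k + √l)) with ¬ (k + 1 - √l < d n), addE (x n))
    have := norm_add_le (∑ n ∈ (S.filter (fun n => ¬ d n < k + √l)) with k + 1 - √l < d n,
      addE (x n)) (∑ n ∈ (S.filter (fun n => ¬ d n < k + √l)) with ¬ (k + 1 - √l < d n),
      addE (x n))
    linarith
  set K := Icc ⌊d 0⌋ ⌊d (N - 1)⌋ with hK
  have hmaps : ∀ n ∈ range N, ⌊d n⌋ ∈ K := by
    intro n hn
    rw [mem_range] at hn
    rw [hK, mem_Icc]
    exact ⟨Int.floor_mono (mono 0 n (by omega) hn),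
      Int.floor_mono (mono n (N - 1) (by omega) (by omega))⟩
  rw [← sum_fiberwise_of_maps_to hmaps]
  have hKc : (K.card : ℝ) ≤ A * l * N + 2 := by
    rw [hK, Int.card_Icc]
    have h0 : ⌊d 0⌋ ≤ ⌊d (N - 1)⌋ := (mem_Icc.1 (hmaps 0 (by grind))).2
    have e : (((⌊d (N - 1)⌋ + 1 - ⌊d 0⌋).toNat : ℤ) : ℝ) = ⌊d (N - 1)⌋ + 1 - ⌊d 0⌋ := by
      rw [Int.toNat_of_nonneg (by omega)]; grind
    rw [Int.cast_natCast] at e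
    rw [e]
    have g := grow2 0 (N - 1) (by omega)
    rw [zero_add] at g
    have : ((N - 1 : ℕ) : ℝ) ≤ N := by exact_mod_cast Nat.sub_le _ _
    have : A * l * ((N - 1 : ℕ) : ℝ) ≤ A * l * N := by gcongr
    have := Int.floor_le (d (N - 1))
    have := Int.lt_floor_add_one (d 0)
    linarith
  calc ‖∑ k ∈ K, ∑ n ∈ range N with ⌊d n⌋ = k, addE (x n)‖
      ≤ ∑ k ∈ K, 4 / √l := norm_sum_le_of_le _ fun k _ => hfib k
    _ = K.card * (4 / √l) := by simp
    _ ≤ (A * l * N + 2) * (4 / √l) := by gcongr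
    _ = 4 * A * N * √l + 8 / √l := by
      field_simp
      grind
    _ ≤ 10 * A * (N * √l + 1 / √l) := by
      have a1 : 0 ≤ A * N * √l := by positivity
      have a2 : 0 ≤ (A - 1) * (1 / √l) := mul_nonneg (by linarith) (by bound)
      have a3 : 0 < 1 / √l := by bound
      grind

end ExponentialSums

section WeylDifferencing

open Finset

/-- The Weyl–van der Corput differencing inequality. -/
lemma weyl_van_der_corput (z : ℕ → ℂ) (hz : ∀ n, ‖z n‖ ≤ 1) {N H : ℕ} (hH : 1 ≤ H) (hHN : H ≤ N) :
    ‖∑ n ∈ range N, z n‖ ^ 2 ≤ 4 * N / H * (N + ∑ h ∈ Ico 1 H,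
      ‖∑ n ∈ range (N - h), z (n + h) * (starRingEnd ℂ) (z n)‖) := by
  set c : ℕ → ℝ := fun h => ‖∑ n ∈ range (N - h), z (n + h) * (starRingEnd ℂ) (z n)‖ with hc
  set w : ℕ → ℕ → ℂ := fun m k => if k ≤ m ∧ m < N + k then z (m - k) else 0 with hw
  have hcorr : ∀ k l, k ≤ l → l < H → ∑ m ∈ range (N + H), w m k * (starRingEnd ℂ) (w m l) =
        ∑ n ∈ range (N - (l - k)), z (n + (l - k)) * (starRingEnd ℂ) (z n) := by
    intro k l hkl hl
    symm
    apply sum_of_injOn (fun n => l + n)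
    · bound
    · intro n hn
      grind
    · intro m hm hm2
      simp only [hw]
      split_ifs with h1 h2
      · exfalso
        apply hm2
        refine ⟨m - l, ?_, ?_⟩
        · grind
        grind
      all_goals simp
    grind
  have hnorm : ∀ k < H, ∀ l < H, ‖∑ m ∈ range (N + H), w m k * (starRingEnd ℂ) (w m l)‖ =
        if k ≤ l then c (l - k) else c (k - l) := by
    intro k hk l hl
    split_ifs with h
    · grind
    · rw [← norm_conj, map_sum]
      simp only [map_mul, Complex.conj_conj]
      simp only [mul_comm ((starRingEnd ℂ) (w _ k))]
      grind
  have hsum1 : ∀ k < H, ∑ m ∈ range (N + H), w m k = ∑ n ∈ range N, z n := by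
    intro k hk
    symm
    apply sum_of_injOn (fun n => k + n)
    · bound
    · intro n hn
      simp only [coe_range, Set.mem_Iio] at hn ⊢
      omega
    · intro m hm hm2
      simp only [hw]
      split_ifs with h1
      · exfalso
        apply hm2
        refine ⟨m - k, ?_, ?_⟩
        · simp only [coe_range, Set.mem_Iio]; omega
        grind
      · rfl
    · intro n hn
      rw [mem_range] at hn
      simp only [hw]
      rw [if_pos (by omega)]
      bound
  have hc0 : ∀ h, 0 ≤ c h := fun h => norm_nonneg _
  have hrow : ∀ k < H, ∑ l ∈ range H, (if k ≤ l then c (l - k) else c (k - l)) ≤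
      2 * ∑ h ∈ range H, c h := by
    intro k hk
    rw [sum_ite, two_mul]
    apply add_le_add
    · rw [← sum_image (f := c) (g := fun l => l - k)]
      · apply sum_le_sum_of_subset_of_nonneg
        · intro h hh
          simp only [mem_image, mem_filter, mem_range] at hh ⊢
          omega
        bound
      · intro a ha b hb h
        simp only [coe_filter, mem_range, Set.mem_ofPred_eq] at ha hb h
        omega
    · rw [← sum_image (f := c) (g := fun l => k - l)]
      · apply sum_le_sum_of_subset_of_nonneg
        · intro h hh
          simp only [mem_image, mem_filter, mem_range] at hh ⊢
          omega
        bound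
      · intro a ha b hb h
        simp only [coe_filter, mem_range, Set.mem_ofPred_eq] at ha hb h
        omega
  have hsq : ∑ m ∈ range (N + H), ‖∑ k ∈ range H, w m k‖ ^ 2 ≤ H * (2 * ∑ h ∈ range H, c h) := by
    have e : ((∑ m ∈ range (N + H), ‖∑ k ∈ range H, w m k‖ ^ 2 : ℝ) : ℂ) =
        ∑ k ∈ range H, ∑ l ∈ range H, ∑ m ∈ range (N + H), w m k * (starRingEnd ℂ) (w m l) := by
      push_cast
      have : ∀ m, ((‖∑ k ∈ range H, w m k‖ : ℂ)) ^ 2 =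
          ∑ k ∈ range H, ∑ l ∈ range H, w m k * (starRingEnd ℂ) (w m l) := by
        intro m
        rw [← Complex.mul_conj', map_sum, sum_mul_sum]
      simp_rw [this]
      rw [sum_comm]
      apply sum_congr rfl
      intro k _
      rw [sum_comm]
    have hn0 : 0 ≤ ∑ m ∈ range (N + H), ‖∑ k ∈ range H, w m k‖ ^ 2 := sum_nonneg fun _ _ => by bound
    rw [← Complex.norm_of_nonneg hn0, e]
    calc _ ≤ ∑ k ∈ range H, ∑ l ∈ range H, (if k ≤ l then c (l - k) else c (k - l)) := by
          refine norm_sum_le_of_le _ fun k hk => norm_sum_le_of_le _ fun l hl => ?_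
          rw [hnorm k (mem_range.1 hk) l (mem_range.1 hl)]
      _ ≤ ∑ k ∈ range H, 2 * ∑ h ∈ range H, c h := sum_le_sum fun k hk => hrow k (mem_range.1 hk)
      _ = _ := by simp
  have hCS : (H * ‖∑ n ∈ range N, z n‖) ^ 2 ≤
      (N + H) * ∑ m ∈ range (N + H), ‖∑ k ∈ range H, w m k‖ ^ 2 := by
    have e : (H : ℂ) * ∑ n ∈ range N, z n = ∑ m ∈ range (N + H), ∑ k ∈ range H, w m k := by
      rw [sum_comm, sum_congr rfl fun k hk => hsum1 k (mem_range.1 hk)]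
      simp
    have e2 : H * ‖∑ n ∈ range N, z n‖ = ‖∑ m ∈ range (N + H), ∑ k ∈ range H, w m k‖ := by
      rw [← e, norm_mul]; simp
    rw [e2]
    calc _ ≤ (∑ m ∈ range (N + H), ‖∑ k ∈ range H, w m k‖) ^ 2 := by
          bound
      _ ≤ _ := by
          have := sq_sum_le_card_mul_sum_sq (s := range (N + H))
            (f := fun m => ‖∑ k ∈ range H, w m k‖)
          simpa using this
  have hc0N : c 0 ≤ N := by
    simp only [hc]
    refine (norm_sum_le_of_le (n := fun _ => (1 : ℝ)) _ fun n _ => ?_).trans (by simp)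
    rw [norm_mul, norm_conj]
    bound
  have hsplit : ∑ h ∈ range H, c h = c 0 + ∑ h ∈ Ico 1 H, c h := by
    rw [range_eq_Ico, sum_eq_sum_Ico_succ_bot (by omega)]
  have hHpos : (0 : ℝ) < H := by bound
  have hHN' : (H : ℝ) ≤ N := by exact_mod_cast hHN
  have hS0 : 0 ≤ ∑ h ∈ Ico 1 H, c h := sum_nonneg fun _ _ => hc0 _
  have hfin : (H * ‖∑ n ∈ range N, z n‖) ^ 2 ≤ (2 * N) * (H * (2 * (N + ∑ h ∈ Ico 1 H, c h))) := by
    refine hCS.trans ?_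
    refine mul_le_mul (by linarith) (hsq.trans ?_) (sum_nonneg fun _ _ => by bound) (by bound)
    rw [hsplit]
    gcongr
  rw [div_mul_eq_mul_div, le_div_iff₀ hHpos]
  have : H * (‖∑ n ∈ range N, z n‖ ^ 2 * H) ≤ H * (4 * N * (N + ∑ h ∈ Ico 1 H, c h)) := by nlinarith
  exact le_of_mul_le_mul_left this hHpos

lemma norm_sum_addE_le (s : Finset ℕ) (x : ℕ → ℝ) : ‖∑ n ∈ s, addE (x n)‖ ≤ s.card := by
  refine (norm_sum_le _ _).trans ?_
  simp [norm_addE]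

lemma addE_mul_conj (x y : ℝ) : addE x * (starRingEnd ℂ) (addE y) = addE (x - y) := by
  rw [conj_addE, ← addE_add, sub_eq_add_neg]

/-- Combining the differencing inequality with a bound for the differenced sums that is uniform
in the shift. -/
lemma differencing_bound (x : ℕ → ℝ) {N H : ℕ} (hH : 1 ≤ H) (hHN : H ≤ N) {B : ℝ}
    (hB : ∀ h, 1 ≤ h → h < H → ‖∑ n ∈ range (N - h), addE (x (n + h) - x n)‖ ≤ B)
    (hB0 : 0 ≤ B) :
    ‖∑ n ∈ range N, addE (x n)‖ ^ 2 ≤ 4 * N ^ 2 / H + 4 * N * B := by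
  have hHpos : (0 : ℝ) < H := by bound
  have := weyl_van_der_corput (fun n => addE (x n)) (fun n => (norm_addE _).le) hH hHN
  simp only [addE_mul_conj] at this
  refine this.trans ?_
  have hb : ∑ h ∈ Ico 1 H, ‖∑ n ∈ range (N - h), addE (x (n + h) - x n)‖ ≤ H * B := by
    calc _ ≤ ∑ h ∈ Ico 1 H, B := sum_le_sum fun h hh => by
            grind
      _ = ((H - 1 : ℕ) : ℝ) * B := by simp
      _ ≤ H * B := by gcongr; grind
  calc _ ≤ 4 * N / H * (N + H * B) := by gcongr
    _ = _ := by field_simp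

lemma exists_nat_rpow {l a : ℝ} (hl : 0 < l) (hl1 : l ≤ 1) (ha : 0 < a) :
    ∃ H : ℕ, 1 ≤ H ∧ l ^ (-a) ≤ H ∧ (H : ℝ) ≤ 2 * l ^ (-a) ∧ ∀ N : ℕ, l ^ (-a) ≤ N → H ≤ N := by
  have h1 : 1 ≤ l ^ (-a) := Real.one_le_rpow_of_pos_of_le_one_of_nonpos hl hl1 (by linarith)
  refine ⟨⌈l ^ (-a)⌉₊, Nat.one_le_ceil_iff.2 (by linarith), Nat.le_ceil _, ?_, ?_⟩
  · have := (Nat.ceil_lt_add_one (by linarith : 0 ≤ l ^ (-a))).le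
    linarith
  norm_num

/-- A third derivative test. -/
lemma van_der_corput_three {A l : ℝ} (hA : 1 ≤ A) (hl : 0 < l) (x : ℕ → ℝ) (N : ℕ)
    (h1 : ∀ n, n + 2 < N → l ≤ x (n + 3) - 3 * x (n + 2) + 3 * x (n + 1) - x n)
    (h2 : ∀ n, n + 2 < N → x (n + 3) - 3 * x (n + 2) + 3 * x (n + 1) - x n ≤ A * l) :
    ‖∑ n ∈ range N, addE (x n)‖ ^ 2 ≤
      100 * A * (N ^ 2 * l ^ (1 / 3 : ℝ) + N * l ^ (-(1 / 2) : ℝ)) := by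
  have triv : ‖∑ n ∈ range N, addE (x n)‖ ^ 2 ≤ (N : ℝ) ^ 2 := by
    gcongr; simpa using norm_sum_addE_le (range N) x
  have p1 : 0 ≤ (N : ℝ) ^ 2 * l ^ (1 / 3 : ℝ) := by bound
  have p2 : 0 ≤ (N : ℝ) * l ^ (-(1 / 2) : ℝ) := by bound
  have triv2 : ∀ b : ℝ, b ≤ N ^ 2 * l ^ (1 / 3 : ℝ) + N * l ^ (-(1 / 2) : ℝ) →
      b ≤ 100 * A * (N ^ 2 * l ^ (1 / 3 : ℝ) + N * l ^ (-(1 / 2) : ℝ)) := by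
    intro b hb
    nlinarith
  rcases le_or_gt 1 l with hl1 | hl1
  · refine triv.trans (triv2 _ ?_)
    have : (1 : ℝ) ≤ l ^ (1 / 3 : ℝ) := one_le_rpow hl1 (by norm_num)
    nlinarith [sq_nonneg (N : ℝ)]
  obtain ⟨H, hH1, hHl, hHu, hHN⟩ := exists_nat_rpow hl hl1.le (a := 1 / 3) (by norm_num)
  rcases le_or_gt (l ^ (-(1 / 3) : ℝ)) N with hN | hN
  swap
  · refine triv.trans (triv2 _ ?_)
    have : l ^ (-(1 / 3) : ℝ) ≤ l ^ (-(1 / 2) : ℝ) :=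
      Real.rpow_le_rpow_of_exponent_ge hl hl1.le (by norm_num)
    have h0 : (0 : ℝ) ≤ N := by bound
    nlinarith
  have hHpos : (0 : ℝ) < H := by bound
  have key := differencing_bound x hH1 (hHN N hN)
    (B := 10 * A * (N * √(l * H) + l ^ (-(1 / 2) : ℝ))) (by
      intro h hh1 hh2
      have hh0 : (0 : ℝ) < h := by bound
      have hd : ∀ n k, x (n + k + 2) - x (n + 2) - 2 * (x (n + k + 1) - x (n + 1)) +
          (x (n + k) - x n) = ∑ j ∈ range k, (x (n + j + 3) - 3 * x (n + j + 2) +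
            3 * x (n + j + 1) - x (n + j)) := by
        intro n k
        induction k with
        | zero => simp
        | succ k ih =>
          rw [sum_range_succ, ← ih]
          ring_nf
      have v := van_der_corput_two hA (l := l * h) (by bound) (fun n => x (n + h) - x n) (N - h) (by
          intro n hn
          have e := hd n h
          have : (range h).card • l ≤ _ := card_nsmul_le_sum (range h) _ l (fun j hj =>
            h1 (n + j) (by grind))
          grind) (by
          intro n hn
          have e := hd n h
          have : _ ≤ (range h).card • (A * l) := sum_le_card_nsmul (range h) _ (A * l)
            (fun j hj => h2 (n + j) (by grind))
          grind)
      refine v.trans ?_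
      have a1 : ((N - h : ℕ) : ℝ) ≤ N := by norm_num
      have a2 : √(l * h) ≤ √(l * H) := by gcongr
      have a3 : 1 / √(l * h) ≤ l ^ (-(1 / 2) : ℝ) := by
        rw [rpow_neg hl.le, ← sqrt_eq_rpow, one_div]
        apply inv_anti₀ (sqrt_pos.2 hl)
        bound
      gcongr) (by positivity)
  refine key.trans ?_
  have b1 : 4 * (N : ℝ) ^ 2 / H ≤ 4 * N ^ 2 * l ^ (1 / 3 : ℝ) := by
    rw [div_le_iff₀ hHpos]
    have : 1 ≤ l ^ (1 / 3 : ℝ) * H := by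
      calc (1 : ℝ) = l ^ (1 / 3 : ℝ) * l ^ (-(1 / 3) : ℝ) := by
            rw [← rpow_add hl]; norm_num
        _ ≤ _ := by gcongr
    nlinarith [sq_nonneg (N : ℝ)]
  have b2 : √(l * H) ≤ 2 * l ^ (1 / 3 : ℝ) := by
    apply Real.sqrt_le_iff.2 ⟨by bound, ?_⟩
    have e : l * l ^ (-(1 / 3) : ℝ) = (l ^ (1 / 3 : ℝ)) ^ 2 := by
      rw [← rpow_natCast, ← rpow_mul hl.le]
      nth_rw 1 [← rpow_one l]
      rw [← rpow_add hl]
      norm_num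
    calc l * H ≤ l * (2 * l ^ (-(1 / 3) : ℝ)) := by gcongr
      _ = 2 * (l ^ (1 / 3 : ℝ)) ^ 2 := by grind
      _ ≤ _ := by nlinarith [sq_nonneg (l ^ (1 / 3 : ℝ))]
  have b3 : 4 * (N : ℝ) * (10 * A * (N * √(l * H) + l ^ (-(1 / 2) : ℝ))) ≤
    4 * (N : ℝ) * (10 * A * (N * (2 * l ^ (1 / 3 : ℝ)) + l ^ (-(1 / 2) : ℝ))) := by gcongr
  nlinarith

/-- A fourth derivative test. -/
lemma van_der_corput_four {A l : ℝ} (hA : 1 ≤ A) (hl : 0 < l) (x : ℕ → ℝ) (N : ℕ)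
    (h1 : ∀ n, n + 3 < N → l ≤ x (n + 4) - 4 * x (n + 3) + 6 * x (n + 2) - 4 * x (n + 1) + x n)
    (h2 : ∀ n, n + 3 < N →
      x (n + 4) - 4 * x (n + 3) + 6 * x (n + 2) - 4 * x (n + 1) + x n ≤ A * l) :
    ‖∑ n ∈ range N, addE (x n)‖ ^ 2 ≤
      100 * A * (N ^ 2 * l ^ (1 / 7 : ℝ) + N * √N * l ^ (-(1 / 4) : ℝ)) := by
  have triv : ‖∑ n ∈ range N, addE (x n)‖ ^ 2 ≤ (N : ℝ) ^ 2 := by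
    gcongr; simpa using norm_sum_addE_le (range N) x
  have p1 : 0 ≤ (N : ℝ) ^ 2 * l ^ (1 / 7 : ℝ) := by bound
  have p2 : 0 ≤ (N : ℝ) * √N * l ^ (-(1 / 4) : ℝ) := by bound
  have triv2 : ∀ b : ℝ, b ≤ N ^ 2 * l ^ (1 / 7 : ℝ) + N * √N * l ^ (-(1 / 4) : ℝ) →
      b ≤ 100 * A * (N ^ 2 * l ^ (1 / 7 : ℝ) + N * √N * l ^ (-(1 / 4) : ℝ)) := by
    intro b hb
    nlinarith
  rcases Nat.eq_zero_or_pos N with rfl | hN0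
  · simp
  have hN1 : (1 : ℝ) ≤ N := by bound
  have hsN : 1 ≤ √(N : ℝ) := Real.one_le_sqrt.2 hN1
  rcases le_or_gt 1 l with hl1 | hl1
  · refine triv.trans (triv2 _ ?_)
    have : (1 : ℝ) ≤ l ^ (1 / 7 : ℝ) := one_le_rpow hl1 (by norm_num)
    nlinarith [sq_nonneg (N : ℝ)]
  obtain ⟨H, hH1, hHl, hHu, hHN⟩ := exists_nat_rpow hl hl1.le (a := 1 / 7) (by norm_num)
  rcases le_or_gt (l ^ (-(1 / 7) : ℝ)) N with hN | hN
  swap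
  · refine triv.trans (triv2 _ ?_)
    have : l ^ (-(1 / 7) : ℝ) ≤ l ^ (-(1 / 4) : ℝ) :=
      Real.rpow_le_rpow_of_exponent_ge hl hl1.le (by norm_num)
    have h3 : (N : ℝ) ≤ √N * l ^ (-(1 / 4) : ℝ) := by nlinarith
    nlinarith
  have hHpos : (0 : ℝ) < H := by bound
  have key := differencing_bound x hH1 (hHN N hN)
    (B := 10 * A * (N * (l * H) ^ (1 / 6 : ℝ) + √N * l ^ (-(1 / 4) : ℝ))) (by
      intro h hh1 hh2
      have hh0 : (0 : ℝ) < h := by bound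
      have hd : ∀ n k, x (n + k + 3) - x (n + 3) - 3 * (x (n + k + 2) - x (n + 2)) +
          3 * (x (n + k + 1) - x (n + 1)) - (x (n + k) - x n) =
          ∑ j ∈ range k, (x (n + j + 4) - 4 * x (n + j + 3) + 6 * x (n + j + 2) -
            4 * x (n + j + 1) + x (n + j)) := by
        intro n k
        induction k with
        | zero => simp
        | succ k ih =>
          rw [sum_range_succ, ← ih]
          ring_nf
      have v := van_der_corput_three hA (l := l * h) (by bound)
        (fun n => x (n + h) - x n) (N - h) (by
          intro n hn
          have e := hd n h
          have : (range h).card • l ≤ _ := card_nsmul_le_sum (range h) _ l (fun j hj =>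
            h1 (n + j) (by grind))
          grind) (by
          intro n hn
          have e := hd n h
          have : _ ≤ (range h).card • (A * l) := sum_le_card_nsmul (range h) _ (A * l)
            (fun j hj => h2 (n + j) (by grind))
          grind)
      have a1 : ((N - h : ℕ) : ℝ) ≤ N := by norm_num
      have a2 : (l * h) ^ (1 / 3 : ℝ) ≤ ((l * H) ^ (1 / 6 : ℝ)) ^ 2 := by
        rw [← rpow_natCast, ← rpow_mul (by bound)]
        norm_num
        gcongr
      have a3 : (l * h) ^ (-(1 / 2) : ℝ) ≤ (l ^ (-(1 / 4) : ℝ)) ^ 2 := by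
        rw [← rpow_natCast, ← rpow_mul hl.le]
        norm_num
        apply rpow_le_rpow_of_nonpos hl ?_ (by norm_num)
        bound
      refine abs_le_of_sq_le_sq' ?_ (by positivity) |>.2
      refine v.trans ?_
      have s : √(N : ℝ) ^ 2 = N := Real.sq_sqrt (by bound)
      set u := (l * H) ^ (1 / 6 : ℝ)
      set v := l ^ (-(1 / 4) : ℝ)
      have hu : 0 ≤ u := by bound
      have hv : 0 ≤ v := by bound
      calc 100 * A * (((N - h : ℕ) : ℝ) ^ 2 * (l * h) ^ (1 / 3 : ℝ) +
              ((N - h : ℕ) : ℝ) * (l * h) ^ (-(1 / 2) : ℝ))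
          ≤ 100 * A * (N ^ 2 * u ^ 2 + N * v ^ 2) := by gcongr
        _ = 100 * A * (N ^ 2 * u ^ 2 + √N ^ 2 * v ^ 2) := by rw [s]
        _ ≤ 100 * (A * A) * (N * u + √N * v) ^ 2 := by
          have q : 0 ≤ (N * u) * (√N * v) := by positivity
          gcongr
          · nlinarith
          grind
        _ = _ := by ring) (by positivity)
  refine key.trans ?_
  have b1 : 4 * (N : ℝ) ^ 2 / H ≤ 4 * N ^ 2 * l ^ (1 / 7 : ℝ) := by
    rw [div_le_iff₀ hHpos]
    have : 1 ≤ l ^ (1 / 7 : ℝ) * H := by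
      calc (1 : ℝ) = l ^ (1 / 7 : ℝ) * l ^ (-(1 / 7) : ℝ) := by
            rw [← rpow_add hl]; norm_num
        _ ≤ _ := by gcongr
    nlinarith [sq_nonneg (N : ℝ)]
  have b2 : (l * H) ^ (1 / 6 : ℝ) ≤ 2 * l ^ (1 / 7 : ℝ) := by
    calc (l * H) ^ (1 / 6 : ℝ) ≤ (2 * l ^ (6 / 7 : ℝ)) ^ (1 / 6 : ℝ) := by
          refine rpow_le_rpow (by bound) ?_ (by norm_num)
          calc l * H ≤ l * (2 * l ^ (-(1 / 7) : ℝ)) := by gcongr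
            _ = 2 * (l ^ (1 : ℝ) * l ^ (-(1 / 7) : ℝ)) := by rw [rpow_one]; ring
            _ = _ := by rw [← rpow_add hl]; norm_num
      _ = 2 ^ (1 / 6 : ℝ) * l ^ (1 / 7 : ℝ) := by
          rw [mul_rpow (by norm_num) (by bound), ← rpow_mul hl.le]; norm_num
      _ ≤ 2 ^ (1 : ℝ) * l ^ (1 / 7 : ℝ) := by gcongr <;> norm_num
      _ = _ := by bound
  have b3 : 4 * (N : ℝ) * (10 * A * (N * (l * H) ^ (1 / 6 : ℝ) + √N * l ^ (-(1 / 4) : ℝ))) ≤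
    4 * (N : ℝ) * (10 * A * (N * (2 * l ^ (1 / 7 : ℝ)) + √N * l ^ (-(1 / 4) : ℝ))) := by
    gcongr
  nlinarith

end WeylDifferencing

section LogPhase

open Finset

/-- Iterated forward differences with step one. -/
def iterDiff : ℕ → (ℝ → ℝ) → ℝ → ℝ
  | 0, f, x => f x
  | k + 1, f, x => iterDiff k f (x + 1) - iterDiff k f x

lemma hasDerivAt_iterDiff {f f' : ℝ → ℝ} (h : ∀ y, 0 < y → HasDerivAt f (f' y) y) (k : ℕ) :
    ∀ y, 0 < y → HasDerivAt (iterDiff k f) (iterDiff k f' y) y := by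
  induction k with
  | zero => exact h
  | succ k ih =>
    intro y hy
    exact ((ih (y + 1) (by linarith)).comp_add_const y 1).sub (ih y hy)

lemma exists_iterDiff_eq {g : ℕ → ℝ → ℝ}
    (h : ∀ j y, 0 < y → HasDerivAt (g j) (g (j + 1) y) y) (k : ℕ) :
    ∀ (j : ℕ) (x : ℝ), 0 < x → ∃ η : ℝ, x ≤ η ∧ η ≤ x + k ∧ iterDiff k (g j) x = g (j + k) η := by
  induction k with
  | zero => bound
  | succ k ih =>
    intro j x hx
    have hd := hasDerivAt_iterDiff (h j) k
    obtain ⟨ξ, hξ, e⟩ := exists_hasDerivAt_eq_slope (iterDiff k (g j)) (iterDiff k (g (j + 1)))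
      (show x < x + 1 by linarith)
      (fun y hy => (hd y (by grind)).continuousAt.continuousWithinAt)
      (fun y hy => hd y (by grind))
    obtain ⟨η, h1, h2, h3⟩ := ih (j + 1) ξ (by grind)
    refine ⟨η, by linarith [hξ.1], by push_cast; linarith [hξ.2], ?_⟩
    have e' : iterDiff (k + 1) (g j) x = iterDiff k (g (j + 1)) ξ := by rw [e]; simp [iterDiff]
    grind

/-- The successive derivatives of `-log`. -/
def negLogDeriv : ℕ → ℝ → ℝ
  | 0, y => -log y
  | j + 1, y => (-1) ^ (j + 1) * (j.factorial : ℝ) * (y ^ (j + 1))⁻¹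

lemma hasDerivAt_negLogDeriv (j : ℕ) (y : ℝ) (hy : 0 < y) :
    HasDerivAt (negLogDeriv j) (negLogDeriv (j + 1) y) y := by
  cases j with
  | zero =>
    have := (Real.hasDerivAt_log hy.ne').neg
    refine this.congr_deriv ?_
    simp [negLogDeriv]
  | succ j =>
    have := ((hasDerivAt_pow (j + 1) y).inv (by positivity)).const_mul
      ((-1) ^ (j + 1) * (j.factorial : ℝ))
    refine this.congr_deriv ?_
    simp only [negLogDeriv, Nat.factorial_succ]
    grind

/-- The phase `n ↦ -(t/2π) log (a + n)`. -/
def logPhase (t a : ℝ) (n : ℕ) : ℝ := -(t / (2 * π) * log (a + n))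

lemma iterDiff_log_bounds {N a : ℝ} (hN : 1 ≤ N) (ha : N ≤ a) (ha2 : a ≤ 2 * N) {n k : ℕ}
    (hn : (n : ℝ) ≤ N) (hk : k ≤ 4) (hk0 : 1 ≤ k) :
    ∃ η, N ≤ η ∧ η ≤ 7 * N ∧
      iterDiff k (negLogDeriv 0) (a + n) = (-1) ^ k * ((k - 1).factorial : ℝ) * (η ^ k)⁻¹ := by
  obtain ⟨η, h1, h2, h3⟩ := exists_iterDiff_eq hasDerivAt_negLogDeriv k 0 (a + n) (by grind)
  have hk' : (k : ℝ) ≤ 4 := by simp_all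
  refine ⟨η, by have : (0 : ℝ) ≤ n := by positivity
                linarith, by linarith, ?_⟩
  rw [h3]
  obtain ⟨k, rfl⟩ : ∃ m, k = m + 1 := ⟨k - 1, by omega⟩
  simp [negLogDeriv, zero_add]

lemma logPhase_add (t a : ℝ) (n j : ℕ) :
    logPhase t a (n + j) = t / (2 * π) * negLogDeriv 0 (a + n + j) := by
  simp only [logPhase, negLogDeriv]
  grind

lemma inv_pow_bounds {N η : ℝ} (hN : 1 ≤ N) (h1 : N ≤ η) (h2 : η ≤ 7 * N) (k : ℕ) :
    (N ^ k)⁻¹ / 7 ^ k ≤ (η ^ k)⁻¹ ∧ (η ^ k)⁻¹ ≤ (N ^ k)⁻¹ := by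
  have hη : 0 < η := by linarith
  have hN0 : 0 < N := by linarith
  constructor
  · rw [div_eq_mul_inv, ← mul_inv, ← mul_pow]
    bound
  bound

lemma logPhase_sum_two {N a t : ℝ} (ht : 0 < t) (hN : 1 ≤ N) (ha : N ≤ a) (ha2 : a ≤ 2 * N)
    {M : ℕ} (hM : (M : ℝ) ≤ N) :
    ‖∑ n ∈ range M, addE (logPhase t a n)‖ ≤ 10000 * (√t + N / √t) := by
  set r := t / (2 * π) with hr
  have hr0 : 0 < r := by bound
  have hN0 : 0 < N := by linarith
  have hb : ∀ n, n + 1 < M → (r * ((N ^ 2)⁻¹ / 7 ^ 2)) ≤ logPhase t a (n + 2) -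
      2 * logPhase t a (n + 1) + logPhase t a n ∧ logPhase t a (n + 2) -
      2 * logPhase t a (n + 1) + logPhase t a n ≤ 49 * (r * ((N ^ 2)⁻¹ / 7 ^ 2)) := by
    intro n hn
    obtain ⟨η, h1, h2, h3⟩ := iterDiff_log_bounds hN ha ha2 (n := n) (k := 2)
      (by have : (n : ℝ) + 1 < M := by exact_mod_cast hn
          linarith) (by norm_num) (by norm_num)
    obtain ⟨q1, q2⟩ := inv_pow_bounds hN h1 h2 2
    have e : logPhase t a (n + 2) - 2 * logPhase t a (n + 1) + logPhase t a n = r * (η ^ 2)⁻¹ := by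
      have h3' : iterDiff 2 (negLogDeriv 0) (a + n) = (η ^ 2)⁻¹ := by rw [h3]; norm_num
      rw [← h3']
      have e0 := logPhase_add t a n 0
      rw [add_zero] at e0
      rw [logPhase_add, logPhase_add, e0, ← hr]
      simp only [iterDiff]
      grind
    rw [e]
    constructor
    · gcongr
    · calc r * (η ^ 2)⁻¹ ≤ r * (N ^ 2)⁻¹ := by gcongr
        _ = _ := by ring
  have v := van_der_corput_two (A := 49) (by norm_num) (by bound) (logPhase t a) M
    (fun n hn => (hb n hn).1) (fun n hn => (hb n hn).2)
  refine v.trans ?_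
  have hpi := pi_gt_three
  have hpi4 := Real.pi_le_four
  have hst : 0 < √t := sqrt_pos.2 ht
  have s1 : √(r * ((N ^ 2)⁻¹ / 7 ^ 2)) ≤ √t / N := by
    apply Real.sqrt_le_iff.2 ⟨by bound, ?_⟩
    rw [div_pow, Real.sq_sqrt ht.le, hr, div_mul_eq_mul_div, div_le_div_iff₀ (by bound) (by bound)]
    field_simp
    nlinarith
  have s2 : 1 / √(r * ((N ^ 2)⁻¹ / 7 ^ 2)) ≤ 20 * (N / √t) := by
    rw [div_le_iff₀ (sqrt_pos.2 (by positivity))]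
    have : √t / (20 * N) ≤ √(r * ((N ^ 2)⁻¹ / 7 ^ 2)) := by
      apply Real.le_sqrt_of_sq_le
      rw [div_pow, Real.sq_sqrt ht.le, hr, div_mul_eq_mul_div, div_le_div_iff₀ (by bound)
        (by bound)]
      field_simp
      nlinarith
    calc 1 = 20 * (N / √t) * (√t / (20 * N)) := by field_simp
      _ ≤ _ := by gcongr
  calc 10 * 49 * (M * √(r * ((N ^ 2)⁻¹ / 7 ^ 2)) + 1 / √(r * ((N ^ 2)⁻¹ / 7 ^ 2)))
      ≤ 10 * 49 * (N * (√t / N) + 20 * (N / √t)) := by gcongr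
    _ = 10 * 49 * (√t + 20 * (N / √t)) := by field_simp
    _ ≤ _ := by have : 0 ≤ N / √t := by bound
                linarith

lemma logPhase_sum_three {N a t : ℝ} (ht : 0 < t) (hN : 1 ≤ N) (ha : N ≤ a) (ha2 : a ≤ 2 * N)
    {M : ℕ} (hM : (M : ℝ) ≤ N) :
    ‖∑ n ∈ range M, addE (logPhase t a n)‖ ^ 2 ≤
      34300 * (N ^ 2 * (t / (1000 * N ^ 3)) ^ (1 / 3 : ℝ) + N * (t / (2000 * N ^ 3)) ^ (-(1 / 2) : ℝ)) := by
  set r := t / (2 * π) with hr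
  have hr0 : 0 < r := by bound
  have hN0 : 0 < N := by linarith
  set l := r * (2 * ((N ^ 3)⁻¹ / 7 ^ 3)) with hl
  have hb : ∀ n, n + 2 < M → l ≤ -logPhase t a (n + 3) - 3 * -logPhase t a (n + 2) +
      3 * -logPhase t a (n + 1) - -logPhase t a n ∧ -logPhase t a (n + 3) -
      3 * -logPhase t a (n + 2) + 3 * -logPhase t a (n + 1) - -logPhase t a n ≤ 343 * l := by
    intro n hn
    obtain ⟨η, h1, h2, h3⟩ := iterDiff_log_bounds hN ha ha2 (n := n) (k := 3)
      (by have : (n : ℝ) + 2 < M := by exact_mod_cast hn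
          linarith) (by norm_num) (by norm_num)
    obtain ⟨q1, q2⟩ := inv_pow_bounds hN h1 h2 3
    have e : -logPhase t a (n + 3) - 3 * -logPhase t a (n + 2) +
      3 * -logPhase t a (n + 1) - -logPhase t a n = r * (2 * (η ^ 3)⁻¹) := by
      have h3' : 2 * (η ^ 3)⁻¹ = -iterDiff 3 (negLogDeriv 0) (a + n) := by rw [h3]; norm_num
      rw [h3']
      have e0 := logPhase_add t a n 0
      rw [add_zero] at e0
      rw [logPhase_add, logPhase_add, logPhase_add, e0, ← hr]
      simp only [iterDiff]
      grind
    rw [e]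
    constructor
    · bound
    · calc r * (2 * (η ^ 3)⁻¹) ≤ r * (2 * (N ^ 3)⁻¹) := by gcongr
        _ = _ := by grind
  have v := van_der_corput_three (A := 343) (by norm_num) (by positivity)
    (fun n => -logPhase t a n) M (fun n hn => (hb n hn).1) (fun n hn => (hb n hn).2)
  have hpi := pi_gt_three
  have hpi4 := Real.pi_le_four
  have e : ‖∑ n ∈ range M, addE (logPhase t a n)‖ = ‖∑ n ∈ range M, addE (-logPhase t a n)‖ := by
    rw [← norm_conj, map_sum]
    simp only [conj_addE]
  rw [e]
  refine v.trans ?_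
  have l1 : l ≤ t / (1000 * N ^ 3) := by
    rw [hl, hr, div_mul_eq_mul_div, div_le_div_iff₀ (by bound) (by bound)]
    field_simp
    nlinarith
  have l2 : t / (2000 * N ^ 3) ≤ l := by
    rw [hl, hr, div_mul_eq_mul_div, div_le_div_iff₀ (by bound) (by bound)]
    field_simp
    nlinarith
  have l3 : l ^ (-(1 / 2) : ℝ) ≤ (t / (2000 * N ^ 3)) ^ (-(1 / 2) : ℝ) :=
    rpow_le_rpow_of_nonpos (by bound) l2 (by norm_num)
  have e2 : (100 : ℝ) * 343 = 34300 := by norm_num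
  rw [e2]
  gcongr

lemma logPhase_sum_four {N a t : ℝ} (ht : 0 < t) (hN : 1 ≤ N) (ha : N ≤ a) (ha2 : a ≤ 2 * N)
    {M : ℕ} (hM : (M : ℝ) ≤ N) :
    ‖∑ n ∈ range M, addE (logPhase t a n)‖ ^ 2 ≤
      240100 * (N ^ 2 * (t / (2000 * N ^ 4)) ^ (1 / 7 : ℝ) +
        N * √N * (t / (6000 * N ^ 4)) ^ (-(1 / 4) : ℝ)) := by
  set r := t / (2 * π) with hr
  have hr0 : 0 < r := by bound
  have hN0 : 0 < N := by linarith
  set l := r * (6 * ((N ^ 4)⁻¹ / 7 ^ 4)) with hl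
  have hb : ∀ n, n + 3 < M → l ≤ logPhase t a (n + 4) - 4 * logPhase t a (n + 3) +
      6 * logPhase t a (n + 2) - 4 * logPhase t a (n + 1) + logPhase t a n ∧
      logPhase t a (n + 4) - 4 * logPhase t a (n + 3) +
      6 * logPhase t a (n + 2) - 4 * logPhase t a (n + 1) + logPhase t a n ≤ 2401 * l := by
    intro n hn
    obtain ⟨η, h1, h2, h3⟩ := iterDiff_log_bounds hN ha ha2 (n := n) (k := 4)
      (by have : (n : ℝ) + 3 < M := by exact_mod_cast hn
          linarith) (by norm_num) (by norm_num)
    obtain ⟨q1, q2⟩ := inv_pow_bounds hN h1 h2 4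
    have e : logPhase t a (n + 4) - 4 * logPhase t a (n + 3) +
      6 * logPhase t a (n + 2) - 4 * logPhase t a (n + 1) + logPhase t a n =
        r * (6 * (η ^ 4)⁻¹) := by
      have h3' : 6 * (η ^ 4)⁻¹ = iterDiff 4 (negLogDeriv 0) (a + n) := by rw [h3]; bound
      rw [h3']
      have e0 := logPhase_add t a n 0
      rw [add_zero] at e0
      rw [logPhase_add, logPhase_add, logPhase_add, logPhase_add, e0, ← hr]
      simp only [iterDiff]
      grind
    rw [e]
    constructor
    · bound
    · calc r * (6 * (η ^ 4)⁻¹) ≤ r * (6 * (N ^ 4)⁻¹) := by gcongr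
        _ = _ := by grind
  have v := van_der_corput_four (A := 2401) (by norm_num) (by positivity)
    (logPhase t a) M (fun n hn => (hb n hn).1) (fun n hn => (hb n hn).2)
  have hpi := pi_gt_three
  have hpi4 := Real.pi_le_four
  refine v.trans ?_
  have l1 : l ≤ t / (2000 * N ^ 4) := by
    rw [hl, hr, div_mul_eq_mul_div, div_le_div_iff₀ (by bound) (by bound)]
    field_simp
    nlinarith
  have l2 : t / (6000 * N ^ 4) ≤ l := by
    rw [hl, hr, div_mul_eq_mul_div, div_le_div_iff₀ (by bound) (by bound)]
    field_simp
    nlinarith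
  have l3 : l ^ (-(1 / 4) : ℝ) ≤ (t / (6000 * N ^ 4)) ^ (-(1 / 4) : ℝ) :=
    rpow_le_rpow_of_nonpos (by bound) l2 (by norm_num)
  have e2 : (100 : ℝ) * 2401 = 240100 := by norm_num
  rw [e2]
  gcongr

/-- Kusmin–Landau for the logarithmic phase. -/
lemma logPhase_sum_one {N a t : ℝ} (ht : 0 < t) (hN : 1 ≤ N) (ha : N ≤ a) (ha2 : a ≤ 2 * N)
    (htN : t ≤ N) {M : ℕ} (hM : (M : ℝ) ≤ N) :
    ‖∑ n ∈ range M, addE (logPhase t a n)‖ ≤ 56 * (N / t) := by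
  set r := t / (2 * π) with hr
  have hr0 : 0 < r := by bound
  have hN0 : 0 < N := by linarith
  have hpi := pi_gt_three
  have hpi4 := Real.pi_le_four
  have hb : ∀ n, n < M → -(r / N) ≤ logPhase t a (n + 1) - logPhase t a n ∧
      logPhase t a (n + 1) - logPhase t a n ≤ -(r / N / 7) := by
    intro n hn
    obtain ⟨η, h1, h2, h3⟩ := iterDiff_log_bounds hN ha ha2 (n := n) (k := 1)
      (by have : (n : ℝ) < M := by simp_all
          linarith) (by norm_num) (by norm_num)
    obtain ⟨q1, q2⟩ := inv_pow_bounds hN h1 h2 1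
    have e : logPhase t a (n + 1) - logPhase t a n = -(r * η⁻¹) := by
      have h3' : η⁻¹ = -iterDiff 1 (negLogDeriv 0) (a + n) := by rw [h3]; norm_num
      rw [h3']
      have e0 := logPhase_add t a n 0
      rw [add_zero] at e0
      rw [logPhase_add, e0, ← hr]
      simp only [iterDiff]
      grind
    rw [e]
    simp only [pow_one] at q1 q2
    constructor
    · rw [div_eq_mul_inv]; gcongr
    · calc -(r * η⁻¹) ≤ -(r * (N⁻¹ / 7)) := by gcongr
        _ = _ := by ring
  have hm : ∀ n, n + 1 < M → logPhase t a (n + 1) - logPhase t a n ≤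
      logPhase t a (n + 2) - logPhase t a (n + 1) := by
    intro n hn
    obtain ⟨η, h1, h2, h3⟩ := iterDiff_log_bounds hN ha ha2 (n := n) (k := 2)
      (by have : (n : ℝ) + 1 < M := by exact_mod_cast hn
          linarith) (by norm_num) (by norm_num)
    have e0 := logPhase_add t a n 0
    rw [add_zero] at e0
    have h3' : iterDiff 2 (negLogDeriv 0) (a + n) = (η ^ 2)⁻¹ := by rw [h3]; norm_num
    have e : logPhase t a (n + 2) - 2 * logPhase t a (n + 1) + logPhase t a n = r * (η ^ 2)⁻¹ := by
      rw [← h3', logPhase_add, logPhase_add, e0, ← hr]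
      simp only [iterDiff]
      grind
    have : 0 ≤ r * (η ^ 2)⁻¹ := by bound
    linarith
  have hrN : r / N ≤ 1 / 6 := by
    rw [hr, div_div, div_le_div_iff₀ (by bound) (by norm_num)]
    nlinarith
  have v := kusmin_landau (θ := r / N / 7) (by bound) (fun n => logPhase t a n - ((-n : ℤ) : ℝ)) M
    (fun n hn => by grind)
    (fun n hn => by grind)
    (fun n hn => by grind)
  simp only [addE_sub_int] at v
  refine v.trans ?_
  rw [hr]
  field_simp
  linarith

end LogPhase

section MeanValue

open Finset MeasureTheory

lemma norm_integral_exp_le {θ : ℝ} (hθ : θ ≠ 0) (a b : ℝ) :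
    ‖∫ t in a..b, exp ((t * θ : ℝ) * I)‖ ≤ 2 / |θ| := by
  have h0 : ((θ : ℂ) * I) ≠ 0 := by simp [hθ]
  have e : ∀ t : ℝ, exp ((t * θ : ℝ) * I) = exp ((θ : ℂ) * I * t) := by
    intro t; congr 1; push_cast; ring
  simp_rw [e]
  rw [integral_exp_mul_complex h0, norm_div, norm_mul, norm_I, mul_one, norm_real, norm_eq_abs]
  gcongr
  refine (norm_sub_le _ _).trans ?_
  rw [← e, ← e, norm_exp_ofReal_mul_I, norm_exp_ofReal_mul_I]
  norm_num

lemma sum_inv_dist_le {M m : ℕ} (hm : m ≤ M) :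
    ∑ n ∈ (Icc 1 M).erase m, 1 / |(n : ℝ) - m| ≤ 2 * (1 + log M) := by
  have hh : ∑ h ∈ Icc 1 M, 1 / (h : ℝ) ≤ 1 + log M := by
    have := harmonic_le_one_add_log M
    rw [harmonic_eq_sum_Icc] at this
    simp_all
  have key : ∀ s : Finset ℕ, ∀ g : ℕ → ℕ, Set.InjOn g s → (∀ n ∈ s, g n ∈ Icc 1 M) →
      (∀ n ∈ s, |(n : ℝ) - m| = g n) → ∑ n ∈ s, 1 / |(n : ℝ) - m| ≤ 1 + log M := by
    intro s g hg hm hv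
    calc ∑ n ∈ s, 1 / |(n : ℝ) - m| = ∑ n ∈ s, 1 / (g n : ℝ) :=
          sum_congr rfl fun n hn => by grind
      _ = ∑ h ∈ s.image g, 1 / (h : ℝ) := by rw [sum_image hg]
      _ ≤ ∑ h ∈ Icc 1 M, 1 / (h : ℝ) := by
          apply sum_le_sum_of_subset_of_nonneg
          · grind
          bound
      _ ≤ _ := hh
  rw [← sum_filter_add_sum_filter_not _ (fun n => n < m)]
  have h1 := key (((Icc 1 M).erase m).filter (fun n => n < m)) (fun n => m - n)
    (by intro a ha b hb h
        grind)
    (by grind)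
    (by intro n hn
        simp only [mem_filter] at hn
        rw [Nat.cast_sub hn.2.le, abs_sub_comm, abs_of_nonneg]
        have : (n : ℝ) < m := by exact_mod_cast hn.2
        linarith)
  have h2 := key (((Icc 1 M).erase m).filter (fun n => ¬ n < m)) (fun n => n - m)
    (by intro a ha b hb h
        grind)
    (by grind)
    (by intro n hn
        simp only [mem_filter] at hn
        rw [Nat.cast_sub (by omega), abs_of_nonneg]
        have : (m : ℝ) ≤ n := by exact_mod_cast (by omega)
        linarith)
  linarith

lemma inv_abs_log_sub_le {m n M : ℕ} (hm : m ∈ Icc 1 M) (hn : n ∈ Icc 1 M) (h : n ≠ m) :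
    1 / |log n - log m| ≤ M / |(n : ℝ) - m| := by
  wlog hlt : m < n generalizing m n
  · grind
  simp only [mem_Icc] at hm hn
  have hm0 : (0 : ℝ) < m := by bound
  have hn0 : (0 : ℝ) < n := by bound
  have hlt' : (m : ℝ) < n := by simp_all
  have hnM : (n : ℝ) ≤ M := by simp_all
  have h1 : ((n : ℝ) - m) / n ≤ log n - log m := by
    rw [← Real.log_div hn0.ne' hm0.ne']
    refine le_trans (le_of_eq ?_) (Real.one_sub_inv_le_log_of_pos (by bound))
    field_simp
  have hd : 0 < (n : ℝ) - m := by linarith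
  have h2 : 0 < ((n : ℝ) - m) / n := by bound
  rw [abs_of_pos (h2.trans_le h1), abs_of_pos hd]
  calc 1 / (log n - log m) ≤ 1 / (((n : ℝ) - m) / n) := by gcongr
    _ = n / ((n : ℝ) - m) := by bound
    _ ≤ _ := by gcongr

lemma mean_value (M : ℕ) (b : ℕ → ℂ) {T : ℝ} (hT : 0 ≤ T) :
    ∫ t in T..2 * T, ‖∑ m ∈ Icc 1 M, b m * exp ((t * -log m : ℝ) * I)‖ ^ 2
      ≤ (T + 4 * M * (1 + log M)) * ∑ m ∈ Icc 1 M, ‖b m‖ ^ 2 := by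
  set E : ℕ → ℝ → ℂ := fun m t => exp ((t * -log m : ℝ) * I) with hE
  have hEc : ∀ m, Continuous (E m) := by fun_prop
  have hmul : ∀ m n t, E m t * (starRingEnd ℂ) (E n t) = exp ((t * (log n - log m) : ℝ) * I) := by
    intro m n t
    simp only [hE]
    rw [← Complex.exp_conj, ← exp_add]
    congr 1
    simp only [map_mul, Complex.conj_ofReal, Complex.conj_I]
    push_cast; ring
  have hI : ∀ m ∈ Icc 1 M, ∀ n ∈ Icc 1 M, ‖∫ t in T..2 * T, E m t * (starRingEnd ℂ) (E n t)‖
        ≤ (if n = m then T else 0) + 2 * (M * (1 / |(n : ℝ) - m|)) := by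
    intro m hm n hn
    simp_rw [hmul]
    by_cases h : n = m
    · subst h
      simp only [sub_self, mul_zero, ofReal_zero, zero_mul, Complex.exp_zero]
      rw [intervalIntegral.integral_const]
      simp only [if_true, abs_zero, div_zero, mul_zero, add_zero]
      rw [norm_smul, norm_one, mul_one, norm_eq_abs, abs_of_nonneg] <;> linarith
    · rw [if_neg h, zero_add]
      have hne : log n - log m ≠ 0 := by
        simp only [mem_Icc] at hm hn
        have hm0 : (0 : ℝ) < m := by bound
        have hn0 : (0 : ℝ) < n := by bound
        rw [sub_ne_zero]
        intro hh
        exact h (by exact_mod_cast Real.log_injOn_pos hn0 hm0 hh)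
      refine (norm_integral_exp_le hne _ _).trans ?_
      have := inv_abs_log_sub_le hm hn h
      grind
  have hexp : ((∫ t in T..2 * T, ‖∑ m ∈ Icc 1 M, b m * E m t‖ ^ 2 : ℝ) : ℂ) =
      ∑ m ∈ Icc 1 M, ∑ n ∈ Icc 1 M, b m * (starRingEnd ℂ) (b n) *
        ∫ t in T..2 * T, E m t * (starRingEnd ℂ) (E n t) := by
    rw [← intervalIntegral.integral_ofReal]
    have : ∀ t : ℝ, ((‖∑ m ∈ Icc 1 M, b m * E m t‖ ^ 2 : ℝ) : ℂ) =
        ∑ m ∈ Icc 1 M, ∑ n ∈ Icc 1 M, b m * (starRingEnd ℂ) (b n) *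
          (E m t * (starRingEnd ℂ) (E n t)) := by
      intro t
      push_cast
      rw [← Complex.mul_conj', map_sum, sum_mul_sum]
      refine sum_congr rfl fun m _ => sum_congr rfl fun n _ => ?_
      grind
    simp_rw [this]
    have hc : ∀ m n, Continuous fun t => E m t * (starRingEnd ℂ) (E n t) := fun m n =>
      (hEc m).mul (Complex.continuous_conj.comp (hEc n))
    rw [intervalIntegral.integral_finsetSum]
    · refine sum_congr rfl fun m _ => ?_
      rw [intervalIntegral.integral_finsetSum]
      · refine sum_congr rfl fun n _ => ?_
        bound
      · intro n _
        exact ((hc m n).const_mul _).intervalIntegrable _ _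
    · intro m _
      exact (continuous_finsetSum _ fun n _ => (hc m n).const_mul _).intervalIntegrable _ _
  have hnn : 0 ≤ ∫ t in T..2 * T, ‖∑ m ∈ Icc 1 M, b m * E m t‖ ^ 2 :=
    intervalIntegral.integral_nonneg (by linarith) fun t _ => by bound
  have h1 : ∫ t in T..2 * T, ‖∑ m ∈ Icc 1 M, b m * E m t‖ ^ 2 ≤
      ∑ m ∈ Icc 1 M, ∑ n ∈ Icc 1 M, ‖b m‖ * ‖b n‖ *
        ((if n = m then T else 0) + 2 * (M * (1 / |(n : ℝ) - m|))) := by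
    rw [← abs_of_nonneg hnn, ← norm_eq_abs, ← norm_real, hexp]
    refine (norm_sum_le _ _).trans (sum_le_sum fun m hm => (norm_sum_le _ _).trans
      (sum_le_sum fun n hn => ?_))
    rw [norm_mul, norm_mul, RCLike.norm_conj]
    gcongr
    grind
  refine h1.trans ?_
  have h2 : ∀ m ∈ Icc 1 M, ∀ n ∈ Icc 1 M, ‖b m‖ * ‖b n‖ *
        ((if n = m then T else 0) + 2 * (M * (1 / |(n : ℝ) - m|))) ≤
      (if n = m then T * ‖b m‖ ^ 2 else 0) + (M * (‖b m‖ ^ 2 * (1 / |(n : ℝ) - m|)) +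
        M * (‖b n‖ ^ 2 * (1 / |(m : ℝ) - n|))) := by
    intro m _ n _
    rw [mul_add]
    apply add_le_add
    · split_ifs with h
      · subst h; grind
      · simp
    · rw [abs_sub_comm (m : ℝ)]
      have := two_mul_le_add_sq ‖b m‖ ‖b n‖
      calc ‖b m‖ * ‖b n‖ * (2 * (M * (1 / |(n : ℝ) - m|))) =
          (2 * ‖b m‖ * ‖b n‖) * (M * (1 / |(n : ℝ) - m|)) := by ring
        _ ≤ (‖b m‖ ^ 2 + ‖b n‖ ^ 2) * (M * (1 / |(n : ℝ) - m|)) := by gcongr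
        _ = _ := by ring
  refine (sum_le_sum fun m hm => sum_le_sum fun n hn => h2 m hm n hn).trans ?_
  have h3 : ∀ m ∈ Icc 1 M, ∑ n ∈ Icc 1 M, (M : ℝ) * (‖b m‖ ^ 2 * (1 / |(n : ℝ) - m|)) ≤
      2 * M * (1 + log M) * ‖b m‖ ^ 2 := by
    intro m hm
    rw [← mul_sum, ← mul_sum, ← sum_erase (a := m) _ (by simp)]
    have := sum_inv_dist_le (mem_Icc.1 hm).2
    calc (M : ℝ) * (‖b m‖ ^ 2 * ∑ n ∈ (Icc 1 M).erase m, 1 / |(n : ℝ) - m|)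
        ≤ M * (‖b m‖ ^ 2 * (2 * (1 + log M))) := by gcongr
      _ = _ := by ring
  simp_rw [sum_add_distrib]
  have h4 := sum_le_sum h3
  have h5 : ∑ m ∈ Icc 1 M, ∑ n ∈ Icc 1 M, (M : ℝ) * (‖b n‖ ^ 2 * (1 / |(m : ℝ) - n|)) =
      ∑ m ∈ Icc 1 M, ∑ n ∈ Icc 1 M, (M : ℝ) * (‖b m‖ ^ 2 * (1 / |(n : ℝ) - m|)) := sum_comm
  have h6 : ∑ m ∈ Icc 1 M, ∑ n ∈ Icc 1 M, (if n = m then T * ‖b m‖ ^ 2 else 0) =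
      T * ∑ m ∈ Icc 1 M, ‖b m‖ ^ 2 := by
    rw [mul_sum]
    refine sum_congr rfl fun m hm => ?_
    rw [sum_ite_eq' , if_pos hm]
  rw [h5, h6]
  rw [← mul_sum] at h4
  linarith

end MeanValue

section DivisorBound

open Finset MeasureTheory

lemma exists_card_divisors_le {ε : ℝ} (hε : 0 < ε) :
    ∃ C : ℝ, 1 ≤ C ∧ ∀ m : ℕ, m ≠ 0 → (m.divisors.card : ℝ) ≤ C * (m : ℝ) ^ ε := by
  have hl2 : 0 < log 2 := Real.log_pos (by norm_num)
  obtain ⟨B, hB⟩ := exists_nat_gt ((2 : ℝ) ^ (1 / ε))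
  set K : ℝ := max 1 (1 / (ε * log 2)) with hK
  have hK1 : 1 ≤ K := le_max_left _ _
  refine ⟨K ^ B, one_le_pow₀ hK1, fun m hm => ?_⟩
  have hfac : (m : ℝ) ^ ε = ∏ p ∈ m.primeFactors, ((p : ℝ) ^ m.factorization p) ^ ε := by
    rw [Real.finsetProd_rpow _ _ (fun p _ => by bound)]
    congr 1
    conv_lhs => rw [← Nat.prod_factorization_pow_eq_self hm]
    rw [Finsupp.prod, Nat.support_factorization]
    bound
  rw [Nat.card_divisors hm, hfac]
  push_cast
  have hone : ∀ p ∈ m.primeFactors, ((m.factorization p : ℝ) + 1) ≤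
      (if p < B then K else 1) * ((p : ℝ) ^ m.factorization p) ^ ε := by
    intro p hp
    have hp2 : (2 : ℝ) ≤ p := by exact_mod_cast (Nat.prime_of_mem_primeFactors hp).two_le
    set a := m.factorization p
    rw [← rpow_natCast, ← rpow_mul (by bound), mul_comm (a : ℝ), rpow_mul (by bound), rpow_natCast]
    split_ifs with hpB
    · have h1 : 1 + a * (ε * log 2) ≤ ((p : ℝ) ^ ε) ^ a := by
        calc 1 + a * (ε * log 2) ≤ Real.exp (a * (ε * log 2)) := by
              linarith [Real.add_one_le_exp ((a : ℝ) * (ε * log 2))]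
          _ = ((2 : ℝ) ^ ε) ^ a := by
              rw [Real.rpow_def_of_pos (by norm_num), ← Real.exp_nat_mul]
              grind
          _ ≤ _ := by gcongr
      have h2 : (a : ℝ) ≤ K * (a * (ε * log 2)) := by
        have : 1 ≤ K * (ε * log 2) := by
          calc 1 = 1 / (ε * log 2) * (ε * log 2) := by field_simp
            _ ≤ _ := by bound
        nlinarith [(cast_nonneg a : (0 : ℝ) ≤ a)]
      calc (a : ℝ) + 1 ≤ K * (1 + a * (ε * log 2)) := by linarith
        _ ≤ _ := by gcongr
    · rw [one_mul]
      have h1 : (2 : ℝ) ≤ (p : ℝ) ^ ε := by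
        have : (2 : ℝ) ^ (1 / ε) ≤ p := hB.le.trans (by exact_mod_cast not_lt.1 hpB)
        calc (2 : ℝ) = ((2 : ℝ) ^ (1 / ε)) ^ ε := by
              rw [← rpow_mul (by norm_num)]; field_simp; simp
          _ ≤ _ := by gcongr
      calc (a : ℝ) + 1 ≤ (2 : ℝ) ^ a := by exact_mod_cast Nat.succ_le_of_lt Nat.lt_two_pow_self
        _ ≤ _ := by gcongr
  refine (prod_le_prod (fun _ _ => by bound) hone).trans ?_
  rw [prod_mul_distrib]
  gcongr
  rw [prod_ite, prod_const_one, mul_one, prod_const]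
  refine pow_le_pow_right₀ hK1 ?_
  calc _ ≤ (range B).card := card_le_card fun p hp => by
        grind
    _ = B := card_range B

lemma card_prod_eq_le (k m : ℕ) (hm : m ≠ 0) (s : Finset ℕ) :
    ((piFinset fun _ : Fin k => s).filter fun f => ∏ i, f i = m).card ≤ m.divisors.card ^ k := by
  calc _ ≤ (piFinset fun _ : Fin k => m.divisors).card := by
        refine card_le_card fun f hf => ?_
        rw [mem_filter] at hf
        rw [mem_piFinset]
        intro i
        rw [Nat.mem_divisors]
        exact ⟨hf.2 ▸ dvd_prod_of_mem _ (mem_univ i), hm⟩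
    _ = _ := by simp

lemma power_moment (k : ℕ) {ε : ℝ} (hε : 0 < ε) :
    ∃ C : ℝ, 0 ≤ C ∧ ∀ (N : ℕ) (c : ℕ → ℂ) (A T : ℝ) (s : Finset ℕ), 1 ≤ N → 0 ≤ A → 0 ≤ T →
      (∀ n ∈ s, ‖c n‖ ≤ A) → s ⊆ Icc 1 (2 * N) →
      ∫ t in T..2 * T, ‖∑ n ∈ s, c n * exp ((t * -log n : ℝ) * I)‖ ^ (2 * k)
        ≤ C * ((T + (N : ℝ) ^ k * (N : ℝ) ^ ε) * ((N : ℝ) ^ k * (N : ℝ) ^ ε * A ^ (2 * k))) := by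
  set δ : ℝ := ε / (2 * k ^ 2 + 1) with hδ
  have hδ0 : 0 < δ := by positivity
  obtain ⟨C₁, hC₁, hdiv⟩ := exists_card_divisors_le hδ0
  set P : ℝ := (2 : ℝ) ^ k with hP
  have hP1 : 1 ≤ P := one_le_pow₀ (by norm_num)
  refine ⟨(1 + 4 * P * ((1 + 1 / δ) * P ^ ε)) * (P * P ^ ε * C₁ ^ (2 * k)), by positivity, ?_⟩
  intro N c A T s hN hA hT hc hs
  have hN1 : (1 : ℝ) ≤ N := by bound
  set M : ℕ := (2 * N) ^ k with hM
  have hM1 : 1 ≤ M := Nat.one_le_pow _ _ (by omega)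
  have hM1' : (1 : ℝ) ≤ M := by bound
  have hMr : (M : ℝ) = P * N ^ k := by rw [hM, hP]; push_cast; rw [mul_pow]
  set b : ℕ → ℂ := fun m =>
    ∑ f ∈ (piFinset fun _ : Fin k => s).filter (fun f => ∏ i, f i = m), ∏ i, c (f i)
    with hb
  have hpow : ∀ t : ℝ, (∑ n ∈ s, c n * exp ((t * -log n : ℝ) * I)) ^ k =
      ∑ m ∈ Icc 1 M, b m * exp ((t * -log m : ℝ) * I) := by
    intro t
    have h0 := prod_univ_sum (fun _ : Fin k => s) (fun _ n => c n * exp ((t * -log n : ℝ) * I))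
    rw [prod_const, card_univ, Fintype.card_fin] at h0
    rw [h0]
    have hmaps : ∀ f ∈ piFinset (fun _ : Fin k => s), ∏ i, f i ∈ Icc 1 M := by
      intro f hf
      rw [mem_piFinset] at hf
      rw [mem_Icc]
      constructor
      · exact Nat.one_le_iff_ne_zero.2 (prod_ne_zero_iff.2 fun i _ => by grind)
      · calc ∏ i, f i ≤ ∏ _i : Fin k, (2 * N) :=
              prod_le_prod' fun i _ => (mem_Icc.1 (hs (hf i))).2
          _ = M := by simp [hM]
    rw [← sum_fiberwise_of_maps_to hmaps]
    refine sum_congr rfl fun m _ => ?_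
    rw [hb, sum_mul]
    refine sum_congr rfl fun f hf => ?_
    rw [mem_filter, mem_piFinset] at hf
    rw [prod_mul_distrib, ← Complex.exp_sum]
    congr 2
    rw [← sum_mul, ← Complex.ofReal_sum, ← mul_sum, sum_neg_distrib, ← hf.2, Nat.cast_prod,
      Real.log_prod]
    intro i _
    have := mem_Icc.1 (hs (hf.1 i))
    exact_mod_cast (by omega : f i ≠ 0)
  have hbn : ∀ m ∈ Icc 1 M, ‖b m‖ ^ 2 ≤ C₁ ^ (2 * k) * (M : ℝ) ^ (2 * k * δ) * A ^ (2 * k) := by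
    intro m hm
    have hm' := mem_Icc.1 hm
    have hm0 : m ≠ 0 := by omega
    have h1 : ‖b m‖ ≤ (C₁ * (M : ℝ) ^ δ) ^ k * A ^ k := by
      calc ‖b m‖ ≤ ∑ f ∈ (piFinset fun _ : Fin k => s).filter (fun f => ∏ i, f i = m),
            A ^ k := by
            refine norm_sum_le_of_le _ fun f hf => ?_
            rw [mem_filter, mem_piFinset] at hf
            rw [norm_prod]
            calc ∏ i, ‖c (f i)‖ ≤ ∏ _i : Fin k, A :=
                  prod_le_prod (fun _ _ => norm_nonneg _) fun i _ => hc _ (hf.1 i)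
              _ = A ^ k := by simp
        _ ≤ ((m.divisors.card : ℝ)) ^ k * A ^ k := by
            rw [sum_const, nsmul_eq_mul]
            gcongr
            exact_mod_cast card_prod_eq_le k m hm0 s
        _ ≤ _ := by
            gcongr
            refine (hdiv m hm0).trans ?_
            gcongr
            grind
    calc ‖b m‖ ^ 2 ≤ ((C₁ * (M : ℝ) ^ δ) ^ k * A ^ k) ^ 2 := by gcongr
      _ = _ := by
        rw [mul_pow, ← pow_mul, ← pow_mul, mul_pow, ← rpow_natCast ((M : ℝ) ^ δ),
          ← rpow_mul (by bound), mul_comm k 2]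
        grind
  have hmv := mean_value M b hT
  simp_rw [← hpow, norm_pow, ← pow_mul, mul_comm k 2] at hmv
  refine hmv.trans ?_
  have hkk : (k : ℝ) ≤ k ^ 2 := by
    rcases Nat.eq_zero_or_pos k with h | h
    · simp [h]
    bound
  have hrp : ∀ x : ℝ, 0 ≤ x → x * k ≤ ε → x ≤ ε → (M : ℝ) ^ x ≤ P ^ ε * (N : ℝ) ^ ε := by
    intro x hx hxk hxe
    rw [hMr, mul_rpow (by bound) (by bound)]
    gcongr
    · rw [← rpow_natCast, ← rpow_mul (by bound)]
      refine rpow_le_rpow_of_exponent_le hN1 (by grind)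
  have hde : δ * (2 * k ^ 2 + 1) = ε := by rw [hδ]; field_simp
  have e1 : (M : ℝ) ^ (2 * k * δ) ≤ P ^ ε * (N : ℝ) ^ ε := by
    refine hrp _ (by bound) (by nlinarith) ?_
    nlinarith
  have e2 : 1 + log M ≤ (1 + 1 / δ) * (P ^ ε * (N : ℝ) ^ ε) := by
    have h1 : log M ≤ (M : ℝ) ^ δ / δ := Real.log_le_rpow_div (by bound) hδ0
    have h2 : (1 : ℝ) ≤ (M : ℝ) ^ δ := one_le_rpow hM1' hδ0.le
    have h3 : (M : ℝ) ^ δ ≤ P ^ ε * (N : ℝ) ^ ε := hrp _ hδ0.le (by nlinarith) (by nlinarith)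
    calc 1 + log M ≤ (M : ℝ) ^ δ + (M : ℝ) ^ δ / δ := by linarith
      _ = (1 + 1 / δ) * (M : ℝ) ^ δ := by ring
      _ ≤ _ := by gcongr
  have hsum : ∑ m ∈ Icc 1 M, ‖b m‖ ^ 2 ≤
      (P * P ^ ε * C₁ ^ (2 * k)) * ((N : ℝ) ^ k * (N : ℝ) ^ ε * A ^ (2 * k)) := by
    refine (sum_le_sum hbn).trans ?_
    rw [sum_const, Nat.card_Icc, nsmul_eq_mul, Nat.add_sub_cancel, hMr]
    rw [hMr] at e1
    calc P * N ^ k * (C₁ ^ (2 * k) * (P * (N : ℝ) ^ k) ^ (2 * k * δ) * A ^ (2 * k))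
        ≤ P * N ^ k * (C₁ ^ (2 * k) * (P ^ ε * (N : ℝ) ^ ε) * A ^ (2 * k)) := by gcongr
      _ = _ := by ring
  have hlogM : 0 ≤ log M := log_nonneg hM1'
  have hfirst : T + 4 * M * (1 + log M) ≤
      (1 + 4 * P * ((1 + 1 / δ) * P ^ ε)) * (T + (N : ℝ) ^ k * (N : ℝ) ^ ε) := by
    calc T + 4 * M * (1 + log M)
        ≤ T + 4 * (P * N ^ k) * ((1 + 1 / δ) * (P ^ ε * (N : ℝ) ^ ε)) := by rw [← hMr]; gcongr
      _ = T + 4 * P * ((1 + 1 / δ) * P ^ ε) * (N ^ k * (N : ℝ) ^ ε) := by ring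
      _ ≤ _ := by
        have h1 : 0 ≤ 4 * P * ((1 + 1 / δ) * P ^ ε) * T := by positivity
        have h2 : 0 ≤ (N : ℝ) ^ k * (N : ℝ) ^ ε := by positivity
        linarith
  calc _ ≤ ((1 + 4 * P * ((1 + 1 / δ) * P ^ ε)) * (T + (N : ℝ) ^ k * (N : ℝ) ^ ε)) *
        ((P * P ^ ε * C₁ ^ (2 * k)) * ((N : ℝ) ^ k * (N : ℝ) ^ ε * A ^ (2 * k))) := by
        refine mul_le_mul hfirst hsum (sum_nonneg fun _ _ => by bound) (by positivity)
    _ = _ := by ring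

end DivisorBound

section PeriodicSums

open Finset MeasureTheory

structure IsPeriodicCoeff (a : ℕ → ℂ) (q : ℕ) : Prop where
  pos : 0 < q
  zero : a 0 = 0
  periodic : ∀ n, a (n + q) = a n
  norm_le : ∀ n, ‖a n‖ ≤ 1

lemma IsPeriodicCoeff.apply_add_mul {a : ℕ → ℂ} {q : ℕ} (h : IsPeriodicCoeff a q) (n k : ℕ) :
    a (n + q * k) = a n := by
  induction k with
  | zero => simp
  | succ k ih => rw [mul_add, mul_one, ← add_assoc, h.periodic, ih]

def osc (t : ℝ) (n : ℕ) : ℂ := exp ((t * -log n : ℝ) * I)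

lemma norm_osc (t : ℝ) (n : ℕ) : ‖osc t n‖ = 1 := norm_exp_ofReal_mul_I _

lemma sum_Ico_eq_sum_residues {M : Type*} [AddCommMonoid M] {q : ℕ} (hq : 0 < q) (A B : ℕ)
    (f : ℕ → M) : ∑ n ∈ Ico A B, f n =
      ∑ r ∈ range q, ∑ k ∈ range ((B - A - r + q - 1) / q), f (A + r + q * k) := by
  rw [sum_sigma']
  have hk : ∀ r k, r < q → (k < (B - A - r + q - 1) / q ↔ A + r + q * k < B) := by
    intro r k hr
    rw [Nat.lt_iff_add_one_le, Nat.le_div_iff_mul_le hq, add_mul, one_mul, mul_comm k q]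
    omega
  symm
  refine sum_bij' (fun p _ => A + p.1 + q * p.2) (fun n _ => ⟨(n - A) % q, (n - A) / q⟩)
    ?_ ?_ ?_ ?_ ?_
  · grind
  · intro n hn
    simp only [mem_sigma, mem_range, mem_Ico] at hn ⊢
    have h1 := Nat.mod_lt (n - A) hq
    rw [hk _ _ h1]
    have h2 := Nat.mod_add_div (n - A) q
    grind
  · rintro ⟨r, k⟩ h
    simp only [mem_sigma, mem_range] at h
    have e : A + r + q * k - A = r + q * k := by omega
    simp only [e, Nat.add_mul_mod_self_left, Nat.mod_eq_of_lt h.1, Nat.add_mul_div_left _ _ hq,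
      Nat.div_eq_of_lt h.1, zero_add]
  · intro n hn
    simp only [mem_Ico] at hn
    have h2 := Nat.mod_add_div (n - A) q
    grind
  grind

lemma periodic_sum_le {a : ℕ → ℂ} {q : ℕ} (ha : IsPeriodicCoeff a q) {A B : ℕ} (hA : 2 * q ≤ A)
    (hB : 2 * B ≤ 3 * A) {t Bd : ℝ}
    (h : ∀ (α : ℝ) (M : ℕ), (A / q : ℝ) ≤ α → α ≤ 2 * (A / q : ℝ) → (M : ℝ) ≤ A / q →
      ‖∑ n ∈ range M, addE (logPhase t α n)‖ ≤ Bd) :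
    ‖∑ n ∈ Ico A B, a n * osc t n‖ ≤ q * Bd := by
  have hq := ha.pos
  have hq0 : (0 : ℝ) < q := by bound
  rw [sum_Ico_eq_sum_residues hq]
  have : (q : ℝ) * Bd = ∑ r ∈ range q, Bd := by simp
  rw [this]
  refine norm_sum_le_of_le _ fun r hr => ?_
  rw [mem_range] at hr
  set M := (B - A - r + q - 1) / q with hM
  set α : ℝ := (A + r : ℕ) / q with hα
  have hr' : (r : ℝ) < q := by exact_mod_cast hr
  have hA' : 2 * (q : ℝ) ≤ A := by exact_mod_cast hA
  have e : ∀ k : ℕ, a (A + r + q * k) * osc t (A + r + q * k) =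
      (a (A + r) * exp ((t * -log q : ℝ) * I)) * addE (logPhase t α k) := by
    intro k
    rw [ha.apply_add_mul, mul_assoc]
    congr 1
    rw [osc, addE, logPhase, ← exp_add]
    congr 1
    have : ((A + r + q * k : ℕ) : ℝ) = q * (α + k) := by grind
    rw [this, log_mul hq0.ne' (by
      have h0 : (0 : ℝ) < A := by linarith
      have : 0 < α := by rw [hα]; push_cast; positivity
      positivity)]
    have hpi : (π : ℂ) ≠ 0 := by norm_num
    push_cast
    grind
  simp_rw [e]
  rw [← mul_sum, norm_mul, norm_mul, norm_exp_ofReal_mul_I, mul_one]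
  refine (mul_le_of_le_one_left (norm_nonneg _) (ha.norm_le _)).trans (h α M ?_ ?_ ?_)
  · bound
  · rw [hα]; push_cast; rw [← mul_div_assoc]; gcongr; linarith
  · rw [le_div_iff₀ hq0]
    have h1 : M * q ≤ B - A - r + q - 1 := Nat.div_mul_le_self _ _
    have h2 : M * q ≤ A := by omega
    exact_mod_cast h2

lemma norm_sum_range_antitone_mul_le {g : ℕ → ℝ} {c : ℕ → ℂ} {M : ℕ} {Bd : ℝ}
    (hg : Antitone g) (hg0 : ∀ n, 0 ≤ g n)
    (h : ∀ m ≤ M, ‖∑ n ∈ range m, c n‖ ≤ Bd) :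
    ‖∑ n ∈ range M, (g n : ℂ) * c n‖ ≤ g 0 * Bd := by
  have hB : 0 ≤ Bd := by simpa using h 0 (Nat.zero_le _)
  have h0 := sum_range_by_parts (fun n => (g n : ℂ)) c M
  simp only [smul_eq_mul] at h0
  rw [h0]
  have h1 : ‖(g (M - 1) : ℂ) * ∑ i ∈ range M, c i‖ ≤ g (M - 1) * Bd := by
    rw [norm_mul, norm_real, norm_eq_abs, abs_of_nonneg (hg0 _)]
    bound
  have h2 : ‖∑ i ∈ range (M - 1), ((g (i + 1) : ℂ) - g i) * ∑ j ∈ range (i + 1), c j‖ ≤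
      ∑ i ∈ range (M - 1), (g i - g (i + 1)) * Bd := by
    refine norm_sum_le_of_le _ fun i hi => ?_
    rw [mem_range] at hi
    have := hg (Nat.le_succ i)
    rw [norm_mul, ← Complex.ofReal_sub, norm_real, norm_eq_abs, abs_sub_comm,
      abs_of_nonneg (by grind)]
    gcongr
    grind
  rw [← sum_mul, sum_range_sub'] at h2
  refine (norm_sub_le _ _).trans ?_
  linarith

lemma norm_sum_Ico_rpow_mul_le {c : ℕ → ℂ} {A B : ℕ} {σ Bd : ℝ} (hA : 0 < A) (hσ : 0 ≤ σ)
    (h : ∀ m ≤ B, ‖∑ n ∈ Ico A m, c n‖ ≤ Bd) :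
    ‖∑ n ∈ Ico A B, (((n : ℝ) ^ (-σ) : ℝ) : ℂ) * c n‖ ≤ (A : ℝ) ^ (-σ) * Bd := by
  rcases le_or_gt A B with hAB | hAB
  · have h1 := norm_sum_range_antitone_mul_le (g := fun i => ((A + i : ℕ) : ℝ) ^ (-σ))
      (c := fun i => c (A + i)) (M := B - A) (Bd := Bd)
      (by
        intro i j hij
        have : (0 : ℝ) < (A + i : ℕ) := by bound
        exact rpow_le_rpow_of_nonpos this (by simp_all) (by linarith))
      (fun n => by bound)
      (by
        intro m hm
        have := h (A + m) (by omega)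
        rwa [sum_Ico_eq_sum_range, Nat.add_sub_cancel_left] at this)
    rw [sum_Ico_eq_sum_range]
    grind
  · rw [Ico_eq_empty (by omega), sum_empty, norm_zero]
    have : 0 ≤ Bd := by simpa using h 0 (Nat.zero_le _)
    bound

/-- Bounds for twisted sums over dyadic blocks give bounds with weight `n ^ (-σ)`. -/
lemma dyadic_periodic_sum_le {a : ℕ → ℂ} {q : ℕ} (ha : IsPeriodicCoeff a q) {N : ℕ}
    (hN : 2 * q ≤ N) (hN2 : 2 ∣ N) {t σ Bd : ℝ} (hσ : 0 ≤ σ)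
    (h : ∀ (x : ℝ), N / q ≤ x → x ≤ 3 / 2 * (N / q) → ∀ (α : ℝ) (M : ℕ),
      x ≤ α → α ≤ 2 * x → (M : ℝ) ≤ x →
      ‖∑ n ∈ range M, addE (logPhase t α n)‖ ≤ Bd) :
    ‖∑ n ∈ Ico N (2 * N), (((n : ℝ) ^ (-σ) : ℝ) : ℂ) * (a n * osc t n)‖ ≤
      2 * ((N : ℝ) ^ (-σ) * (q * Bd)) := by
  have hq := ha.pos
  obtain ⟨m, rfl⟩ := hN2
  have hm : 0 < m := by omega
  have hm' : (0 : ℝ) < m := by bound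
  have hq' : (0 : ℝ) < q := by bound
  rw [← sum_Ico_consecutive (n := 3 * m) _ (by omega) (by omega)]
  have h1 : ‖∑ n ∈ Ico (2 * m) (3 * m), (((n : ℝ) ^ (-σ) : ℝ) : ℂ) * (a n * osc t n)‖ ≤
      ((2 * m : ℕ) : ℝ) ^ (-σ) * (q * Bd) := by
    refine norm_sum_Ico_rpow_mul_le (by omega) hσ fun B hB => ?_
    refine periodic_sum_le ha hN (by omega) (h _ le_rfl ?_)
    have : 0 ≤ ((2 * m : ℕ) : ℝ) / q := by bound
    linarith
  have h2 : ‖∑ n ∈ Ico (3 * m) (2 * (2 * m)), (((n : ℝ) ^ (-σ) : ℝ) : ℂ) * (a n * osc t n)‖ ≤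
      ((3 * m : ℕ) : ℝ) ^ (-σ) * (q * Bd) := by
    refine norm_sum_Ico_rpow_mul_le (by omega) hσ fun B hB => ?_
    refine periodic_sum_le ha (by omega) (by omega) (h _ ?_ ?_)
    · gcongr; omega
    grind
  have hB : 0 ≤ Bd := by
    have := h (((2 * m : ℕ) : ℝ) / q) le_rfl (by
      have : 0 ≤ ((2 * m : ℕ) : ℝ) / q := by bound
      linarith) (((2 * m : ℕ) : ℝ) / q) 0 le_rfl (by
      have : 0 ≤ ((2 * m : ℕ) : ℝ) / q := by bound
      linarith) (by push_cast; bound)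
    simpa using this
  have h3 : ((3 * m : ℕ) : ℝ) ^ (-σ) ≤ ((2 * m : ℕ) : ℝ) ^ (-σ) :=
    rpow_le_rpow_of_nonpos (by bound) (by grind) (by linarith)
  calc _ ≤ _ := norm_add_le _ _
    _ ≤ ((2 * m : ℕ) : ℝ) ^ (-σ) * (q * Bd) + ((2 * m : ℕ) : ℝ) ^ (-σ) * (q * Bd) := by
        refine add_le_add h1 (h2.trans ?_)
        gcongr
    _ = _ := by ring

end PeriodicSums

section Continuation

open Finset MeasureTheory

def coeffMean (a : ℕ → ℂ) (q : ℕ) : ℂ := (∑ i ∈ range q, a i) / q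

def coeffRem (a : ℕ → ℂ) (q : ℕ) (x : ℝ) : ℂ := ∑ n ∈ Icc 0 ⌊x⌋₊, a n - coeffMean a q * x

variable {a : ℕ → ℂ} {q : ℕ}

lemma IsPeriodicCoeff.norm_mean_le (ha : IsPeriodicCoeff a q) : ‖coeffMean a q‖ ≤ 1 := by
  have hq : (0 : ℝ) < q := by exact_mod_cast ha.pos
  rw [coeffMean, norm_div, Complex.norm_natCast, div_le_one hq]
  refine (norm_sum_le_of_le (n := fun _ => (1 : ℝ)) _ fun i _ => ha.norm_le i).trans ?_
  simp

lemma IsPeriodicCoeff.sum_range_mul_add (ha : IsPeriodicCoeff a q) (k r : ℕ) :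
    ∑ i ∈ range (q * k + r), a i = k * ∑ i ∈ range q, a i + ∑ i ∈ range r, a i := by
  have h0 : ∀ k r, ∑ x ∈ range r, a (q * k + x) = ∑ x ∈ range r, a x := fun k r =>
    sum_congr rfl fun x _ => by rw [add_comm, ha.apply_add_mul]
  rw [sum_range_add, h0]
  congr 1
  induction k with
  | zero => simp
  | succ k ih => rw [mul_add, mul_one, sum_range_add, h0, ih]; grind

lemma IsPeriodicCoeff.norm_rem_le (ha : IsPeriodicCoeff a q) {x : ℝ} (hx : 0 ≤ x) :
    ‖coeffRem a q x‖ ≤ 2 * q + 2 := by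
  have hq : (0 : ℝ) < q := by exact_mod_cast ha.pos
  set n := ⌊x⌋₊ + 1 with hn
  have e : Icc 0 ⌊x⌋₊ = range n := by grind
  rw [coeffRem, e]
  set k := n / q
  set r := n % q
  have hr : r < q := Nat.mod_lt _ ha.pos
  have hkr : q * k + r = n := Nat.div_add_mod n q
  rw [← hkr, ha.sum_range_mul_add]
  have hmean : ∑ i ∈ range q, a i = coeffMean a q * q := by
    rw [coeffMean, div_mul_cancel₀]
    exact_mod_cast ha.pos.ne'
  rw [hmean]
  have e2 : (k : ℂ) * (coeffMean a q * q) + ∑ i ∈ range r, a i - coeffMean a q * x =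
      coeffMean a q * ((q * k - x : ℝ) : ℂ) + ∑ i ∈ range r, a i := by push_cast; ring
  rw [e2]
  have h1 : ‖∑ i ∈ range r, a i‖ ≤ r := by
    refine (norm_sum_le_of_le (n := fun _ => (1 : ℝ)) _ fun i _ => ha.norm_le i).trans ?_
    simp
  have hr' : (r : ℝ) < q := by simp_all
  have hr0 : (0 : ℝ) ≤ r := cast_nonneg r
  have hkr' : (q : ℝ) * k + r = ⌊x⌋₊ + 1 := by exact_mod_cast hkr
  have h2 : |(q : ℝ) * k - x| ≤ 1 + q := by
    have := Nat.floor_le hx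
    have := Nat.lt_floor_add_one x
    rw [abs_le]; constructor <;> linarith
  refine (norm_add_le _ _).trans ?_
  rw [norm_mul, norm_real, norm_eq_abs]
  have := mul_le_mul ha.norm_mean_le h2 (abs_nonneg _) zero_le_one
  linarith

lemma measurable_coeffRem : Measurable (coeffRem a q) := by
  unfold coeffRem
  fun_prop

lemma IsPeriodicCoeff.integrableOn_rem (ha : IsPeriodicCoeff a q) {s : ℂ} (hs : 0 < s.re)
    {c : ℝ} (hc : 0 < c) :
    IntegrableOn (fun x : ℝ => coeffRem a q x * (x : ℂ) ^ (-s - 1)) (Set.Ioi c) := by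
  refine Integrable.bdd_mul (c := 2 * q + 2) (integrableOn_Ioi_cpow_of_lt (by simp; linarith) hc)
    measurable_coeffRem.aestronglyMeasurable ?_
  refine (ae_restrict_iff' measurableSet_Ioi).2 (Filter.Eventually.of_forall fun x hx => ?_)
  exact ha.norm_rem_le (hc.trans hx).le

lemma IsPeriodicCoeff.norm_integral_rem_le (ha : IsPeriodicCoeff a q) {s : ℂ} (hs : 0 < s.re)
    {c : ℝ} (hc : 0 < c) :
    ‖∫ x in Set.Ioi c, coeffRem a q x * (x : ℂ) ^ (-s - 1)‖ ≤
      (2 * q + 2) * (c ^ (-s.re) / s.re) := by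
  have h1 : ‖∫ x in Set.Ioi c, coeffRem a q x * (x : ℂ) ^ (-s - 1)‖ ≤
      ∫ x in Set.Ioi c, (2 * q + 2) * x ^ (-s.re - 1) := by
    refine norm_integral_le_of_norm_le
      ((integrableOn_Ioi_rpow_of_lt (by linarith) hc).const_mul _) ?_
    refine (ae_restrict_iff' measurableSet_Ioi).2 (Filter.Eventually.of_forall fun x hx => ?_)
    have hx0 : 0 < x := hc.trans hx
    rw [norm_mul, Complex.norm_cpow_eq_rpow_re_of_pos hx0]
    simp only [sub_re, neg_re, Complex.one_re]
    gcongr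
    exact ha.norm_rem_le hx0.le
  refine h1.trans (le_of_eq ?_)
  rw [integral_const_mul, integral_Ioi_rpow_of_lt (by linarith) hc]
  grind

/-- The continuation of `∑ a n * n ^ (-s)` to `0 < re s`, for a periodic sequence. -/
def periodicL (a : ℕ → ℂ) (q : ℕ) (s : ℂ) : ℂ :=
  coeffMean a q * s / (s - 1) + s * ∫ x in Set.Ioi (1 : ℝ), coeffRem a q x * (x : ℂ) ^ (-s - 1)

lemma IsPeriodicCoeff.differentiableAt_integral (ha : IsPeriodicCoeff a q) {s : ℂ}
    (hs : 0 < s.re) : DifferentiableAt ℂ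
      (fun s => ∫ x in Set.Ioi (1 : ℝ), coeffRem a q x * (x : ℂ) ^ (-s - 1)) s := by
  set f : ℝ → ℂ := Set.indicator (Set.Ioi 1) (coeffRem a q) with hf
  have hb : ∀ x, ‖f x‖ ≤ 2 * q + 2 := by
    intro x
    by_cases hx : x ∈ Set.Ioi (1 : ℝ)
    · rw [hf, Set.indicator_of_mem hx]
      exact ha.norm_rem_le (zero_le_one.trans (le_of_lt hx))
    · rw [hf, Set.indicator_of_notMem hx, norm_zero]; bound
  have hfm : Measurable f := measurable_coeffRem.indicator measurableSet_Ioi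
  have hmel : ∀ s : ℂ, ∫ x in Set.Ioi (1 : ℝ), coeffRem a q x * (x : ℂ) ^ (-s - 1) =
      mellin f (-s) := by
    intro s
    rw [mellin]
    have : ∀ t : ℝ, (t : ℂ) ^ (-s - 1) • f t =
        Set.indicator (Set.Ioi 1) (fun t : ℝ => coeffRem a q t * (t : ℂ) ^ (-s - 1)) t := by
      intro t
      by_cases ht : t ∈ Set.Ioi (1 : ℝ)
      · rw [hf, Set.indicator_of_mem ht, Set.indicator_of_mem ht, smul_eq_mul, mul_comm]
      simp_all
    simp_rw [this]
    rw [setIntegral_indicator measurableSet_Ioi]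
    bound
  simp_rw [hmel]
  have : DifferentiableAt ℂ (mellin f) (-s) := by
    refine mellin_differentiableAt_of_isBigO_rpow (a := 0) (b := -s.re - 1) ?_ ?_ (by simpa) ?_
      (by simp)
    · refine LocallyIntegrable.locallyIntegrableOn ?_ _
      refine (locallyIntegrable_const ((2 * q + 2 : ℝ))).mono hfm.aestronglyMeasurable ?_
      refine Filter.Eventually.of_forall fun x => ?_
      rw [norm_of_nonneg (by bound)]
      bound
    · refine Asymptotics.IsBigO.of_bound (2 * q + 2) (Filter.Eventually.of_forall fun x => ?_)
      simp_all
    · refine Asymptotics.IsBigO.of_bound 1 ?_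
      have : Set.Ioo (0 : ℝ) 1 ∈ nhdsWithin 0 (Set.Ioi 0) := Ioo_mem_nhdsGT one_pos
      filter_upwards [this] with x hx
      rw [hf, Set.indicator_of_notMem (by grind), norm_zero]
      bound
  fun_prop

lemma IsPeriodicCoeff.differentiableAt_periodicL (ha : IsPeriodicCoeff a q) {s : ℂ}
    (hs : 0 < s.re) (h1 : s ≠ 1) : DifferentiableAt ℂ (periodicL a q) s := by
  have := ha.differentiableAt_integral hs
  unfold periodicL
  have h2 : s - 1 ≠ 0 := sub_ne_zero.2 h1
  fun_prop

lemma IsPeriodicCoeff.differentiableAt_mul_periodicL (ha : IsPeriodicCoeff a q) {s : ℂ}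
    (hs : 0 < s.re) : DifferentiableAt ℂ (fun s => coeffMean a q * s + (s - 1) * (s *
      ∫ x in Set.Ioi (1 : ℝ), coeffRem a q x * (x : ℂ) ^ (-s - 1))) s := by
  have := ha.differentiableAt_integral hs
  fun_prop

lemma sub_one_mul_periodicL {s : ℂ} (h1 : s ≠ 1) : (s - 1) * periodicL a q s =
    coeffMean a q * s + (s - 1) * (s *
      ∫ x in Set.Ioi (1 : ℝ), coeffRem a q x * (x : ℂ) ^ (-s - 1)) := by
  have h2 : s - 1 ≠ 0 := sub_ne_zero.2 h1
  rw [periodicL, mul_add]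
  grind

lemma IsPeriodicCoeff.periodicL_eq_LSeries (ha : IsPeriodicCoeff a q) {s : ℂ} (hs : 1 < s.re) :
    periodicL a q s = LSeries a s := by
  have hsum : ∀ x : ℝ, ∑ k ∈ Icc 1 ⌊x⌋₊, a k = coeffRem a q x + coeffMean a q * x := by
    intro x
    rw [coeffRem, sub_add_cancel, ← add_sum_Ioc_eq_sum_Icc (Nat.zero_le _), ha.zero, zero_add]
    rfl
  rw [LSeries_eq_mul_integral a (r := 1) zero_le_one hs]
  · have h0 : ∀ x ∈ Set.Ioi (1 : ℝ), (∑ k ∈ Icc 1 ⌊x⌋₊, a k) * (x : ℂ) ^ (-(s + 1)) =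
        coeffRem a q x * (x : ℂ) ^ (-s - 1) + coeffMean a q * (x : ℂ) ^ (-s) := by
      intro x hx
      have hx0 : (x : ℂ) ≠ 0 := by
        have : 0 < x := zero_lt_one.trans hx
        exact_mod_cast this.ne'
      rw [hsum, add_mul, neg_add', mul_assoc]
      congr 2
      rw [Complex.cpow_sub _ _ hx0, cpow_one]
      field_simp
    rw [setIntegral_congr_fun measurableSet_Ioi h0, integral_add
      (ha.integrableOn_rem (by linarith) one_pos)
      ((integrableOn_Ioi_cpow_of_lt (by simpa using hs) one_pos).const_mul _),
      integral_const_mul, integral_Ioi_cpow_of_lt (by simpa using hs) one_pos]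
    have h2 : s - 1 ≠ 0 := by
      intro h
      have := congrArg Complex.re h
      simp at this; linarith
    have h3 : -s + 1 ≠ 0 := by grind
    rw [periodicL, Complex.ofReal_one, Complex.one_cpow]
    grind
  · exact LSeriesSummable_of_le_const_mul_rpow (x := 1) hs ⟨1, fun n _ => by
      simpa using ha.norm_le n⟩
  · refine Asymptotics.IsBigO.of_bound 1 (Filter.Eventually.of_forall fun n => ?_)
    refine (norm_sum_le_of_le (n := fun _ => (1 : ℝ)) _ fun i _ => ha.norm_le i).trans ?_
    simp

lemma IsPeriodicCoeff.periodicL_truncated (ha : IsPeriodicCoeff a q) {s : ℂ} (hs : 0 < s.re)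
    (h1 : s ≠ 1) {N : ℕ} (hN : 1 ≤ N) :
    periodicL a q s = ∑ n ∈ Icc 0 N, (n : ℂ) ^ (-s) * a n +
      coeffMean a q * (N : ℂ) ^ (1 - s) / (s - 1) - coeffRem a q N * (N : ℂ) ^ (-s) +
      s * ∫ x in Set.Ioi (N : ℝ), coeffRem a q x * (x : ℂ) ^ (-s - 1) := by
  have hN' : (1 : ℝ) ≤ N := by bound
  have hs0 : s ≠ 0 := by rintro rfl; simp at hs
  have h2 : s - 1 ≠ 0 := sub_ne_zero.2 h1
  have hder : ∀ x ∈ Set.Icc (1 : ℝ) N,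
      HasDerivAt (fun x : ℝ => (x : ℂ) ^ (-s)) (-s * (x : ℂ) ^ (-s - 1)) x := by
    intro x hx
    have hx0 : x ≠ 0 := by grind
    exact hasDerivAt_ofReal_cpow_const hx0 (neg_ne_zero.2 hs0)
  have hcont : ContinuousOn (fun x : ℝ => -s * (x : ℂ) ^ (-s - 1)) (Set.Icc (1 : ℝ) N) := by
    refine continuousOn_const.mul (ContinuousOn.cpow_const (by fun_prop) fun x hx => ?_)
    exact Complex.ofReal_mem_slitPlane.2 (by grind)
  have habel := sum_mul_eq_sub_integral_mul₀' (f := fun x : ℝ => (x : ℂ) ^ (-s)) a ha.zero N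
    (fun x hx => (hder x hx).differentiableAt)
    ((hcont.integrableOn_Icc).congr_fun (fun x hx => (hder x hx).deriv.symm) measurableSet_Icc)
  have hE : ∀ x : ℝ, ∑ k ∈ Icc 0 ⌊x⌋₊, a k = coeffRem a q x + coeffMean a q * x := by
    intro x; rw [coeffRem, sub_add_cancel]
  have hEN : ∑ k ∈ Icc 0 N, a k = coeffRem a q N + coeffMean a q * N := by
    have := hE N
    rwa [Nat.floor_natCast, ofReal_natCast] at this
  have hint : ∫ x in Set.Ioc (1 : ℝ) N, deriv (fun x : ℝ => (x : ℂ) ^ (-s)) x *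
      ∑ k ∈ Icc 0 ⌊x⌋₊, a k = -s * (∫ x in Set.Ioc (1 : ℝ) N, coeffRem a q x * (x : ℂ) ^ (-s - 1)) +
        -s * coeffMean a q * (((N : ℂ) ^ (1 - s) - 1) / (1 - s)) := by
    have h0 : ∀ x ∈ Set.Ioc (1 : ℝ) N, deriv (fun x : ℝ => (x : ℂ) ^ (-s)) x *
        ∑ k ∈ Icc 0 ⌊x⌋₊, a k = -s * (coeffRem a q x * (x : ℂ) ^ (-s - 1)) +
          -s * coeffMean a q * (x : ℂ) ^ (-s) := by
      intro x hx
      have hx0 : (x : ℂ) ≠ 0 := by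
        have : 0 < x := zero_lt_one.trans hx.1
        exact_mod_cast this.ne'
      rw [(hder x ⟨hx.1.le, hx.2⟩).deriv, hE]
      have : (x : ℂ) ^ (-s) = (x : ℂ) ^ (-s - 1) * x := by
        rw [Complex.cpow_sub _ _ hx0, cpow_one]; field_simp
      grind
    have hc2 : ContinuousOn (fun x : ℝ => (x : ℂ) ^ (-s)) (Set.Icc (1 : ℝ) N) := fun x hx =>
      (hder x hx).continuousAt.continuousWithinAt
    rw [setIntegral_congr_fun measurableSet_Ioc h0, integral_add, integral_const_mul,
      integral_const_mul]
    · congr 2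
      rw [← intervalIntegral.integral_of_le hN', integral_cpow]
      · rw [show -s + 1 = 1 - s by ring]; simp
      · right
        refine ⟨fun h => h1 (neg_injective h), ?_⟩
        rw [Set.uIcc_of_le hN']
        grind
    · exact ((ha.integrableOn_rem hs one_pos).mono_set Set.Ioc_subset_Ioi_self).const_mul _
    · exact (hc2.integrableOn_Icc.mono_set Set.Ioc_subset_Icc_self).const_mul _
  simp only [ofReal_natCast] at habel
  rw [habel, hint, hEN, periodicL]
  have hsplit : ∫ x in Set.Ioi (1 : ℝ), coeffRem a q x * (x : ℂ) ^ (-s - 1) =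
      (∫ x in Set.Ioc (1 : ℝ) N, coeffRem a q x * (x : ℂ) ^ (-s - 1)) +
      ∫ x in Set.Ioi (N : ℝ), coeffRem a q x * (x : ℂ) ^ (-s - 1) := by
    rw [← Set.Ioc_union_Ioi_eq_Ioi hN', setIntegral_union (Set.Ioc_disjoint_Ioi le_rfl)
      measurableSet_Ioi
      ((ha.integrableOn_rem hs one_pos).mono_set Set.Ioc_subset_Ioi_self)
      (ha.integrableOn_rem hs (by linarith))]
  rw [hsplit]
  have hN0 : (N : ℂ) ≠ 0 := by exact_mod_cast (by omega : N ≠ 0)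
  have e : (N : ℂ) ^ (1 - s) = (N : ℂ) ^ (-s) * N := by
    rw [show 1 - s = -s + 1 by ring, Complex.cpow_add _ _ hN0, cpow_one]
  grind

lemma IsPeriodicCoeff.norm_periodicL_sub_le (ha : IsPeriodicCoeff a q) {s : ℂ} (hs : 0 < s.re)
    (h1 : s ≠ 1) {N : ℕ} (hN : 1 ≤ N) :
    ‖periodicL a q s - ∑ n ∈ Icc 0 N, (n : ℂ) ^ (-s) * a n‖ ≤
      (N : ℝ) ^ (1 - s.re) / ‖s - 1‖ + (2 * q + 2) * (N : ℝ) ^ (-s.re) * (1 + ‖s‖ / s.re) := by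
  have hN' : (0 : ℝ) < N := by bound
  rw [ha.periodicL_truncated hs h1 hN]
  have e : ∀ A B C D : ℂ, A + B - C + D - A = B - C + D := by grind
  rw [e]
  have hn : ∀ z : ℂ, ‖(N : ℂ) ^ z‖ = (N : ℝ) ^ z.re := fun z => by
    rw [← ofReal_natCast, Complex.norm_cpow_eq_rpow_re_of_pos hN']
  have b1 : ‖coeffMean a q * (N : ℂ) ^ (1 - s) / (s - 1)‖ ≤ (N : ℝ) ^ (1 - s.re) / ‖s - 1‖ := by
    rw [norm_div, norm_mul, hn]
    simp only [sub_re, Complex.one_re]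
    gcongr
    exact mul_le_of_le_one_left (by bound) ha.norm_mean_le
  have b2 : ‖coeffRem a q N * (N : ℂ) ^ (-s)‖ ≤ (2 * q + 2) * (N : ℝ) ^ (-s.re) := by
    rw [norm_mul, hn, neg_re]
    gcongr
    exact ha.norm_rem_le hN'.le
  have b3 : ‖s * ∫ x in Set.Ioi (N : ℝ), coeffRem a q x * (x : ℂ) ^ (-s - 1)‖ ≤
      ‖s‖ * ((2 * q + 2) * ((N : ℝ) ^ (-s.re) / s.re)) := by
    rw [norm_mul]
    gcongr
    exact ha.norm_integral_rem_le hs hN'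
  refine (norm_add_le _ _).trans ((add_le_add ((norm_sub_le _ _).trans (add_le_add b1 b2))
    b3).trans (le_of_eq ?_))
  ring

lemma natCast_cpow_eq_osc {n : ℕ} (hn : n ≠ 0) (σ t : ℝ) :
    (n : ℂ) ^ (-(σ + t * I)) = (((n : ℝ) ^ (-σ) : ℝ) : ℂ) * osc t n := by
  have hn0 : (n : ℂ) ≠ 0 := by simp_all
  rw [neg_add, Complex.cpow_add _ _ hn0, Complex.ofReal_cpow (by bound), osc,
    Complex.cpow_def_of_ne_zero hn0 (-(t * I))]
  push_cast
  grind

end Continuation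

section DyadicBounds

open Finset MeasureTheory

def dyadicSum (a : ℕ → ℂ) (σ : ℝ) (N : ℕ) (t : ℝ) : ℂ :=
  ∑ n ∈ Ico N (2 * N), (((n : ℝ) ^ (-σ) : ℝ) : ℂ) * (a n * osc t n)

lemma continuous_osc (n : ℕ) : Continuous fun t => osc t n := by unfold osc; fun_prop

lemma continuous_dyadicSum (a : ℕ → ℂ) (σ : ℝ) (N : ℕ) : Continuous (dyadicSum a σ N) := by
  unfold dyadicSum
  exact continuous_finsetSum _ fun n _ => (((continuous_osc n).const_mul _).const_mul _)

variable {a : ℕ → ℂ} {q : ℕ}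

lemma dyadicSum_trivial (ha : IsPeriodicCoeff a q) {N : ℕ} (hN : 1 ≤ N) {σ σ₀ t : ℝ}
    (h0 : 0 ≤ σ₀) (hσ : σ₀ ≤ σ) : ‖dyadicSum a σ N t‖ ≤ (N : ℝ) ^ (-σ₀) * N := by
  have hN' : (1 : ℝ) ≤ N := by bound
  refine (norm_sum_le_of_le (n := fun _ => (N : ℝ) ^ (-σ₀)) _ fun n hn => ?_).trans ?_
  · rw [mem_Ico] at hn
    have hn' : (N : ℝ) ≤ n := by simp_all
    rw [norm_mul, norm_mul, norm_osc, mul_one, norm_real, norm_eq_abs, abs_of_nonneg (by bound)]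
    calc (n : ℝ) ^ (-σ) * ‖a n‖ ≤ (n : ℝ) ^ (-σ) * 1 := by gcongr; exact ha.norm_le n
      _ ≤ (n : ℝ) ^ (-σ₀) := by
        rw [mul_one]
        exact rpow_le_rpow_of_exponent_le (by linarith) (by linarith)
      _ ≤ (N : ℝ) ^ (-σ₀) := rpow_le_rpow_of_nonpos (by bound) hn' (by linarith)
  · rw [sum_const, Nat.card_Ico, nsmul_eq_mul, show 2 * N - N = N by omega, mul_comm]

lemma dyadicSum_le_of_logPhase (ha : IsPeriodicCoeff a q) {Y Bd : ℝ} {j : ℕ} {t σ σ₀ : ℝ}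
    (h0 : 0 ≤ σ₀) (hσ : σ₀ ≤ σ) (hY : 1 ≤ Y) (hBd : Bd ≤ Y)
    (h : 2 * q ≤ 2 ^ j → ∀ x : ℝ, 1 ≤ x → ((2 ^ j : ℕ) : ℝ) / q ≤ x →
      x ≤ 3 / 2 * (((2 ^ j : ℕ) : ℝ) / q) →
      ∀ (α : ℝ) (M : ℕ), x ≤ α → α ≤ 2 * x → (M : ℝ) ≤ x →
      ‖∑ n ∈ range M, addE (logPhase t α n)‖ ≤ Bd) :
    ‖dyadicSum a σ (2 ^ j) t‖ ≤ 2 * q * (((2 ^ j : ℕ) : ℝ) ^ (-σ₀) * Y) := by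
  have hq : (0 : ℝ) < q := by exact_mod_cast ha.pos
  have hN1 : 1 ≤ 2 ^ j := Nat.one_le_two_pow
  have hN' : (1 : ℝ) ≤ (2 ^ j : ℕ) := by bound
  by_cases hj : 2 * q ≤ 2 ^ j
  · have hj2 : 2 ∣ 2 ^ j := by
      refine dvd_pow_self 2 ?_
      rintro rfl
      have := ha.pos
      omega
    have h1 := dyadic_periodic_sum_le ha hj hj2 (t := t) (σ := σ) (Bd := Y) (by linarith) (by
      intro x hx1 hx2 α M h1 h2 h3
      refine (h hj x ?_ hx1 hx2 α M h1 h2 h3).trans hBd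
      refine le_trans ?_ hx1
      rw [le_div_iff₀ hq]
      have : (2 : ℝ) * q ≤ (2 ^ j : ℕ) := by exact_mod_cast hj
      linarith)
    have h2 : ((2 ^ j : ℕ) : ℝ) ^ (-σ) ≤ (2 ^ j : ℕ) ^ (-σ₀) :=
      rpow_le_rpow_of_exponent_le hN' (by linarith)
    calc _ ≤ _ := h1
      _ ≤ 2 * (((2 ^ j : ℕ) : ℝ) ^ (-σ₀) * (q * Y)) := by gcongr
      _ = _ := by ring
  · refine (dyadicSum_trivial ha hN1 h0 hσ).trans ?_
    have h1 : ((2 ^ j : ℕ) : ℝ) ≤ 2 * q := by exact_mod_cast (not_le.1 hj).le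
    calc ((2 ^ j : ℕ) : ℝ) ^ (-σ₀) * ((2 ^ j : ℕ) : ℝ)
        ≤ (2 ^ j : ℕ) ^ (-σ₀) * (2 * q * Y) := by
          gcongr
          nlinarith
      _ = _ := by ring

lemma dyadicSum_one (ha : IsPeriodicCoeff a q) {j : ℕ} {T t σ σ₀ : ℝ}
    (h0 : 0 ≤ σ₀) (hσ : σ₀ ≤ σ) (hT : 1 ≤ T) (ht : T ≤ t) (ht2 : t ≤ 2 * T)
    (hN : 2 * q * T ≤ (2 ^ j : ℕ)) :
    ‖dyadicSum a σ (2 ^ j) t‖ ≤ 2 * q * (((2 ^ j : ℕ) : ℝ) ^ (-σ₀) *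
      (84 * (((2 ^ j : ℕ) : ℝ) / T))) := by
  have hq : (1 : ℝ) ≤ q := by exact_mod_cast ha.pos
  have hNT : T ≤ (2 ^ j : ℕ) := by nlinarith
  refine dyadicSum_le_of_logPhase ha h0 hσ ?_ le_rfl ?_
  · have : 1 ≤ (2 ^ j : ℕ) / T := by rwa [one_le_div (by linarith)]
    linarith
  · intro _ x hx hx1 hx2 α M h1 h2 h3
    have htx : t ≤ x := by
      refine ht2.trans (le_trans ?_ hx1)
      rw [le_div_iff₀ (by linarith)]
      linarith
    refine (logPhase_sum_one (by linarith) hx h1 h2 htx h3).trans ?_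
    have : x ≤ 3 / 2 * ((2 ^ j : ℕ) : ℝ) := by
      refine hx2.trans ?_
      bound
    calc 56 * (x / t) ≤ 56 * (3 / 2 * ((2 ^ j : ℕ) : ℝ) / T) := by gcongr
      _ = _ := by ring

lemma dyadicSum_two (ha : IsPeriodicCoeff a q) {j : ℕ} {T t σ σ₀ : ℝ}
    (h0 : 0 ≤ σ₀) (hσ : σ₀ ≤ σ) (hT : 1 ≤ T) (ht : T ≤ t) (ht2 : t ≤ 2 * T) :
    ‖dyadicSum a σ (2 ^ j) t‖ ≤ 2 * q * (((2 ^ j : ℕ) : ℝ) ^ (-σ₀) *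
      (20000 * (T ^ (1 / 2 : ℝ) + ((2 ^ j : ℕ) : ℝ) * T ^ (-(1 / 2) : ℝ)))) := by
  have hq : (1 : ℝ) ≤ q := by exact_mod_cast ha.pos
  have hT1 : 1 ≤ T ^ (1 / 2 : ℝ) := one_le_rpow hT (by norm_num)
  refine dyadicSum_le_of_logPhase ha h0 hσ ?_ le_rfl ?_
  · have : 0 ≤ (2 ^ j : ℕ) * T ^ (-(1 / 2) : ℝ) := by bound
    linarith
  · intro _ x hx hx1 hx2 α M h1 h2 h3
    refine (logPhase_sum_two (by linarith) hx h1 h2 h3).trans ?_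
    have hxN : x ≤ 3 / 2 * ((2 ^ j : ℕ) : ℝ) := by
      refine hx2.trans ?_
      bound
    have e1 : √t ≤ 2 * T ^ (1 / 2 : ℝ) := by
      rw [← sqrt_eq_rpow]
      calc √t ≤ √(2 ^ 2 * T) := Real.sqrt_le_sqrt (by linarith)
        _ = 2 * √T := by bound
    have e2 : x / √t ≤ 3 / 2 * ((2 ^ j : ℕ) : ℝ) * T ^ (-(1 / 2) : ℝ) := by
      rw [rpow_neg (by linarith), ← sqrt_eq_rpow, ← div_eq_mul_inv]
      have : 0 < √T := sqrt_pos.2 (by linarith)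
      gcongr
    have : 0 ≤ (2 ^ j : ℕ) * T ^ (-(1 / 2) : ℝ) := by positivity
    linarith

lemma dyadicSum_three (ha : IsPeriodicCoeff a q) {j : ℕ} {T t σ σ₀ : ℝ}
    (h0 : 0 ≤ σ₀) (hσ : σ₀ ≤ σ) (hT : 1 ≤ T) (ht : T ≤ t) (ht2 : t ≤ 2 * T) :
    ‖dyadicSum a σ (2 ^ j) t‖ ≤ 2 * q * (((2 ^ j : ℕ) : ℝ) ^ (-σ₀) *
      (34300 * (((2 ^ j : ℕ) : ℝ) ^ (1 / 2 : ℝ) * T ^ (1 / 6 : ℝ) +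
        ((2 ^ j : ℕ) : ℝ) ^ (5 / 4 : ℝ) * T ^ (-(1 / 4) : ℝ)))) := by
  have hq : (1 : ℝ) ≤ q := by exact_mod_cast ha.pos
  have hN1 : (1 : ℝ) ≤ (2 ^ j : ℕ) := by bound
  set N : ℝ := ((2 ^ j : ℕ) : ℝ) with hN
  have hT0 : 0 < T := by linarith
  have g1 : 1 ≤ N ^ (1 / 2 : ℝ) * T ^ (1 / 6 : ℝ) :=
    one_le_mul_of_one_le_of_one_le (one_le_rpow hN1 (by norm_num)) (one_le_rpow hT (by norm_num))
  have g2 : 0 ≤ N ^ (5 / 4 : ℝ) * T ^ (-(1 / 4) : ℝ) := by bound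
  refine dyadicSum_le_of_logPhase ha h0 hσ (by linarith) le_rfl ?_
  intro _ x hx hx1 hx2 α M h1 h2 h3
  have hxN : x ≤ 3 / 2 * N := by
    refine hx2.trans ?_
    bound
  have hx0 : 0 < x := by linarith
  have ht0 : 0 < t := by linarith
  refine abs_le_of_sq_le_sq' ?_ (by positivity) |>.2
  refine (logPhase_sum_three (by linarith) hx h1 h2 h3).trans ?_
  have e1 : x ^ 2 * (t / (1000 * x ^ 3)) ^ (1 / 3 : ℝ) ≤ N * T ^ (1 / 3 : ℝ) := by
    have : (t / (1000 * x ^ 3)) ^ (1 / 3 : ℝ) ≤ T ^ (1 / 3 : ℝ) / (5 * x) := by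
      have h5 : T ^ (1 / 3 : ℝ) / (5 * x) = (T / (5 * x) ^ 3) ^ (1 / 3 : ℝ) := by
        rw [Real.div_rpow (by bound) (by bound), ← rpow_natCast (5 * x), ← rpow_mul (by bound)]
        norm_num
      rw [h5]
      refine rpow_le_rpow (by bound) ?_ (by norm_num)
      rw [div_le_div_iff₀ (by bound) (by bound)]
      have : 0 < x ^ 3 := by bound
      nlinarith
    calc x ^ 2 * (t / (1000 * x ^ 3)) ^ (1 / 3 : ℝ) ≤ x ^ 2 * (T ^ (1 / 3 : ℝ) / (5 * x)) := by
          gcongr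
      _ = x / 5 * T ^ (1 / 3 : ℝ) := by field_simp
      _ ≤ _ := by gcongr; linarith
  have e2 : x * (t / (2000 * x ^ 3)) ^ (-(1 / 2) : ℝ) ≤
      1000 * (N ^ (5 / 2 : ℝ) * T ^ (-(1 / 2) : ℝ)) := by
    have h4 : (t / (2000 * x ^ 3)) ^ (-(1 / 2) : ℝ) ≤ (T / (2000 * (2 * N) ^ 3)) ^ (-(1 / 2) : ℝ) := by
      refine rpow_le_rpow_of_nonpos (by positivity) ?_ (by norm_num)
      gcongr
      grind
    have h5 : (T / (2000 * (2 * N) ^ 3)) ^ (-(1 / 2) : ℝ) ≤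
        200 * (N ^ (3 / 2 : ℝ) * T ^ (-(1 / 2) : ℝ)) := by
      have : (200 : ℝ) = (40000 : ℝ) ^ (1 / 2 : ℝ) := by bound
      rw [this, show (3 / 2 : ℝ) = (3 : ℕ) * (1 / 2 : ℝ) by norm_num, rpow_mul (by bound),
        rpow_natCast, rpow_neg hT0.le, ← Real.inv_rpow hT0.le,
        rpow_neg (by positivity), ← Real.inv_rpow (by positivity),
        ← mul_rpow (by bound) (by bound),
        ← mul_rpow (by bound) (by bound)]
      refine rpow_le_rpow (by positivity) ?_ (by norm_num)
      rw [inv_div, mul_pow, div_eq_mul_inv]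
      have : 0 ≤ N ^ 3 * T⁻¹ := by bound
      nlinarith
    have h6 : N ^ (5 / 2 : ℝ) = N * N ^ (3 / 2 : ℝ) := by
      rw [← Real.rpow_one_add' (by bound) (by norm_num)]; norm_num
    calc x * (t / (2000 * x ^ 3)) ^ (-(1 / 2) : ℝ)
        ≤ 3 / 2 * N * (200 * (N ^ (3 / 2 : ℝ) * T ^ (-(1 / 2) : ℝ))) := by
          gcongr
          grind
      _ = 300 * (N ^ (5 / 2 : ℝ) * T ^ (-(1 / 2) : ℝ)) := by grind
      _ ≤ _ := by
        have : 0 ≤ N ^ (5 / 2 : ℝ) * T ^ (-(1 / 2) : ℝ) := by bound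
        linarith
  have s1 : (N ^ (1 / 2 : ℝ) * T ^ (1 / 6 : ℝ)) ^ 2 = N * T ^ (1 / 3 : ℝ) := by
    rw [mul_pow, ← rpow_natCast, ← rpow_natCast, ← rpow_mul (by bound), ← rpow_mul hT0.le]
    norm_num
  have s2 : (N ^ (5 / 4 : ℝ) * T ^ (-(1 / 4) : ℝ)) ^ 2 = N ^ (5 / 2 : ℝ) * T ^ (-(1 / 2) : ℝ) := by
    rw [mul_pow, ← rpow_natCast, ← rpow_natCast, ← rpow_mul (by bound), ← rpow_mul hT0.le]
    norm_num
  rw [← s1] at e1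
  rw [← s2] at e2
  set u := N ^ (1 / 2 : ℝ) * T ^ (1 / 6 : ℝ)
  set v := N ^ (5 / 4 : ℝ) * T ^ (-(1 / 4) : ℝ)
  have huv : 0 ≤ u * v := mul_nonneg (by linarith) g2
  calc 34300 * (x ^ 2 * (t / (1000 * x ^ 3)) ^ (1 / 3 : ℝ) + x * (t / (2000 * x ^ 3)) ^ (-(1 / 2) : ℝ))
      ≤ 34300 * (u ^ 2 + 1000 * v ^ 2) := by gcongr
    _ ≤ (34300 * (u + v)) ^ 2 := by nlinarith [sq_nonneg u, sq_nonneg v]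

lemma dyadicSum_four (ha : IsPeriodicCoeff a q) {j : ℕ} {T t σ σ₀ : ℝ}
    (h0 : 0 ≤ σ₀) (hσ : σ₀ ≤ σ) (hT : 1 ≤ T) (ht : T ≤ t) (ht2 : t ≤ 2 * T) :
    ‖dyadicSum a σ (2 ^ j) t‖ ≤ 2 * q * (((2 ^ j : ℕ) : ℝ) ^ (-σ₀) *
      (240100 * (((2 ^ j : ℕ) : ℝ) ^ (5 / 7 : ℝ) * T ^ (1 / 14 : ℝ) +
        ((2 ^ j : ℕ) : ℝ) ^ (5 / 4 : ℝ) * T ^ (-(1 / 8) : ℝ)))) := by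
  have hq : (1 : ℝ) ≤ q := by exact_mod_cast ha.pos
  have hN1 : (1 : ℝ) ≤ (2 ^ j : ℕ) := by bound
  set N : ℝ := ((2 ^ j : ℕ) : ℝ) with hN
  have hT0 : 0 < T := by linarith
  have g1 : 1 ≤ N ^ (5 / 7 : ℝ) * T ^ (1 / 14 : ℝ) :=
    one_le_mul_of_one_le_of_one_le (one_le_rpow hN1 (by norm_num)) (one_le_rpow hT (by norm_num))
  have g2 : 0 ≤ N ^ (5 / 4 : ℝ) * T ^ (-(1 / 8) : ℝ) := by bound
  refine dyadicSum_le_of_logPhase ha h0 hσ (by linarith) le_rfl ?_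
  intro _ x hx hx1 hx2 α M h1 h2 h3
  have hxN : x ≤ 3 / 2 * N := by
    refine hx2.trans ?_
    bound
  have hx0 : 0 < x := by linarith
  have ht0 : 0 < t := by linarith
  refine abs_le_of_sq_le_sq' ?_ (by positivity) |>.2
  refine (logPhase_sum_four (by linarith) hx h1 h2 h3).trans ?_
  have e1 : x ^ 2 * (t / (2000 * x ^ 4)) ^ (1 / 7 : ℝ) ≤ 4 * (N ^ (10 / 7 : ℝ) * T ^ (1 / 7 : ℝ)) := by
    have h5 : (t / (2000 * x ^ 4)) ^ (1 / 7 : ℝ) ≤ T ^ (1 / 7 : ℝ) * x ^ (-(4 / 7) : ℝ) := by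
      have h5 : T ^ (1 / 7 : ℝ) * x ^ (-(4 / 7) : ℝ) = (T / x ^ 4) ^ (1 / 7 : ℝ) := by
        rw [Real.div_rpow (by bound) (by bound), ← rpow_natCast,
          ← rpow_mul (by bound), rpow_neg hx0.le]
        grind
      rw [h5]
      refine rpow_le_rpow (by bound) ?_ (by norm_num)
      rw [div_le_div_iff₀ (by bound) (by bound)]
      have : 0 < x ^ 4 := by bound
      nlinarith
    have h6 : x ^ 2 * x ^ (-(4 / 7) : ℝ) = x ^ (10 / 7 : ℝ) := by
      rw [← rpow_natCast, ← rpow_add hx0]; norm_num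
    have h7 : x ^ (10 / 7 : ℝ) ≤ 4 * N ^ (10 / 7 : ℝ) := by
      calc x ^ (10 / 7 : ℝ) ≤ (2 * N) ^ (10 / 7 : ℝ) := by gcongr; linarith
        _ = 2 ^ (10 / 7 : ℝ) * N ^ (10 / 7 : ℝ) := mul_rpow (by norm_num) (by bound)
        _ ≤ 2 ^ (2 : ℝ) * N ^ (10 / 7 : ℝ) := by
          gcongr
          · norm_num
          grind
        _ = _ := by norm_num
    calc x ^ 2 * (t / (2000 * x ^ 4)) ^ (1 / 7 : ℝ)
        ≤ x ^ 2 * (T ^ (1 / 7 : ℝ) * x ^ (-(4 / 7) : ℝ)) := by gcongr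
      _ = x ^ (10 / 7 : ℝ) * T ^ (1 / 7 : ℝ) := by grind
      _ ≤ 4 * N ^ (10 / 7 : ℝ) * T ^ (1 / 7 : ℝ) := by gcongr
      _ = _ := by ring
  have e2 : x * √x * (t / (6000 * x ^ 4)) ^ (-(1 / 4) : ℝ) ≤
      100 * (N ^ (5 / 2 : ℝ) * T ^ (-(1 / 4) : ℝ)) := by
    have h4 : (t / (6000 * x ^ 4)) ^ (-(1 / 4) : ℝ) ≤ (T / (10 * x) ^ 4) ^ (-(1 / 4) : ℝ) := by
      refine rpow_le_rpow_of_nonpos (by bound) ?_ (by norm_num)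
      rw [mul_pow]
      gcongr
      grind
    have h5 : (T / (10 * x) ^ 4) ^ (-(1 / 4) : ℝ) = 10 * x * T ^ (-(1 / 4) : ℝ) := by
      rw [Real.div_rpow hT0.le (by bound), ← rpow_natCast, ← rpow_mul (by bound)]
      norm_num
      rw [Real.rpow_neg_one]
      field_simp
    have h6 : x * √x * x = x ^ (5 / 2 : ℝ) := by
      rw [sqrt_eq_rpow]
      calc x * x ^ (1 / 2 : ℝ) * x = x ^ (1 : ℝ) * x ^ (1 / 2 : ℝ) * x ^ (1 : ℝ) := by simp
        _ = _ := by rw [← rpow_add hx0, ← rpow_add hx0]; norm_num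
    have h7 : x ^ (5 / 2 : ℝ) ≤ 8 * N ^ (5 / 2 : ℝ) := by
      calc x ^ (5 / 2 : ℝ) ≤ (2 * N) ^ (5 / 2 : ℝ) := by gcongr; linarith
        _ = 2 ^ (5 / 2 : ℝ) * N ^ (5 / 2 : ℝ) := mul_rpow (by norm_num) (by bound)
        _ ≤ 2 ^ (3 : ℝ) * N ^ (5 / 2 : ℝ) := by
          gcongr
          · norm_num
          grind
        _ = _ := by norm_num
    calc x * √x * (t / (6000 * x ^ 4)) ^ (-(1 / 4) : ℝ)
        ≤ x * √x * (10 * x * T ^ (-(1 / 4) : ℝ)) := by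
          gcongr
          grind
      _ = 10 * (x ^ (5 / 2 : ℝ) * T ^ (-(1 / 4) : ℝ)) := by grind
      _ ≤ 10 * (8 * N ^ (5 / 2 : ℝ) * T ^ (-(1 / 4) : ℝ)) := by gcongr
      _ ≤ _ := by
        have : 0 ≤ N ^ (5 / 2 : ℝ) * T ^ (-(1 / 4) : ℝ) := by bound
        linarith
  have s1 : (N ^ (5 / 7 : ℝ) * T ^ (1 / 14 : ℝ)) ^ 2 = N ^ (10 / 7 : ℝ) * T ^ (1 / 7 : ℝ) := by
    rw [mul_pow, ← rpow_natCast, ← rpow_natCast, ← rpow_mul (by bound), ← rpow_mul hT0.le]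
    norm_num
  have s2 : (N ^ (5 / 4 : ℝ) * T ^ (-(1 / 8) : ℝ)) ^ 2 = N ^ (5 / 2 : ℝ) * T ^ (-(1 / 4) : ℝ) := by
    rw [mul_pow, ← rpow_natCast, ← rpow_natCast, ← rpow_mul (by bound), ← rpow_mul hT0.le]
    norm_num
  rw [← s1] at e1
  rw [← s2] at e2
  set u := N ^ (5 / 7 : ℝ) * T ^ (1 / 14 : ℝ)
  set v := N ^ (5 / 4 : ℝ) * T ^ (-(1 / 8) : ℝ)
  have huv : 0 ≤ u * v := mul_nonneg (by linarith) g2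
  calc 240100 * (x ^ 2 * (t / (2000 * x ^ 4)) ^ (1 / 7 : ℝ) +
        x * √x * (t / (6000 * x ^ 4)) ^ (-(1 / 4) : ℝ))
      ≤ 240100 * (4 * u ^ 2 + 100 * v ^ 2) := by gcongr
    _ ≤ (240100 * (u + v)) ^ 2 := by nlinarith [sq_nonneg u, sq_nonneg v]

end DyadicBounds

section DyadicMoments

open Finset MeasureTheory

variable {a : ℕ → ℂ} {q : ℕ}

lemma rpow_add_rpow_le {T s₁ s₂ : ℝ} (hT : 1 ≤ T) : T ^ s₁ + T ^ s₂ ≤ 2 * T ^ max s₁ s₂ := by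
  have h1 := rpow_le_rpow_of_exponent_le hT (le_max_left s₁ s₂)
  have h2 := rpow_le_rpow_of_exponent_le hT (le_max_right s₁ s₂)
  linarith

lemma dyadicSum_moment_of_le (ha : IsPeriodicCoeff a q) {k K : ℕ} (hkK : 2 * k ≤ K)
    {w : ℝ} (hw1 : w ≤ 1) :
    ∃ C, 0 ≤ C ∧ ∀ (T : ℝ) (j : ℕ) (σ s B x : ℝ), 1 ≤ T → 1 - w ≤ σ → 0 ≤ B →
      ((2 ^ j : ℕ) : ℝ) = T ^ x →
      (∀ t, T ≤ t → t ≤ 2 * T → ‖dyadicSum a σ (2 ^ j) t‖ ≤ B * T ^ s) →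
      (K - 2 * k) * s + x * (-k + 2 * k * w + 1 / 100) ≤ 0 →
      (K - 2 * k) * s + x * (1 / 50 + 2 * k * w) ≤ 1 →
      ∫ t in T..2 * T, ‖dyadicSum a σ (2 ^ j) t‖ ^ K ≤ C * B ^ (K - 2 * k) * T := by
  obtain ⟨C, hC, h⟩ := power_moment k (show (0 : ℝ) < 1 / 100 by norm_num)
  refine ⟨2 * C, by bound, fun T j σ s B x hT hσ hB hx hD h1 h2 => ?_⟩
  have hT0 : 0 < T := by linarith
  set N : ℕ := 2 ^ j with hN
  have hN1 : 1 ≤ N := Nat.one_le_two_pow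
  have hN' : (1 : ℝ) ≤ N := by bound
  have h3 := h N (fun n => (((n : ℝ) ^ (-σ) : ℝ) : ℂ) * a n) ((N : ℝ) ^ (-(1 - w))) T
    (Ico N (2 * N)) hN1 (by bound) hT0.le (by
      intro n hn
      rw [mem_Ico] at hn
      have hn' : (N : ℝ) ≤ n := by exact_mod_cast hn.1
      rw [norm_mul, norm_real, norm_eq_abs, abs_of_nonneg (by bound)]
      calc (n : ℝ) ^ (-σ) * ‖a n‖ ≤ (n : ℝ) ^ (-σ) * 1 := by gcongr; exact ha.norm_le n
        _ ≤ (n : ℝ) ^ (-(1 - w)) := by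
          rw [mul_one]
          exact rpow_le_rpow_of_exponent_le (by linarith) (by linarith)
        _ ≤ (N : ℝ) ^ (-(1 - w)) := rpow_le_rpow_of_nonpos (by bound) hn' (by linarith))
    (by grind)
  have h4 : ∀ t, (∑ n ∈ Ico N (2 * N), (((n : ℝ) ^ (-σ) : ℝ) : ℂ) * a n *
      exp ((t * -log n : ℝ) * I)) = dyadicSum a σ N t := by
    intro t
    unfold dyadicSum osc
    grind
  simp only [h4] at h3
  have hcont := (continuous_dyadicSum a σ N).norm
  have h5 : ∫ t in T..2 * T, ‖dyadicSum a σ N t‖ ^ K ≤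
      ∫ t in T..2 * T, (B * T ^ s) ^ (K - 2 * k) * ‖dyadicSum a σ N t‖ ^ (2 * k) := by
    refine integral_mono_on (by linarith) ((hcont.pow _).intervalIntegrable _ _)
      (((hcont.pow _).const_mul _).intervalIntegrable _ _) fun t ht => ?_
    calc ‖dyadicSum a σ N t‖ ^ K
        = ‖dyadicSum a σ N t‖ ^ (K - 2 * k) * ‖dyadicSum a σ N t‖ ^ (2 * k) := by
          rw [← pow_add, Nat.sub_add_cancel hkK]
      _ ≤ _ := by gcongr; grind
  rw [intervalIntegral.integral_const_mul] at h5
  refine h5.trans ((mul_le_mul_of_nonneg_left h3 (by bound)).trans ?_)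
  have e1 : (N : ℝ) ^ k * (N : ℝ) ^ (1 / 100 : ℝ) = T ^ (x * (k + 1 / 100)) := by
    rw [hx, ← rpow_natCast, ← rpow_mul hT0.le, ← rpow_mul hT0.le, ← rpow_add hT0]
    grind
  have e2 : ((N : ℝ) ^ (-(1 - w))) ^ (2 * k) = T ^ (x * (-(1 - w) * (2 * k))) := by
    rw [hx, ← rpow_natCast, ← rpow_mul hT0.le, ← rpow_mul hT0.le]
    grind
  have e3 : (T ^ s) ^ (K - 2 * k) = T ^ ((K - 2 * k) * s) := by
    rw [← rpow_natCast, ← rpow_mul hT0.le, Nat.cast_sub hkK]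
    grind
  rw [mul_pow, e3, e1, e2]
  have f1 : T ^ ((K - 2 * k) * s) * (T * (T ^ (x * (k + 1 / 100)) * T ^ (x * (-(1 - w) * (2 * k))))) ≤ T := by
    rw [← rpow_add hT0]
    nth_rewrite 2 [← rpow_one T]
    rw [← rpow_add hT0, ← rpow_add hT0]
    nth_rewrite 2 [← rpow_one T]
    exact rpow_le_rpow_of_exponent_le hT (by linarith)
  have f2 : T ^ ((K - 2 * k) * s) * (T ^ (x * (k + 1 / 100)) *
      (T ^ (x * (k + 1 / 100)) * T ^ (x * (-(1 - w) * (2 * k))))) ≤ T := by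
    rw [← rpow_add hT0, ← rpow_add hT0, ← rpow_add hT0]
    nth_rewrite 2 [← rpow_one T]
    exact rpow_le_rpow_of_exponent_le hT (by linarith)
  have hCB : 0 ≤ C * B ^ (K - 2 * k) := by bound
  calc _ = C * B ^ (K - 2 * k) * (T ^ ((K - 2 * k) * s) * (T * (T ^ (x * (k + 1 / 100)) *
        T ^ (x * (-(1 - w) * (2 * k))))) + T ^ ((K - 2 * k) * s) * (T ^ (x * (k + 1 / 100)) *
      (T ^ (x * (k + 1 / 100)) * T ^ (x * (-(1 - w) * (2 * k)))))) := by ring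
    _ ≤ C * B ^ (K - 2 * k) * (T + T) := by gcongr
    _ = _ := by ring

variable {T x σ w : ℝ} {j : ℕ}

lemma dyadicSum_trivial_rpow (ha : IsPeriodicCoeff a q) (hT : 1 ≤ T) (hw1 : w ≤ 1)
    (hσ : 1 - w ≤ σ) (hx : ((2 ^ j : ℕ) : ℝ) = T ^ x) (t : ℝ) :
    ‖dyadicSum a σ (2 ^ j) t‖ ≤ 2 * q * 10 ^ 6 * T ^ (w * x) := by
  have hT0 : 0 < T := by linarith
  have hq : (1 : ℝ) ≤ q := by exact_mod_cast ha.pos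
  refine (dyadicSum_trivial ha Nat.one_le_two_pow (by linarith) hσ).trans ?_
  have : (T ^ x) ^ (-(1 - w)) * T ^ x = T ^ (w * x) := by
    rw [← rpow_mul hT0.le, ← rpow_add hT0]; grind
  rw [hx, this]
  have : 0 < T ^ (w * x) := by bound
  nlinarith

lemma rpow_pair_le (hT : 1 ≤ T) {q : ℕ} {A s₁ s₂ : ℝ} (hA : A ≤ 500000) :
    2 * q * (A * (T ^ s₁ + T ^ s₂)) ≤ 2 * q * 10 ^ 6 * T ^ max s₁ s₂ := by
  have h1 := rpow_add_rpow_le hT (s₁ := s₁) (s₂ := s₂)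
  have hT0 : 0 < T := by linarith
  have : 0 ≤ T ^ s₁ + T ^ s₂ := by bound
  calc 2 * q * (A * (T ^ s₁ + T ^ s₂)) ≤ 2 * q * (500000 * (2 * T ^ max s₁ s₂)) := by gcongr
    _ = _ := by ring

lemma dyadicSum_two_rpow (ha : IsPeriodicCoeff a q) (hT : 1 ≤ T) (hw1 : w ≤ 1)
    (hσ : 1 - w ≤ σ) (hx : ((2 ^ j : ℕ) : ℝ) = T ^ x) (t : ℝ) (ht : T ≤ t) (ht2 : t ≤ 2 * T) :
    ‖dyadicSum a σ (2 ^ j) t‖ ≤ 2 * q * 10 ^ 6 *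
      T ^ max (-(1 - w) * x + 1 / 2) (w * x - 1 / 2) := by
  have hT0 : 0 < T := by linarith
  refine (dyadicSum_two ha (by linarith) hσ hT ht ht2).trans ?_
  refine le_trans (le_of_eq ?_) (rpow_pair_le hT (A := 20000) (by norm_num))
  rw [hx, ← rpow_mul hT0.le, show w * x - 1 / 2 = x * -(1 - w) + (x + -(1 / 2)) by ring,
    show -(1 - w) * x + 1 / 2 = x * -(1 - w) + 1 / 2 by ring]
  simp only [rpow_add hT0]
  ring

lemma dyadicSum_three_rpow (ha : IsPeriodicCoeff a q) (hT : 1 ≤ T) (hw1 : w ≤ 1)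
    (hσ : 1 - w ≤ σ) (hx : ((2 ^ j : ℕ) : ℝ) = T ^ x) (t : ℝ) (ht : T ≤ t) (ht2 : t ≤ 2 * T) :
    ‖dyadicSum a σ (2 ^ j) t‖ ≤ 2 * q * 10 ^ 6 *
      T ^ max (-(1 - w) * x + x / 2 + 1 / 6) (-(1 - w) * x + 5 / 4 * x - 1 / 4) := by
  have hT0 : 0 < T := by linarith
  refine (dyadicSum_three ha (by linarith) hσ hT ht ht2).trans ?_
  refine le_trans (le_of_eq ?_) (rpow_pair_le hT (A := 34300) (by norm_num))
  rw [hx, ← rpow_mul hT0.le, ← rpow_mul hT0.le, ← rpow_mul hT0.le,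
    show -(1 - w) * x + x / 2 + 1 / 6 = x * -(1 - w) + (x * (1 / 2) + 1 / 6) by ring,
    show -(1 - w) * x + 5 / 4 * x - 1 / 4 = x * -(1 - w) + (x * (5 / 4) + -(1 / 4)) by ring]
  simp only [rpow_add hT0]
  ring

lemma dyadicSum_four_rpow (ha : IsPeriodicCoeff a q) (hT : 1 ≤ T) (hw1 : w ≤ 1)
    (hσ : 1 - w ≤ σ) (hx : ((2 ^ j : ℕ) : ℝ) = T ^ x) (t : ℝ) (ht : T ≤ t) (ht2 : t ≤ 2 * T) :
    ‖dyadicSum a σ (2 ^ j) t‖ ≤ 2 * q * 10 ^ 6 *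
      T ^ max (-(1 - w) * x + 5 / 7 * x + 1 / 14) (-(1 - w) * x + 5 / 4 * x - 1 / 8) := by
  have hT0 : 0 < T := by linarith
  refine (dyadicSum_four ha (by linarith) hσ hT ht ht2).trans ?_
  refine le_trans (le_of_eq ?_) (rpow_pair_le hT (A := 240100) (by norm_num))
  rw [hx, ← rpow_mul hT0.le, ← rpow_mul hT0.le, ← rpow_mul hT0.le,
    show -(1 - w) * x + 5 / 7 * x + 1 / 14 = x * -(1 - w) + (x * (5 / 7) + 1 / 14) by ring,
    show -(1 - w) * x + 5 / 4 * x - 1 / 8 = x * -(1 - w) + (x * (5 / 4) + -(1 / 8)) by ring]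
  simp only [rpow_add hT0]
  ring

/-- The exponents and abscissae for which the moment bounds below are available. -/
def IsMomentPair (K : ℕ) (w : ℝ) : Prop :=
  (K = 10 ∧ w = 1 / 4) ∨ (K = 28 ∧ w = 1 / 8) ∨ (K = 52 ∧ w = 1 / 16)

lemma dyadicSum_moment_small (ha : IsPeriodicCoeff a q) {K : ℕ} (hKw : IsMomentPair K w) :
    ∃ C, 0 ≤ C ∧ ∀ (T : ℝ) (j : ℕ) (σ x : ℝ), 1 ≤ T → 1 - w ≤ σ →
      ((2 ^ j : ℕ) : ℝ) = T ^ x → 0 ≤ x → x ≤ 101 / 100 →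
      ∫ t in T..2 * T, ‖dyadicSum a σ (2 ^ j) t‖ ^ K ≤ C * T := by
  have hB : (0 : ℝ) ≤ 2 * q * 10 ^ 6 := by bound
  rcases hKw with ⟨rfl, rfl⟩ | ⟨rfl, rfl⟩ | ⟨rfl, rfl⟩
  · obtain ⟨C, hC, h⟩ := dyadicSum_moment_of_le ha (k := 3) (K := 10) (by norm_num)
      (w := 1 / 4) (by norm_num)
    obtain ⟨C', hC', h'⟩ := dyadicSum_moment_of_le ha (k := 2) (K := 10) (by norm_num)
      (w := 1 / 4) (by norm_num)
    refine ⟨C * (2 * q * 10 ^ 6) ^ (10 - 2 * 3) + C' * (2 * q * 10 ^ 6) ^ (10 - 2 * 2),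
      by bound, fun T j σ x hT hσ hx hx0 hx1 => ?_⟩
    have p1 : 0 ≤ C * (2 * q * 10 ^ 6) ^ (10 - 2 * 3) * T := by positivity
    have p2 : 0 ≤ C' * (2 * q * 10 ^ 6) ^ (10 - 2 * 2) * T := by positivity
    rw [add_mul]
    by_cases c1 : x ≤ 55 / 100
    · suffices ∫ t in T..2 * T, ‖dyadicSum a σ (2 ^ j) t‖ ^ 10 ≤
          C * (2 * q * 10 ^ 6) ^ (10 - 2 * 3) * T by linarith
      by_cases c2 : x ≤ 39 / 100
      · refine h T j σ _ _ x hT hσ hB hx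
          (fun t _ _ => dyadicSum_trivial_rpow ha hT (by norm_num) hσ hx t) ?_ ?_ <;>
        grind
      · refine h T j σ _ _ x hT hσ hB hx
          (fun t => dyadicSum_three_rpow ha hT (by norm_num) hσ hx t) ?_ ?_ <;>
        grind
    · suffices ∫ t in T..2 * T, ‖dyadicSum a σ (2 ^ j) t‖ ^ 10 ≤
          C' * (2 * q * 10 ^ 6) ^ (10 - 2 * 2) * T by linarith
      by_cases c2 : x ≤ 60 / 100
      · refine h' T j σ _ _ x hT hσ hB hx
          (fun t => dyadicSum_three_rpow ha hT (by norm_num) hσ hx t) ?_ ?_ <;>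
        grind
      · refine h' T j σ _ _ x hT hσ hB hx
          (fun t => dyadicSum_two_rpow ha hT (by norm_num) hσ hx t) ?_ ?_ <;>
        grind
  on_goal 1 =>
    obtain ⟨C, hC, h⟩ := dyadicSum_moment_of_le ha (k := 4) (K := 28) (by norm_num) (w := 1 / 8)
      (by norm_num)
    refine ⟨C * (2 * q * 10 ^ 6) ^ (28 - 2 * 4), by bound, fun T j σ x hT hσ hx hx0 hx1 => ?_⟩
  on_goal 2 =>
    obtain ⟨C, hC, h⟩ := dyadicSum_moment_of_le ha (k := 4) (K := 52) (by norm_num) (w := 1 / 16)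
      (by norm_num)
    refine ⟨C * (2 * q * 10 ^ 6) ^ (52 - 2 * 4), by bound, fun T j σ x hT hσ hx hx0 hx1 => ?_⟩
  all_goals
    by_cases c1 : x ≤ 28 / 100
    · refine h T j σ _ _ x hT hσ hB hx
        (fun t _ _ => dyadicSum_trivial_rpow ha hT (by norm_num) hσ hx t) ?_ ?_ <;>
      grind
    by_cases c2 : x ≤ 38 / 100
    · refine h T j σ _ _ x hT hσ hB hx
        (fun t => dyadicSum_four_rpow ha hT (by norm_num) hσ hx t) ?_ ?_ <;>
      grind
    by_cases c3 : x ≤ 65 / 100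
    · refine h T j σ _ _ x hT hσ hB hx
        (fun t => dyadicSum_three_rpow ha hT (by norm_num) hσ hx t) ?_ ?_ <;>
      grind
    · refine h T j σ _ _ x hT hσ hB hx
        (fun t => dyadicSum_two_rpow ha hT (by norm_num) hσ hx t) ?_ ?_ <;>
      grind

end DyadicMoments

section PeriodicMoments

open Finset MeasureTheory

variable {a : ℕ → ℂ} {q : ℕ}

lemma dyadicSum_large (ha : IsPeriodicCoeff a q) {w : ℝ} (hw1 : w ≤ 1 / 2) {j : ℕ}
    {T t σ : ℝ} (hσ : 1 - w ≤ σ) (hT : 1 ≤ T) (ht : T ≤ t) (ht2 : t ≤ 2 * T)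
    (hN : 2 * q * T ≤ (2 ^ j : ℕ)) (hN2 : ((2 ^ j : ℕ) : ℝ) ≤ 2 * T ^ 2) :
    ‖dyadicSum a σ (2 ^ j) t‖ ≤ 400 * q := by
  have hT0 : 0 < T := by linarith
  refine (dyadicSum_one ha (by linarith) hσ hT ht ht2 hN).trans ?_
  have hN1 : (1 : ℝ) ≤ (2 ^ j : ℕ) := by bound
  set N : ℝ := ((2 ^ j : ℕ) : ℝ)
  have h1 : N ^ (-(1 - w)) * N ≤ 2 * T := by
    calc N ^ (-(1 - w)) * N = N ^ w := by
          nth_rewrite 2 [← rpow_one N]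
          rw [← rpow_add (by linarith)]; grind
      _ ≤ N ^ (1 / 2 : ℝ) := rpow_le_rpow_of_exponent_le hN1 hw1
      _ ≤ ((2 * T) ^ 2) ^ (1 / 2 : ℝ) := by gcongr; bound
      _ = 2 * T := by rw [← sqrt_eq_rpow, Real.sqrt_sq (by bound)]
  calc 2 * q * (N ^ (-(1 - w)) * (84 * (N / T))) = 168 * q * (N ^ (-(1 - w)) * N) / T := by ring
    _ ≤ 168 * q * (2 * T) / T := by gcongr
    _ = 336 * q := by grind
    _ ≤ _ := by grind

lemma dyadicSum_second_moment (ha : IsPeriodicCoeff a q) {j : ℕ} {T σ : ℝ} (hσ : 1 / 2 ≤ σ)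
    (hT : 0 ≤ T) :
    ∫ t in T..2 * T, ‖dyadicSum a σ (2 ^ j) t‖ ^ 2 ≤
      T + 8 * ((2 ^ j : ℕ) : ℝ) * (1 + log (2 * ((2 ^ j : ℕ) : ℝ))) := by
  have hN1 : 1 ≤ 2 ^ j := Nat.one_le_two_pow
  set N : ℕ := 2 ^ j
  have hN' : (1 : ℝ) ≤ N := by bound
  have h := mean_value (2 * N)
    (fun n => if n ∈ Ico N (2 * N) then (((n : ℝ) ^ (-σ) : ℝ) : ℂ) * a n else 0) hT
  have hsub : Ico N (2 * N) ⊆ Icc 1 (2 * N) := by grind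
  have h4 : ∀ t : ℝ, (∑ n ∈ Icc 1 (2 * N),
      (if n ∈ Ico N (2 * N) then (((n : ℝ) ^ (-σ) : ℝ) : ℂ) * a n else 0) *
      exp ((t * -log n : ℝ) * I)) = dyadicSum a σ N t := by
    intro t
    unfold dyadicSum osc
    rw [← sum_subset hsub]
    · exact sum_congr rfl fun n hn => by grind
    grind
  simp only [h4] at h
  refine h.trans ?_
  have h5 : ∑ m ∈ Icc 1 (2 * N),
      ‖(if m ∈ Ico N (2 * N) then (((m : ℝ) ^ (-σ) : ℝ) : ℂ) * a m else 0)‖ ^ 2 ≤ 1 := by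
    rw [← sum_subset hsub]
    · calc _ ≤ ∑ m ∈ Ico N (2 * N), (N : ℝ)⁻¹ := by
            refine sum_le_sum fun n hn => ?_
            rw [if_pos hn]
            rw [mem_Ico] at hn
            have hn' : (N : ℝ) ≤ n := by exact_mod_cast hn.1
            rw [norm_mul, norm_real, norm_eq_abs, abs_of_nonneg (by bound)]
            calc ((n : ℝ) ^ (-σ) * ‖a n‖) ^ 2 ≤ ((n : ℝ) ^ (-σ) * 1) ^ 2 := by
                  gcongr; exact ha.norm_le n
              _ ≤ ((N : ℝ) ^ (-(1 / 2) : ℝ)) ^ 2 := by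
                rw [mul_one]
                gcongr
                exact (rpow_le_rpow_of_exponent_le (by linarith) (by linarith)).trans
                  (rpow_le_rpow_of_nonpos (by bound) hn' (by norm_num))
              _ = (N : ℝ)⁻¹ := by
                rw [← rpow_natCast, ← rpow_mul (by bound)]
                norm_num
                rw [Real.rpow_neg_one]
        _ = 1 := by
          rw [sum_const, Nat.card_Ico, nsmul_eq_mul, show 2 * N - N = N by omega]
          bound
    · intro n _ hn; rw [if_neg hn]; simp
  have hlog : 0 ≤ log (2 * (N : ℝ)) := log_nonneg (by linarith)
  calc _ ≤ (T + 4 * ((2 * N : ℕ) : ℝ) * (1 + log ((2 * N : ℕ) : ℝ))) * 1 := by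
        push_cast
        gcongr
    _ = _ := by grind

/-- The pointwise approximation of `periodicL` by dyadic sums. -/
lemma norm_periodicL_le_sum_dyadicSum (ha : IsPeriodicCoeff a q) {J : ℕ} {T t σ : ℝ} (hT : 2 ≤ T)
    (ht : T ≤ t) (ht2 : t ≤ 2 * T) (hσ : 1 / 2 ≤ σ) (hσ2 : σ ≤ 2) (hJ : T ^ 2 ≤ ((2 ^ J : ℕ) : ℝ))
    (hJ2 : ((2 ^ J : ℕ) : ℝ) ≤ 2 * T ^ 2) :
    ‖periodicL a q (σ + t * I)‖ ≤ ∑ j ∈ range J, ‖dyadicSum a σ (2 ^ j) t‖ + (18 * q + 21) := by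
  have hT0 : 0 < T := by linarith
  set s : ℂ := σ + t * I with hs
  have hre : s.re = σ := by simp [hs]
  have him : s.im = t := by simp [hs]
  have hs1 : s ≠ 1 := by
    intro h
    have := congrArg Complex.im h
    rw [him] at this
    simp at this
    linarith
  have h := ha.norm_periodicL_sub_le (s := s) (by grind) hs1 (Nat.one_le_two_pow (n := J))
  rw [hre] at h
  have hN1 : (1 : ℝ) ≤ ((2 ^ J : ℕ) : ℝ) := by bound
  have hsum : ∑ n ∈ Icc (0 : ℕ) (2 ^ J), (n : ℂ) ^ (-s) * a n =
      ∑ j ∈ range J, dyadicSum a σ (2 ^ j) t + ((2 ^ J : ℕ) : ℂ) ^ (-s) * a (2 ^ J) := by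
    have e1 : Icc 0 (2 ^ J) = range (2 ^ J + 1) := by ext; simp
    rw [e1, sum_range_succ]
    congr 1
    have : ∀ J : ℕ, ∑ n ∈ range (2 ^ J), (n : ℂ) ^ (-s) * a n =
        ∑ j ∈ range J, dyadicSum a σ (2 ^ j) t := by
      intro J
      induction J with
      | zero => simp [ha.zero]
      | succ J ih =>
        rw [sum_range_succ, ← ih, range_eq_Ico, range_eq_Ico,
          ← sum_Ico_consecutive _ (Nat.zero_le (2 ^ J)) (Nat.pow_le_pow_right two_pos (Nat.le_succ J))]
        congr 1
        unfold dyadicSum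
        rw [show 2 ^ (J + 1) = 2 * 2 ^ J by ring]
        refine sum_congr rfl fun n hn => ?_
        have : n ≠ 0 := by grind
        rw [natCast_cpow_eq_osc this]
        ring
    grind
  rw [hsum] at h
  have hterm : ‖((2 ^ J : ℕ) : ℂ) ^ (-s) * a (2 ^ J)‖ ≤ 1 := by
    rw [norm_mul, Complex.norm_natCast_cpow_of_pos (by bound), neg_re, hre]
    exact mul_le_one₀ (Real.rpow_le_one_of_one_le_of_nonpos hN1 (by linarith)) (norm_nonneg _)
      (ha.norm_le _)
  set N : ℝ := ((2 ^ J : ℕ) : ℝ)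
  have ht1 : T ≤ ‖s - 1‖ := by
    refine le_trans ?_ (Complex.abs_im_le_norm _)
    rw [Complex.sub_im, him, Complex.one_im, sub_zero]
    grind
  have hsn : ‖s‖ ≤ 3 * T := by
    rw [hs]
    refine (norm_add_le _ _).trans ?_
    rw [norm_mul, norm_I, norm_real, norm_real, norm_eq_abs,
      norm_eq_abs, abs_of_nonneg (by linarith), abs_of_nonneg (by linarith)]
    linarith
  have b1 : N ^ (1 - σ) / ‖s - 1‖ ≤ 2 := by
    rw [div_le_iff₀ (by linarith)]
    calc N ^ (1 - σ) ≤ N ^ (1 / 2 : ℝ) := rpow_le_rpow_of_exponent_le hN1 (by linarith)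
      _ ≤ ((2 * T) ^ 2) ^ (1 / 2 : ℝ) := by gcongr; nlinarith
      _ = 2 * T := by rw [← sqrt_eq_rpow, Real.sqrt_sq (by bound)]
      _ ≤ _ := by linarith
  have b2 : N ^ (-σ) ≤ T⁻¹ := by
    calc N ^ (-σ) ≤ N ^ (-(1 / 2) : ℝ) := rpow_le_rpow_of_exponent_le hN1 (by linarith)
      _ ≤ (T ^ 2) ^ (-(1 / 2) : ℝ) := rpow_le_rpow_of_nonpos (by bound) hJ (by norm_num)
      _ = T⁻¹ := by rw [rpow_neg (by bound), ← sqrt_eq_rpow, Real.sqrt_sq hT0.le]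
  have b3 : (2 * q + 2) * N ^ (-σ) * (1 + ‖s‖ / σ) ≤ (2 * q + 2) * 7 := by
    have e1 : 1 + ‖s‖ / σ ≤ 7 * T := by
      have : ‖s‖ / σ ≤ 6 * T := by
        rw [div_le_iff₀ (by linarith)]
        nlinarith
      linarith
    calc (2 * q + 2) * N ^ (-σ) * (1 + ‖s‖ / σ) ≤ (2 * q + 2) * T⁻¹ * (7 * T) := by gcongr
      _ = _ := by field_simp
  have hq : (0 : ℝ) ≤ q := by bound
  set S := ∑ j ∈ range J, dyadicSum a σ (2 ^ j) t
  set y := ((2 ^ J : ℕ) : ℂ) ^ (-s) * a (2 ^ J)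
  calc ‖periodicL a q s‖ = ‖(periodicL a q s - (S + y)) + S + y‖ := by grind
    _ ≤ ‖periodicL a q s - (S + y)‖ + ‖S‖ + ‖y‖ := norm_add₃_le
    _ ≤ (2 + (2 * q + 2) * 7) + ∑ j ∈ range J, ‖dyadicSum a σ (2 ^ j) t‖ + 1 := by
      gcongr
      · linarith
      bound
    _ ≤ _ := by linarith

lemma continuous_periodicL_line (ha : IsPeriodicCoeff a q) {σ : ℝ} (hσ : 0 < σ) {T : ℝ}
    (hT : 0 < T) :
    ContinuousOn (fun t : ℝ => periodicL a q (σ + t * I)) (Set.uIcc T (2 * T)) := by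
  intro t ht
  rw [Set.uIcc_of_le (by linarith)] at ht
  have h1 : DifferentiableAt ℂ (periodicL a q) (σ + t * I) := by
    refine ha.differentiableAt_periodicL (by simpa using hσ) ?_
    intro h
    have := congrArg Complex.im h
    simp at this
    grind
  exact (ContinuousAt.comp (f := fun t : ℝ => (σ : ℂ) + t * I) h1.continuousAt
    (by fun_prop)).continuousWithinAt

lemma periodicL_moment_of_dyadic (ha : IsPeriodicCoeff a q) {K : ℕ} (hK : 1 ≤ K) {w C T₀ : ℝ}
    (hw1 : w ≤ 1 / 2) (hC : 0 ≤ C)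
    (h : ∀ (T σ : ℝ) (J : ℕ), T₀ ≤ T → 1 - w ≤ σ → σ ≤ 2 → ((2 ^ J : ℕ) : ℝ) ≤ 2 * T ^ 2 →
      ∑ j ∈ range J, ∫ t in T..2 * T, ‖dyadicSum a σ (2 ^ j) t‖ ^ K ≤ C * T * log T) :
    ∃ C' T₁ : ℝ, 0 ≤ C' ∧ 3 ≤ T₁ ∧ ∀ T σ : ℝ, T₁ ≤ T → 1 - w ≤ σ → σ ≤ 2 →
      ∫ t in T..2 * T, ‖periodicL a q (σ + t * I)‖ ^ K ≤ C' * T * log T ^ K := by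
  set c : ℝ := 18 * q + 21 with hc
  have hc0 : 0 ≤ c := by bound
  refine ⟨7 ^ (K - 1) * (C + c ^ K), max T₀ 3, by bound, le_max_right _ _, fun T σ hT hσ hσ2 => ?_⟩
  have hT3 : 3 ≤ T := (le_max_right _ _).trans hT
  have hT0 : T₀ ≤ T := (le_max_left _ _).trans hT
  have hTpos : 0 < T := by linarith
  have hlog : 1 ≤ log T := by
    rw [le_log_iff_exp_le hTpos]
    exact exp_one_lt_d9.le.trans (by norm_num; linarith)
  obtain ⟨n, hn1, hn2⟩ := exists_nat_pow_near (x := T ^ 2) (y := 2) (by bound) (by norm_num)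
  set J := n + 1
  have hJ : T ^ 2 ≤ ((2 ^ J : ℕ) : ℝ) := by grind
  have hJ2 : ((2 ^ J : ℕ) : ℝ) ≤ 2 * T ^ 2 := by push_cast; rw [pow_succ]; linarith
  have hJlog : (J : ℝ) + 1 ≤ 7 * log T := by
    have h1 := log_le_log (by bound) hn1
    rw [log_pow, log_pow] at h1
    have h2 := Real.log_two_gt_d9
    have : (J : ℝ) = n + 1 := by push_cast [J]; ring
    push_cast at h1
    have hn0 : (0 : ℝ) ≤ n := by bound
    nlinarith
  have hpt : ∀ t ∈ Set.Icc T (2 * T), ‖periodicL a q (σ + t * I)‖ ^ K ≤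
      (J + 1 : ℝ) ^ (K - 1) * (∑ j ∈ range J, ‖dyadicSum a σ (2 ^ j) t‖ ^ K + c ^ K) := by
    intro t ht
    obtain ⟨m, rfl⟩ : ∃ m, K = m + 1 := ⟨K - 1, by omega⟩
    have h1 := norm_periodicL_le_sum_dyadicSum ha (by linarith) ht.1 ht.2 (by linarith) hσ2 hJ hJ2
    set f : ℕ → ℝ := fun j => if j < J then ‖dyadicSum a σ (2 ^ j) t‖ else c with hf
    have e : ∀ p : ℕ, ∑ j ∈ range (J + 1), f j ^ p =
        ∑ j ∈ range J, ‖dyadicSum a σ (2 ^ j) t‖ ^ p + c ^ p := by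
      intro p
      rw [sum_range_succ]
      congr 1
      · exact sum_congr rfl fun j hj => by grind
      grind
    have h2 := pow_sum_div_card_le_sum_pow (s := range (J + 1)) (f := f) (by grind) m
    have e1 := e 1
    simp only [pow_one] at e1
    rw [e, e1, card_range, div_le_iff₀ (by bound)] at h2
    calc _ ≤ _ := pow_le_pow_left₀ (norm_nonneg _) h1 (m + 1)
      _ ≤ _ := h2
      _ = _ := by grind
  have hcont := fun j => ((continuous_dyadicSum a σ (2 ^ j)).norm.pow K)
  calc ∫ t in T..2 * T, ‖periodicL a q (σ + t * I)‖ ^ K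
      ≤ ∫ t in T..2 * T, (J + 1 : ℝ) ^ (K - 1) *
        (∑ j ∈ range J, ‖dyadicSum a σ (2 ^ j) t‖ ^ K + c ^ K) := by
        refine integral_mono_on (by linarith) ?_ ?_ hpt
        · exact ((continuous_periodicL_line ha (by linarith) hTpos).norm.pow K).intervalIntegrable
        · exact (((continuous_finsetSum _ fun j _ => hcont j).add continuous_const).const_mul
            _).intervalIntegrable _ _
    _ = (J + 1 : ℝ) ^ (K - 1) * (∑ j ∈ range J, (∫ t in T..2 * T, ‖dyadicSum a σ (2 ^ j) t‖ ^ K) +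
        T * c ^ K) := by
        rw [intervalIntegral.integral_const_mul, intervalIntegral.integral_add,
          intervalIntegral.integral_finsetSum, intervalIntegral.integral_const]
        · congr 2
          rw [smul_eq_mul]; ring
        · exact fun j _ => (hcont j).intervalIntegrable _ _
        · exact (continuous_finsetSum _ fun j _ => hcont j).intervalIntegrable _ _
        bound
    _ ≤ (7 * log T) ^ (K - 1) * (C * T * log T + T * log T * c ^ K) := by
        have e0 : 0 ≤ ∑ j ∈ range J, (∫ t in T..2 * T, ‖dyadicSum a σ (2 ^ j) t‖ ^ K) :=
          sum_nonneg fun j _ => intervalIntegral.integral_nonneg (by linarith) fun _ _ => by bound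
        gcongr
        · grind
        bound
    _ = 7 ^ (K - 1) * (C + c ^ K) * T * (log T ^ (K - 1) * log T) := by rw [mul_pow]; ring
    _ = _ := by rw [← pow_succ, Nat.sub_add_cancel hK]

lemma exists_two_pow_le_log {T : ℝ} (hT : 3 ≤ T) {J : ℕ} (hJ : ((2 ^ J : ℕ) : ℝ) ≤ 2 * T ^ 2) :
    (J : ℝ) ≤ 5 * log T := by
  have hlog : 1 ≤ log T := by
    rw [le_log_iff_exp_le (by linarith)]
    exact exp_one_lt_d9.le.trans (by bound)
  push_cast at hJ
  have h1 := log_le_log (by bound) hJ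
  rw [log_pow, log_mul (by norm_num) (by positivity), log_pow] at h1
  have h2 := Real.log_two_gt_d9
  have h3 := Real.log_two_lt_d9
  push_cast at h1
  have : (0 : ℝ) ≤ J := by bound
  nlinarith

/-- Moments of `periodicL` on vertical lines. -/
lemma periodicL_moment (ha : IsPeriodicCoeff a q) {K : ℕ} {w : ℝ} (hKw : IsMomentPair K w) :
    ∃ C T₁ : ℝ, 0 ≤ C ∧ 3 ≤ T₁ ∧ ∀ T σ : ℝ, T₁ ≤ T → 1 - w ≤ σ → σ ≤ 2 →
      ∫ t in T..2 * T, ‖periodicL a q (σ + t * I)‖ ^ K ≤ C * T * log T ^ K := by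
  obtain ⟨C, hC, h⟩ := dyadicSum_moment_small ha hKw
  have hK : 1 ≤ K ∧ w ≤ 1 / 2 := by
    rcases hKw with ⟨rfl, rfl⟩ | ⟨rfl, rfl⟩ | ⟨rfl, rfl⟩ <;> norm_num
  have hq : (1 : ℝ) ≤ q := by exact_mod_cast ha.pos
  refine periodicL_moment_of_dyadic ha hK.1 hK.2 (C := 5 * (C + (400 * q) ^ K))
    (T₀ := max 3 ((2 * q) ^ (100 : ℕ))) (by bound) fun T σ J hT hσ hσ2 hJ => ?_
  have hT3 : 3 ≤ T := (le_max_left _ _).trans hT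
  have hTq : (2 * q : ℝ) ^ (100 : ℕ) ≤ T := (le_max_right _ _).trans hT
  have hT0 : 0 < T := by linarith
  have hlogT : 0 < log T := Real.log_pos (by linarith)
  have key : ∀ j ∈ range J, ∫ t in T..2 * T, ‖dyadicSum a σ (2 ^ j) t‖ ^ K ≤
      (C + (400 * q) ^ K) * T := by
    intro j hj
    have hN1 : (1 : ℝ) ≤ (2 ^ j : ℕ) := by bound
    set x := log ((2 ^ j : ℕ) : ℝ) / log T with hx
    have hx' : ((2 ^ j : ℕ) : ℝ) = T ^ x := by
      rw [Real.rpow_def_of_pos hT0, hx, mul_div_cancel₀ _ hlogT.ne', Real.exp_log (by linarith)]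
    have hx0 : 0 ≤ x := div_nonneg (log_nonneg hN1) hlogT.le
    by_cases hx1 : x ≤ 101 / 100
    · refine (h T j σ x (by linarith) hσ hx' hx0 hx1).trans ?_
      gcongr
      bound
    · have hNT : 2 * q * T ≤ (2 ^ j : ℕ) := by
        have e1 : (2 * q : ℝ) ≤ T ^ (1 / 100 : ℝ) := by
          calc (2 * q : ℝ) = ((2 * q : ℝ) ^ (100 : ℕ)) ^ (1 / 100 : ℝ) := by
                rw [← rpow_natCast, ← rpow_mul (by bound)]
                norm_num
            _ ≤ _ := by gcongr
        rw [hx']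
        calc 2 * q * T ≤ T ^ (1 / 100 : ℝ) * T ^ (1 : ℝ) := by bound
          _ = T ^ (101 / 100 : ℝ) := by rw [← rpow_add hT0]; norm_num
          _ ≤ _ := rpow_le_rpow_of_exponent_le (by linarith) (by linarith)
      have hN2 : ((2 ^ j : ℕ) : ℝ) ≤ 2 * T ^ 2 := by
        refine le_trans ?_ hJ
        exact_mod_cast Nat.pow_le_pow_right two_pos (mem_range.1 hj).le
      calc ∫ t in T..2 * T, ‖dyadicSum a σ (2 ^ j) t‖ ^ K
          ≤ ∫ t in T..2 * T, (400 * q : ℝ) ^ K := by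
            refine integral_mono_on (by linarith)
              (((continuous_dyadicSum a σ _).norm.pow K).intervalIntegrable _ _)
              (continuous_const.intervalIntegrable _ _) fun t ht => ?_
            gcongr
            exact dyadicSum_large ha hK.2 hσ (by linarith) ht.1 ht.2 hNT hN2
        _ = (400 * q) ^ K * T := by rw [intervalIntegral.integral_const, smul_eq_mul]; ring
        _ ≤ _ := by bound
  refine (sum_le_sum key).trans ?_
  rw [sum_const, card_range, nsmul_eq_mul]
  have := exists_two_pow_le_log hT3 hJ
  calc (J : ℝ) * ((C + (400 * q) ^ K) * T) ≤ 5 * log T * ((C + (400 * q) ^ K) * T) := by gcongr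
    _ = _ := by ring

lemma periodicL_second_moment (ha : IsPeriodicCoeff a q) :
    ∃ C T₁ : ℝ, 0 ≤ C ∧ 3 ≤ T₁ ∧ ∀ T σ : ℝ, T₁ ≤ T → 1 / 2 ≤ σ → σ ≤ 2 →
      ∫ t in T..2 * T, ‖periodicL a q (σ + t * I)‖ ^ 2 ≤ C * T * log T ^ 2 := by
  have hq : (1 : ℝ) ≤ q := by exact_mod_cast ha.pos
  have main := periodicL_moment_of_dyadic ha (K := 2) (by norm_num) (w := 1 / 2) le_rfl
    (C := 5 * (1 + (400 * q) ^ 2) + 192 * q) (T₀ := 4 * q + 3) (by bound) ?_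
  · grind
  intro T σ J hT hσ hσ2 hJ
  have hT3 : 3 ≤ T := by linarith
  have hT0 : 0 < T := by linarith
  have hlogT : 1 ≤ log T := by
    rw [le_log_iff_exp_le (by linarith)]
    exact exp_one_lt_d9.le.trans (by norm_num; linarith)
  set B : ℕ → ℝ := fun j => if ((2 ^ j : ℕ) : ℝ) < 2 * q * T then ((2 ^ j : ℕ) : ℝ) else 0 with hB
  have key : ∀ j ∈ range J, ∫ t in T..2 * T, ‖dyadicSum a σ (2 ^ j) t‖ ^ 2 ≤
      (1 + (400 * q) ^ 2) * T + 48 * log T * B j := by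
    intro j hj
    have hN1 : (1 : ℝ) ≤ (2 ^ j : ℕ) := by bound
    by_cases hx1 : ((2 ^ j : ℕ) : ℝ) < 2 * q * T
    · refine (dyadicSum_second_moment ha (by linarith) hT0.le).trans ?_
      simp only [hB, if_pos hx1]
      have h1 : 1 + log (2 * ((2 ^ j : ℕ) : ℝ)) ≤ 3 * log T := by
        have : log (2 * ((2 ^ j : ℕ) : ℝ)) ≤ log (T ^ 2) := log_le_log (by linarith) (by nlinarith)
        rw [log_pow] at this
        grind
      have h2 : 0 ≤ (400 * q : ℝ) ^ 2 * T := by bound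
      have h3 : 8 * ((2 ^ j : ℕ) : ℝ) * (1 + log (2 * ((2 ^ j : ℕ) : ℝ))) ≤
          8 * ((2 ^ j : ℕ) : ℝ) * (3 * log T) := by gcongr
      have h4 : 0 ≤ log T * ((2 ^ j : ℕ) : ℝ) := by positivity
      linarith
    · have hN2 : ((2 ^ j : ℕ) : ℝ) ≤ 2 * T ^ 2 := by
        refine le_trans ?_ hJ
        exact_mod_cast Nat.pow_le_pow_right two_pos (mem_range.1 hj).le
      simp only [hB, if_neg hx1, mul_zero, add_zero]
      calc ∫ t in T..2 * T, ‖dyadicSum a σ (2 ^ j) t‖ ^ 2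
          ≤ ∫ t in T..2 * T, (400 * q : ℝ) ^ 2 := by
            refine integral_mono_on (by linarith)
              (((continuous_dyadicSum a σ _).norm.pow 2).intervalIntegrable _ _)
              (continuous_const.intervalIntegrable _ _) fun t ht => ?_
            gcongr
            exact dyadicSum_large ha (w := 1 / 2) le_rfl hσ (by linarith) ht.1 ht.2
              (not_lt.1 hx1) hN2
        _ = (400 * q) ^ 2 * T := by rw [intervalIntegral.integral_const, smul_eq_mul]; ring
        _ ≤ _ := by grind
  have hBsum : ∀ J : ℕ, ∑ j ∈ range J, B j ≤ ((2 ^ J : ℕ) : ℝ) ∧ ∑ j ∈ range J, B j ≤ 4 * q * T := by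
    intro J
    induction J with
    | zero => simp; bound
    | succ J ih =>
      rw [sum_range_succ]
      have e : ((2 ^ (J + 1) : ℕ) : ℝ) = 2 * ((2 ^ J : ℕ) : ℝ) := by grind
      grind
  refine (sum_le_sum key).trans ?_
  rw [sum_add_distrib, sum_const, card_range, nsmul_eq_mul, ← mul_sum]
  have h1 := exists_two_pow_le_log hT3 hJ
  have h2 := (hBsum J).2
  calc (J : ℝ) * ((1 + (400 * q) ^ 2) * T) + 48 * log T * ∑ j ∈ range J, B j
      ≤ 5 * log T * ((1 + (400 * q) ^ 2) * T) + 48 * log T * (4 * q * T) := by gcongr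
    _ = _ := by ring

end PeriodicMoments

section PeriodicProducts

open Finset MeasureTheory

variable {a : ℕ → ℂ} {q : ℕ}

lemma IsPeriodicCoeff.conj (ha : IsPeriodicCoeff a q) :
    IsPeriodicCoeff (fun n => starRingEnd ℂ (a n)) q :=
  ⟨ha.pos, by simp [ha.zero], fun n => by simp only [ha.periodic], fun n => by
    simpa using ha.norm_le n⟩

lemma periodicL_conj (a : ℕ → ℂ) (q : ℕ) (s : ℂ) :
    periodicL (fun n => starRingEnd ℂ (a n)) q (starRingEnd ℂ s) =
      starRingEnd ℂ (periodicL a q s) := by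
  have hm : coeffMean (fun n => starRingEnd ℂ (a n)) q = starRingEnd ℂ (coeffMean a q) := by
    simp [coeffMean]
  have hr : ∀ x, coeffRem (fun n => starRingEnd ℂ (a n)) q x = starRingEnd ℂ (coeffRem a q x) := by
    intro x; simp [coeffRem, hm]
  have hi : ∫ x in Set.Ioi (1 : ℝ), coeffRem (fun n => starRingEnd ℂ (a n)) q x *
      (x : ℂ) ^ (-(starRingEnd ℂ s) - 1) =
      starRingEnd ℂ (∫ x in Set.Ioi (1 : ℝ), coeffRem a q x * (x : ℂ) ^ (-s - 1)) := by
    rw [← integral_conj]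
    refine setIntegral_congr_fun measurableSet_Ioi fun x hx => ?_
    have hx0 : (0 : ℝ) < x := zero_lt_one.trans hx
    have harg : (x : ℂ).arg ≠ π := by rw [Complex.arg_ofReal_of_nonneg hx0.le]; exact pi_pos.ne
    have := Complex.cpow_conj (x : ℂ) (-s - 1) harg
    simp_all
  simp only [periodicL, hm, hi, map_add, map_mul, map_div₀, map_sub, map_one]

lemma sum_rpow_sub_one_le {w : ℝ} (hw : 0 < w) (hw1 : w ≤ 1) (N : ℕ) :
    ∑ n ∈ Icc 1 N, (n : ℝ) ^ (w - 1) ≤ (N : ℝ) ^ w / w := by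
  induction N with
  | zero => simp [Real.zero_rpow hw.ne']
  | succ N ih =>
    rw [sum_Icc_succ_top (by omega)]
    have hN : (0 : ℝ) < (N + 1 : ℕ) := by bound
    have hb : (N : ℝ) ^ w ≤ ((N + 1 : ℕ) : ℝ) ^ w - w * ((N + 1 : ℕ) : ℝ) ^ (w - 1) := by
      have h := rpow_one_add_le_one_add_mul_self (s := -1 / ((N + 1 : ℕ) : ℝ)) (p := w)
        (by rw [le_div_iff₀ hN]; grind) hw.le hw1
      have e1 : (N : ℝ) = ((N + 1 : ℕ) : ℝ) * (1 + -1 / ((N + 1 : ℕ) : ℝ)) := by grind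
      have h0 : 0 ≤ 1 + -1 / ((N + 1 : ℕ) : ℝ) := by
        by_contra hneg
        push Not at hneg
        have := mul_neg_of_pos_of_neg hN hneg
        grind
      rw [e1, mul_rpow hN.le h0, Real.rpow_sub_one hN.ne']
      have := mul_le_mul_of_nonneg_left h (Real.rpow_nonneg hN.le w)
      grind
    have : (N : ℝ) ^ w / w ≤ ((N + 1 : ℕ) : ℝ) ^ w / w - ((N + 1 : ℕ) : ℝ) ^ (w - 1) := by
      rw [div_le_iff₀ hw, sub_mul, div_mul_cancel₀ _ hw.ne']
      linarith
    linarith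

lemma IsPeriodicCoeff.norm_periodicL_le_rpow (ha : IsPeriodicCoeff a q) {w σ t : ℝ} (hw : 0 < w)
    (hw1 : w ≤ 1 / 2) (hσ : 1 - w ≤ σ) (hσ2 : σ ≤ 2) (ht : 1 ≤ t) :
    ‖periodicL a q (σ + t * I)‖ ≤ (1 / w + 1 + 14 * (2 * q + 2)) * t ^ w := by
  set s : ℂ := σ + t * I with hs
  have hre : s.re = σ := by simp [hs]
  have him : s.im = t := by simp [hs]
  have hσ0 : 1 / 2 ≤ σ := by linarith
  have h1 : s ≠ 1 := by
    intro h
    have := congrArg Complex.im h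
    rw [him] at this
    simp at this
    linarith
  set N := ⌊t⌋₊ with hNdef
  have hN : 1 ≤ N := Nat.le_floor (by grind)
  have hN1 : (1 : ℝ) ≤ N := by bound
  have hN0 : (0 : ℝ) < N := by linarith
  have hNt : (N : ℝ) ≤ t := Nat.floor_le (by linarith)
  have htN : t ≤ 2 * N := by
    have := (Nat.lt_floor_add_one t).le
    grind
  have key := ha.norm_periodicL_sub_le (by grind) h1 hN
  rw [hre] at key
  have hNw : (N : ℝ) ^ w ≤ t ^ w := rpow_le_rpow hN0.le hNt hw.le
  have htw : 0 < t ^ w := Real.rpow_pos_of_pos (by linarith) _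
  have b1 : ‖∑ n ∈ Icc 0 N, (n : ℂ) ^ (-s) * a n‖ ≤ 1 / w * t ^ w := by
    have : ∑ n ∈ Icc 0 N, (n : ℂ) ^ (-s) * a n = ∑ n ∈ Icc 1 N, (n : ℂ) ^ (-s) * a n := by
      symm
      refine sum_subset (Icc_subset_Icc_left (by omega)) fun n hn hn' => ?_
      have : n = 0 := by grind
      simp [this, ha.zero]
    rw [this]
    refine (norm_sum_le_of_le (n := fun n : ℕ => (n : ℝ) ^ (w - 1)) _ fun n hn => ?_).trans ?_
    · have hn1 : 1 ≤ n := (mem_Icc.1 hn).1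
      have hn0 : (0 : ℝ) < n := by bound
      rw [norm_mul, ← ofReal_natCast, Complex.norm_cpow_eq_rpow_re_of_pos hn0, neg_re, hre]
      refine (mul_le_of_le_one_right (Real.rpow_nonneg hn0.le _) (ha.norm_le n)).trans ?_
      exact rpow_le_rpow_of_exponent_le (by bound) (by linarith)
    · refine (sum_rpow_sub_one_le hw (by linarith) N).trans ?_
      rw [one_div_mul_eq_div]
      gcongr
  have b2 : (N : ℝ) ^ (1 - σ) / ‖s - 1‖ ≤ t ^ w := by
    have hn : 1 ≤ ‖s - 1‖ := by
      refine ht.trans ?_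
      have := Complex.abs_im_le_norm (s - 1)
      rw [Complex.sub_im, him, Complex.one_im, sub_zero] at this
      grind
    refine (div_le_self (Real.rpow_nonneg hN0.le _) hn).trans (le_trans ?_ hNw)
    exact rpow_le_rpow_of_exponent_le hN1 (by linarith)
  have b3 : (2 * q + 2) * (N : ℝ) ^ (-σ) * (1 + ‖s‖ / σ) ≤ 14 * (2 * q + 2) * t ^ w := by
    have hsn : ‖s‖ ≤ 3 * t := by
      refine (norm_add_le _ _).trans ?_
      simp only [norm_real, norm_mul, norm_I, mul_one, norm_eq_abs]
      grind
    have h7 : 1 + ‖s‖ / σ ≤ 14 * N := by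
      have : ‖s‖ / σ ≤ 6 * t := by
        rw [div_le_iff₀ (by linarith)]
        nlinarith
      linarith
    have h8 : (N : ℝ) ^ (-σ) ≤ (N : ℝ) ^ (w - 1) := rpow_le_rpow_of_exponent_le hN1 (by linarith)
    calc (2 * q + 2) * (N : ℝ) ^ (-σ) * (1 + ‖s‖ / σ)
        ≤ (2 * q + 2) * (N : ℝ) ^ (w - 1) * (14 * N) := by gcongr
      _ = 14 * (2 * q + 2) * ((N : ℝ) ^ (w - 1) * N) := by ring
      _ = 14 * (2 * q + 2) * (N : ℝ) ^ w := by
          rw [Real.rpow_sub_one hN0.ne', div_mul_cancel₀ _ hN0.ne']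
      _ ≤ _ := by gcongr
  have := norm_le_norm_add_norm_sub' (periodicL a q s) (∑ n ∈ Icc 0 N, (n : ℂ) ^ (-s) * a n)
  linarith

lemma periodicL_moment_scaled {K : ℕ} {w : ℝ} {C T₁ : ℝ} (hC : 0 ≤ C)
    (h : ∀ T σ : ℝ, T₁ ≤ T → 1 - w ≤ σ → σ ≤ 2 →
      ∫ t in T..2 * T, ‖periodicL a q (σ + t * I)‖ ^ K ≤ C * T * log T ^ K)
    {e : ℕ} (he : 1 ≤ e) (he2 : e ≤ 16) {T σ : ℝ} (hT : T₁ ≤ T) (hT16 : 16 ≤ T)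
    (hσ : 1 - w ≤ e * σ) (hσ2 : e * σ ≤ 2) :
    ∫ t in T..2 * T, ‖periodicL a q (e * (σ + t * I))‖ ^ K ≤ 2 ^ K * C * T * log T ^ K := by
  have he0 : (0 : ℝ) < e := by bound
  have he1 : (1 : ℝ) ≤ e := by bound
  have he3 : (e : ℝ) ≤ 16 := by exact_mod_cast he2
  have hT0 : 0 < T := by linarith
  have e1 : ∀ t : ℝ, ‖periodicL a q (e * (σ + t * I))‖ ^ K =
      (fun u : ℝ => ‖periodicL a q ((e * σ : ℝ) + u * I)‖ ^ K) (e * t) := by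
    intro t
    simp only
    congr 3
    push_cast
    ring
  rw [intervalIntegral.integral_congr (fun t _ => e1 t), intervalIntegral.integral_comp_mul_left
    (fun u : ℝ => ‖periodicL a q ((e * σ : ℝ) + u * I)‖ ^ K) he0.ne', smul_eq_mul,
    show (e : ℝ) * (2 * T) = 2 * (e * T) by ring]
  have hTe : T₁ ≤ e * T := hT.trans (by nlinarith)
  have := h (e * T) (e * σ) hTe hσ hσ2
  have hlog : log (e * T) ≤ 2 * log T := by
    rw [log_mul he0.ne' hT0.ne']
    have := log_le_log he0 (he3.trans hT16)
    linarith
  have hlog0 : 0 ≤ log (e * T) := log_nonneg (by nlinarith)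
  calc (e : ℝ)⁻¹ * _ ≤ (e : ℝ)⁻¹ * (C * (e * T) * log (e * T) ^ K) := by gcongr
    _ = C * T * log (e * T) ^ K := by field_simp
    _ ≤ C * T * (2 * log T) ^ K := by gcongr
    _ = _ := by rw [mul_pow]; ring

lemma prod_le_one_add_sum_pow {ι : Type*} [Fintype ι] {y : ι → ℝ} {K : ι → ℕ}
    (hy : ∀ i, 0 ≤ y i) (hK : ∀ i, 1 ≤ K i) (hsum : ∑ i, ((K i : ℝ))⁻¹ ≤ 1) :
    ∏ i, y i ≤ 1 + ∑ i, y i ^ K i := by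
  set M : ℝ := 1 + ∑ i, y i ^ K i with hM
  have hS : 0 ≤ ∑ i, y i ^ K i := sum_nonneg fun i _ => pow_nonneg (hy i) _
  have hM1 : 1 ≤ M := by linarith
  have h1 : ∀ i, y i ≤ M ^ ((K i : ℝ)⁻¹) := by
    intro i
    have h2 : y i ^ K i ≤ M := by
      have := single_le_sum (f := fun i => y i ^ K i) (fun i _ => pow_nonneg (hy i) _) (mem_univ i)
      linarith
    have hk : K i ≠ 0 := by grind
    calc y i = (y i ^ K i) ^ ((K i : ℝ)⁻¹) := (Real.pow_rpow_inv_natCast (hy i) hk).symm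
      _ ≤ _ := rpow_le_rpow (pow_nonneg (hy i) _) h2 (by bound)
  calc ∏ i, y i ≤ ∏ i, M ^ ((K i : ℝ)⁻¹) := prod_le_prod (fun i _ => hy i) fun i _ => h1 i
    _ = M ^ (∑ i, (K i : ℝ)⁻¹) := (Real.rpow_sum_of_pos (by linarith) _ _).symm
    _ ≤ M ^ (1 : ℝ) := rpow_le_rpow_of_exponent_le hM1 hsum
    _ = M := rpow_one M

/-- A finite family of periodic Dirichlet series `L_i (e_i s)`, each with a moment exponent `K_i`
valid on the line `re s = 1 / 16`. -/
structure LFamily (ι : Type*) [Fintype ι] where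
  coeff : ι → ℕ → ℂ
  period : ι → ℕ
  scale : ι → ℕ
  moment : ι → ℕ
  depth : ι → ℝ
  isPeriodic : ∀ i, IsPeriodicCoeff (coeff i) (period i)
  scale_eq : ∀ i, (scale i : ℝ) = 16 * (1 - depth i)
  depth_pos : ∀ i, 1 / 16 ≤ depth i
  isMoment : ∀ i, (moment i = 2 ∧ depth i = 1 / 2) ∨ IsMomentPair (moment i) (depth i)
  sum_inv_moment : ∑ i, (moment i : ℝ)⁻¹ ≤ 1
  sum_depth : ∑ i, depth i ≤ 2

namespace LFamily

variable {ι : Type*} [Fintype ι] (A : LFamily ι)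

/-- The product of the series of the family. -/
def eval (s : ℂ) : ℂ := ∏ i, periodicL (A.coeff i) (A.period i) (A.scale i * s)

/-- The family with conjugate coefficients. -/
def conj : LFamily ι := { A with
    coeff := fun i n => starRingEnd ℂ (A.coeff i n)
    isPeriodic := fun i => (A.isPeriodic i).conj }

lemma eval_conj (s : ℂ) : A.conj.eval (starRingEnd ℂ s) = starRingEnd ℂ (A.eval s) := by
  simp only [eval, conj, map_prod]
  refine prod_congr rfl fun i _ => ?_
  rw [← periodicL_conj]
  simp

lemma norm_eval_neg (σ t : ℝ) : ‖A.eval (σ + (-t : ℝ) * I)‖ = ‖A.conj.eval (σ + t * I)‖ := by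
  have := A.eval_conj (σ + (-t : ℝ) * I)
  simp_all

lemma depth_le (i : ι) : A.depth i ≤ 1 / 2 := by
  rcases A.isMoment i with ⟨_, h⟩ | ⟨_, h⟩ | ⟨_, h⟩ | ⟨_, h⟩ <;> rw [h] <;> norm_num

lemma one_le_moment (i : ι) : 1 ≤ A.moment i := by
  rcases A.isMoment i with ⟨h, _⟩ | ⟨h, _⟩ | ⟨h, _⟩ | ⟨h, _⟩ <;> rw [h] <;> norm_num

lemma scale_bounds (i : ι) : 8 ≤ A.scale i ∧ A.scale i ≤ 15 := by
  have h1 := A.scale_eq i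
  have h2 := A.depth_le i
  have h3 := A.depth_pos i
  constructor
  · have : (8 : ℝ) ≤ A.scale i := by linarith
    exact_mod_cast this
  · have : (A.scale i : ℝ) ≤ 15 := by linarith
    exact_mod_cast this

lemma scale_mul_bounds {σ : ℝ} (h1 : 1 / 16 ≤ σ) (h2 : σ ≤ 13 / 100) (i : ι) :
    1 - A.depth i ≤ A.scale i * σ ∧ A.scale i * σ ≤ 2 := by
  have h := A.scale_eq i
  have h3 : (8 : ℝ) ≤ A.scale i := by exact_mod_cast (A.scale_bounds i).1
  have h4 : (A.scale i : ℝ) ≤ 15 := by exact_mod_cast (A.scale_bounds i).2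
  constructor <;> nlinarith

lemma moment_bound (i : ι) : ∃ C T₁ : ℝ, 0 ≤ C ∧ 3 ≤ T₁ ∧ ∀ T σ : ℝ, T₁ ≤ T →
    1 - A.depth i ≤ σ → σ ≤ 2 →
    ∫ t in T..2 * T, ‖periodicL (A.coeff i) (A.period i) (σ + t * I)‖ ^ A.moment i ≤
      C * T * log T ^ A.moment i := by
  rcases A.isMoment i with ⟨h1, h2⟩ | h
  · rw [h1, h2, show (1 : ℝ) - 1 / 2 = 1 / 2 by norm_num]
    exact periodicL_second_moment (A.isPeriodic i)
  · exact periodicL_moment (A.isPeriodic i) h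

lemma exists_norm_eval_le_pos : ∃ C : ℝ, 0 ≤ C ∧ ∀ σ t : ℝ, 1 / 16 ≤ σ → σ ≤ 13 / 100 → 1 ≤ t →
    ‖A.eval (σ + t * I)‖ ≤ C * t ^ 2 := by
  refine ⟨∏ i, ((1 / A.depth i + 1 + 14 * (2 * A.period i + 2)) * 15 ^ (A.depth i)),
    prod_nonneg fun i _ => ?_, fun σ t h1 h2 ht => ?_⟩
  · have := A.depth_pos i
    have : 0 < A.depth i := by linarith
    positivity
  have hb : ∀ i, ‖periodicL (A.coeff i) (A.period i) (A.scale i * (σ + t * I))‖ ≤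
      ((1 / A.depth i + 1 + 14 * (2 * A.period i + 2)) * 15 ^ (A.depth i)) * t ^ (A.depth i) := by
    intro i
    obtain ⟨h3, h4⟩ := A.scale_mul_bounds h1 h2 i
    have hd : 0 < A.depth i := by linarith [A.depth_pos i]
    have h5 : (8 : ℝ) ≤ A.scale i := by exact_mod_cast (A.scale_bounds i).1
    have h6 : (A.scale i : ℝ) ≤ 15 := by exact_mod_cast (A.scale_bounds i).2
    have := (A.isPeriodic i).norm_periodicL_le_rpow hd (A.depth_le i) h3 h4
      (t := A.scale i * t) (by nlinarith)
    have e1 : ((A.scale i * σ : ℝ) : ℂ) + ((A.scale i * t : ℝ) : ℂ) * I =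
        A.scale i * (σ + t * I) := by push_cast; ring
    rw [e1] at this
    refine this.trans ?_
    rw [mul_assoc _ (_ ^ _), ← mul_rpow (by norm_num) (by linarith)]
    gcongr
  rw [eval, norm_prod]
  refine (prod_le_prod (fun i _ => norm_nonneg _) fun i _ => hb i).trans ?_
  rw [prod_mul_distrib, ← Real.rpow_sum_of_pos (by linarith), ← Real.rpow_two]
  refine mul_le_mul_of_nonneg_left (rpow_le_rpow_of_exponent_le ht A.sum_depth)
    (prod_nonneg fun i _ => ?_)
  have := A.depth_pos i
  have : 0 < A.depth i := by linarith
  positivity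

lemma exists_norm_eval_le : ∃ C : ℝ, 0 ≤ C ∧ ∀ σ t : ℝ, 1 / 16 ≤ σ → σ ≤ 13 / 100 → 1 ≤ |t| →
    ‖A.eval (σ + t * I)‖ ≤ C * t ^ 2 := by
  obtain ⟨C, hC, h⟩ := A.exists_norm_eval_le_pos
  obtain ⟨C', hC', h'⟩ := A.conj.exists_norm_eval_le_pos
  refine ⟨max C C', le_max_of_le_left hC, fun σ t h1 h2 ht => ?_⟩
  rcases le_abs.1 ht with h3 | h3
  · refine (h σ t h1 h2 h3).trans ?_
    bound
  · have := A.norm_eval_neg σ (-t)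
    rw [neg_neg] at this
    rw [this]
    refine (h' σ (-t) h1 h2 h3).trans ?_
    rw [neg_sq]
    bound

lemma continuousOn_factor (i : ι) {σ T : ℝ} (hσ : 0 < σ) (hT : 0 < T) :
    ContinuousOn (fun t : ℝ => periodicL (A.coeff i) (A.period i) (A.scale i * (σ + t * I)))
      (Set.uIcc T (2 * T)) := by
  intro t ht
  rw [Set.uIcc_of_le (by linarith)] at ht
  have h5 : (8 : ℝ) ≤ A.scale i := by exact_mod_cast (A.scale_bounds i).1
  have h1 : DifferentiableAt ℂ (periodicL (A.coeff i) (A.period i)) (A.scale i * (σ + t * I)) := by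
    refine (A.isPeriodic i).differentiableAt_periodicL ?_ ?_
    · simp
      nlinarith
    · intro h
      have := congrArg Complex.im h
      simp at this
      rcases this with h | h
      · rw [h] at h5; grind
      grind
  have hc : Continuous fun t : ℝ => (A.scale i : ℂ) * (σ + t * I) := by fun_prop
  exact (ContinuousAt.comp (f := fun t : ℝ => (A.scale i : ℂ) * (σ + t * I))
    h1.continuousAt hc.continuousAt).continuousWithinAt

lemma continuousOn_eval {σ T : ℝ} (hσ : 0 < σ) (hT : 0 < T) :
    ContinuousOn (fun t : ℝ => A.eval (σ + t * I)) (Set.uIcc T (2 * T)) := by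
  simp only [eval]
  exact continuousOn_finsetProd _ fun i _ => A.continuousOn_factor i hσ hT

lemma exists_integral_eval_le_pos : ∃ C T₁ : ℝ, 0 ≤ C ∧ 3 ≤ T₁ ∧ ∀ T σ : ℝ, T₁ ≤ T →
    1 / 16 ≤ σ → σ ≤ 13 / 100 →
    ∫ t in T..2 * T, ‖A.eval (σ + t * I)‖ ≤ C * T * log T ^ Fintype.card ι := by
  choose C T₁ hC hT₁ h using A.moment_bound
  refine ⟨1 + ∑ i, 2 ^ A.moment i * C i, 16 + ∑ i, T₁ i, ?_, ?_, fun T σ hT h1 h2 => ?_⟩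
  · have : 0 ≤ ∑ i, 2 ^ A.moment i * C i := sum_nonneg fun i _ => mul_nonneg (by bound) (hC i)
    linarith
  · have : 0 ≤ ∑ i, T₁ i := sum_nonneg fun i _ => by grind
    linarith
  have hsT : 0 ≤ ∑ i, T₁ i := sum_nonneg fun i _ => by grind
  have hT16 : 16 ≤ T := by linarith
  have hTi : ∀ i, T₁ i ≤ T := fun i => by
    have := single_le_sum (f := T₁) (fun i _ => by grind) (mem_univ i)
    linarith
  have hT0 : 0 < T := by linarith
  have hl : 0 < log T := Real.log_pos (by linarith)
  have hσ0 : 0 < σ := by linarith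
  set g : ι → ℝ → ℝ := fun i t =>
    ‖periodicL (A.coeff i) (A.period i) (A.scale i * (σ + t * I))‖ with hg
  have hgc : ∀ i, ContinuousOn (g i) (Set.uIcc T (2 * T)) :=
    fun i => (A.continuousOn_factor i hσ0 hT0).norm
  have hpt : ∀ t : ℝ, ‖A.eval (σ + t * I)‖ ≤
      log T ^ Fintype.card ι * (1 + ∑ i, (log T ^ A.moment i)⁻¹ * g i t ^ A.moment i) := by
    intro t
    have := prod_le_one_add_sum_pow (y := fun i => g i t / log T) (K := A.moment)
      (fun i => div_nonneg (norm_nonneg _) hl.le) A.one_le_moment A.sum_inv_moment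
    rw [prod_div_distrib, prod_const, div_le_iff₀ (by bound)] at this
    rw [eval, norm_prod]
    refine this.trans (le_of_eq ?_)
    rw [mul_comm, card_univ]
    congr 2
    refine sum_congr rfl fun i _ => ?_
    rw [div_pow, div_eq_inv_mul]
  have hint : ∀ i ∈ univ, IntervalIntegrable (fun t => (log T ^ A.moment i)⁻¹ * g i t ^ A.moment i)
      volume T (2 * T) := fun i _ =>
    (continuousOn_const.mul ((hgc i).pow _)).intervalIntegrable
  have hsumint : IntervalIntegrable (fun t => ∑ i, (log T ^ A.moment i)⁻¹ *
      g i t ^ A.moment i) volume T (2 * T) := by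
    have := IntervalIntegrable.sum univ hint
    rwa [show (∑ i, fun t => (log T ^ A.moment i)⁻¹ * g i t ^ A.moment i) =
      fun t => ∑ i, (log T ^ A.moment i)⁻¹ * g i t ^ A.moment i by ext; simp] at this
  calc ∫ t in T..2 * T, ‖A.eval (σ + t * I)‖
      ≤ ∫ t in T..2 * T, log T ^ Fintype.card ι *
          (1 + ∑ i, (log T ^ A.moment i)⁻¹ * g i t ^ A.moment i) := by
        refine integral_mono_on (by linarith)
          (A.continuousOn_eval hσ0 hT0).norm.intervalIntegrable ?_ fun t _ => hpt t
        refine IntervalIntegrable.const_mul ?_ _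
        exact intervalIntegrable_const.add hsumint
    _ = log T ^ Fintype.card ι *
          (T + ∑ i, (log T ^ A.moment i)⁻¹ * ∫ t in T..2 * T, g i t ^ A.moment i) := by
        rw [intervalIntegral.integral_const_mul, intervalIntegral.integral_add
          intervalIntegrable_const hsumint, intervalIntegral.integral_finsetSum hint]
        simp only [intervalIntegral.integral_const, intervalIntegral.integral_const_mul]
        congr 2
        simp
        ring
    _ ≤ log T ^ Fintype.card ι * (T + ∑ i, 2 ^ A.moment i * C i * T) := by
        refine mul_le_mul_of_nonneg_left (add_le_add le_rfl (sum_le_sum fun i _ => ?_)) (by bound)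
        obtain ⟨h3, h4⟩ := A.scale_mul_bounds h1 h2 i
        have hs := A.scale_bounds i
        rw [inv_mul_le_iff₀ (by bound), mul_comm (log T ^ _)]
        exact periodicL_moment_scaled (hC i) (h i) (by omega) (by omega) (hTi i) hT16 h3 h4
    _ = _ := by rw [← sum_mul]; ring

lemma exists_integral_eval_le : ∃ C T₁ : ℝ, 0 ≤ C ∧ 3 ≤ T₁ ∧ ∀ T σ : ℝ, T₁ ≤ T →
    1 / 16 ≤ σ → σ ≤ 13 / 100 →
    ∫ t in T..2 * T, (‖A.eval (σ + t * I)‖ + ‖A.eval (σ + (-t : ℝ) * I)‖) ≤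
      C * T * log T ^ Fintype.card ι := by
  obtain ⟨C, T₁, hC, hT₁, h⟩ := A.exists_integral_eval_le_pos
  obtain ⟨C', T₁', hC', hT₁', h'⟩ := A.conj.exists_integral_eval_le_pos
  refine ⟨C + C', max T₁ T₁', by bound, le_max_of_le_left hT₁, fun T σ hT h1 h2 => ?_⟩
  have hT0 : 0 < T := by grind
  have hσ0 : 0 < σ := by linarith
  simp only [A.norm_eval_neg]
  rw [intervalIntegral.integral_add (A.continuousOn_eval hσ0 hT0).norm.intervalIntegrable
    (A.conj.continuousOn_eval hσ0 hT0).norm.intervalIntegrable]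
  grind

end LFamily

end PeriodicProducts

section EulerCoefficients

open Finset Polynomial

/-- The multiplicative function whose values at powers of a prime `p` are the coefficients of the
polynomial `b p`. -/
def eulerCoeff (b : ℕ → ℂ[X]) (n : ℕ) : ℂ :=
  if n = 0 then 0 else n.factorization.prod fun p k => (b p).coeff k

variable {b : ℕ → ℂ[X]}

lemma eulerCoeff_one : eulerCoeff b 1 = 1 := by simp [eulerCoeff]

lemma eulerCoeff_mul {m n : ℕ} (h : m.Coprime n) :
    eulerCoeff b (m * n) = eulerCoeff b m * eulerCoeff b n := by
  by_cases hm : m = 0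
  · simp [eulerCoeff, hm]
  by_cases hn : n = 0
  · simp [eulerCoeff, hn]
  rw [eulerCoeff, eulerCoeff, eulerCoeff, if_neg hm, if_neg hn, if_neg (mul_ne_zero hm hn),
    Nat.factorization_mul_of_coprime h]
  exact Finsupp.prod_add_index_of_disjoint (Nat.Coprime.disjoint_primeFactors h) _

lemma eulerCoeff_prime_pow (hb : ∀ p, (b p).coeff 0 = 1) {p : ℕ} (hp : p.Prime) (k : ℕ) :
    eulerCoeff b (p ^ k) = (b p).coeff k := by
  rw [eulerCoeff, if_neg (pow_ne_zero _ hp.ne_zero), hp.factorization_pow,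
    Finsupp.prod_single_index (h := fun p k => (b p).coeff k) (hb p)]

lemma term_eulerCoeff_mul {s : ℂ} {m n : ℕ} (h : m.Coprime n) : term (eulerCoeff b) s (m * n) =
      term (eulerCoeff b) s m * term (eulerCoeff b) s n := by
  by_cases hm : m = 0
  · bound
  by_cases hn : n = 0
  · bound
  rw [term_of_ne_zero hm, term_of_ne_zero hn,
    term_of_ne_zero (mul_ne_zero hm hn), eulerCoeff_mul h, Nat.cast_mul,
    Complex.natCast_mul_natCast_cpow]
  grind

lemma term_eulerCoeff_prime_pow (hb : ∀ p, (b p).coeff 0 = 1) {p : ℕ} (hp : p.Prime) (s : ℂ)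
    (k : ℕ) : term (eulerCoeff b) s (p ^ k) = (b p).coeff k * ((p : ℂ) ^ (-s)) ^ k := by
  rw [term_of_ne_zero (pow_ne_zero _ hp.ne_zero), eulerCoeff_prime_pow hb hp,
    div_eq_mul_inv, Nat.cast_pow, ← Complex.natCast_cpow_natCast_mul, ← Complex.cpow_neg,
    ← Complex.cpow_nat_mul]
  grind

lemma norm_term_eulerCoeff_prime_pow (hb : ∀ p, (b p).coeff 0 = 1) {p : ℕ} (hp : p.Prime) (s : ℂ)
    (k : ℕ) : ‖term (eulerCoeff b) s (p ^ k)‖ = ‖(b p).coeff k‖ * ((p : ℝ) ^ (-s.re)) ^ k := by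
  rw [term_eulerCoeff_prime_pow hb hp, norm_mul, norm_pow, ← ofReal_natCast,
    Complex.norm_cpow_eq_rpow_re_of_pos (by exact_mod_cast hp.pos), neg_re]

lemma hasSum_term_prime_pow (hb : ∀ p, (b p).coeff 0 = 1) {p : ℕ} (hp : p.Prime) (s : ℂ) :
    HasSum (fun k => term (eulerCoeff b) s (p ^ k)) ((b p).eval ((p : ℂ) ^ (-s))) := by
  simp only [term_eulerCoeff_prime_pow hb hp]
  rw [eval_eq_sum_range]
  refine hasSum_sum_of_ne_finset_zero fun k hk => ?_
  rw [coeff_eq_zero_of_natDegree_lt (by grind), zero_mul]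

/-- The value at `x` of the polynomial with coefficients the norms of those of `P`. -/
def normEval (P : ℂ[X]) (x : ℝ) : ℝ := ∑ k ∈ range (P.natDegree + 1), ‖P.coeff k‖ * x ^ k

lemma hasSum_norm_term_prime_pow (hb : ∀ p, (b p).coeff 0 = 1) {p : ℕ} (hp : p.Prime) (s : ℂ) :
    HasSum (fun k => ‖term (eulerCoeff b) s (p ^ k)‖) (normEval (b p) ((p : ℝ) ^ (-s.re))) := by
  simp only [norm_term_eulerCoeff_prime_pow hb hp]
  refine hasSum_sum_of_ne_finset_zero fun k hk => ?_
  rw [coeff_eq_zero_of_natDegree_lt (by grind), norm_zero, zero_mul]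

lemma sum_norm_term_le (hb : ∀ p, (b p).coeff 0 = 1) {s : ℂ} {B : ℝ}
    (hB : ∀ N : ℕ, ∏ p ∈ N.primesBelow, normEval (b p) ((p : ℝ) ^ (-s.re)) ≤ B) (N : ℕ) :
    ∑ n ∈ range N, ‖term (eulerCoeff b) s n‖ ≤ B := by
  have h := EulerProduct.summable_and_hasSum_smoothNumbers_prod_primesBelow_tsum
    (f := fun n => ‖term (eulerCoeff b) s n‖)
    (by simp [term_of_ne_zero, eulerCoeff_one])
    (fun {m n} h => by rw [term_eulerCoeff_mul h, norm_mul])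
    (fun {p} hp => by simpa using (hasSum_norm_term_prime_pow hb hp s).summable) N
  have e : ∏ p ∈ N.primesBelow, ∑' k : ℕ, ‖term (eulerCoeff b) s (p ^ k)‖ =
      ∏ p ∈ N.primesBelow, normEval (b p) ((p : ℝ) ^ (-s.re)) :=
    prod_congr rfl fun p hp =>
      (hasSum_norm_term_prime_pow hb (Nat.prime_of_mem_primesBelow hp) s).tsum_eq
  rw [e] at h
  refine le_trans ?_ (hB N)
  have h2 : HasSum ((N.smoothNumbers : Set ℕ).indicator
      fun n => ‖term (eulerCoeff b) s n‖) _ := hasSum_subtype_iff_indicator.1 h.2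
  rw [← h2.tsum_eq]
  refine le_trans (le_of_eq ?_) (h2.summable.sum_le_tsum (range N) fun n _ =>
    Set.indicator_nonneg (fun _ _ => norm_nonneg _) _)
  refine sum_congr rfl fun n hn => ?_
  by_cases hn0 : n = 0
  · subst hn0
    rw [Set.indicator_of_notMem]
    · simp
    · exact fun h => Nat.ne_zero_of_mem_smoothNumbers h rfl
  · rw [Set.indicator_of_mem]
    exact Nat.mem_smoothNumbers_of_lt (Nat.pos_of_ne_zero hn0) (mem_range.1 hn)

lemma lseriesSummable_eulerCoeff (hb : ∀ p, (b p).coeff 0 = 1) {s : ℂ} {B : ℝ}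
    (hB : ∀ N : ℕ, ∏ p ∈ N.primesBelow, normEval (b p) ((p : ℝ) ^ (-s.re)) ≤ B) :
    LSeriesSummable (eulerCoeff b) s :=
  Summable.of_norm (summable_of_sum_range_le (fun _ => norm_nonneg _) (sum_norm_term_le hb hB))

lemma norm_lseries_eulerCoeff_le (hb : ∀ p, (b p).coeff 0 = 1) {s : ℂ} {B : ℝ}
    (hB : ∀ N : ℕ, ∏ p ∈ N.primesBelow, normEval (b p) ((p : ℝ) ^ (-s.re)) ≤ B) :
    ‖LSeries (eulerCoeff b) s‖ ≤ B :=
  (norm_tsum_le_tsum_norm (lseriesSummable_eulerCoeff hb hB).norm).trans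
    (Real.tsum_le_of_sum_range_le (fun _ => norm_nonneg _) (sum_norm_term_le hb hB))

lemma hasProd_lseries_eulerCoeff (hb : ∀ p, (b p).coeff 0 = 1) {s : ℂ}
    (hs : LSeriesSummable (eulerCoeff b) s) :
    HasProd (fun p : Nat.Primes => (b p).eval ((p : ℂ) ^ (-s))) (LSeries (eulerCoeff b) s) := by
  have h := EulerProduct.eulerProduct_hasProd (f := term (eulerCoeff b) s)
    (by simp [term_of_ne_zero, eulerCoeff_one]) (fun {m n} h => term_eulerCoeff_mul h)
    hs.norm (by simp)
  have e : (fun p : Nat.Primes => ∑' k : ℕ, term (eulerCoeff b) s ((p : ℕ) ^ k)) =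
      fun p : Nat.Primes => (b p).eval ((p : ℂ) ^ (-s)) :=
    funext fun p => (hasSum_term_prime_pow hb p.2 s).tsum_eq
  rw [e] at h
  exact h

lemma sum_primesBelow_rpow_le {a : ℝ} (ha : 1 < a) (N : ℕ) :
    ∑ p ∈ N.primesBelow, (p : ℝ) ^ (-a) ≤ ∑' n : ℕ, (n : ℝ) ^ (-a) :=
  (Real.summable_nat_rpow.2 (by linarith)).sum_le_tsum _ fun _ _ => by bound

lemma prod_primesBelow_one_add_rpow_le {a : ℝ} (ha : 1 < a) (N : ℕ) :
    ∏ p ∈ N.primesBelow, (1 + (p : ℝ) ^ (-a)) ≤ a / (a - 1) := by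
  have hs := Real.summable_nat_rpow.2 (show -a < -1 by linarith)
  have h1 : ∑ n ∈ range 1, ((1 : ℝ) + n) ^ (-a) = 1 := by simp
  have hz : ∑' n : ℕ, (n : ℝ) ^ (-a) ≤ a / (a - 1) := by
    refine Real.tsum_le_of_sum_range_le (fun _ => by bound) fun M => ?_
    refine (sum_le_sum_of_subset_of_nonneg (range_subset_range.2 (show M ≤ M + 1 by omega))
      fun _ _ _ => by bound).trans ?_
    rw [sum_range_succ']
    simp only [Nat.cast_zero, Real.zero_rpow (show -a ≠ 0 by linarith), add_zero]
    rcases Nat.eq_zero_or_pos M with rfl | hM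
    · simp only [range_zero, sum_empty]
      bound
    have hanti : AntitoneOn (fun x : ℝ => x ^ (-a)) (Set.Icc ((1 : ℕ) : ℝ) (M : ℕ)) := by
      intro x hx y hy hxy
      simp only [Nat.cast_one, Set.mem_Icc] at hx
      exact rpow_le_rpow_of_nonpos (by linarith) hxy (by linarith)
    have hi := hanti.sum_le_integral_Ico hM
    obtain ⟨M, rfl⟩ : ∃ M', M = M' + 1 := ⟨M - 1, by omega⟩
    rw [sum_range_succ']
    have e1 : ∑ k ∈ range M, ((k + 1 + 1 : ℕ) : ℝ) ^ (-a) =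
        ∑ i ∈ Ico 1 (M + 1), ((i + 1 : ℕ) : ℝ) ^ (-a) := by
      rw [Finset.sum_Ico_eq_sum_range]
      grind
    rw [e1]
    refine (add_le_add_left hi _).trans ?_
    rw [integral_rpow (Or.inr ⟨by linarith, by
      rw [Set.uIcc_of_le (by grind)]
      simp⟩)]
    have h3 : (0 : ℝ) ≤ ((M + 1 : ℕ) : ℝ) ^ (-a + 1) := by bound
    simp only [Nat.cast_one, Real.one_rpow, zero_add]
    have e2 : a / (a - 1) = 1 + 1 / (a - 1) := by grind
    rw [e2, show (((M + 1 : ℕ) : ℝ) ^ (-a + 1) - 1) / (-a + 1) =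
      (1 - ((M + 1 : ℕ) : ℝ) ^ (-a + 1)) / (a - 1) by
        rw [← neg_div_neg_eq]; congr 1 <;> ring, add_comm]
    gcongr
    linarith
  refine le_trans ?_ hz
  set f : ℕ →*₀ ℝ :=
    { toFun := fun n => (n : ℝ) ^ (-a)
      map_zero' := by simp [Real.zero_rpow (show -a ≠ 0 by linarith)]
      map_one' := by simp
      map_mul' := fun m n => by push_cast; exact mul_rpow (cast_nonneg _) (cast_nonneg _) } with hf
  have hlt : ∀ {p : ℕ}, p.Prime → ‖f p‖ < 1 := by
    intro p hp
    have : (0 : ℝ) ≤ (p : ℝ) ^ (-a) := by bound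
    simp only [hf, MonoidWithZeroHom.coe_mk, ZeroHom.coe_mk]
    rw [norm_of_nonneg this]
    exact Real.rpow_lt_one_of_one_lt_of_neg (by exact_mod_cast hp.one_lt) (by linarith)
  have h := (EulerProduct.summable_and_hasSum_smoothNumbers_prod_primesBelow_geometric
    (f := (f : ℕ →* ℝ)) (fun {p} hp => hlt hp) N).2
  have h2 := hasSum_subtype_iff_indicator.1 h
  calc ∏ p ∈ N.primesBelow, (1 + (p : ℝ) ^ (-a))
      ≤ ∏ p ∈ N.primesBelow, (1 - (f : ℕ →* ℝ) p)⁻¹ := by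
        refine prod_le_prod (fun p _ => by bound) fun p hp => ?_
        have h0 : (0 : ℝ) ≤ (p : ℝ) ^ (-a) := by bound
        have h1 := hlt (Nat.prime_of_mem_primesBelow hp)
        have e : (f : ℕ →* ℝ) p = (p : ℝ) ^ (-a) := rfl
        rw [show f p = (p : ℝ) ^ (-a) from rfl, norm_of_nonneg h0] at h1
        rw [e, ← one_div, le_div_iff₀ (by linarith)]
        nlinarith
    _ = _ := h2.tsum_eq.symm
    _ ≤ ∑' n : ℕ, (n : ℝ) ^ (-a) := by
        refine h2.summable.tsum_le_tsum (fun n => ?_) hs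
        exact Set.indicator_le_self' (fun m _ => Real.rpow_nonneg (cast_nonneg m) _) _

end EulerCoefficients

section FieldSeries

open Finset Polynomial

/-- The discriminant exponent `16 (1 - 1 / 2 ^ (j + 1))` at a prime of ramification index
`2 ^ (j + 1)`. -/
def discExp (j : ℕ) : ℕ := 16 - 2 ^ (3 - j)

/-- Index set of the Dirichlet characters modulo `2 ^ (j + 1)`, `j < J`. -/
abbrev LIndex (J : ℕ) : Type := Σ j : Fin J, DirichletCharacter ℂ (2 ^ ((j : ℕ) + 1))

instance (n : ℕ) [NeZero n] : Fintype (DirichletCharacter ℂ n) := ofFinite _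

instance (J : ℕ) : Fintype (LIndex J) := inferInstance

def fieldPoly (J p : ℕ) : ℂ[X] :=
  1 + ∑ i : LIndex J, C (i.2 (p : ZMod (2 ^ ((i.1 : ℕ) + 1)))) * X ^ discExp i.1

def corrPoly (J p : ℕ) : ℂ[X] :=
  fieldPoly J p * ∏ i : LIndex J, (1 - C (i.2 (p : ZMod (2 ^ ((i.1 : ℕ) + 1)))) * X ^ discExp i.1)

/-- The number of characters of `(ℤ / p)ˣ` of order `2 ^ (j + 1)`, `j < J`, with discriminant
exponent `k`. -/
def localCount (J p k : ℕ) : ℕ :=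
  if k = 0 then 1 else ∑ j ∈ range J, if discExp j = k ∧ p % 2 ^ (j + 1) = 1 then 2 ^ j else 0

def fieldCount (J n : ℕ) : ℕ :=
  if n = 0 then 0 else n.factorization.prod fun p k => localCount J p k

lemma discExp_bounds {J : ℕ} (hJ : J ≤ 4) (j : Fin J) :
    8 ≤ discExp j ∧ discExp j ≤ 15 ∧ ((j : ℕ) ≠ 0 → 12 ≤ discExp j) := by
  have : (j : ℕ) < 4 := j.2.trans_le hJ
  generalize (j : ℕ) = k at this
  interval_cases k <;> simp [discExp]

lemma card_dirichletCharacter_two_pow (j : ℕ) :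
    Fintype.card (DirichletCharacter ℂ (2 ^ (j + 1))) = 2 ^ j := by
  rw [← card_eq_fintype_card, DirichletCharacter.card_eq_totient_of_hasEnoughRootsOfUnity,
    Nat.totient_prime_pow_succ prime_two]
  simp

lemma card_LIndex_eq_sum (J : ℕ) {M : Type*} [AddCommMonoid M] (g : Fin J → M) :
    ∑ i : LIndex J, g i.1 = ∑ j : Fin J, 2 ^ (j : ℕ) • g j := by
  rw [Fintype.sum_sigma]
  refine sum_congr rfl fun j _ => ?_
  change ∑ _χ : DirichletCharacter ℂ (2 ^ ((j : ℕ) + 1)), g j = _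
  rw [sum_const, card_univ, card_dirichletCharacter_two_pow]

lemma card_LIndex {J : ℕ} (hJ : J ≤ 4) : Fintype.card (LIndex J) ≤ 15 := by
  have := card_LIndex_eq_sum J (fun _ => 1)
  simp only [sum_const, card_univ, smul_eq_mul, mul_one] at this
  rw [this]
  interval_cases J <;> simp [Fin.sum_univ_succ]

lemma sum_characters_two_pow (j p : ℕ) :
    ∑ χ : DirichletCharacter ℂ (2 ^ (j + 1)), χ (p : ZMod (2 ^ (j + 1))) =
      if p % 2 ^ (j + 1) = 1 then 2 ^ j else 0 := by
  have h := DirichletCharacter.sum_characters_eq ℂ (n := 2 ^ (j + 1)) (p : ZMod (2 ^ (j + 1)))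
  have e : (p : ZMod (2 ^ (j + 1))) = 1 ↔ p % 2 ^ (j + 1) = 1 := by
    have h1 := ZMod.natCast_eq_natCast_iff' p 1 (2 ^ (j + 1))
    rwa [Nat.cast_one, Nat.mod_eq_of_lt (a := 1) (Nat.one_lt_two_pow (by omega))] at h1
  rw [Nat.totient_prime_pow_succ prime_two] at h
  simp only [e] at h
  grind

lemma coeff_fieldPoly {J : ℕ} (hJ : J ≤ 4) (p k : ℕ) :
    (fieldPoly J p).coeff k = (localCount J p k : ℂ) := by
  rw [fieldPoly, coeff_add, finsetSum_coeff, localCount]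
  simp only [coeff_C_mul, coeff_X_pow, coeff_one]
  by_cases hk : k = 0
  · subst hk
    simp only [if_true, Nat.cast_one]
    rw [sum_eq_zero, add_zero]
    intro i _
    rw [if_neg (by have := (discExp_bounds hJ i.1).1; omega), mul_zero]
  · rw [if_neg hk, if_neg hk, zero_add, Fintype.sum_sigma, ← Fin.sum_univ_eq_sum_range
      (fun j => if discExp j = k ∧ p % 2 ^ (j + 1) = 1 then 2 ^ j else 0)]
    push_cast
    refine sum_congr rfl fun j _ => ?_
    change ∑ χ : DirichletCharacter ℂ (2 ^ ((j : ℕ) + 1)), χ (p : ZMod (2 ^ ((j : ℕ) + 1))) *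
      (if k = discExp j then (1 : ℂ) else 0) = _
    rw [← sum_mul, sum_characters_two_pow]
    grind

lemma coeff_zero_fieldPoly {J : ℕ} (hJ : J ≤ 4) (p : ℕ) : (fieldPoly J p).coeff 0 = 1 := by
  rw [coeff_fieldPoly hJ, localCount, if_pos rfl, Nat.cast_one]

lemma coeff_zero_corrPoly {J : ℕ} (hJ : J ≤ 4) (p : ℕ) : (corrPoly J p).coeff 0 = 1 := by
  rw [corrPoly, mul_coeff_zero, coeff_zero_fieldPoly hJ, one_mul, coeff_zero_eq_eval_zero,
    eval_prod]
  refine prod_eq_one fun i _ => ?_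
  have := (discExp_bounds hJ i.1).1
  simp [zero_pow (show discExp i.1 ≠ 0 by omega)]

lemma eulerCoeff_fieldPoly {J : ℕ} (hJ : J ≤ 4) (n : ℕ) :
    eulerCoeff (fieldPoly J) n = (fieldCount J n : ℂ) := by
  rw [eulerCoeff, fieldCount]
  split_ifs
  · simp
  · simp only [coeff_fieldPoly hJ, Finsupp.prod]
    bound

lemma fieldPoly_mod {J : ℕ} (hJ : J ≤ 4) (p : ℕ) (i : LIndex J) :
    i.2 ((p % 16 : ℕ) : ZMod (2 ^ ((i.1 : ℕ) + 1))) = i.2 (p : ZMod (2 ^ ((i.1 : ℕ) + 1))) := by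
  congr 1
  rw [ZMod.natCast_eq_natCast_iff]
  have h : 2 ^ ((i.1 : ℕ) + 1) ∣ 16 := by
    have : (i.1 : ℕ) < 4 := i.1.2.trans_le hJ
    exact pow_dvd_pow 2 (show (i.1 : ℕ) + 1 ≤ 4 by omega)
  exact (Nat.mod_modEq p 16).of_dvd h

lemma corrPoly_mod {J : ℕ} (hJ : J ≤ 4) (p : ℕ) : corrPoly J (p % 16) = corrPoly J p := by
  simp only [corrPoly, fieldPoly, fieldPoly_mod hJ]

lemma exists_prod_one_sub {ι : Type*} (s : Finset ι) (c : ι → ℂ) (d : ι → ℕ) :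
    ∃ R : ℂ[X], ∏ i ∈ s, (1 - C (c i) * X ^ (12 + d i)) =
      1 - X ^ 12 * ∑ i ∈ s, C (c i) * X ^ d i + X ^ 24 * R := by
  induction s using Finset.induction_on with
  | empty => bound
  | insert i s hi ih =>
    obtain ⟨R, hR⟩ := ih
    rw [prod_insert hi, sum_insert hi, hR]
    refine ⟨R * (1 - C (c i) * X ^ (12 + d i)) + C (c i) * X ^ d i * ∑ i ∈ s, C (c i) * X ^ d i, ?_⟩
    grind

lemma mul_one_sub_expand {A : Type*} [CommRing A] (x a D R : A) :
    (1 + a * x ^ 8 + x ^ 12 * D) * ((1 - a * x ^ 8) * (1 - x ^ 12 * D + x ^ 24 * R)) =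
      1 - a ^ 2 * x ^ 16 + x ^ 20 * (D * (a ^ 2 * x ^ 8 - a) - x ^ 4 * D ^ 2 * (1 - a * x ^ 8)
        + x ^ 4 * R * (1 - a ^ 2 * x ^ 16 + x ^ 12 * D * (1 - a * x ^ 8))) := by
  ring

lemma exists_mul_prod_one_sub_eq {ι : Type*} [Fintype ι] (c : ι → ℂ) (e : ι → ℕ) (i₀ : ι)
    (h8 : e i₀ = 8) (he : ∀ i, i ≠ i₀ → 12 ≤ e i) :
    ∃ R : ℂ[X], (1 + ∑ i, C (c i) * X ^ e i) * ∏ i, (1 - C (c i) * X ^ e i) =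
      1 - C (c i₀ ^ 2) * X ^ 16 + X ^ 20 * R := by
  have hd : ∀ i ∈ univ.erase i₀, (X : ℂ[X]) ^ e i = X ^ (12 + (e i - 12)) := fun i hi =>
    congrArg _ (Nat.add_sub_cancel' (he i (ne_of_mem_erase hi))).symm
  obtain ⟨R, hR⟩ := exists_prod_one_sub (univ.erase i₀) c (fun i => e i - 12)
  have e1 : ∑ i ∈ univ.erase i₀, C (c i) * X ^ e i =
      X ^ 12 * ∑ i ∈ univ.erase i₀, C (c i) * X ^ (e i - 12) := by
    rw [mul_sum]
    exact sum_congr rfl fun i hi => by grind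
  have e2 : ∏ i ∈ univ.erase i₀, (1 - C (c i) * X ^ e i) =
      ∏ i ∈ univ.erase i₀, (1 - C (c i) * X ^ (12 + (e i - 12))) :=
    prod_congr rfl fun i hi => by grind
  rw [← add_sum_erase univ _ (mem_univ i₀), ← mul_prod_erase univ _ (mem_univ i₀), e1, e2, hR,
    h8, ← add_assoc, C_pow]
  exact ⟨_, mul_one_sub_expand _ _ _ _⟩

lemma LIndex.val_ne_zero {J : ℕ} (hJ0 : 0 < J) {i : LIndex J} (h : i ≠ ⟨⟨0, hJ0⟩, 1⟩) :
    (i.1 : ℕ) ≠ 0 := by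
  obtain ⟨⟨j, hj⟩, χ⟩ := i
  intro h0
  simp only at h0
  subst h0
  apply h
  have : Fintype.card (DirichletCharacter ℂ (2 ^ (0 + 1))) ≤ 1 :=
    (card_dirichletCharacter_two_pow 0).le
  rw [Fintype.card_le_one_iff.1 this χ 1]
  rfl

lemma exists_corrPoly_eq {J : ℕ} (hJ0 : 0 < J) (hJ : J ≤ 4) (p : ℕ) :
    ∃ (u : ℂ) (R : ℂ[X]), ‖u‖ ≤ 1 ∧ corrPoly J p = 1 - C u * X ^ 16 + X ^ 20 * R := by
  obtain ⟨R, hR⟩ := exists_mul_prod_one_sub_eq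
    (fun i : LIndex J => i.2 (p : ZMod (2 ^ ((i.1 : ℕ) + 1)))) (fun i => discExp i.1)
    ⟨⟨0, hJ0⟩, 1⟩ (by bound)
    (fun i hi => (discExp_bounds hJ i.1).2.2 (LIndex.val_ne_zero hJ0 hi))
  refine ⟨_, R, ?_, hR⟩
  rw [norm_pow]
  exact pow_le_one₀ (norm_nonneg _) (norm_le_one _ _)

lemma normEval_eq_sum {P : ℂ[X]} {M : ℕ} (hM : P.natDegree < M) (x : ℝ) :
    normEval P x = ∑ k ∈ range M, ‖P.coeff k‖ * x ^ k := by
  refine sum_subset (range_subset_range.2 hM) fun k _ hk => ?_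
  rw [coeff_eq_zero_of_natDegree_lt (by grind), norm_zero, zero_mul]

lemma normEval_add_le (P Q : ℂ[X]) {x : ℝ} (hx : 0 ≤ x) :
    normEval (P + Q) x ≤ normEval P x + normEval Q x := by
  set M := (P + Q).natDegree + P.natDegree + Q.natDegree + 1
  rw [normEval_eq_sum (M := M) (by omega), normEval_eq_sum (P := P) (M := M) (by omega),
    normEval_eq_sum (P := Q) (M := M) (by omega), ← sum_add_distrib]
  refine sum_le_sum fun k _ => ?_
  rw [coeff_add, ← add_mul]
  gcongr
  exact norm_add_le _ _

lemma normEval_C_mul_X_pow (u : ℂ) (k : ℕ) (x : ℝ) : normEval (C u * X ^ k) x = ‖u‖ * x ^ k := by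
  have hM : (C u * X ^ k : ℂ[X]).natDegree < k + 1 := Nat.lt_succ_of_le (natDegree_C_mul_X_pow_le u k)
  rw [normEval_eq_sum hM, sum_eq_single k]
  · simp
  · simp_all
  · simp

lemma normEval_one (x : ℝ) : normEval 1 x = 1 := by
  have := normEval_C_mul_X_pow 1 0 x
  simp_all

lemma normEval_nonneg (P : ℂ[X]) {x : ℝ} (hx : 0 ≤ x) : 0 ≤ normEval P x :=
  sum_nonneg fun _ _ => by bound

lemma normEval_X_pow_mul (P : ℂ[X]) (m : ℕ) {x : ℝ} (hx : 0 ≤ x) (hx1 : x ≤ 1) :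
    normEval (X ^ m * P) x ≤ x ^ m * normEval P 1 := by
  have hM : (X ^ m * P).natDegree < m + (P.natDegree + 1) := by
    refine Nat.lt_of_le_of_lt natDegree_mul_le ?_
    bound
  rw [normEval_eq_sum hM, sum_range_add, normEval, mul_sum]
  have h0 : ∑ k ∈ range m, ‖(X ^ m * P).coeff k‖ * x ^ k = 0 := by
    refine sum_eq_zero fun k hk => ?_
    rw [coeff_X_pow_mul', if_neg (by grind), norm_zero, zero_mul]
  rw [h0, zero_add]
  refine sum_le_sum fun k _ => ?_
  rw [add_comm m k, coeff_X_pow_mul, pow_add, one_pow, mul_one]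
  have h1 : x ^ k ≤ 1 := pow_le_one₀ hx hx1
  have h2 : 0 ≤ ‖P.coeff k‖ * x ^ m := by bound
  nlinarith

lemma exists_normEval_corrPoly_le {J : ℕ} (hJ0 : 0 < J) (hJ : J ≤ 4) :
    ∃ B : ℝ, 0 ≤ B ∧ ∀ (p : ℕ) (x : ℝ), 0 ≤ x → x ≤ 1 →
      normEval (corrPoly J p) x ≤ 1 + x ^ 16 + B * x ^ 20 := by
  choose u R hu hR using exists_corrPoly_eq hJ0 hJ
  refine ⟨∑ r ∈ range 16, normEval (R r) 1, sum_nonneg fun r _ => normEval_nonneg _ zero_le_one,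
    fun p x hx hx1 => ?_⟩
  rw [← corrPoly_mod hJ, hR, sub_eq_add_neg, ← neg_mul, ← C_neg]
  refine (normEval_add_le _ _ hx).trans (add_le_add ((normEval_add_le _ _ hx).trans
    (add_le_add (normEval_one x).le ?_)) ?_)
  · rw [normEval_C_mul_X_pow, norm_neg]
    exact mul_le_of_le_one_left (by bound) (hu _)
  · refine (normEval_X_pow_mul _ _ hx hx1).trans ?_
    rw [mul_comm]
    gcongr
    exact single_le_sum (f := fun r => normEval (R r) 1)
      (fun r _ => normEval_nonneg _ zero_le_one) (mem_range.2 (Nat.mod_lt p (by norm_num)))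

lemma prod_primesBelow_one_add_mul_rpow_le {a B : ℝ} (ha : 1 < a) (hB : 0 ≤ B) (N : ℕ) :
    ∏ p ∈ N.primesBelow, (1 + B * (p : ℝ) ^ (-a)) ≤ Real.exp (B * ∑' n : ℕ, (n : ℝ) ^ (-a)) := by
  calc ∏ p ∈ N.primesBelow, (1 + B * (p : ℝ) ^ (-a))
      ≤ ∏ p ∈ N.primesBelow, Real.exp (B * (p : ℝ) ^ (-a)) :=
        prod_le_prod (fun p _ => by bound) fun p _ => by rw [add_comm]; exact Real.add_one_le_exp _
    _ = Real.exp (B * ∑ p ∈ N.primesBelow, (p : ℝ) ^ (-a)) := by rw [← Real.exp_sum, mul_sum]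
    _ ≤ _ := by
        gcongr
        exact sum_primesBelow_rpow_le ha N

lemma pow_rpow_neg (p k : ℕ) (σ : ℝ) : ((p : ℝ) ^ (-σ)) ^ k = (p : ℝ) ^ (-(k * σ)) := by
  rw [← Real.rpow_mul_natCast (cast_nonneg p)]
  congr 1
  ring

lemma lseriesSummable_fieldPoly {J : ℕ} (hJ : J ≤ 4) {s : ℂ} (hs : 1 / 8 < s.re) :
    LSeriesSummable (eulerCoeff (fieldPoly J)) s := by
  refine lseriesSummable_eulerCoeff (coeff_zero_fieldPoly hJ)
    (B := Real.exp (15 * ∑' n : ℕ, (n : ℝ) ^ (-(8 * s.re)))) fun N => ?_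
  refine le_trans (prod_le_prod (fun p _ => normEval_nonneg _ (by bound)) fun p hp => ?_)
    (prod_primesBelow_one_add_mul_rpow_le (a := 8 * s.re) (by linarith) (by norm_num) N)
  have hp1 : (1 : ℝ) ≤ p := by exact_mod_cast (Nat.prime_of_mem_primesBelow hp).one_lt.le
  have hx1 : (p : ℝ) ^ (-s.re) ≤ 1 := Real.rpow_le_one_of_one_le_of_nonpos hp1 (by linarith)
  have e := pow_rpow_neg p 8 s.re
  push_cast at e
  rw [← e]
  set x : ℝ := (p : ℝ) ^ (-s.re)
  have hx : 0 ≤ x := by bound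
  have hs : ∀ (t : Finset (LIndex J)),
      normEval (∑ i ∈ t, C (i.2 (p : ZMod (2 ^ ((i.1 : ℕ) + 1)))) * X ^ discExp i.1) x ≤
        #t * x ^ 8 := by
    intro t
    induction t using Finset.induction_on with
    | empty => simp [normEval]
    | insert i t hi ih =>
      rw [sum_insert hi, card_insert_of_notMem hi]
      refine (normEval_add_le _ _ hx).trans ?_
      rw [normEval_C_mul_X_pow]
      have h1 : ‖i.2 (p : ZMod (2 ^ ((i.1 : ℕ) + 1)))‖ * x ^ discExp i.1 ≤ 1 * x ^ 8 :=
        mul_le_mul (norm_le_one _ _)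
          (pow_le_pow_of_le_one hx hx1 (discExp_bounds hJ i.1).1) (by bound) zero_le_one
      push_cast
      linarith
  rw [fieldPoly]
  refine (normEval_add_le _ _ hx).trans ?_
  rw [normEval_one]
  refine add_le_add le_rfl ((hs univ).trans ?_)
  rw [card_univ]
  gcongr
  exact_mod_cast card_LIndex hJ

lemma exists_prod_normEval_corrPoly_le {J : ℕ} (hJ0 : 0 < J) (hJ : J ≤ 4) :
    ∃ B : ℝ, 0 ≤ B ∧ ∀ σ : ℝ, 1 / 16 < σ → σ ≤ 1 → ∀ N : ℕ,
      ∏ p ∈ N.primesBelow, normEval (corrPoly J p) ((p : ℝ) ^ (-σ)) ≤ B / (σ - 1 / 16) := by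
  obtain ⟨B, hB, h⟩ := exists_normEval_corrPoly_le hJ0 hJ
  refine ⟨Real.exp (B * ∑' n : ℕ, (n : ℝ) ^ (-(5 / 4 : ℝ))), (exp_pos _).le, fun σ hσ hσ1 N => ?_⟩
  calc ∏ p ∈ N.primesBelow, normEval (corrPoly J p) ((p : ℝ) ^ (-σ))
      ≤ ∏ p ∈ N.primesBelow, ((1 + (p : ℝ) ^ (-(16 * σ))) * (1 + B * (p : ℝ) ^ (-(5 / 4 : ℝ)))) := by
        refine prod_le_prod (fun p _ => normEval_nonneg _ (by bound)) fun p hp => ?_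
        have hp1 : (1 : ℝ) ≤ p := by exact_mod_cast (Nat.prime_of_mem_primesBelow hp).one_lt.le
        have hx1 : (p : ℝ) ^ (-σ) ≤ 1 := Real.rpow_le_one_of_one_le_of_nonpos hp1 (by linarith)
        refine (h p _ (by bound) hx1).trans ?_
        have e := pow_rpow_neg p 16 σ
        push_cast at e
        have e2 := pow_rpow_neg p 20 σ
        push_cast at e2
        rw [e, e2]
        have h3 : (p : ℝ) ^ (-(20 * σ)) ≤ (p : ℝ) ^ (-(5 / 4 : ℝ)) :=
          rpow_le_rpow_of_exponent_le hp1 (by linarith)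
        have h4 : 0 ≤ (p : ℝ) ^ (-(16 * σ)) := by bound
        have h5 : 0 ≤ B * (p : ℝ) ^ (-(5 / 4 : ℝ)) := by bound
        have h6 := mul_le_mul_of_nonneg_left h3 hB
        nlinarith [mul_nonneg h4 h5]
    _ ≤ (16 * σ / (16 * σ - 1)) * Real.exp (B * ∑' n : ℕ, (n : ℝ) ^ (-(5 / 4 : ℝ))) := by
        rw [prod_mul_distrib]
        refine mul_le_mul (prod_primesBelow_one_add_rpow_le (by linarith) N)
          (prod_primesBelow_one_add_mul_rpow_le (by norm_num) hB N)
          (prod_nonneg fun p _ => by bound) (div_nonneg (by linarith) (by linarith))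
    _ ≤ _ := by
        rw [div_eq_mul_inv (Real.exp _), mul_comm]
        refine mul_le_mul_of_nonneg_left ?_ (exp_pos _).le
        rw [← one_div, div_le_div_iff₀ (by linarith) (by linarith)]
        nlinarith

end FieldSeries

section FieldPerron

open Finset Polynomial

lemma isPeriodicCoeff_dirichletCharacter (j : ℕ) (χ : DirichletCharacter ℂ (2 ^ (j + 1))) :
    IsPeriodicCoeff (fun n => χ (n : ZMod (2 ^ (j + 1)))) (2 ^ (j + 1)) where
  pos := by bound
  zero := by
    have : Fact (1 < 2 ^ (j + 1)) := ⟨Nat.one_lt_two_pow (by omega)⟩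
    simp only [Nat.cast_zero]
    exact MulChar.map_zero χ
  periodic n := by bound
  norm_le n := norm_le_one _ _

def charFamily {J : ℕ} (hJ : J ≤ 4) : LFamily (LIndex J) where
  coeff i n := i.2 (n : ZMod (2 ^ ((i.1 : ℕ) + 1)))
  period i := 2 ^ ((i.1 : ℕ) + 1)
  scale i := discExp i.1
  moment i := if (i.1 : ℕ) = 0 then 2 else if (i.1 : ℕ) = 1 then 10 else if (i.1 : ℕ) = 2 then 28
    else 52
  depth i := 1 / 2 ^ ((i.1 : ℕ) + 1)
  isPeriodic i := isPeriodicCoeff_dirichletCharacter _ _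
  scale_eq i := by
    have : (i.1 : ℕ) < 4 := i.1.2.trans_le hJ
    generalize (i.1 : ℕ) = k at this
    interval_cases k <;> norm_num [discExp]
  depth_pos i := by
    have : (i.1 : ℕ) < 4 := i.1.2.trans_le hJ
    generalize (i.1 : ℕ) = k at this
    interval_cases k <;> norm_num
  isMoment i := by
    have : (i.1 : ℕ) < 4 := i.1.2.trans_le hJ
    generalize (i.1 : ℕ) = k at this
    interval_cases k <;> norm_num [IsMomentPair]
  sum_inv_moment := by
    have := card_LIndex_eq_sum J (fun j => ((if (j : ℕ) = 0 then 2 else if (j : ℕ) = 1 then 10 else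
      if (j : ℕ) = 2 then 28 else 52 : ℕ) : ℝ)⁻¹)
    rw [this]
    interval_cases J <;> norm_num [Fin.sum_univ_succ]
  sum_depth := by
    have := card_LIndex_eq_sum J (fun j => (1 : ℝ) / 2 ^ ((j : ℕ) + 1))
    rw [this]
    interval_cases J <;> norm_num [Fin.sum_univ_succ]

/-- A Dirichlet series with nonnegative coefficients having a meromorphic continuation `F` to
`1 / 16 < re s` with simple poles and controlled size near the line `re s = 1 / 16`. -/
structure PerronSeries {J : ℕ} (f : ℕ → ℝ) (pole : Fin J → ℝ) (F Q : ℂ → ℂ) : Prop where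
  nonneg : ∀ n, 0 ≤ f n
  zero : f 0 = 0
  summable : ∀ s : ℂ, 1 / 8 < s.re → LSeriesSummable (fun n => (f n : ℂ)) s
  lseries_eq : ∀ s : ℂ, 1 / 8 < s.re → LSeries (fun n => (f n : ℂ)) s = F s
  pole_injective : Function.Injective pole
  pole_mem : ∀ j, 1 / 15 ≤ pole j ∧ pole j ≤ 1 / 8
  differentiableOn : DifferentiableOn ℂ Q {s | 1 / 16 < s.re}
  eq_mul : ∀ s : ℂ, 1 / 16 < s.re → (∀ j, s ≠ pole j) → Q s = F s * ∏ j, (s - pole j)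
  growth : ∀ σ₀ : ℝ, 1 / 16 < σ₀ → ∃ C : ℝ, 0 ≤ C ∧ ∀ σ t : ℝ, σ₀ ≤ σ → σ ≤ 13 / 100 → 1 ≤ |t| →
    ‖F (σ + t * I)‖ ≤ C * t ^ 2
  moment : ∃ C T₁ : ℝ, 0 ≤ C ∧ 3 ≤ T₁ ∧ ∀ T σ : ℝ, T₁ ≤ T → 1 / 16 < σ → σ ≤ 13 / 100 →
    ∫ t in T..2 * T, (‖F (σ + t * I)‖ + ‖F (σ + (-t : ℝ) * I)‖) ≤ C / (σ - 1 / 16) * T * log T ^ 15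
  small : ∀ T₁ : ℝ, ∃ C : ℝ, 0 ≤ C ∧ ∀ σ t : ℝ, 1 / 16 < σ → σ ≤ 8 / 125 → |t| ≤ T₁ →
    ‖F (σ + t * I)‖ ≤ C / (σ - 1 / 16)

lemma IsPeriodicCoeff.differentiableAt_periodicL_of_mean_eq_zero {a : ℕ → ℂ} {q : ℕ}
    (ha : IsPeriodicCoeff a q) (h : coeffMean a q = 0) {s : ℂ} (hs : 0 < s.re) :
    DifferentiableAt ℂ (periodicL a q) s := by
  have := ha.differentiableAt_integral hs
  have e : periodicL a q = fun s => s * ∫ x in Set.Ioi (1 : ℝ), coeffRem a q x * (x : ℂ) ^ (-s - 1) := by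
    funext s
    simp [periodicL, h]
  simp_all

lemma coeffMean_dirichletCharacter {j : ℕ} {χ : DirichletCharacter ℂ (2 ^ (j + 1))} (h : χ ≠ 1) :
    coeffMean (fun n => χ (n : ZMod (2 ^ (j + 1)))) (2 ^ (j + 1)) = 0 := by
  have h1 := MulChar.sum_eq_zero_of_ne_one h
  have h2 : ∑ i ∈ range (2 ^ (j + 1)), χ (i : ZMod (2 ^ (j + 1))) = 0 := by
    rw [← h1]
    refine sum_bij (fun i _ => (i : ZMod (2 ^ (j + 1)))) (fun _ _ => mem_univ _) ?_ ?_
      fun _ _ => rfl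
    · intro a ha b hb hab
      rw [ZMod.natCast_eq_natCast_iff', Nat.mod_eq_of_lt (mem_range.1 ha),
        Nat.mod_eq_of_lt (mem_range.1 hb)] at hab
      bound
    · intro b _
      exact ⟨b.val, mem_range.2 (ZMod.val_lt b), by simp⟩
  rw [coeffMean, h2, zero_div]

lemma LSeriesSummable_corrPoly {J : ℕ} (hJ0 : 0 < J) (hJ : J ≤ 4) {s : ℂ} (hs : 1 / 16 < s.re) :
    LSeriesSummable (eulerCoeff (corrPoly J)) s := by
  obtain ⟨B, hB, h⟩ := exists_prod_normEval_corrPoly_le hJ0 hJ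
  have : LSeriesSummable (eulerCoeff (corrPoly J)) ((min s.re 1 : ℝ) : ℂ) := by
    refine lseriesSummable_eulerCoeff (coeff_zero_corrPoly hJ) (h (min s.re 1) ?_ ?_)
    · grind
    grind
  refine this.of_re_le_re ?_
  bound

lemma differentiableOn_LSeries_corrPoly {J : ℕ} (hJ0 : 0 < J) (hJ : J ≤ 4) :
    DifferentiableOn ℂ (LSeries (eulerCoeff (corrPoly J))) {s | 1 / 16 < s.re} := by
  refine (LSeries_differentiableOn _).mono fun s hs => ?_
  have h : LSeries.abscissaOfAbsConv (eulerCoeff (corrPoly J)) ≤ ((1 / 16 : ℝ) : EReal) :=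
    LSeries.abscissaOfAbsConv_le_of_forall_lt_LSeriesSummable fun y hy =>
      LSeriesSummable_corrPoly hJ0 hJ (by bound)
  exact h.trans_lt (by simp_all)

lemma LFamily.differentiableAt_eval {ι : Type*} [Fintype ι] (A : LFamily ι) {s : ℂ}
    (hs : 0 < s.re) (h : ∀ i, (A.scale i : ℂ) * s ≠ 1) : DifferentiableAt ℂ A.eval s := by
  have : A.eval = fun s => ∏ i, periodicL (A.coeff i) (A.period i) (A.scale i * s) := rfl
  rw [this]
  refine DifferentiableAt.fun_finsetProd fun i _ => ?_
  have h1 : DifferentiableAt ℂ (periodicL (A.coeff i) (A.period i)) (A.scale i * s) := by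
    refine (A.isPeriodic i).differentiableAt_periodicL ?_ (h i)
    have : (0 : ℝ) < A.scale i := by
      have := (A.scale_bounds i).1
      bound
    simpa using mul_pos this hs
  fun_prop

def poleFactor {J : ℕ} (i : LIndex J) (s : ℂ) : ℂ :=
  if i.2 = 1 then s - ((1 / discExp i.1 : ℝ) : ℂ) else 1

lemma prod_poleFactor {J : ℕ} (s : ℂ) :
    ∏ i : LIndex J, poleFactor i s = ∏ j : Fin J, (s - ((1 / discExp j : ℝ) : ℂ)) := by
  rw [Fintype.prod_sigma]
  refine prod_congr rfl fun j _ => ?_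
  simp only [poleFactor]
  change ∏ χ : DirichletCharacter ℂ (2 ^ ((j : ℕ) + 1)), (if χ = 1 then
    s - ((1 / discExp j : ℝ) : ℂ) else 1) = _
  bound

def regFactor {J : ℕ} (hJ : J ≤ 4) (i : LIndex J) (s : ℂ) : ℂ :=
  if i.2 = 1 then (discExp i.1 : ℂ)⁻¹ *
    (coeffMean ((charFamily hJ).coeff i) ((charFamily hJ).period i) * (discExp i.1 * s) +
      (discExp i.1 * s - 1) * ((discExp i.1 * s) * ∫ x in Set.Ioi (1 : ℝ),
        coeffRem ((charFamily hJ).coeff i) ((charFamily hJ).period i) x *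
          (x : ℂ) ^ (-(discExp i.1 * s) - 1)))
  else periodicL ((charFamily hJ).coeff i) ((charFamily hJ).period i) (discExp i.1 * s)

lemma discExp_ne_zero {J : ℕ} (hJ : J ≤ 4) (j : Fin J) : (discExp j : ℂ) ≠ 0 := by
  have := (discExp_bounds hJ j).1
  exact_mod_cast (by omega : discExp j ≠ 0)

lemma regFactor_eq {J : ℕ} (hJ : J ≤ 4) (i : LIndex J) {s : ℂ}
    (hs : s ≠ ((1 / discExp i.1 : ℝ) : ℂ)) : regFactor hJ i s =
      periodicL ((charFamily hJ).coeff i) ((charFamily hJ).period i) (discExp i.1 * s) *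
        poleFactor i s := by
  have h0 := discExp_ne_zero hJ i.1
  rw [regFactor, poleFactor]
  split_ifs
  · rw [← sub_one_mul_periodicL]
    · push_cast
      field_simp
    · intro h
      apply hs
      push_cast
      grind
  grind

lemma differentiableAt_regFactor {J : ℕ} (hJ : J ≤ 4) (i : LIndex J) {s : ℂ} (hs : 0 < s.re) :
    DifferentiableAt ℂ (regFactor hJ i) s := by
  have h0 : 0 < (discExp i.1 * s).re := by
    have : (0 : ℝ) < discExp i.1 := by
      have := (discExp_bounds hJ i.1).1
      bound
    simp_all
  have hlin : DifferentiableAt ℂ (fun s => (discExp i.1 : ℂ) * s) s := by fun_prop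
  by_cases h : i.2 = 1
  · have e : regFactor hJ i = fun s => (discExp i.1 : ℂ)⁻¹ * ((fun s =>
        coeffMean ((charFamily hJ).coeff i) ((charFamily hJ).period i) * s + (s - 1) * (s *
        ∫ x in Set.Ioi (1 : ℝ), coeffRem ((charFamily hJ).coeff i) ((charFamily hJ).period i) x *
          (x : ℂ) ^ (-s - 1))) ((fun s => (discExp i.1 : ℂ) * s) s)) := by
      funext s
      rw [regFactor, if_pos h]
    rw [e]
    exact ((((charFamily hJ).isPeriodic i).differentiableAt_mul_periodicL h0).comp s
      hlin).const_mul _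
  · have e : regFactor hJ i = fun s => periodicL ((charFamily hJ).coeff i)
        ((charFamily hJ).period i) ((fun s => (discExp i.1 : ℂ) * s) s) := by
      funext s
      rw [regFactor, if_neg h]
    rw [e]
    exact (((charFamily hJ).isPeriodic i).differentiableAt_periodicL_of_mean_eq_zero
      (coeffMean_dirichletCharacter h) h0).comp s hlin

/-- The meromorphic continuation of the series of `fieldCount J`. -/
def fieldSeries {J : ℕ} (hJ : J ≤ 4) (s : ℂ) : ℂ :=
  (charFamily hJ).eval s * LSeries (eulerCoeff (corrPoly J)) s

lemma LSeries_fieldCount {J : ℕ} (hJ0 : 0 < J) (hJ : J ≤ 4) {s : ℂ} (hs : 1 / 8 < s.re) :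
    LSeries (fun n => (fieldCount J n : ℂ)) s = fieldSeries hJ s := by
  have e0 : (fun n => (fieldCount J n : ℂ)) = eulerCoeff (fieldPoly J) :=
    funext fun n => (eulerCoeff_fieldPoly hJ n).symm
  have hF := hasProd_lseries_eulerCoeff (coeff_zero_fieldPoly hJ) (lseriesSummable_fieldPoly hJ hs)
  have hG := hasProd_lseries_eulerCoeff (coeff_zero_corrPoly hJ)
    (LSeriesSummable_corrPoly hJ0 hJ (by linarith : 1 / 16 < s.re))
  have hre : ∀ i : LIndex J, 1 < (discExp i.1 * s).re := by
    intro i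
    have : (8 : ℝ) ≤ discExp i.1 := by exact_mod_cast (discExp_bounds hJ i.1).1
    simp only [mul_re, Complex.natCast_re, Complex.natCast_im, zero_mul, sub_zero]
    nlinarith
  have hA : HasProd (fun p : Nat.Primes => ∏ i : LIndex J,
      (1 - i.2 (p : ℕ) * ((p : ℂ) ^ (-s)) ^ discExp i.1)⁻¹) ((charFamily hJ).eval s) := by
    refine hasProd_prod fun i _ => ?_
    have h1 := DirichletCharacter.LSeries_eulerProduct_hasProd i.2 (hre i)
    have h2 := ((charFamily hJ).isPeriodic i).periodicL_eq_LSeries (hre i)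
    change HasProd _ (periodicL ((charFamily hJ).coeff i) ((charFamily hJ).period i)
      (discExp i.1 * s))
    rw [h2]
    convert h1 using 5 with p
    · rw [← Complex.cpow_nat_mul, mul_neg]
    · rfl
  rw [e0, fieldSeries]
  refine hF.unique ?_
  convert hA.mul hG using 1
  funext p
  rw [corrPoly, eval_mul, eval_prod, mul_left_comm, ← prod_mul_distrib]
  rw [prod_eq_one, mul_one]
  intro i _
  simp only [eval_sub, eval_one, eval_mul, eval_C, eval_pow, eval_X]
  refine inv_mul_cancel₀ ?_
  intro h
  have h1 : ‖(1 : ℂ)‖ < 1 := by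
    rw [sub_eq_zero.1 h, norm_mul, norm_pow, Complex.norm_natCast_cpow_of_pos p.2.pos]
    refine (mul_le_of_le_one_left (by bound) (norm_le_one _ _)).trans_lt ?_
    refine pow_lt_one₀ (by bound) ?_ ?_
    · exact Real.rpow_lt_one_of_one_lt_of_neg (by exact_mod_cast p.2.one_lt)
        (by rw [neg_re]; linarith)
    · have := (discExp_bounds hJ i.1).1
      omega
  simp at h1

lemma exists_norm_LSeries_corrPoly_le {J : ℕ} (hJ0 : 0 < J) (hJ : J ≤ 4) : ∃ B : ℝ, 0 ≤ B ∧
    ∀ s : ℂ, 1 / 16 < s.re → s.re ≤ 1 →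
      ‖LSeries (eulerCoeff (corrPoly J)) s‖ ≤ B / (s.re - 1 / 16) := by
  obtain ⟨B, hB, h⟩ := exists_prod_normEval_corrPoly_le hJ0 hJ
  exact ⟨B, hB, fun s h1 h2 => norm_lseries_eulerCoeff_le (coeff_zero_corrPoly hJ) (h _ h1 h2)⟩

lemma differentiableAt_fieldSeries {J : ℕ} (hJ0 : 0 < J) (hJ : J ≤ 4) {s : ℂ} (hs : 1 / 16 < s.re)
    (h : ∀ i : LIndex J, (discExp i.1 : ℂ) * s ≠ 1) : DifferentiableAt ℂ (fieldSeries hJ) s := by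
  have h1 := (charFamily hJ).differentiableAt_eval (s := s) (by linarith) h
  have h2 : DifferentiableAt ℂ (LSeries (eulerCoeff (corrPoly J))) s :=
    (differentiableOn_LSeries_corrPoly hJ0 hJ).differentiableAt
      ((isOpen_lt continuous_const Complex.continuous_re).mem_nhds hs)
  exact h1.mul h2

lemma perronSeries_fieldCount {J : ℕ} (hJ0 : 0 < J) (hJ : J ≤ 4) :
    PerronSeries (fun n => (fieldCount J n : ℝ)) (fun j : Fin J => 1 / (discExp j : ℝ))
      (fieldSeries hJ) (fun s => LSeries (eulerCoeff (corrPoly J)) s * ∏ i, regFactor hJ i s) := by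
  obtain ⟨B, hB, hG⟩ := exists_norm_LSeries_corrPoly_le hJ0 hJ
  have hpos : ∀ j : Fin J, (8 : ℝ) ≤ discExp j ∧ (discExp j : ℝ) ≤ 15 := fun j =>
    ⟨by exact_mod_cast (discExp_bounds hJ j).1, by exact_mod_cast (discExp_bounds hJ j).2.1⟩
  have hcast : (fun n => ((fieldCount J n : ℝ) : ℂ)) = fun n => (fieldCount J n : ℂ) := by bound
  refine ⟨fun n => cast_nonneg _, by simp [fieldCount], ?_, ?_, ?_, ?_, ?_, ?_, ?_, ?_, ?_⟩
  · intro s hs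
    rw [hcast, show (fun n => (fieldCount J n : ℂ)) = eulerCoeff (fieldPoly J) from
      funext fun n => (eulerCoeff_fieldPoly hJ n).symm]
    exact lseriesSummable_fieldPoly hJ hs
  · intro s hs
    rw [hcast]
    exact LSeries_fieldCount hJ0 hJ hs
  · intro j k hjk
    have h1 : (discExp j : ℝ) = discExp k := by grind
    have h2 : discExp j = discExp k := by exact_mod_cast h1
    have hj : (j : ℕ) < 4 := j.2.trans_le hJ
    have hk : (k : ℕ) < 4 := k.2.trans_le hJ
    apply Fin.ext
    generalize (j : ℕ) = a at h2 hj
    generalize (k : ℕ) = b at h2 hk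
    interval_cases a <;> interval_cases b <;> simp_all [discExp]
  · intro j
    have := hpos j
    constructor
    · exact one_div_le_one_div_of_le (by linarith) this.2
    bound
  · refine (differentiableOn_LSeries_corrPoly hJ0 hJ).mul ?_
    intro s hs
    have hs' : 1 / 16 < s.re := hs
    exact (DifferentiableAt.fun_finsetProd fun i _ =>
      differentiableAt_regFactor hJ i (by linarith)).differentiableWithinAt
  · intro s hs hp
    rw [← prod_poleFactor, fieldSeries, LFamily.eval, prod_congr rfl fun i _ =>
      regFactor_eq hJ i (hp i.1), prod_mul_distrib]
    simp only [charFamily]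
    ring
  · intro σ₀ hσ₀
    obtain ⟨C, hC, h⟩ := (charFamily hJ).exists_norm_eval_le
    have h0 : 0 < σ₀ - 1 / 16 := by linarith
    refine ⟨C * (B / (σ₀ - 1 / 16)), by bound, fun σ t h1 h2 ht => ?_⟩
    have h3 := hG (σ + t * I) (by simp; linarith) (by simp; linarith)
    have h5 : (σ + t * I : ℂ).re = σ := by simp
    rw [h5] at h3
    have h4 : B / (σ - 1 / 16) ≤ B / (σ₀ - 1 / 16) := by gcongr
    rw [fieldSeries, norm_mul, mul_right_comm]
    exact mul_le_mul (h σ t (by linarith) h2 ht) (h3.trans h4) (norm_nonneg _) (by bound)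
  · obtain ⟨C, T₁, hC, hT₁, h⟩ := (charFamily hJ).exists_integral_eval_le
    refine ⟨C * B, T₁, by bound, hT₁, fun T σ hT h1 h2 => ?_⟩
    have hσ : 0 < σ - 1 / 16 := by linarith
    have hT0 : 0 < T := by linarith
    have hl : 1 ≤ log T := by
      rw [le_log_iff_exp_le hT0]
      linarith [exp_one_lt_d9]
    have hd : ∀ t : ℝ, t ≠ 0 → ∀ i : LIndex J, (discExp i.1 : ℂ) * (σ + t * I) ≠ 1 := by
      intro t ht i he
      have := congrArg Complex.im he
      simp [ht] at this
      have h8 := (discExp_bounds hJ i.1).1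
      omega
    have hlin : ∀ c : ℝ, Continuous fun t : ℝ => (σ + ((c * t : ℝ) : ℂ) * I : ℂ) := by fun_prop
    have hcF : ∀ c : ℝ, c ≠ 0 → ContinuousOn (fun t : ℝ =>
        fieldSeries hJ (σ + ((c * t : ℝ) : ℂ) * I)) (Set.uIcc T (2 * T)) := by
      intro c hc t ht
      rw [Set.uIcc_of_le (by linarith)] at ht
      have ht0 : c * t ≠ 0 := mul_ne_zero hc (by grind)
      exact ((differentiableAt_fieldSeries hJ0 hJ (by simpa using h1)
        (hd _ ht0)).continuousAt.comp (f := fun t : ℝ => (σ + ((c * t : ℝ) : ℂ) * I : ℂ))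
        (hlin c).continuousAt).continuousWithinAt
    have hcA : ∀ c : ℝ, c ≠ 0 → ContinuousOn (fun t : ℝ =>
        (charFamily hJ).eval (σ + ((c * t : ℝ) : ℂ) * I)) (Set.uIcc T (2 * T)) := by
      intro c hc t ht
      rw [Set.uIcc_of_le (by linarith)] at ht
      have ht0 : c * t ≠ 0 := mul_ne_zero hc (by grind)
      exact (((charFamily hJ).differentiableAt_eval (by simp; linarith)
        (hd _ ht0)).continuousAt.comp (f := fun t : ℝ => (σ + ((c * t : ℝ) : ℂ) * I : ℂ))
        (hlin c).continuousAt).continuousWithinAt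
    have c1 := hcF 1 one_ne_zero
    have c2 := hcF (-1) (by norm_num)
    have c3 := hcA 1 one_ne_zero
    have c4 := hcA (-1) (by norm_num)
    simp only [one_mul, neg_mul] at c1 c2 c3 c4
    have hpt : ∀ t : ℝ, ‖fieldSeries hJ (σ + t * I)‖ ≤
        B / (σ - 1 / 16) * ‖(charFamily hJ).eval (σ + t * I)‖ := by
      intro t
      have h3 := hG (σ + t * I) (by simp; linarith) (by simp; linarith)
      have h5 : (σ + t * I : ℂ).re = σ := by simp
      rw [h5] at h3
      rw [fieldSeries, norm_mul, mul_comm]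
      gcongr
    calc _ ≤ ∫ t in T..2 * T, B / (σ - 1 / 16) * (‖(charFamily hJ).eval (σ + t * I)‖ +
            ‖(charFamily hJ).eval (σ + (-t : ℝ) * I)‖) := by
          refine integral_mono_on (by linarith) (c1.norm.add c2.norm).intervalIntegrable
            ((c3.norm.add c4.norm).const_smul (B / (σ - 1 / 16))).intervalIntegrable fun t _ => ?_
          grind
      _ ≤ B / (σ - 1 / 16) * (C * T * log T ^ Fintype.card (LIndex J)) := by
          rw [intervalIntegral.integral_const_mul]
          gcongr
          grind
      _ ≤ B / (σ - 1 / 16) * (C * T * log T ^ 15) := by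
          gcongr
          exact card_LIndex hJ
      _ = _ := by ring
  · intro T₁
    have hK : IsCompact (Set.Icc (1 / 16 : ℝ) (8 / 125) ×ˢ Set.Icc (-T₁) T₁) :=
      isCompact_Icc.prod isCompact_Icc
    have hc : ContinuousOn (fun x : ℝ × ℝ => (charFamily hJ).eval (x.1 + x.2 * I))
        (Set.Icc (1 / 16 : ℝ) (8 / 125) ×ˢ Set.Icc (-T₁) T₁) := by
      rintro ⟨σ, t⟩ ⟨⟨h1, h2⟩, -⟩
      simp only at h1 h2
      refine ((((charFamily hJ).differentiableAt_eval (s := σ + t * I)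
        (by simp; linarith) ?_).continuousAt).comp
        (f := fun x : ℝ × ℝ => (x.1 + x.2 * I : ℂ)) (x := (σ, t))
        (by fun_prop)).continuousWithinAt
      intro i he
      have h3 := congrArg Complex.re he
      have h4 : (discExp i.1 : ℝ) * σ = 1 := by simpa [charFamily] using h3
      have := hpos i.1
      nlinarith
    obtain ⟨C, hC⟩ := hK.exists_bound_of_continuousOn hc
    refine ⟨max C 0 * B, by bound, fun σ t h1 h2 ht => ?_⟩
    have h3 := hG (σ + t * I) (by simp; linarith) (by simp; linarith)
    have h5 : (σ + t * I : ℂ).re = σ := by simp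
    rw [h5] at h3
    rw [fieldSeries, norm_mul, mul_div_assoc]
    exact mul_le_mul ((hC (σ, t) ⟨⟨h1.le, h2⟩, abs_le.1 ht⟩).trans (le_max_left _ _)) h3
      (norm_nonneg _) (le_max_right _ _)

end FieldPerron

section LaplaceInversion

open MeasureTheory Set Filter Topology FourierTransform

lemma laplace_inversion {φ : ℝ → ℂ} (hφ : Continuous φ) (h0 : ∀ u ≤ 0, φ u = 0) {c : ℝ}
    {Φ : ℂ → ℂ} (hint : IntegrableOn (fun u : ℝ => exp (-(c * u)) * φ u) (Ioi 0))
    (hΦ : ∀ t : ℝ, ∫ u in Ioi (0 : ℝ), exp (-((c + t * I) * u)) * φ u = Φ (c + t * I))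
    (hI : Integrable fun t : ℝ => Φ (c + t * I)) (u : ℝ) :
    ∫ t : ℝ, Φ (c + t * I) * exp ((c + t * I) * u) = 2 * π * φ u := by
  have hpi := pi_pos
  set f : ℝ → ℂ := fun u => exp (-(c * u)) * φ u with hf
  have hfc : Continuous f := by fun_prop
  have hf0 : ∀ u ∉ Ioi (0 : ℝ), f u = 0 := by grind
  have hfi : Integrable f := by
    rw [← integrableOn_univ]
    exact hint.of_forall_sdiff_eq_zero MeasurableSet.univ fun x hx => hf0 x hx.2
  have hF : ∀ ξ : ℝ, 𝓕 f ξ = Φ (c + (2 * π * ξ : ℝ) * I) := by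
    intro ξ
    rw [Real.fourier_real_eq_integral_exp_smul, ← hΦ, ← setIntegral_eq_integral_of_forall_compl_eq_zero
      (s := Ioi 0) fun x hx => by rw [hf0 x hx, smul_zero]]
    refine setIntegral_congr_fun measurableSet_Ioi fun v _ => ?_
    simp only [hf, smul_eq_mul]
    rw [← mul_assoc, ← exp_add]
    congr 2
    push_cast
    ring
  have hFi : Integrable (𝓕 f) := by
    have := hI.comp_mul_left' (R := 2 * π) (by grind)
    exact this.congr (Eventually.of_forall fun ξ => (hF ξ).symm)
  have h := congrFun (hfc.fourierInv_fourier_eq hfi hFi) u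
  rw [Real.fourierInv_eq'] at h
  have e : ∀ ξ : ℝ, exp ((2 * π * inner ℝ ξ u : ℝ) * I) • 𝓕 f ξ =
      exp (-(c * u)) * (fun t : ℝ => Φ (c + t * I) * exp ((c + t * I) * u)) (2 * π * ξ) := by
    intro ξ
    simp only [hF, smul_eq_mul, RCLike.inner_apply, conj_trivial]
    rw [mul_comm (exp _), mul_left_comm (exp _), ← exp_add]
    congr 2
    push_cast
    ring
  simp only [e] at h
  rw [integral_const_mul, Measure.integral_comp_mul_left (fun t : ℝ => Φ (c + t * I) *
        exp ((c + t * I) * u))] at h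
  have h2 := mul_left_cancel₀ (Complex.exp_ne_zero _) h
  rw [abs_of_pos (by grind), Complex.real_smul] at h2
  rw [← h2, ← mul_assoc]
  push_cast
  rw [mul_inv_cancel₀ (by norm_num), one_mul]

lemma tendsto_pow_mul_exp_neg {z : ℂ} (hz : 0 < z.re) (k : ℕ) :
    Tendsto (fun u : ℝ => exp (-(z * u)) * (u : ℂ) ^ k) atTop (𝓝 0) := by
  rw [tendsto_zero_iff_norm_tendsto_zero]
  have h := tendsto_rpow_mul_exp_neg_mul_atTop_nhds_zero k z.re hz
  refine h.congr' ?_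
  filter_upwards [eventually_ge_atTop 0] with u hu
  rw [norm_mul, norm_exp, norm_pow, norm_real, norm_of_nonneg hu, rpow_natCast, mul_comm]
  simp

lemma integrableOn_pow_mul_exp_neg {z : ℂ} (hz : 0 < z.re) (k : ℕ) :
    IntegrableOn (fun u : ℝ => exp (-(z * u)) * (u : ℂ) ^ k) (Ioi 0) := by
  have h := integrableOn_rpow_mul_exp_neg_mul_rpow (p := 1) (s := k) (b := z.re)
    (by grind) one_pos hz
  refine h.mono' (by fun_prop) ?_
  filter_upwards [self_mem_ae_restrict measurableSet_Ioi] with u hu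
  rw [norm_mul, norm_exp, norm_pow, norm_real, norm_of_nonneg hu.le, rpow_natCast, mul_comm]
  simp

lemma integrableOn_quadratic_mul_exp_neg {z : ℂ} (hz : 0 < z.re) (α β γ : ℂ) :
    IntegrableOn (fun u : ℝ => exp (-(z * u)) * (α + β * u + γ * u ^ 2)) (Ioi 0) := by
  have h := (((integrableOn_pow_mul_exp_neg hz 0).mul_const α).add
    ((integrableOn_pow_mul_exp_neg hz 1).mul_const β)).add
    ((integrableOn_pow_mul_exp_neg hz 2).mul_const γ)
  refine IntegrableOn.congr_fun h (fun u _ => ?_) measurableSet_Ioi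
  simp only [Pi.add_apply]
  ring

lemma integral_quadratic_mul_exp_neg {z : ℂ} (hz : 0 < z.re) (α β γ : ℂ) :
    ∫ u in Ioi (0 : ℝ), exp (-(z * u)) * (α + β * u + γ * u ^ 2) =
      α / z + β / z ^ 2 + 2 * γ / z ^ 3 := by
  have hz0 : z ≠ 0 := by rintro rfl; simp at hz
  set P : ℝ → ℂ := fun u => -(exp (-(z * u)) * (u : ℂ) ^ 0 * (α / z + β / z ^ 2 + 2 * γ / z ^ 3)
    + exp (-(z * u)) * (u : ℂ) ^ 1 * (β / z + 2 * γ / z ^ 2) +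
    exp (-(z * u)) * (u : ℂ) ^ 2 * (γ / z)) with hP
  have ht : Tendsto P atTop (𝓝 0) := by
    have := ((((tendsto_pow_mul_exp_neg hz 0).mul_const (α / z + β / z ^ 2 + 2 * γ / z ^ 3)).add
      ((tendsto_pow_mul_exp_neg hz 1).mul_const (β / z + 2 * γ / z ^ 2))).add
      ((tendsto_pow_mul_exp_neg hz 2).mul_const (γ / z))).neg
    simpa only [zero_mul, add_zero, neg_zero] using this
  have hd : ∀ u : ℝ, HasDerivAt P (exp (-(z * u)) * (α + β * u + γ * u ^ 2)) u := by
    intro u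
    have h1 : HasDerivAt (fun u : ℝ => (u : ℂ)) 1 u := Complex.ofRealCLM.hasDerivAt
    have h2 : HasDerivAt (fun u : ℝ => exp (-(z * u)))
        (exp (-(z * u)) * (-(z * 1))) u := ((h1.const_mul z).neg).cexp
    have h3 := (((h2.mul (h1.pow 0)).mul_const (α / z + β / z ^ 2 + 2 * γ / z ^ 3)).add
      ((h2.mul (h1.pow 1)).mul_const (β / z + 2 * γ / z ^ 2))).add
      ((h2.mul (h1.pow 2)).mul_const (γ / z))
    refine h3.neg.congr_deriv ?_
    simp only [Pi.pow_apply]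
    grind
  have := integral_Ioi_of_hasDerivAt_of_tendsto (a := (0 : ℝ)) (hd 0).continuousAt.continuousWithinAt
    (fun u _ => hd u) (integrableOn_quadratic_mul_exp_neg hz α β γ) ht
  rw [this]
  simp [hP]

end LaplaceInversion

section ExplicitFormula

open MeasureTheory Set Filter Topology

lemma exists_partialFraction {U : Set ℂ} (hU : IsOpen U) {Q : ℂ → ℂ} (hQ : DifferentiableOn ℂ Q U)
    (S : Finset ℂ) (hS : (S : Set ℂ) ⊆ U) : ∃ (r H : ℂ → ℂ), DifferentiableOn ℂ H U ∧
      ∀ s ∈ U, s ∉ S → Q s / ∏ a ∈ S, (s - a) = ∑ a ∈ S, r a / (s - a) + H s := by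
  induction S using Finset.induction_on with
  | empty => exact ⟨0, Q, hQ, fun s _ _ => by simp⟩
  | insert b S hb ih =>
    obtain ⟨r, H, hH, h⟩ := ih (subset_trans (by simp) hS)
    have hbU : b ∈ U := hS (by simp)
    refine ⟨fun a => if a = b then H b - ∑ a ∈ S, r a / (a - b) else r a / (a - b), dslope H b,
      (Complex.differentiableOn_dslope (hU.mem_nhds hbU)).2 hH, fun s hs hsS => ?_⟩
    rw [Finset.mem_insert, not_or] at hsS
    have h1 : s - b ≠ 0 := sub_ne_zero.2 hsS.1
    have e : ∀ a ∈ S, (if a = b then H b - ∑ a ∈ S, r a / (a - b) else r a / (a - b)) / (s - a) =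
        r a / (s - a) / (s - b) + r a / (a - b) / (s - b) := by
      grind
    simp only [Finset.sum_insert hb, if_true]
    rw [Finset.prod_insert hb, Finset.sum_congr rfl e,
      Finset.sum_add_distrib, ← Finset.sum_div, ← Finset.sum_div, mul_comm, ← div_div, h s hs hsS.2,
      dslope_of_ne _ hsS.1, slope_def_field]
    grind

lemma PerronSeries.exists_eq_sum_add {J : ℕ} {f : ℕ → ℝ} {pole : Fin J → ℝ} {F Q : ℂ → ℂ}
    (h : PerronSeries f pole F Q) : ∃ (r : Fin J → ℂ) (H : ℂ → ℂ),
      DifferentiableOn ℂ H {s | 1 / 16 < s.re} ∧ ∀ s : ℂ, 1 / 16 < s.re → (∀ j, s ≠ pole j) →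
        F s = ∑ j, r j / (s - pole j) + H s := by
  have hinj : Function.Injective fun j => (pole j : ℂ) :=
    Complex.ofReal_injective.comp h.pole_injective
  obtain ⟨r, H, hH, h1⟩ := exists_partialFraction
    (isOpen_lt continuous_const Complex.continuous_re) h.differentiableOn
    (Finset.univ.image fun j => (pole j : ℂ)) (by
      intro s hs
      obtain ⟨j, -, rfl⟩ := Finset.mem_image.1 hs
      have := (h.pole_mem j).1
      change 1 / 16 < (pole j : ℂ).re
      rw [ofReal_re]
      linarith)
  refine ⟨fun j => r (pole j), H, hH, fun s hs hp => ?_⟩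
  have h2 := h1 s hs (by grind)
  rw [Finset.sum_image hinj.injOn, Finset.prod_image hinj.injOn, h.eq_mul s hs hp,
    mul_div_cancel_right₀ _ (Finset.prod_ne_zero_iff.2 fun j _ => sub_ne_zero.2 (hp j))] at h2
  exact h2

/-- The positive part of `u ^ 2 / 2`. -/
def rampSq (u : ℝ) : ℝ := (max u 0) ^ 2 / 2

/-- The inverse Laplace transform of `1 / (s ^ 3 * (s - a))`. -/
def expTail (a u : ℝ) : ℝ :=
  (Real.exp (a * max u 0) - 1 - a * max u 0 - (a * max u 0) ^ 2 / 2) / a ^ 3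

lemma norm_inv_cube_le {c : ℝ} (hc : 0 < c) (hc1 : c ≤ 1) (t : ℝ) :
    ‖((c + t * I : ℂ) ^ 3)⁻¹‖ ≤ (c ^ 3)⁻¹ * (1 + t ^ 2)⁻¹ := by
  have h1 : ‖(c + t * I : ℂ)‖ ^ 2 = c ^ 2 + t ^ 2 := by
    rw [← Complex.normSq_eq_norm_sq, Complex.normSq_add_mul_I]
  have h2 : c ≤ ‖(c + t * I : ℂ)‖ := by
    have := abs_re_le_norm (c + t * I)
    simp only [add_re, ofReal_re, mul_re, Complex.I_re, mul_zero,
      ofReal_im, Complex.I_im, mul_one, sub_self, add_zero] at this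
    grind
  rw [norm_inv, norm_pow, ← mul_inv]
  refine inv_anti₀ (by positivity) ?_
  have h3 : c ^ 2 * (1 + t ^ 2) ≤ c ^ 2 + t ^ 2 := by
    nlinarith [sq_nonneg t, mul_le_of_le_one_left (sq_nonneg t) (pow_le_one₀ hc.le hc1 : c ^ 2 ≤ 1)]
  calc c ^ 3 * (1 + t ^ 2) = c * (c ^ 2 * (1 + t ^ 2)) := by ring
    _ ≤ ‖(c + t * I : ℂ)‖ * ‖(c + t * I : ℂ)‖ ^ 2 := by
      rw [h1]
      gcongr
    _ = _ := by ring

lemma add_mul_I_ne_zero {c : ℝ} (hc : 0 < c) (t : ℝ) : (c + t * I : ℂ) ≠ 0 := by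
  intro h
  have := congrArg Complex.re h
  simp at this
  linarith

lemma integrable_inv_cube_mul {c : ℝ} (hc : 0 < c) (hc1 : c ≤ 1) {Ψ : ℝ → ℂ} {M : ℝ}
    (hΨ : Continuous Ψ) (hM : ∀ t, ‖Ψ t‖ ≤ M) :
    Integrable fun t : ℝ => Ψ t * ((c + t * I : ℂ) ^ 3)⁻¹ := by
  have hM0 : 0 ≤ M := (norm_nonneg _).trans (hM 0)
  refine ((integrable_inv_one_add_sq.const_mul (M * (c ^ 3)⁻¹))).mono'
    (Continuous.aestronglyMeasurable ?_) (Eventually.of_forall fun t => ?_)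
  · have : ∀ t : ℝ, (c + t * I : ℂ) ^ 3 ≠ 0 := fun t => pow_ne_zero 3 (add_mul_I_ne_zero hc t)
    fun_prop
  · rw [norm_mul, mul_assoc]
    exact mul_le_mul (hM t) (norm_inv_cube_le hc hc1 t) (norm_nonneg _) hM0

lemma integral_rampSq {c : ℝ} (hc : 0 < c) (hc1 : c ≤ 1) (u : ℝ) :
    ∫ t : ℝ, ((c + t * I : ℂ) ^ 3)⁻¹ * exp ((c + t * I) * u) = 2 * π * rampSq u := by
  have key : ∀ z : ℂ, ∀ u ∈ Ioi (0 : ℝ), exp (-(z * u)) * (0 + 0 * u + (1 / 2 : ℂ) * u ^ 2) =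
      exp (-(z * u)) * rampSq u := by
    intro z u hu
    rw [rampSq, max_eq_left (le_of_lt hu)]
    push_cast
    ring
  refine laplace_inversion (φ := fun u => (rampSq u : ℂ)) (Φ := fun s => (s ^ 3)⁻¹) ?_ ?_ ?_ ?_ ?_ u
  · unfold rampSq
    fun_prop
  · intro u hu
    simp [rampSq, hu]
  · exact (integrableOn_quadratic_mul_exp_neg (z := c) (by simpa) 0 0 (1 / 2)).congr_fun
      (key c) measurableSet_Ioi
  · intro t
    rw [← setIntegral_congr_fun measurableSet_Ioi (key (c + t * I)),
      integral_quadratic_mul_exp_neg (by simpa)]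
    simp
  · have := integrable_inv_cube_mul hc hc1 (Ψ := fun _ => 1) (M := 1) continuous_const (by simp)
    grind

lemma integral_expTail {a c : ℝ} (ha : 0 < a) (hac : a < c) (hc1 : c ≤ 1) (u : ℝ) :
    ∫ t : ℝ, ((c + t * I - a : ℂ)⁻¹ * ((c + t * I : ℂ) ^ 3)⁻¹) *
      exp ((c + t * I) * u) = 2 * π * expTail a u := by
  have hc : 0 < c := ha.trans hac
  have ha0 : (a : ℂ) ≠ 0 := by exact_mod_cast ha.ne'
  have key : ∀ z : ℂ, ∀ u ∈ Ioi (0 : ℝ), (exp (-((z - a) * u)) * (1 + 0 * u + 0 * u ^ 2) -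
      exp (-(z * u)) * (1 + a * u + (a ^ 2 / 2 : ℂ) * u ^ 2)) / a ^ 3 =
      exp (-(z * u)) * expTail a u := by
    intro z u hu
    have : exp (-((z - a) * u)) = exp (-(z * u)) * exp (a * u) := by
      rw [← exp_add]
      grind
    rw [expTail, max_eq_left (le_of_lt hu), this]
    push_cast
    grind
  refine laplace_inversion (φ := fun u => (expTail a u : ℂ)) (Φ := fun s => (s - a)⁻¹ * (s ^ 3)⁻¹)
    ?_ ?_ ?_ ?_ ?_ u
  · unfold expTail
    fun_prop
  · intro u hu
    simp [expTail, hu]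
  · refine IntegrableOn.congr_fun ?_ (key c) measurableSet_Ioi
    exact ((integrableOn_quadratic_mul_exp_neg (z := c - a) (by simpa) 1 0 0).sub
      (integrableOn_quadratic_mul_exp_neg (z := c) (by simpa) 1 a (a ^ 2 / 2))).div_const _
  · intro t
    have hz : (c + t * I : ℂ) ≠ 0 := add_mul_I_ne_zero hc t
    have hza : (c + t * I - a : ℂ) ≠ 0 := by
      have := add_mul_I_ne_zero (sub_pos.2 hac) t
      push_cast at this
      grind
    rw [← setIntegral_congr_fun measurableSet_Ioi (key (c + t * I)), integral_div,
      integral_sub (integrableOn_quadratic_mul_exp_neg (by simpa) _ _ _)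
        (integrableOn_quadratic_mul_exp_neg (by simpa) _ _ _),
      integral_quadratic_mul_exp_neg (by simpa), integral_quadratic_mul_exp_neg (by simpa)]
    grind
  · refine integrable_inv_cube_mul hc hc1 (M := (c - a)⁻¹) ?_ fun t => ?_
    · have : ∀ t : ℝ, (c + t * I - a : ℂ) ≠ 0 := by
        intro t
        have := add_mul_I_ne_zero (sub_pos.2 hac) t
        push_cast at this
        grind
      fun_prop
    · rw [norm_inv]
      refine inv_anti₀ (sub_pos.2 hac) ?_
      have := abs_re_le_norm (c + t * I - a)
      simp only [add_re, sub_re, ofReal_re, mul_re, Complex.I_re,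
        mul_zero, ofReal_im, Complex.I_im, mul_one, sub_self, add_zero] at this
      grind

end ExplicitFormula

section SmoothedSum

open MeasureTheory Set Filter Topology

/-- The normalised second forward difference of `g` with step `δ`. -/
def secondDiff (δ : ℝ) (g : ℝ → ℝ) (u : ℝ) : ℝ := (g (u + 2 * δ) - 2 * g (u + δ) + g u) / δ ^ 2

lemma secondDiff_rampSq_of_nonneg {δ v : ℝ} (hδ : 0 < δ) (hv : 0 ≤ v) :
    secondDiff δ rampSq v = 1 := by
  simp only [secondDiff, rampSq]
  rw [max_eq_left (by linarith : 0 ≤ v + 2 * δ), max_eq_left (by linarith : 0 ≤ v + δ),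
    max_eq_left hv]
  field_simp
  ring

lemma secondDiff_rampSq_of_le {δ v : ℝ} (hδ : 0 < δ) (hv : v ≤ -(2 * δ)) :
    secondDiff δ rampSq v = 0 := by
  simp only [secondDiff, rampSq]
  grind

lemma secondDiff_rampSq_mem {δ : ℝ} (hδ : 0 < δ) (v : ℝ) :
    0 ≤ secondDiff δ rampSq v ∧ secondDiff δ rampSq v ≤ 1 := by
  rcases le_total 0 v with hv | hv
  · rw [secondDiff_rampSq_of_nonneg hδ hv]
    norm_num
  rcases le_total v (-(2 * δ)) with hv2 | hv2
  · rw [secondDiff_rampSq_of_le hδ hv2]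
    norm_num
  simp only [secondDiff, rampSq]
  rw [div_le_one (by bound), max_eq_right hv, max_eq_left (by linarith : 0 ≤ v + 2 * δ)]
  rcases le_total v (-δ) with hv3 | hv3
  · rw [max_eq_right (by linarith : v + δ ≤ 0)]
    exact ⟨div_nonneg (by nlinarith [sq_nonneg (v + 2 * δ)]) (by bound), by nlinarith⟩
  · rw [max_eq_left (by linarith : 0 ≤ v + δ)]
    exact ⟨div_nonneg (by nlinarith) (by bound), by nlinarith⟩

lemma secondDiff_expTail {a δ u : ℝ} (ha : 0 < a) (hδ : 0 < δ) (hu : 0 ≤ u) :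
    secondDiff δ (expTail a) u =
      Real.exp (a * u) / a * ((Real.exp (a * δ) - 1) / (a * δ)) ^ 2 - 1 / a := by
  simp only [secondDiff, expTail]
  rw [max_eq_left (by linarith : 0 ≤ u + 2 * δ), max_eq_left (by linarith : 0 ≤ u + δ),
    max_eq_left hu, show a * (u + 2 * δ) = a * u + a * δ + a * δ by ring,
    show a * (u + δ) = a * u + a * δ by ring, Real.exp_add, Real.exp_add]
  grind

lemma abs_secondDiff_expTail_sub_le {a δ u : ℝ} (ha : 1 / 15 ≤ a) (ha1 : a ≤ 1) (hδ : 0 < δ)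
    (hδ1 : δ ≤ Real.exp (-u)) (hu : 0 ≤ u) :
    |secondDiff δ (expTail a) u - Real.exp (a * u) / a| ≤ 20 := by
  have ha0 : 0 < a := by linarith
  have hx0 : 0 < a * δ := by bound
  have hd1 : δ ≤ 1 := hδ1.trans (Real.exp_le_one_iff.2 (by linarith))
  have hx1 : a * δ ≤ 1 := by bound
  set x := a * δ with hx
  have h1 : x ≤ Real.exp x - 1 := by linarith [Real.add_one_le_exp x]
  have h2 : Real.exp x - 1 ≤ x + x ^ 2 := by
    have := Real.abs_exp_sub_one_sub_id_le (x := x) (by grind)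
    grind
  have h3 : 1 ≤ (Real.exp x - 1) / x := by rwa [le_div_iff₀ hx0, one_mul]
  have h4 : (Real.exp x - 1) / x ≤ 1 + x := by
    rw [div_le_iff₀ hx0]
    nlinarith
  rw [secondDiff_expTail ha0 hδ hu, ← hx]
  set y := (Real.exp x - 1) / x
  have h5 : |y ^ 2 - 1| ≤ 3 * x := by
    rw [abs_of_nonneg (by bound)]
    nlinarith
  have h6 : Real.exp (a * u) * δ ≤ 1 := by
    calc Real.exp (a * u) * δ ≤ Real.exp (a * u) * Real.exp (-u) := by gcongr
      _ = Real.exp (a * u - u) := by rw [← Real.exp_add]; congr 1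
      _ ≤ 1 := Real.exp_le_one_iff.2 (by nlinarith)
  have h7 : (1 : ℝ) / a ≤ 15 := by
    rw [div_le_iff₀ ha0]
    linarith
  have e : Real.exp (a * u) / a * y ^ 2 - 1 / a - Real.exp (a * u) / a =
      Real.exp (a * u) / a * (y ^ 2 - 1) - 1 / a := by ring
  rw [e]
  refine (abs_sub _ _).trans ?_
  rw [abs_mul, abs_of_pos (by bound : 0 < Real.exp (a * u) / a), abs_of_pos (by bound : 0 < 1 / a)]
  have h8 : Real.exp (a * u) / a * |y ^ 2 - 1| ≤ 3 := by
    calc Real.exp (a * u) / a * |y ^ 2 - 1| ≤ Real.exp (a * u) / a * (3 * x) := by gcongr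
      _ = 3 * (Real.exp (a * u) * δ) := by grind
      _ ≤ 3 := by linarith
  linarith

/-- The Laplace transform of the second difference of `rampSq`, up to sign of the exponent. -/
def smoothKernel (δ : ℝ) (s : ℂ) : ℂ := (exp (δ * s) - 1) ^ 2 / (δ ^ 2 * s ^ 3)

lemma norm_exp_sub_one_le_min {z : ℂ} (hz : z.re ≤ 1) :
    ‖exp z - 1‖ ≤ 4 ∧ ‖exp z - 1‖ ≤ 4 * ‖z‖ := by
  have h1 : ‖exp z - 1‖ ≤ 4 := by
    refine (norm_sub_le _ _).trans ?_
    rw [norm_exp, norm_one]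
    have : Real.exp z.re ≤ Real.exp 1 := exp_le_exp.2 hz
    linarith [exp_one_lt_d9]
  refine ⟨h1, ?_⟩
  rcases le_total ‖z‖ 1 with h | h
  · exact (Complex.norm_exp_sub_one_le h).trans (by bound)
  grind

lemma norm_smoothKernel_le {δ : ℝ} {s : ℂ} (hδ : 0 < δ) (hδ1 : δ ≤ 1) (hs : 0 < s.re)
    (hs1 : s.re ≤ 1) :
    ‖smoothKernel δ s‖ ≤ 16 / ‖s‖ ∧ ‖smoothKernel δ s‖ ≤ 16 / (δ ^ 2 * ‖s‖ ^ 3) := by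
  have hs0 : s ≠ 0 := by rintro rfl; simp at hs
  have hsn : 0 < ‖s‖ := norm_pos_iff.2 hs0
  obtain ⟨h1, h2⟩ := norm_exp_sub_one_le_min (z := δ * s) (by rw [Complex.re_ofReal_mul]; bound)
  rw [norm_mul, norm_real, norm_of_nonneg hδ.le] at h2
  rw [smoothKernel, norm_div, norm_mul, norm_pow, norm_pow, norm_pow, norm_real,
    norm_of_nonneg hδ.le]
  constructor
  · calc ‖exp (δ * s) - 1‖ ^ 2 / (δ ^ 2 * ‖s‖ ^ 3)
        ≤ (4 * (δ * ‖s‖)) ^ 2 / (δ ^ 2 * ‖s‖ ^ 3) := by gcongr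
      _ = 16 / ‖s‖ := by field_simp; ring
  · gcongr
    calc ‖exp (δ * s) - 1‖ ^ 2 ≤ 4 ^ 2 := by gcongr
      _ = 16 := by norm_num

lemma PerronSeries.continuous_line {H : ℂ → ℂ} (hH : DifferentiableOn ℂ H {s | 1 / 16 < s.re})
    {σ : ℝ} (hσ : 1 / 16 < σ) : Continuous fun t : ℝ => H (σ + t * I) := by
  have : ContinuousOn H {s | 1 / 16 < s.re} := hH.continuousOn
  exact this.comp_continuous (by fun_prop) fun t => by simp_all

lemma norm_add_mul_I_sub_ge (σ t a : ℝ) :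
    |σ - a| ≤ ‖(σ + t * I - a : ℂ)‖ ∧ |t| ≤ ‖(σ + t * I - a : ℂ)‖ := by
  have h1 := abs_re_le_norm (σ + t * I - a)
  have h2 := Complex.abs_im_le_norm (σ + t * I - a)
  simp_all

variable {J : ℕ} {f : ℕ → ℝ} {pole : Fin J → ℝ} {F Q : ℂ → ℂ}

lemma PerronSeries.add_mul_I_ne_pole (h : PerronSeries f pole F Q) {σ : ℝ}
    (hσ : σ < 1 / 15 ∨ 1 / 8 < σ) (t : ℝ) (j : Fin J) : (σ + t * I : ℂ) ≠ pole j := by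
  intro e
  have := congrArg Complex.re e
  simp at this
  have := h.pole_mem j
  grind

lemma PerronSeries.hasSum_rampSq (h : PerronSeries f pole F Q) (u : ℝ) :
    HasSum (fun n : ℕ => 2 * π * ((f n * rampSq (u - log n) : ℝ) : ℂ))
      (∫ t : ℝ, F ((13 / 100 : ℝ) + t * I) * (((13 / 100 : ℝ) + t * I : ℂ) ^ 3)⁻¹ *
        exp (((13 / 100 : ℝ) + t * I) * u)) := by
  set c : ℝ := 13 / 100 with hc
  have hc0 : 0 < c := by grind
  have hc1 : c ≤ 1 := by grind
  set T : ℕ → ℝ → ℂ := fun n t => f n * ((c + t * I : ℂ) ^ 3)⁻¹ *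
    exp ((c + t * I) * (u - log n : ℝ)) with hT
  have hexp : ∀ (t v : ℝ), ‖exp ((c + t * I) * v)‖ = Real.exp (c * v) := by
    intro t v
    rw [norm_exp]
    simp
  have hint : ∀ n, Integrable (T n) := by
    intro n
    have := integrable_inv_cube_mul hc0 hc1
      (Ψ := fun t => f n * exp ((c + t * I) * (u - log n : ℝ)))
      (M := ‖(f n : ℂ)‖ * Real.exp (c * (u - log n))) (by fun_prop)
      (fun t => by rw [norm_mul, hexp])
    grind
  have hterm : ∀ (n : ℕ) (t : ℝ), term (fun n => (f n : ℂ)) (c + t * I) n *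
      ((c + t * I : ℂ) ^ 3)⁻¹ * exp ((c + t * I) * u) = T n t := by
    intro n t
    rcases Nat.eq_zero_or_pos n with rfl | hn
    · simp [hT, h.zero]
    rw [term_of_ne_zero hn.ne']
    simp only [hT]
    have hn0 : (n : ℂ) ≠ 0 := by exact_mod_cast hn.ne'
    rw [Complex.cpow_def_of_ne_zero hn0, ← Complex.natCast_log, div_eq_mul_inv, ← Complex.exp_neg]
    push_cast
    rw [mul_sub, sub_eq_add_neg, exp_add]
    ring_nf
  have hs := hasSum_integral_of_summable_integral_norm hint (by
    have h1 := (h.summable (c : ℂ) (by bound)).norm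
    have h2 : ∀ n, ∫ t, ‖T n t‖ = ‖term (fun n => (f n : ℂ)) c n‖ *
        (Real.exp (c * u) * ∫ t : ℝ, ‖((c + t * I : ℂ) ^ 3)⁻¹‖) := by
      intro n
      rw [← mul_assoc, ← integral_const_mul]
      refine integral_congr_ae (Eventually.of_forall fun t => ?_)
      beta_reduce
      rw [← hterm, norm_mul, norm_mul, hexp, LSeries.norm_term_eq, LSeries.norm_term_eq]
      simp
      ring_nf
    simp only [h2]
    exact h1.mul_right _)
  have e1 : ∀ n, ∫ t, T n t = 2 * π * ((f n * rampSq (u - log n) : ℝ) : ℂ) := by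
    intro n
    simp only [hT, mul_assoc (f n : ℂ)]
    rw [integral_const_mul, integral_rampSq hc0 hc1]
    push_cast
    ring
  have e2 : ∀ t : ℝ, ∑' n, T n t = F (c + t * I) * ((c + t * I : ℂ) ^ 3)⁻¹ *
      exp ((c + t * I) * u) := by
    intro t
    simp only [← hterm]
    rw [tsum_mul_right, tsum_mul_right, ← h.lseries_eq _ (by bound)]
    rfl
  grind

lemma PerronSeries.exists_norm_le (h : PerronSeries f pole F Q) :
    ∃ C : ℝ, ∀ t : ℝ, ‖F ((13 / 100 : ℝ) + t * I)‖ ≤ C := by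
  refine ⟨∑' n, ‖term (fun n => (f n : ℂ)) ((13 / 100 : ℝ) : ℂ) n‖, fun t => ?_⟩
  have h0 := h.summable ((13 / 100 : ℝ) : ℂ) (by norm_num)
  have h1 := h.summable ((13 / 100 : ℝ) + t * I : ℂ) (by bound)
  rw [← h.lseries_eq _ (by bound)]
  refine (norm_tsum_le_tsum_norm h1.norm).trans_eq ?_
  simp only [LSeries.norm_term_eq]
  simp

lemma PerronSeries.integral_remainder (h : PerronSeries f pole F Q) {r : Fin J → ℂ} {H : ℂ → ℂ}
    (hH : DifferentiableOn ℂ H {s | 1 / 16 < s.re})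
    (hF : ∀ s : ℂ, 1 / 16 < s.re → (∀ j, s ≠ pole j) → F s = ∑ j, r j / (s - pole j) + H s)
    (u : ℝ) :
    (Integrable fun t : ℝ => H ((13 / 100 : ℝ) + t * I) * (((13 / 100 : ℝ) + t * I : ℂ) ^ 3)⁻¹ *
        exp (((13 / 100 : ℝ) + t * I) * u)) ∧
    HasSum (fun n : ℕ => 2 * π * ((f n * rampSq (u - log n) : ℝ) : ℂ))
      ((∫ t : ℝ, H ((13 / 100 : ℝ) + t * I) * (((13 / 100 : ℝ) + t * I : ℂ) ^ 3)⁻¹ *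
        exp (((13 / 100 : ℝ) + t * I) * u)) +
        ∑ j, r j * (2 * π * expTail (pole j) u)) := by
  have hmain := h.hasSum_rampSq u
  obtain ⟨C, hC⟩ := h.exists_norm_le
  set c : ℝ := 13 / 100 with hc
  have hc0 : 0 < c := by grind
  have hc1 : c ≤ 1 := by grind
  have hexp : ∀ (t v : ℝ), ‖exp ((c + t * I) * v)‖ = Real.exp (c * v) := by
    intro t v
    rw [norm_exp]
    simp
  have hFt : ∀ t : ℝ, F (c + t * I) = ∑ j, r j / (c + t * I - pole j) + H (c + t * I) := fun t =>
    hF _ (by bound) (h.add_mul_I_ne_pole (Or.inr (by grind)) t)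
  have hne : ∀ (j : Fin J) (t : ℝ), (c + t * I - pole j : ℂ) ≠ 0 := fun j t =>
    sub_ne_zero.2 (h.add_mul_I_ne_pole (Or.inr (by grind)) t j)
  have hge : ∀ (j : Fin J) (t : ℝ), ‖(c + t * I - pole j : ℂ)⁻¹‖ ≤ 200 := by
    intro j t
    have h1 := (norm_add_mul_I_sub_ge c t (pole j)).1
    have h2 := h.pole_mem j
    have h3 : (1 : ℝ) / 200 ≤ |c - pole j| := by
      rw [abs_of_pos (by grind)]
      grind
    rw [norm_inv, inv_le_comm₀ (norm_pos_iff.2 (hne j t)) (by norm_num)]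
    linarith
  have hHc : Continuous fun t : ℝ => H (c + t * I) := PerronSeries.continuous_line hH (by grind)
  have hHb : ∀ t : ℝ, ‖H (c + t * I)‖ ≤ C + ∑ j, ‖r j‖ * 200 := by
    intro t
    have : H (c + t * I) = F (c + t * I) - ∑ j, r j / (c + t * I - pole j) := by grind
    rw [this]
    refine (norm_sub_le _ _).trans (add_le_add (hC t) ?_)
    refine norm_sum_le_of_le _ fun j _ => ?_
    rw [div_eq_mul_inv, norm_mul]
    bound
  have hint1 : Integrable fun t : ℝ => H (c + t * I) *
      ((c + t * I : ℂ) ^ 3)⁻¹ * exp ((c + t * I) * u) := by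
    have := integrable_inv_cube_mul hc0 hc1 (Ψ := fun t => H (c + t * I) * exp ((c + t * I) * u))
      (M := (C + ∑ j, ‖r j‖ * 200) * Real.exp (c * u)) (hHc.mul (by fun_prop))
      (fun t => by rw [norm_mul, hexp]; bound)
    grind
  refine ⟨hint1, ?_⟩
  have hint2 : ∀ j : Fin J, Integrable fun t : ℝ => r j * (((c + t * I - pole j : ℂ)⁻¹ *
      ((c + t * I : ℂ) ^ 3)⁻¹) * exp ((c + t * I) * u)) := by
    intro j
    have := integrable_inv_cube_mul hc0 hc1
      (Ψ := fun t => (c + t * I - pole j : ℂ)⁻¹ * exp ((c + t * I) * u))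
      (M := 200 * Real.exp (c * u))
      (by fun_prop (disch := grind))
      (fun t => by rw [norm_mul, hexp]; bound)
    refine (this.const_mul (r j)).congr (Eventually.of_forall fun t => ?_)
    grind
  convert hmain using 1
  have e : ∀ t : ℝ, F (c + t * I) * ((c + t * I : ℂ) ^ 3)⁻¹ * exp ((c + t * I) * u) =
      H (c + t * I) * ((c + t * I : ℂ) ^ 3)⁻¹ * exp ((c + t * I) * u) +
      ∑ j, r j * (((c + t * I - pole j : ℂ)⁻¹ *
        ((c + t * I : ℂ) ^ 3)⁻¹) * exp ((c + t * I) * u)) := by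
    intro t
    rw [hFt, add_mul, add_mul, Finset.sum_mul, Finset.sum_mul, add_comm]
    grind
  simp only [e]
  rw [integral_add hint1 (integrable_finsetSum _ fun j _ => hint2 j),
    integral_finsetSum _ fun j _ => hint2 j]
  congr 1
  refine Finset.sum_congr rfl fun j _ => ?_
  have h2 := h.pole_mem j
  rw [integral_const_mul, integral_expTail (by linarith) (by grind) hc1]

lemma PerronSeries.integral_smoothKernel (h : PerronSeries f pole F Q) {r : Fin J → ℂ}
    {H : ℂ → ℂ} (hH : DifferentiableOn ℂ H {s | 1 / 16 < s.re})
    (hF : ∀ s : ℂ, 1 / 16 < s.re → (∀ j, s ≠ pole j) → F s = ∑ j, r j / (s - pole j) + H s)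
    {δ : ℝ} (hδ : 0 < δ) (u : ℝ) :
    (Integrable fun t : ℝ => H ((13 / 100 : ℝ) + t * I) * smoothKernel δ ((13 / 100 : ℝ) + t * I) *
        exp (((13 / 100 : ℝ) + t * I) * u)) ∧
    HasSum (fun n : ℕ => 2 * π * ((f n * secondDiff δ rampSq (u - log n) : ℝ) : ℂ))
      ((∫ t : ℝ, H ((13 / 100 : ℝ) + t * I) * smoothKernel δ ((13 / 100 : ℝ) + t * I) *
        exp (((13 / 100 : ℝ) + t * I) * u)) +
        ∑ j, r j * (2 * π * secondDiff δ (expTail (pole j)) u)) := by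
  obtain ⟨i2, s2⟩ := h.integral_remainder hH hF (u + 2 * δ)
  obtain ⟨i1, s1⟩ := h.integral_remainder hH hF (u + δ)
  obtain ⟨i0, s0⟩ := h.integral_remainder hH hF u
  set c : ℝ := 13 / 100 with hc
  have hδ0 : (δ : ℂ) ≠ 0 := by exact_mod_cast hδ.ne'
  have e : ∀ t : ℝ, H (c + t * I) * smoothKernel δ (c + t * I) * exp ((c + t * I) * u) =
      ((δ : ℂ) ^ 2)⁻¹ * (H (c + t * I) * ((c + t * I : ℂ) ^ 3)⁻¹ *
        exp ((c + t * I) * (u + 2 * δ : ℝ)) -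
        2 * (H (c + t * I) * ((c + t * I : ℂ) ^ 3)⁻¹ *
        exp ((c + t * I) * (u + δ : ℝ))) +
        H (c + t * I) * ((c + t * I : ℂ) ^ 3)⁻¹ *
        exp ((c + t * I) * u)) := by
    intro t
    generalize (c + t * I : ℂ) = s
    push_cast
    rw [show s * (u + 2 * δ : ℂ) = s * u + δ * s + δ * s by ring,
      show s * (u + δ : ℂ) = s * u + δ * s by ring, exp_add, exp_add,
      smoothKernel, div_eq_mul_inv, mul_inv]
    ring
  simp only [e]
  refine ⟨((i2.sub (i1.const_mul 2)).add i0).const_mul _, ?_⟩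
  have hs := ((s2.sub (s1.mul_left 2)).add s0).mul_left ((δ : ℂ) ^ 2)⁻¹
  have hsplit : ∀ g₂ g₁ g₀ : ℝ → ℂ, Integrable g₂ → Integrable g₁ → Integrable g₀ →
      ∫ t, (g₂ t - 2 * g₁ t + g₀ t) =
      (∫ t, g₂ t) - 2 * (∫ t, g₁ t) + ∫ t, g₀ t := by
    intro g₂ g₁ g₀ h₂ h₁ h₀
    rw [integral_add (f := fun t => g₂ t - 2 * g₁ t) (h₂.sub (h₁.const_mul 2)) h₀,
      integral_sub h₂ (h₁.const_mul 2), integral_const_mul]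
  rw [integral_const_mul, hsplit _ _ _ i2 i1 i0]
  convert hs using 1
  · rfl
  · funext n
    simp only [secondDiff]
    rw [show u - log n + 2 * δ = u + 2 * δ - log n by ring,
      show u - log n + δ = u + δ - log n by ring]
    push_cast
    field_simp
  · simp only [secondDiff]
    push_cast
    have e2 : ∑ j, r j * (2 * π * (((expTail (pole j) (u + 2 * δ) : ℂ) -
        2 * expTail (pole j) (u + δ) + expTail (pole j) u) / δ ^ 2)) =
        ((δ : ℂ) ^ 2)⁻¹ * (∑ j, r j * (2 * π * expTail (pole j) (u + 2 * δ)) -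
        2 * ∑ j, r j * (2 * π * expTail (pole j) (u + δ)) +
        ∑ j, r j * (2 * π * expTail (pole j) u)) := by
      rw [Finset.mul_sum, ← sum_sub_distrib, ← Finset.sum_add_distrib, Finset.mul_sum]
      refine Finset.sum_congr rfl fun j _ => ?_
      field_simp
    rw [e2]
    ring

end SmoothedSum

section ContourShift

open MeasureTheory Set Filter Topology

lemma norm_integral_le_of_shift {G : ℂ → ℂ} {b σ₀ c B C T₁ : ℝ}
    (hG : DifferentiableOn ℂ G {s | b < s.re}) (hb : b < σ₀) (hc : σ₀ ≤ c) (hT₁ : 1 ≤ T₁)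
    (hint : Integrable fun t : ℝ => G (c + t * I))
    (hgrow : ∀ σ t : ℝ, σ₀ ≤ σ → σ ≤ c → 1 ≤ |t| → ‖G (σ + t * I)‖ ≤ C / |t|)
    (hB : ∀ M : ℕ, ‖∫ t in (-(2 ^ M * T₁))..2 ^ M * T₁, G (σ₀ + t * I)‖ ≤ B) :
    ‖∫ t : ℝ, G (c + t * I)‖ ≤ B := by
  have hT : Tendsto (fun M : ℕ => (2 : ℝ) ^ M * T₁) atTop atTop :=
    (tendsto_pow_atTop_atTop_of_one_lt (by norm_num)).atTop_mul_const (by linarith)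
  have h1 := (intervalIntegral_tendsto_integral hint (tendsto_neg_atTop_atBot.comp hT) hT).norm
  have h2 : Tendsto (fun M : ℕ => B + 2 * (C * (c - σ₀)) * ((2 : ℝ) ^ M * T₁)⁻¹) atTop (𝓝 B) := by
    have := (hT.inv_tendsto_atTop.const_mul (2 * (C * (c - σ₀)))).const_add B
    simpa using this
  refine le_of_tendsto_of_tendsto' h1 h2 fun M => ?_
  set T : ℝ := 2 ^ M * T₁ with hTdef
  have hT1 : 1 ≤ T := by bound
  have hrect := Complex.integral_boundary_rect_eq_zero_of_differentiableOn G (σ₀ + (-T : ℝ) * I)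
    (c + T * I) (hG.mono fun s hs => by
      have := hs.1
      simp only [mem_preimage, add_re, ofReal_re, mul_re, Complex.I_re,
        mul_zero, ofReal_im, Complex.I_im, mul_one, sub_self, add_zero] at this
      rw [uIcc_of_le hc] at this
      grind)
  have hre : ∀ x y : ℝ, (x + y * I : ℂ).re = x := fun x y => by simp
  have him : ∀ x y : ℝ, (x + y * I : ℂ).im = y := fun x y => by simp
  rw [hre, hre, him, him] at hrect
  have hhor : ∀ y : ℝ, |y| = T → ‖∫ x : ℝ in σ₀..c, G (x + y * I)‖ ≤ C * (c - σ₀) * T⁻¹ := by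
    intro y hy
    have := intervalIntegral.norm_integral_le_of_norm_le_const (a := σ₀) (b := c)
      (f := fun x : ℝ => G (x + y * I)) (C := C / T) (fun x hx => by grind)
    rw [abs_of_nonneg (by linarith)] at this
    grind
  have e : I * ∫ y : ℝ in (-T)..T, G (c + y * I) = I * (∫ y : ℝ in (-T)..T, G (σ₀ + y * I)) +
      (∫ x : ℝ in σ₀..c, G (x + T * I)) - ∫ x : ℝ in σ₀..c, G (x + (-T : ℝ) * I) := by
    simp only [smul_eq_mul] at hrect
    grind
  have e2 := congrArg norm e
  rw [norm_mul, norm_I, one_mul] at e2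
  simp only [Function.comp_apply]
  rw [e2]
  refine (norm_sub_le _ _).trans ((add_le_add (norm_add_le _ _) le_rfl).trans ?_)
  rw [norm_mul, norm_I, one_mul]
  have h3 := hhor T (abs_of_pos (by linarith))
  have h4 := hhor (-T) (by grind)
  grind

lemma norm_integral_dyadic_le {g : ℝ → ℂ} (hg : Continuous g) (T₁ : ℝ) (M : ℕ) :
    ‖∫ t in (-(2 ^ M * T₁))..2 ^ M * T₁, g t‖ ≤ ‖∫ t in (-T₁)..T₁, g t‖ +
      ∑ m ∈ Finset.range M, |∫ t in 2 ^ m * T₁..2 * (2 ^ m * T₁), (‖g t‖ + ‖g (-t)‖)| := by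
  induction M with
  | zero => simp
  | succ M ih =>
    set T := (2 : ℝ) ^ M * T₁ with hT
    have hii : ∀ a b, IntervalIntegrable g volume a b := fun a b => hg.intervalIntegrable a b
    have e : (2 : ℝ) ^ (M + 1) * T₁ = 2 * T := by grind
    rw [Finset.sum_range_succ, e, ← hT]
    have h1 : ∫ t in (-(2 * T))..2 * T, g t =
        (∫ t in (-T)..T, g t) + ∫ t in T..2 * T, (g t + g (-t)) := by
      have h2 : ∫ t in T..2 * T, g (-t) = ∫ t in (-(2 * T))..(-T), g t :=
        intervalIntegral.integral_comp_neg g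
      rw [intervalIntegral.integral_add (g := fun t => g (-t)) (hii _ _)
        ((hg.comp continuous_neg).intervalIntegrable _ _)]
      rw [h2, ← intervalIntegral.integral_add_adjacent_intervals (hii (-(2 * T)) (-T)) (hii _ _),
        ← intervalIntegral.integral_add_adjacent_intervals (hii (-T) T) (hii _ _)]
      ring
    rw [h1]
    refine (norm_add_le _ _).trans ?_
    rw [← add_assoc]
    refine add_le_add ih ?_
    refine (intervalIntegral.norm_integral_le_abs_integral_norm).trans ?_
    have hc1 : Continuous fun t => ‖g t + g (-t)‖ := by fun_prop
    have hc2 : Continuous fun t => ‖g t‖ + ‖g (-t)‖ := by fun_prop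
    rcases le_total T (2 * T) with hle | hle
    · rw [abs_of_nonneg (intervalIntegral.integral_nonneg hle fun t _ => norm_nonneg _),
        abs_of_nonneg (intervalIntegral.integral_nonneg hle fun t _ => by bound)]
      exact integral_mono_on hle (hc1.intervalIntegrable _ _)
        (hc2.intervalIntegrable _ _) fun t _ => norm_add_le _ _
    · rw [integral_symm, abs_neg, integral_symm (f := fun t => ‖g t‖ + ‖g (-t)‖), abs_neg,
        abs_of_nonneg (intervalIntegral.integral_nonneg hle fun t _ => norm_nonneg _),
        abs_of_nonneg (intervalIntegral.integral_nonneg hle fun t _ => by bound)]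
      exact integral_mono_on hle (hc1.intervalIntegrable _ _)
        (hc2.intervalIntegrable _ _) fun t _ => norm_add_le _ _

lemma exists_sum_min_le : ∃ C : ℝ, 0 ≤ C ∧ ∀ (u : ℝ) (M : ℕ), 1 ≤ u →
    ∑ m ∈ Finset.range M, ((m : ℝ) + 1) ^ 15 * min 1 (4 * Real.exp u ^ 2 / 4 ^ m) ≤ C * u ^ 16 := by
  have hs : Summable fun m : ℕ => ((m : ℝ) + 1) ^ 15 * (1 / 2 : ℝ) ^ m := by
    have h1 := summable_pow_mul_geometric_of_norm_lt_one 15 (r := (1 / 2 : ℝ)) (by norm_num)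
    have h2 := ((summable_nat_add_iff 1).2 h1).mul_left 2
    grind
  set S := ∑' m : ℕ, ((m : ℝ) + 1) ^ 15 * (1 / 2 : ℝ) ^ m with hS
  have hS0 : 0 ≤ S := tsum_nonneg fun m => by bound
  refine ⟨5 ^ 16 + 4 * S, by bound, fun u M hu => ?_⟩
  have hterm : ∀ m ∈ Finset.range M, ((m : ℝ) + 1) ^ 15 * min 1 (4 * Real.exp u ^ 2 / 4 ^ m) ≤
      (if m < ⌈4 * u⌉₊ then (5 * u) ^ 15 else 0) + 4 * (((m : ℝ) + 1) ^ 15 * (1 / 2 : ℝ) ^ m) := by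
    intro m _
    have hpos : 0 ≤ 4 * (((m : ℝ) + 1) ^ 15 * (1 / 2 : ℝ) ^ m) := by bound
    split_ifs with hm
    · have h1 : (m : ℝ) < 4 * u := Nat.lt_ceil.1 hm
      calc ((m : ℝ) + 1) ^ 15 * min 1 (4 * Real.exp u ^ 2 / 4 ^ m)
          ≤ (5 * u) ^ 15 * 1 := by
            gcongr
            · linarith
            grind
        _ ≤ _ := by linarith
    · have h1 : 4 * u ≤ m := Nat.ceil_le.1 (not_lt.1 hm)
      rw [zero_add]
      have h2 : Real.exp u ^ 2 ≤ 2 ^ m := by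
        rw [← Real.exp_nat_mul, ← Real.exp_log (by bound : (0 : ℝ) < 2 ^ m), log_pow]
        apply exp_le_exp.2
        have := Real.log_two_gt_d9
        push_cast
        nlinarith
      calc ((m : ℝ) + 1) ^ 15 * min 1 (4 * Real.exp u ^ 2 / 4 ^ m)
          ≤ ((m : ℝ) + 1) ^ 15 * (4 * 2 ^ m / 4 ^ m) := by
            gcongr
            exact (min_le_right _ _).trans (by gcongr)
        _ = _ := by
            rw [show (4 : ℝ) ^ m = 2 ^ m * 2 ^ m by rw [← mul_pow]; norm_num, one_div, inv_pow]
            field_simp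
  refine (Finset.sum_le_sum hterm).trans ?_
  rw [Finset.sum_add_distrib, ← Finset.mul_sum]
  have h1 : ∑ m ∈ Finset.range M, ((m : ℝ) + 1) ^ 15 * (1 / 2 : ℝ) ^ m ≤ S :=
    hs.sum_le_tsum _ fun m _ => by positivity
  have h2 : ∑ m ∈ Finset.range M, (if m < ⌈4 * u⌉₊ then (5 * u) ^ 15 else 0) ≤ (5 * u) ^ 16 := by
    rw [← Finset.sum_filter, Finset.sum_const, nsmul_eq_mul]
    have h3 : ((Finset.range M).filter fun m => m < ⌈4 * u⌉₊).card ≤ ⌈4 * u⌉₊ := by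
      refine (Finset.card_le_card (t := Finset.range ⌈4 * u⌉₊) fun m hm => ?_).trans_eq
        (Finset.card_range _)
      grind
    have h4 : ((((Finset.range M).filter fun m => m < ⌈4 * u⌉₊).card : ℕ) : ℝ) ≤ 5 * u := by
      refine (Nat.cast_le.2 h3).trans ?_
      have := Nat.ceil_lt_add_one (by linarith : 0 ≤ 4 * u)
      linarith
    calc _ ≤ (5 * u) * (5 * u) ^ 15 := by gcongr
      _ = _ := by ring
  have h3 : 1 ≤ u ^ 16 := one_le_pow₀ hu
  calc _ ≤ (5 * u) ^ 16 + 4 * S := by linarith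
    _ ≤ (5 * u) ^ 16 + 4 * S * u ^ 16 := by nlinarith
    _ = _ := by ring

variable {J : ℕ} {f : ℕ → ℝ} {pole : Fin J → ℝ} {F Q : ℂ → ℂ}

lemma PerronSeries.exists_norm_remainder_le (h : PerronSeries f pole F Q) {r : Fin J → ℂ}
    {H : ℂ → ℂ}
    (hF : ∀ s : ℂ, 1 / 16 < s.re → (∀ j, s ≠ pole j) → F s = ∑ j, r j / (s - pole j) + H s) :
    ∃ R : ℝ, 0 ≤ R ∧ ∀ σ t : ℝ, 1 / 16 < σ → (σ ≤ 8 / 125 ∨ 1 ≤ |t|) →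
      ‖H (σ + t * I)‖ ≤ ‖F (σ + t * I)‖ + R := by
  refine ⟨∑ j, ‖r j‖ * 1000, by positivity, fun σ t hσ hσt => ?_⟩
  have hge : ∀ j : Fin J, (1 : ℝ) / 1000 ≤ ‖(σ + t * I - pole j : ℂ)‖ := by
    intro j
    have h1 := norm_add_mul_I_sub_ge σ t (pole j)
    have h2 := h.pole_mem j
    grind
  have hne : ∀ j : Fin J, (σ + t * I : ℂ) ≠ pole j := by
    intro j e
    have := hge j
    rw [e, sub_self, norm_zero] at this
    grind
  have e : H (σ + t * I) = F (σ + t * I) - ∑ j, r j / (σ + t * I - pole j) := by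
    rw [hF _ (by simpa using hσ) hne]
    ring
  rw [e]
  refine (norm_sub_le _ _).trans (add_le_add le_rfl (norm_sum_le_of_le _ fun j _ => ?_))
  rw [norm_div, div_eq_mul_inv]
  gcongr
  rw [inv_le_comm₀ (by grind) (by norm_num)]
  grind

lemma PerronSeries.continuous_line_of_le (h : PerronSeries f pole F Q) {r : Fin J → ℂ} {H : ℂ → ℂ}
    (hH : DifferentiableOn ℂ H {s | 1 / 16 < s.re})
    (hF : ∀ s : ℂ, 1 / 16 < s.re → (∀ j, s ≠ pole j) → F s = ∑ j, r j / (s - pole j) + H s)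
    {σ : ℝ} (hσ : 1 / 16 < σ) (hσ1 : σ ≤ 8 / 125) :
    Continuous fun t : ℝ => F (σ + t * I) := by
  have hne := h.add_mul_I_ne_pole (σ := σ) (Or.inl (by linarith))
  have e : (fun t : ℝ => F (σ + t * I)) = fun t : ℝ =>
      ∑ j, r j / (σ + t * I - pole j) + H (σ + t * I) :=
    funext fun t => hF _ (by simpa using hσ) (hne t)
  rw [e]
  refine Continuous.add (continuous_finsetSum _ fun j _ => ?_) (PerronSeries.continuous_line hH hσ)
  have : ∀ t : ℝ, (σ + t * I - pole j : ℂ) ≠ 0 := fun t => sub_ne_zero.2 (hne t j)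
  fun_prop

lemma differentiableOn_smoothKernel (δ : ℝ) (hδ : 0 < δ) :
    DifferentiableOn ℂ (smoothKernel δ) {s | 1 / 16 < s.re} := by
  have : ∀ s ∈ {s : ℂ | 1 / 16 < s.re}, (δ ^ 2 * s ^ 3 : ℂ) ≠ 0 := by
    intro s hs
    have hδ0 : (δ : ℂ) ≠ 0 := by exact_mod_cast hδ.ne'
    have hs0 : s ≠ 0 := by
      rintro rfl
      simp only [mem_ofPred_eq, Complex.zero_re] at hs
      linarith
    positivity
  unfold smoothKernel
  fun_prop

end ContourShift

section PerronBound

open MeasureTheory Set Filter Topology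

variable {J : ℕ} {f : ℕ → ℝ} {pole : Fin J → ℝ} {F Q : ℂ → ℂ}

lemma norm_smoothKernel_mul_exp_le {δ u σ t T : ℝ} (hδ : Real.exp (-u) / 2 ≤ δ) (hδ1 : δ ≤ 1)
    (hσ : 0 < σ) (hσ1 : σ ≤ 1) (hT : 0 < T) (ht : T ≤ |t|) :
    ‖smoothKernel δ (σ + t * I) * exp ((σ + t * I) * u)‖ ≤
      16 * Real.exp (σ * u) * min 1 (4 * Real.exp u ^ 2 / T ^ 2) / T := by
  have hδ0 : 0 < δ := lt_of_lt_of_le (by bound) hδ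
  have hre : (σ + t * I : ℂ).re = σ := by simp
  obtain ⟨h1, h2⟩ := norm_smoothKernel_le (δ := δ) (s := σ + t * I) hδ0 hδ1 (by grind) (by grind)
  have hs : T ≤ ‖(σ + t * I : ℂ)‖ := by
    have := (norm_add_mul_I_sub_ge σ t 0).2
    rw [ofReal_zero, sub_zero] at this
    grind
  have hexp : ‖exp ((σ + t * I) * u)‖ = Real.exp (σ * u) := by
    rw [norm_exp]
    simp
  have h3 : ‖smoothKernel δ (σ + t * I)‖ ≤ 16 * min 1 (4 * Real.exp u ^ 2 / T ^ 2) / T := by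
    rcases le_total 1 (4 * Real.exp u ^ 2 / T ^ 2) with h | h
    · rw [min_eq_left h, mul_one]
      exact h1.trans (by gcongr)
    · rw [min_eq_right h]
      refine h2.trans ?_
      have h4 : 16 / (δ ^ 2 * ‖(σ + t * I : ℂ)‖ ^ 3) ≤
          16 / ((Real.exp (-u) / 2) ^ 2 * T ^ 3) := by gcongr
      refine h4.trans_eq ?_
      rw [Real.exp_neg]
      grind
  rw [norm_mul, hexp]
  calc _ ≤ 16 * min 1 (4 * Real.exp u ^ 2 / T ^ 2) / T * Real.exp (σ * u) := by gcongr
    _ = _ := by ring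

lemma PerronSeries.exists_dyadic_le (h : PerronSeries f pole F Q) {r : Fin J → ℂ} {H : ℂ → ℂ}
    (hH : DifferentiableOn ℂ H {s | 1 / 16 < s.re})
    (hF : ∀ s : ℂ, 1 / 16 < s.re → (∀ j, s ≠ pole j) → F s = ∑ j, r j / (s - pole j) + H s) :
    ∃ C T₁ : ℝ, 0 ≤ C ∧ 3 ≤ T₁ ∧ ∀ u δ T : ℝ, 667 ≤ u → Real.exp (-u) / 2 ≤ δ → δ ≤ 1 → T₁ ≤ T →
      ∫ t in T..2 * T, (‖(fun t : ℝ => H ((1 / 16 + 1 / u : ℝ) + t * I) *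
        smoothKernel δ ((1 / 16 + 1 / u : ℝ) + t * I) *
        exp (((1 / 16 + 1 / u : ℝ) + t * I) * u)) t‖ +
        ‖(fun t : ℝ => H ((1 / 16 + 1 / u : ℝ) + t * I) *
        smoothKernel δ ((1 / 16 + 1 / u : ℝ) + t * I) *
        exp (((1 / 16 + 1 / u : ℝ) + t * I) * u)) (-t)‖) ≤
      C * u * Real.exp (u / 16) * (min 1 (4 * Real.exp u ^ 2 / T ^ 2) * log T ^ 15) := by
  obtain ⟨C, T₁, hC, hT₁, hmom⟩ := h.moment
  obtain ⟨R, hR, hrem⟩ := h.exists_norm_remainder_le hF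
  refine ⟨48 * (C + 2 * R), T₁, by bound, hT₁, fun u δ T hu hδ hδ1 hT => ?_⟩
  have hu0 : 0 < u := by linarith
  set σ : ℝ := 1 / 16 + 1 / u with hσdef
  have hu1 : 1 / u ≤ 3 / 2000 := by
    rw [div_le_iff₀ hu0]
    linarith
  have hupos : 0 < 1 / u := by bound
  have hσ : 1 / 16 < σ := by linarith
  have hσ1 : σ ≤ 8 / 125 := by grind
  have hT0 : 0 < T := by linarith
  have hFc := h.continuous_line_of_le hH hF hσ hσ1
  have hE : Real.exp (σ * u) ≤ 3 * Real.exp (u / 16) := by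
    rw [hσdef, show (1 / 16 + 1 / u) * u = 1 + u / 16 by field_simp; ring, Real.exp_add]
    have := exp_one_lt_d9
    gcongr
    linarith
  have hHc := PerronSeries.continuous_line hH hσ
  have hKc := PerronSeries.continuous_line
    (differentiableOn_smoothKernel δ (lt_of_lt_of_le (by bound) hδ)) hσ
  set κ := min 1 (4 * Real.exp u ^ 2 / T ^ 2) with hκ
  have hκ0 : 0 ≤ κ := le_min (by norm_num) (by positivity)
  set A := 16 * Real.exp (σ * u) * κ / T with hA
  have hA0 : 0 ≤ A := by positivity
  have hb : ∀ t : ℝ, T ≤ |t| → ‖H (σ + t * I) * smoothKernel δ (σ + t * I) *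
      exp ((σ + t * I) * u)‖ ≤ A * (‖F (σ + t * I)‖ + R) := by
    intro t ht
    rw [mul_assoc, norm_mul, mul_comm]
    exact mul_le_mul (norm_smoothKernel_mul_exp_le hδ hδ1 (by linarith) (by linarith) hT0 ht)
      (hrem σ t hσ (Or.inl hσ1)) (norm_nonneg _) hA0
  have hc1 : Continuous fun t : ℝ => ‖F (σ + t * I)‖ + ‖F (σ + (-t : ℝ) * I)‖ :=
    hFc.norm.add (hFc.comp continuous_neg).norm
  have hle : T ≤ 2 * T := by linarith
  have hlog : 1 ≤ log T := by
    rw [le_log_iff_exp_le hT0]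
    linarith [exp_one_lt_d9]
  have hlog15 : 1 ≤ log T ^ 15 := one_le_pow₀ hlog
  calc _ ≤ ∫ t in T..2 * T,
        A * ((‖F (σ + t * I)‖ + ‖F (σ + (-t : ℝ) * I)‖) + 2 * R) := by
        have hGc : Continuous fun t : ℝ => H (σ + t * I) *
            smoothKernel δ (σ + t * I) * exp ((σ + t * I) * u) :=
          (hHc.mul hKc).mul (by fun_prop)
        refine integral_mono_on hle
          ((hGc.norm.add (hGc.comp continuous_neg).norm).intervalIntegrable _ _)
          ((continuous_const.mul (hc1.add continuous_const)).intervalIntegrable _ _) fun t ht => ?_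
        have h1 := hb t (ht.1.trans (le_abs_self t))
        have h2 := hb (-t) (by rw [abs_neg]; exact ht.1.trans (le_abs_self t))
        grind
    _ = A * ((∫ t in T..2 * T, (‖F (σ + t * I)‖ + ‖F (σ + (-t : ℝ) * I)‖)) + 2 * R * T) := by
        rw [intervalIntegral.integral_const_mul, intervalIntegral.integral_add
          (hc1.intervalIntegrable _ _) (continuous_const.intervalIntegrable _ _),
          intervalIntegral.integral_const, smul_eq_mul]
        ring
    _ ≤ A * (C * u * T * log T ^ 15 + 2 * R * T * (u * log T ^ 15)) := by
        have h1 := hmom T σ hT hσ (by linarith)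
        rw [show C / (σ - 1 / 16) = C * u by rw [hσdef]; bound] at h1
        have h2 : 1 ≤ u * log T ^ 15 := by nlinarith
        have h3 : 2 * R * T ≤ 2 * R * T * (u * log T ^ 15) :=
          le_mul_of_one_le_right (by positivity) h2
        gcongr
    _ = 16 * Real.exp (σ * u) * ((C + 2 * R) * u * (κ * log T ^ 15)) := by
        rw [hA]
        field_simp
    _ ≤ 16 * (3 * Real.exp (u / 16)) * ((C + 2 * R) * u * (κ * log T ^ 15)) := by gcongr
    _ = _ := by ring

lemma PerronSeries.exists_integral_le (h : PerronSeries f pole F Q) {r : Fin J → ℂ} {H : ℂ → ℂ}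
    (hH : DifferentiableOn ℂ H {s | 1 / 16 < s.re})
    (hF : ∀ s : ℂ, 1 / 16 < s.re → (∀ j, s ≠ pole j) → F s = ∑ j, r j / (s - pole j) + H s) :
    ∃ C : ℝ, 0 ≤ C ∧ ∀ u δ : ℝ, 667 ≤ u → Real.exp (-u) / 2 ≤ δ → δ ≤ 1 →
      ‖∫ t : ℝ, H ((13 / 100 : ℝ) + t * I) * smoothKernel δ ((13 / 100 : ℝ) + t * I) *
        exp (((13 / 100 : ℝ) + t * I) * u)‖ ≤
      C * u ^ 17 * Real.exp (u / 16) := by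
  obtain ⟨C, T₁, hC, hT₁, hdy⟩ := h.exists_dyadic_le hH hF
  obtain ⟨R, hR, hrem⟩ := h.exists_norm_remainder_le hF
  obtain ⟨C₀, hC₀, hsmall⟩ := h.small T₁
  obtain ⟨C₂, hC₂, hsum⟩ := exists_sum_min_le
  have hlogT₁ : 1 ≤ log T₁ := by
    rw [le_log_iff_exp_le (by linarith)]
    linarith [exp_one_lt_d9]
  refine ⟨2 * T₁ * ((C₀ + R) * (256 * 3)) + C * (log T₁ ^ 15 * C₂), by positivity,
    fun u δ hu hδ hδ1 => ?_⟩
  have hδ0 : 0 < δ := lt_of_lt_of_le (by bound) hδ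
  have hu0 : 0 < u := by linarith
  have hdy' := fun m : ℕ => hdy u δ (2 ^ m * T₁) hu hδ hδ1 (by
    have : (1 : ℝ) ≤ 2 ^ m := one_le_pow₀ (by norm_num)
    linarith [le_mul_of_one_le_left (by linarith : 0 ≤ T₁) this])
  set σ : ℝ := 1 / 16 + 1 / u with hσdef
  have hu1 : 1 / u ≤ 3 / 2000 := by
    rw [div_le_iff₀ hu0]
    linarith
  have hupos : 0 < 1 / u := by bound
  have hσ : 1 / 16 < σ := by linarith
  have hσ1 : σ ≤ 8 / 125 := by grind
  have hE : Real.exp (σ * u) ≤ 3 * Real.exp (u / 16) := by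
    rw [hσdef, show (1 / 16 + 1 / u) * u = 1 + u / 16 by field_simp; ring, Real.exp_add]
    have := exp_one_lt_d9
    gcongr
    linarith
  have hHc := PerronSeries.continuous_line hH hσ
  have hKd := differentiableOn_smoothKernel δ hδ0
  have hKc := PerronSeries.continuous_line hKd hσ
  have hexp : ∀ σ t : ℝ, ‖exp ((σ + t * I) * u)‖ = Real.exp (σ * u) := by
    intro σ t
    rw [norm_exp]
    simp
  have hre : ∀ σ t : ℝ, (σ + t * I : ℂ).re = σ := fun σ t => by simp
  obtain ⟨Cg, hCg, hgrow⟩ := h.growth σ hσ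
  refine norm_integral_le_of_shift (b := 1 / 16) (σ₀ := σ) (c := 13 / 100) (T₁ := T₁)
    (C := (Cg + R) * (16 / δ ^ 2) * Real.exp (13 / 100 * u))
    (G := fun s => H s * smoothKernel δ s * exp (s * u)) ?_ hσ (by linarith) (by linarith)
    (h.integral_smoothKernel hH hF hδ0 u).1 ?_ fun M => ?_
  · fun_prop
  · intro σ' t hσ' hσ1' ht
    have ht2 : 1 ≤ t ^ 2 := by rw [← sq_abs]; bound
    have h1 : ‖H (σ' + t * I)‖ ≤ (Cg + R) * t ^ 2 := by
      have h2 := hrem σ' t (by linarith) (Or.inr ht)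
      have h3 := hgrow σ' t hσ' hσ1' ht
      linarith [le_mul_of_one_le_right hR ht2]
    have h4 : ‖smoothKernel δ (σ' + t * I)‖ ≤ 16 / (δ ^ 2 * |t| ^ 3) := by
      refine (norm_smoothKernel_le hδ0 hδ1 (by grind) (by grind)).2.trans ?_
      have := (norm_add_mul_I_sub_ge σ' t 0).2
      rw [ofReal_zero, sub_zero] at this
      gcongr
    rw [norm_mul, norm_mul, hexp]
    calc _ ≤ (Cg + R) * t ^ 2 * (16 / (δ ^ 2 * |t| ^ 3)) * Real.exp (13 / 100 * u) := by gcongr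
      _ = _ := by
        rw [← sq_abs t]
        have : 0 < |t| := by linarith
        field_simp
  · have hGc : Continuous fun t : ℝ => H (σ + t * I) *
        smoothKernel δ (σ + t * I) * exp ((σ + t * I) * u) :=
      (hHc.mul hKc).mul (by fun_prop)
    refine (norm_integral_dyadic_le hGc T₁ M).trans ?_
    have h1 : ‖∫ t in (-T₁)..T₁, H (σ + t * I) * smoothKernel δ (σ + t * I) *
        exp ((σ + t * I) * u)‖ ≤
        2 * T₁ * ((C₀ + R) * (256 * 3)) * u ^ 17 * Real.exp (u / 16) := by
      have := intervalIntegral.norm_integral_le_of_norm_le_const (a := -T₁) (b := T₁)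
        (f := fun t : ℝ => H (σ + t * I) * smoothKernel δ (σ + t * I) *
        exp ((σ + t * I) * u))
        (C := (C₀ + R) * u * 256 * (3 * Real.exp (u / 16))) (fun t ht => by
          rw [uIoc_of_le (by linarith)] at ht
          have ht1 : |t| ≤ T₁ := abs_le.2 ⟨ht.1.le, ht.2⟩
          rw [norm_mul, norm_mul, hexp]
          have h2 : ‖H (σ + t * I)‖ ≤ (C₀ + R) * u := by
            have h3 := hrem σ t hσ (Or.inl hσ1)
            have h4 := hsmall σ t hσ hσ1 ht1
            rw [show C₀ / (σ - 1 / 16) = C₀ * u by rw [hσdef]; bound] at h4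
            linarith [le_mul_of_one_le_right hR (by linarith : 1 ≤ u)]
          have h5 : ‖smoothKernel δ (σ + t * I)‖ ≤ 256 := by
            refine (norm_smoothKernel_le hδ0 hδ1 (by grind) (by grind)).1.trans ?_
            have := (norm_add_mul_I_sub_ge σ t 0).1
            rw [ofReal_zero, sub_zero, sub_zero, abs_of_pos (by linarith)] at this
            rw [div_le_iff₀ (by linarith)]
            linarith
          gcongr)
      refine this.trans ?_
      rw [sub_neg_eq_add, abs_of_pos (by linarith)]
      have hu17 : u ≤ u ^ 17 := le_self_pow₀ (by linarith) (by norm_num)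
      calc _ = 2 * T₁ * ((C₀ + R) * (256 * 3)) * u * Real.exp (u / 16) := by ring
        _ ≤ _ := by gcongr
    have h2 : ∀ m ∈ Finset.range M, |∫ t in 2 ^ m * T₁..2 * (2 ^ m * T₁),
        (‖(fun t : ℝ => H (σ + t * I) *
        smoothKernel δ (σ + t * I) * exp ((σ + t * I) * u)) t‖ +
        ‖(fun t : ℝ => H (σ + t * I) *
        smoothKernel δ (σ + t * I) * exp ((σ + t * I) * u)) (-t)‖)| ≤
        C * u * Real.exp (u / 16) * log T₁ ^ 15 *
          (((m : ℝ) + 1) ^ 15 * min 1 (4 * Real.exp u ^ 2 / 4 ^ m)) := by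
      intro m _
      have h2m : (1 : ℝ) ≤ 2 ^ m := one_le_pow₀ (by norm_num)
      rw [abs_of_nonneg (intervalIntegral.integral_nonneg (by nlinarith) fun t _ => by bound)]
      refine (hdy' m).trans ?_
      have h3 : log (2 ^ m * T₁) ≤ (m + 1) * log T₁ := by
        rw [log_mul (by positivity) (by linarith), log_pow]
        have : log 2 ≤ log T₁ := log_le_log (by norm_num) (by linarith)
        linarith [mul_le_mul_of_nonneg_left this (cast_nonneg (α := ℝ) m)]
      have h3' : 0 ≤ log (2 ^ m * T₁) :=
        log_nonneg (one_le_mul_of_one_le_of_one_le h2m (by linarith))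
      have h4 : (4 : ℝ) ^ m ≤ (2 ^ m * T₁) ^ 2 := by
        rw [show (4 : ℝ) ^ m = (2 ^ m) ^ 2 by rw [← pow_mul, mul_comm m 2, pow_mul]; norm_num]
        gcongr
        exact le_mul_of_one_le_right (by bound) (by linarith)
      calc _ ≤ C * u * Real.exp (u / 16) *
            (min 1 (4 * Real.exp u ^ 2 / 4 ^ m) * ((m + 1) * log T₁) ^ 15) := by
            gcongr
        _ = _ := by grind
    refine (add_le_add h1 (Finset.sum_le_sum h2)).trans ?_
    rw [← Finset.mul_sum]
    calc _ ≤ 2 * T₁ * ((C₀ + R) * (256 * 3)) * u ^ 17 * Real.exp (u / 16) +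
          C * u * Real.exp (u / 16) * log T₁ ^ 15 * (C₂ * u ^ 16) := by
          gcongr
          grind
      _ = _ := by ring

end PerronBound

section PerronAsymptotic

open MeasureTheory Set Filter Topology

variable {J : ℕ} {f : ℕ → ℝ} {pole : Fin J → ℝ} {F Q : ℂ → ℂ}

lemma PerronSeries.exists_smoothedSum_le (h : PerronSeries f pole F Q) :
    ∃ (c : Fin J → ℝ) (C : ℝ), 0 ≤ C ∧ ∀ u δ : ℝ, 667 ≤ u → Real.exp (-u) / 2 ≤ δ →
      δ ≤ Real.exp (-u) → (Summable fun n : ℕ => f n * secondDiff δ rampSq (u - log n)) ∧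
      |∑' n : ℕ, f n * secondDiff δ rampSq (u - log n) - ∑ j, c j * Real.exp (pole j * u)| ≤
        C * u ^ 17 * Real.exp (u / 16) := by
  obtain ⟨r, H, hH, hF⟩ := h.exists_eq_sum_add
  obtain ⟨C, hC, hint⟩ := h.exists_integral_le hH hF
  refine ⟨fun j => (r j).re / pole j, C + ∑ j, |(r j).re| * 20, by positivity,
    fun u δ hu hδ hδ1 => ?_⟩
  have hδ0 : 0 < δ := lt_of_lt_of_le (by bound) hδ
  have hδ2 : δ ≤ 1 := hδ1.trans (Real.exp_le_one_iff.2 (by linarith))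
  have hI := hint u δ hu hδ hδ2
  have hs := (h.integral_smoothKernel hH hF hδ0 u).2
  set A := ∫ t : ℝ, H ((13 / 100 : ℝ) + t * I) * smoothKernel δ ((13 / 100 : ℝ) + t * I) *
        exp (((13 / 100 : ℝ) + t * I) * u)
  have hpi : 0 < 2 * π := by bound
  have hs2 : HasSum (fun n : ℕ => f n * secondDiff δ rampSq (u - log n))
      (A.re / (2 * π) + ∑ j, (r j).re * secondDiff δ (expTail (pole j)) u) := by
    have h1 := (Complex.hasSum_re hs).mul_left (2 * π)⁻¹
    convert h1 using 1
    · rfl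
    · funext n
      rw [← Complex.ofReal_ofNat, ← ofReal_mul, ← ofReal_mul, ofReal_re]
      field_simp
    · rw [add_re, Complex.re_sum, mul_add, Finset.mul_sum, div_eq_inv_mul]
      congr 1
      refine Finset.sum_congr rfl fun j _ => ?_
      rw [← Complex.ofReal_ofNat, ← ofReal_mul, ← ofReal_mul, Complex.re_mul_ofReal]
      field_simp
  refine ⟨hs2.summable, ?_⟩
  rw [hs2.tsum_eq, add_sub_assoc, ← sum_sub_distrib]
  refine (abs_add_le _ _).trans ?_
  have h1 : |A.re / (2 * π)| ≤ C * u ^ 17 * Real.exp (u / 16) := by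
    rw [abs_div, abs_of_pos hpi]
    refine (div_le_self (abs_nonneg _) (by linarith [pi_gt_three])).trans ?_
    exact (abs_re_le_norm A).trans hI
  have h2 : |∑ j, ((r j).re * secondDiff δ (expTail (pole j)) u -
      (r j).re / pole j * Real.exp (pole j * u))| ≤ ∑ j, |(r j).re| * 20 := by
    refine (Finset.abs_sum_le_sum_abs _ _).trans (Finset.sum_le_sum fun j _ => ?_)
    have h3 := h.pole_mem j
    rw [show (r j).re * secondDiff δ (expTail (pole j)) u -
      (r j).re / pole j * Real.exp (pole j * u) = (r j).re *
        (secondDiff δ (expTail (pole j)) u - Real.exp (pole j * u) / pole j) by ring, abs_mul]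
    gcongr
    exact abs_secondDiff_expTail_sub_le h3.1 (by linarith) hδ0 hδ1 (by linarith)
  have h3 : 1 ≤ u ^ 17 * Real.exp (u / 16) :=
    one_le_mul_of_one_le_of_one_le (one_le_pow₀ (by linarith)) (Real.one_le_exp (by linarith))
  have h4 : ∑ j, |(r j).re| * 20 ≤ (∑ j, |(r j).re| * 20) * (u ^ 17 * Real.exp (u / 16)) :=
    le_mul_of_one_le_right (by positivity) h3
  linarith

lemma abs_exp_sub_le_one {a u δ : ℝ} (ha0 : 0 ≤ a) (ha : a ≤ 1 / 8) (hu : 0 ≤ u) (hδ0 : 0 ≤ δ)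
    (hδ : δ ≤ Real.exp (-u)) : |Real.exp (a * (u - 2 * δ)) - Real.exp (a * u)| ≤ 1 := by
  have h1 : Real.exp (a * (u - 2 * δ)) ≤ Real.exp (a * u) := exp_le_exp.2 (by nlinarith)
  rw [abs_sub_comm, abs_of_nonneg (by linarith),
    show a * (u - 2 * δ) = a * u + -(2 * (a * δ)) by ring, Real.exp_add]
  have h2 := Real.add_one_le_exp (-(2 * (a * δ)))
  have h3 : Real.exp (a * u) * δ ≤ 1 := by
    calc Real.exp (a * u) * δ ≤ Real.exp (a * u) * Real.exp (-u) := by gcongr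
      _ = Real.exp (a * u - u) := by rw [← Real.exp_add]; congr 1
      _ ≤ 1 := Real.exp_le_one_iff.2 (by nlinarith)
  have h4 := exp_pos (a * u)
  have h5 : Real.exp (a * u) * (1 - Real.exp (-(2 * (a * δ)))) ≤ Real.exp (a * u) * (2 * (a * δ)) :=
    mul_le_mul_of_nonneg_left (by linarith) h4.le
  have h6 : 2 * a * (Real.exp (a * u) * δ) ≤ 2 * a * 1 := mul_le_mul_of_nonneg_left h3 (by linarith)
  linarith

lemma PerronSeries.exists_isBigO (h : PerronSeries f pole F Q) : ∃ c : Fin J → ℝ,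
    (fun X : ℝ => ∑ n ∈ Finset.Icc 1 ⌊X⌋₊, f n - ∑ j, c j * X ^ pole j) =O[atTop]
      fun X : ℝ => X ^ ((1 : ℝ) / 16) * log X ^ 17 := by
  obtain ⟨c, C, hC, hsm⟩ := h.exists_smoothedSum_le
  refine ⟨c, Asymptotics.IsBigO.of_bound (C + ∑ j, |c j|) ?_⟩
  filter_upwards [eventually_ge_atTop (Real.exp 668)] with X hX
  have hX0 : 0 < X := (exp_pos _).trans_le hX
  obtain ⟨u, rfl⟩ : ∃ u, X = Real.exp u := ⟨log X, (Real.exp_log hX0).symm⟩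
  have hu : 668 ≤ u := exp_le_exp.1 hX
  have hrpow : ∀ a : ℝ, Real.exp u ^ a = Real.exp (a * u) := fun a => by
    rw [← Real.exp_mul, mul_comm]
  simp only [hrpow, Real.log_exp]
  rw [show 1 / 16 * u = u / 16 by ring, norm_eq_abs, norm_of_nonneg (by bound)]
  set δ := Real.exp (-u) with hδ
  have hδ0 : 0 < δ := exp_pos _
  have hδ1 : δ ≤ 1 / 10 := by
    rw [hδ, Real.exp_neg, inv_le_comm₀ (exp_pos _) (by norm_num)]
    linarith [Real.add_one_le_exp u]
  obtain ⟨s1, b1⟩ := hsm u δ (by linarith) (by linarith) le_rfl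
  have hexp2 : Real.exp (2 * δ) ≤ 2 := by
    calc Real.exp (2 * δ) ≤ Real.exp (1 / 5) := exp_le_exp.2 (by linarith)
      _ ≤ 2 := by
        have := Real.abs_exp_sub_one_sub_id_le (x := 1 / 5) (by grind)
        grind
  have e1 : Real.exp (-(u - 2 * δ)) = δ * Real.exp (2 * δ) := by
    rw [hδ, ← Real.exp_add]
    grind
  obtain ⟨s2, b2⟩ := hsm (u - 2 * δ) δ (by linarith) (by rw [e1]; nlinarith)
    (by rw [e1]; exact le_mul_of_one_le_right hδ0.le (Real.one_le_exp (by linarith)))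
  have hup : ∑ n ∈ Finset.Icc 1 ⌊Real.exp u⌋₊, f n ≤
      ∑' n : ℕ, f n * secondDiff δ rampSq (u - log n) := by
    refine le_trans (Finset.sum_le_sum fun n hn => ?_) (s1.sum_le_tsum (Finset.Icc 1 ⌊Real.exp u⌋₊)
      fun n _ => mul_nonneg (h.nonneg n) (secondDiff_rampSq_mem hδ0 _).1)
    rw [Finset.mem_Icc, Nat.le_floor_iff (exp_pos _).le] at hn
    have hn0 : (0 : ℝ) < n := by bound
    rw [secondDiff_rampSq_of_nonneg hδ0
      (sub_nonneg.2 ((Real.log_le_iff_le_exp hn0).2 hn.2)), mul_one]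
  have hlow : ∑' n : ℕ, f n * secondDiff δ rampSq (u - 2 * δ - log n) ≤
      ∑ n ∈ Finset.Icc 1 ⌊Real.exp u⌋₊, f n := by
    rw [tsum_eq_sum (s := Finset.Icc 1 ⌊Real.exp u⌋₊) fun n hn => ?_]
    · exact Finset.sum_le_sum fun n _ =>
        mul_le_of_le_one_right (h.nonneg n) (secondDiff_rampSq_mem hδ0 _).2
    · rcases Nat.eq_zero_or_pos n with rfl | hn0
      · rw [h.zero, zero_mul]
      rw [Finset.mem_Icc, not_and, Nat.le_floor_iff (exp_pos _).le, not_le] at hn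
      have h1 := (Real.lt_log_iff_exp_lt (by grind : (0 : ℝ) < n)).2 (hn hn0)
      rw [secondDiff_rampSq_of_le hδ0 (by linarith), mul_zero]
  have hmono : C * (u - 2 * δ) ^ 17 * Real.exp ((u - 2 * δ) / 16) ≤
      C * u ^ 17 * Real.exp (u / 16) := by
    have : 0 ≤ u - 2 * δ := by linarith
    gcongr <;> linarith
  have hmain : |∑ j, c j * Real.exp (pole j * (u - 2 * δ)) - ∑ j, c j * Real.exp (pole j * u)| ≤
      ∑ j, |c j| := by
    rw [← sum_sub_distrib]
    refine (Finset.abs_sum_le_sum_abs _ _).trans (Finset.sum_le_sum fun j _ => ?_)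
    rw [← mul_sub, abs_mul]
    have h3 := h.pole_mem j
    exact mul_le_of_le_one_right (abs_nonneg _)
      (abs_exp_sub_le_one (by linarith) h3.2 (by linarith) hδ0.le le_rfl)
  have h3 : 1 ≤ u ^ 17 * Real.exp (u / 16) :=
    one_le_mul_of_one_le_of_one_le (one_le_pow₀ (by linarith)) (Real.one_le_exp (by linarith))
  have h4 : ∑ j, |c j| ≤ (∑ j, |c j|) * (u ^ 17 * Real.exp (u / 16)) :=
    le_mul_of_one_le_right (Finset.sum_nonneg fun _ _ => abs_nonneg _) h3
  have h5 : 0 ≤ ∑ j, |c j| := Finset.sum_nonneg fun _ _ => abs_nonneg _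
  rw [abs_le] at b1 b2 hmain ⊢
  grind

end PerronAsymptotic

section FieldCountAsymptotic

open Filter Asymptotics Topology Finset

/-- The summatory function of `fieldCount J`. -/
def fieldCountSum (J : ℕ) (X : ℝ) : ℝ := ∑ n ∈ Icc 1 ⌊X⌋₊, (fieldCount J n : ℝ)

lemma exists_fieldCountSum_isBigO {J : ℕ} (hJ0 : 0 < J) (hJ : J ≤ 4) :
    ∃ c : Fin J → ℝ, (fun X : ℝ => fieldCountSum J X -
      ∑ j : Fin J, c j * X ^ (1 / (discExp j : ℝ))) =O[atTop]
        fun X : ℝ => X ^ ((1 : ℝ) / 16) * log X ^ 17 :=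
  (perronSeries_fieldCount hJ0 hJ).exists_isBigO

lemma isBigO_errorTerm_comp_div {D : ℝ} (hD : 1 ≤ D) :
    (fun X : ℝ => (X / D) ^ ((1 : ℝ) / 16) * log (X / D) ^ 17) =O[atTop]
      fun X : ℝ => X ^ ((1 : ℝ) / 16) * log X ^ 17 := by
  refine IsBigO.of_bound 1 ?_
  filter_upwards [eventually_ge_atTop D] with X hX
  have hX0 : 0 < X := by linarith
  have h1 : 1 ≤ X / D := (one_le_div (by linarith)).2 hX
  have h2 : X / D ≤ X := div_le_self hX0.le hD
  have h3 : 0 ≤ log (X / D) := log_nonneg h1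
  rw [one_mul, norm_of_nonneg (by positivity)]
  refine le_trans ?_ (le_abs_self _)
  have h4 : log (X / D) ≤ log X := log_le_log (by bound) h2
  gcongr

lemma exists_sum_fieldCountSum_isBigO {J : ℕ} (hJ0 : 0 < J) (hJ : J ≤ 4) {α : Type*}
    (A : Finset α) (D : α → ℕ) (hD : ∀ a ∈ A, 1 ≤ D a) :
    ∃ c : Fin J → ℝ, (fun X : ℝ => ∑ a ∈ A, fieldCountSum J (X / D a) -
      ∑ j : Fin J, c j * X ^ (1 / (discExp j : ℝ))) =O[atTop]
        fun X : ℝ => X ^ ((1 : ℝ) / 16) * log X ^ 17 := by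
  obtain ⟨c, hc⟩ := exists_fieldCountSum_isBigO hJ0 hJ
  refine ⟨fun j => ∑ a ∈ A, c j / (D a : ℝ) ^ (1 / (discExp j : ℝ)), ?_⟩
  have h1 : (fun X : ℝ => ∑ a ∈ A, (fieldCountSum J (X / D a) -
      ∑ j : Fin J, c j * (X / D a) ^ (1 / (discExp j : ℝ)))) =O[atTop]
        fun X : ℝ => X ^ ((1 : ℝ) / 16) * log X ^ 17 := by
    refine IsBigO.fun_sum (fun a ha => ?_ : ∀ a ∈ A, (fun X : ℝ => fieldCountSum J (X / D a) -
      ∑ j : Fin J, c j * (X / D a) ^ (1 / (discExp j : ℝ))) =O[atTop] _)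
    have hDa : (1 : ℝ) ≤ D a := by bound
    have ht : Tendsto (fun X : ℝ => X / D a) atTop atTop := tendsto_id.atTop_div_const (by linarith)
    exact (hc.comp_tendsto ht).trans (isBigO_errorTerm_comp_div hDa)
  refine h1.congr' ?_ EventuallyEq.rfl
  filter_upwards [eventually_ge_atTop 0] with X hX
  rw [sum_sub_distrib, Finset.sum_comm]
  congr 1
  refine Finset.sum_congr rfl fun j _ => ?_
  rw [Finset.sum_mul]
  refine Finset.sum_congr rfl fun a _ => ?_
  rw [Real.div_rpow hX (by bound)]
  ring

lemma localCount_mono {J J' : ℕ} (h : J ≤ J') (p k : ℕ) : localCount J p k ≤ localCount J' p k := by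
  rw [localCount, localCount]
  split_ifs
  · rfl
  · exact Finset.sum_le_sum_of_subset (Finset.range_mono h)

lemma fieldCount_mono {J J' : ℕ} (h : J ≤ J') (n : ℕ) : fieldCount J n ≤ fieldCount J' n := by
  rw [fieldCount, fieldCount]
  split_ifs
  · rfl
  · exact Finset.prod_le_prod' fun p _ => localCount_mono h p _

lemma factorization_seventeen_mul_prime {q : ℕ} (hq : q.Prime) :
    (17 ^ 15 * q ^ 8).factorization = Finsupp.single 17 15 + Finsupp.single q 8 := by
  rw [Nat.factorization_mul (by bound) (pow_ne_zero _ hq.ne_zero),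
    Nat.Prime.factorization_pow (by norm_num), hq.factorization_pow]

lemma fieldCount_seventeen_mul_prime {q : ℕ} (hq : q.Prime) (hq17 : q ≠ 17) (J : ℕ) :
    fieldCount J (17 ^ 15 * q ^ 8) = localCount J 17 15 * localCount J q 8 := by
  rw [fieldCount, if_neg (by have := hq.ne_zero; positivity), factorization_seventeen_mul_prime hq,
    Finsupp.prod_add_index_of_disjoint, Finsupp.prod_single_index, Finsupp.prod_single_index]
  · bound
  · bound
  · rw [Finsupp.support_single _ (by norm_num), Finsupp.support_single _ (by norm_num)]
    simpa using hq17.symm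

lemma fieldCount_three_lt_four {q : ℕ} (hq : q.Prime) (hq17 : q ≠ 17) (hq2 : q ≠ 2) :
    fieldCount 3 (17 ^ 15 * q ^ 8) < fieldCount 4 (17 ^ 15 * q ^ 8) := by
  rw [fieldCount_seventeen_mul_prime hq hq17, fieldCount_seventeen_mul_prime hq hq17]
  have h2 : q % 2 = 1 := hq.eq_two_or_odd.resolve_left hq2
  simp [localCount, Finset.sum_range_succ, discExp, h2]

lemma fieldCountSum_mono {J J' : ℕ} (h : J ≤ J') (X : ℝ) : fieldCountSum J X ≤ fieldCountSum J' X :=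
  Finset.sum_le_sum fun n _ => by exact_mod_cast fieldCount_mono h n

lemma primeCounting_le_fieldCountSum_sub {Y : ℝ} (hY : 0 ≤ Y) : (primeCounting ⌊Y⌋₊ : ℝ) - 2 ≤
      fieldCountSum 4 (17 ^ 15 * Y ^ 8) - fieldCountSum 3 (17 ^ 15 * Y ^ 8) := by
  set P := ((Finset.range (⌊Y⌋₊ + 1)).filter Nat.Prime) \ {2, 17}
  have hP : (primeCounting ⌊Y⌋₊ : ℝ) - 2 ≤ (P.card : ℝ) := by
    have h1 : ((Finset.range (⌊Y⌋₊ + 1)).filter Nat.Prime).card - ({2, 17} : Finset ℕ).card ≤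
      P.card := Finset.le_card_sdiff _ _
    have h2 : primeCounting ⌊Y⌋₊ = ((Finset.range (⌊Y⌋₊ + 1)).filter Nat.Prime).card := by
      rw [primeCounting, Nat.primeCounting', Nat.count_eq_card_filter_range]
    rw [← h2] at h1
    have h3 : ({2, 17} : Finset ℕ).card = 2 := rfl
    have h4 : primeCounting ⌊Y⌋₊ ≤ P.card + 2 := by grind
    have h5 : (primeCounting ⌊Y⌋₊ : ℝ) ≤ P.card + 2 := by exact_mod_cast h4
    linarith
  refine hP.trans ?_
  rw [fieldCountSum, fieldCountSum, ← sum_sub_distrib]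
  have hmem : ∀ q ∈ P, q.Prime ∧ q ≠ 2 ∧ q ≠ 17 ∧ q ≤ ⌊Y⌋₊ := by grind
  have hinj : Set.InjOn (fun q : ℕ => 17 ^ 15 * q ^ 8) P := by bound
  have hsub : P.image (fun q : ℕ => 17 ^ 15 * q ^ 8) ⊆ Icc 1 ⌊17 ^ 15 * Y ^ 8⌋₊ := by
    intro n hn
    obtain ⟨q, hq, rfl⟩ := Finset.mem_image.1 hn
    obtain ⟨hq, -, -, hqY⟩ := hmem q hq
    rw [Finset.mem_Icc]
    refine ⟨Nat.one_le_iff_ne_zero.2 (by have := hq.ne_zero; positivity), Nat.le_floor ?_⟩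
    have h1 : (q : ℝ) ≤ Y := (Nat.cast_le.2 hqY).trans (Nat.floor_le hY)
    rw [Nat.cast_mul, Nat.cast_pow, Nat.cast_pow, Nat.cast_ofNat]
    gcongr
  have h0 : ∀ n, (0 : ℝ) ≤ (fieldCount 4 n : ℝ) - fieldCount 3 n := fun n => by
    rw [sub_nonneg]; exact_mod_cast fieldCount_mono (by norm_num) n
  refine le_trans ?_ (Finset.sum_le_sum_of_subset_of_nonneg hsub fun n _ _ => h0 n)
  rw [Finset.sum_image hinj, Finset.card_eq_sum_ones, Nat.cast_sum]
  refine Finset.sum_le_sum fun q hq => ?_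
  obtain ⟨hq, hq2, hq17, -⟩ := hmem q hq
  have h1 := fieldCount_three_lt_four hq hq17 hq2
  have h2 : (fieldCount 3 (17 ^ 15 * q ^ 8) : ℝ) + 1 ≤ fieldCount 4 (17 ^ 15 * q ^ 8) := by
    exact_mod_cast h1
  grind

lemma not_primeCounting_isBigO_rpow :
    ¬ (fun Y : ℝ => (primeCounting ⌊Y⌋₊ : ℝ)) =O[atTop] fun Y : ℝ => Y ^ ((2 : ℝ) / 3) := by
  intro h
  have h1 : (fun Y : ℝ => Y) =O[atTop] fun Y : ℝ => Y ^ ((2 : ℝ) / 3) * log Y := by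
    refine IsBigO.trans ?_ (h.mul (isBigO_refl log atTop))
    refine IsBigO.of_bound 4 ?_
    filter_upwards [eventually_ge_atTop 4, Real.isLittleO_log_id_atTop.bound
      (show (0 : ℝ) < 1 / 16 by norm_num)] with Y hY hl
    rw [id, norm_of_nonneg (log_nonneg (by linarith)), norm_of_nonneg (by linarith)] at hl
    have h2 := Chebyshev.psi_le_primeCounting_mul_log' Y
    have h3 := Chebyshev.psi_ge' (show 0 ≤ Y by linarith)
    have h4 : log (Y + 2) ≤ log 2 + log Y := by
      rw [← log_mul (by norm_num) (by linarith)]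
      exact log_le_log (by linarith) (by linarith)
    rw [norm_of_nonneg (by linarith)]
    have h5 := le_abs_self ((primeCounting ⌊Y⌋₊ : ℝ) * log Y)
    rw [norm_eq_abs]
    have h6 := Real.log_two_gt_d9
    have h7 := Real.log_two_lt_d9
    have h8 : (Y - 1) * 0.69 ≤ (Y - 1) * log 2 := by gcongr <;> linarith
    linarith
  have h2 : (fun Y : ℝ => Y ^ ((2 : ℝ) / 3) * log Y) =o[atTop] fun Y : ℝ => Y := by
    have h3 := (isBigO_refl (fun Y : ℝ => Y ^ ((2 : ℝ) / 3)) atTop).mul_isLittleO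
      (isLittleO_log_rpow_atTop (show (0 : ℝ) < 1 / 3 by norm_num))
    refine h3.congr' EventuallyEq.rfl ?_
    filter_upwards [eventually_gt_atTop 0] with Y hY
    rw [← rpow_add hY]
    norm_num
  have h4 := h1.trans_isLittleO h2
  obtain ⟨Y, hY, hY1⟩ := ((h4.bound (show (0 : ℝ) < 1 / 2 by norm_num)).and
    (eventually_ge_atTop 1)).exists
  rw [norm_of_nonneg (by linarith)] at hY
  linarith

/-- The asymptotic expansion of a difference of sums of `fieldCountSum`, with positive leading
coefficient. -/
lemma exists_asymptotic_of_eq_fieldCountSum {α : Type*} {A A' : Finset α} (hA : A' ⊆ A)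
    (hne : A'.Nonempty) (D : α → ℕ) (hD : ∀ a ∈ A, 1 ≤ D a) {N : ℝ → ℝ}
    (hN : ∀ X : ℝ, 1 ≤ X → 8 * N X = ∑ a ∈ A, fieldCountSum 4 (X / D a) -
      ∑ a ∈ A', fieldCountSum 3 (X / D a)) :
    ∃ c₈ c₁₂ c₁₄ c₁₅ : ℝ, 0 < c₈ ∧
      (fun X : ℝ => N X - c₈ * X ^ ((1:ℝ)/8) - c₁₂ * X ^ ((1:ℝ)/12) - c₁₄ * X ^ ((1:ℝ)/14)
          - c₁₅ * X ^ ((1:ℝ)/15))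
        =O[Filter.atTop] fun X : ℝ => X ^ ((1:ℝ)/16) * log X ^ 17 := by
  obtain ⟨c, hc⟩ := exists_sum_fieldCountSum_isBigO (J := 4) (by norm_num) le_rfl A D hD
  obtain ⟨d, hd⟩ := exists_sum_fieldCountSum_isBigO (J := 3) (by norm_num) (by norm_num) A' D
    fun a ha => hD a (hA ha)
  have key : (fun X : ℝ => N X - (c 0 - d 0) / 8 * X ^ ((1:ℝ)/8) -
      (c 1 - d 1) / 8 * X ^ ((1:ℝ)/12) - (c 2 - d 2) / 8 * X ^ ((1:ℝ)/14)
          - c 3 / 8 * X ^ ((1:ℝ)/15))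
        =O[Filter.atTop] fun X : ℝ => X ^ ((1:ℝ)/16) * log X ^ 17 := by
    refine ((hc.sub hd).const_mul_left (1 / 8)).congr' ?_ EventuallyEq.rfl
    filter_upwards [eventually_ge_atTop 1] with X hX
    have h := hN X hX
    simp only [Fin.sum_univ_four, Fin.sum_univ_three, discExp]
    norm_num
    linarith
  refine ⟨_, _, _, _, ?_, key⟩
  by_contra hneg
  push Not at hneg
  have hpow : ∀ b : ℝ, b ≤ 1 / 12 → (fun X : ℝ => X ^ b) =O[atTop]
      fun X : ℝ => X ^ ((1 : ℝ) / 12) := fun b hb => by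
    refine IsBigO.of_bound 1 ?_
    filter_upwards [eventually_ge_atTop 1] with X hX
    have hX0 : 0 ≤ X := by linarith
    rw [one_mul, norm_of_nonneg (by bound), norm_of_nonneg (by bound)]
    exact rpow_le_rpow_of_exponent_le hX hb
  have herr : (fun X : ℝ => X ^ ((1:ℝ)/16) * log X ^ 17) =O[atTop]
      fun X : ℝ => X ^ ((1 : ℝ) / 12) := by
    have h1 : (fun X : ℝ => log X ^ 17) =O[atTop] fun X : ℝ => X ^ ((1 : ℝ) / 48) := by
      have h2 := (isLittleO_log_rpow_rpow_atTop (17 : ℝ) (show (0 : ℝ) < 1 / 48 by norm_num)).isBigO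
      refine h2.congr' ?_ EventuallyEq.rfl
      bound
    refine ((isBigO_refl (fun X : ℝ => X ^ ((1:ℝ)/16)) atTop).mul h1).congr' EventuallyEq.rfl ?_
    filter_upwards [eventually_gt_atTop 0] with X hX
    rw [← rpow_add hX]
    norm_num
  have hN' : (fun X : ℝ => N X - (c 0 - d 0) / 8 * X ^ ((1:ℝ)/8)) =O[atTop]
      fun X : ℝ => X ^ ((1 : ℝ) / 12) := by
    have h1 := ((key.trans herr).add ((hpow (1 / 12) le_rfl).const_mul_left ((c 1 - d 1) / 8))).add
      (((hpow (1 / 14) (by norm_num)).const_mul_left ((c 2 - d 2) / 8)).add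
      ((hpow (1 / 15) (by norm_num)).const_mul_left (c 3 / 8)))
    refine h1.congr_left fun X => ?_
    ring
  obtain ⟨C, hC⟩ := hN'.bound
  obtain ⟨a, ha⟩ := hne
  have hDa : (1 : ℝ) ≤ D a := by exact_mod_cast hD a (hA ha)
  refine not_primeCounting_isBigO_rpow (IsBigO.of_bound
    (8 * (|C| * (17 ^ 15 * D a : ℝ) ^ ((1 : ℝ) / 12)) + 2) ?_)
  have ht : Tendsto (fun Y : ℝ => 17 ^ 15 * (D a : ℝ) * Y ^ 8) atTop atTop :=
    (tendsto_pow_atTop (by norm_num)).const_mul_atTop (by positivity)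
  filter_upwards [ht.eventually hC, ht.eventually_ge_atTop 1, eventually_ge_atTop 1] with Y h1 h2 hY
  have hY0 : 0 ≤ Y := by linarith
  have h3 := primeCounting_le_fieldCountSum_sub hY0
  have h4 := hN _ h2
  have h5 : ∑ b ∈ A', (fieldCountSum 4 (17 ^ 15 * (D a : ℝ) * Y ^ 8 / D b) -
      fieldCountSum 3 (17 ^ 15 * (D a : ℝ) * Y ^ 8 / D b)) ≤
        8 * N (17 ^ 15 * (D a : ℝ) * Y ^ 8) := by
    rw [h4, sum_sub_distrib]
    refine sub_le_sub_right (Finset.sum_le_sum_of_subset_of_nonneg hA fun b _ _ => ?_) _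
    exact Finset.sum_nonneg fun _ _ => cast_nonneg _
  have h6 := Finset.single_le_sum (f := fun b => fieldCountSum 4 (17 ^ 15 * (D a : ℝ) * Y ^ 8 / D b) -
      fieldCountSum 3 (17 ^ 15 * (D a : ℝ) * Y ^ 8 / D b))
      (fun b _ => sub_nonneg.2 (fieldCountSum_mono (by norm_num) _)) ha
  have h7 : 17 ^ 15 * (D a : ℝ) * Y ^ 8 / D a = 17 ^ 15 * Y ^ 8 := by field_simp
  simp only [h7] at h6
  set X := 17 ^ 15 * (D a : ℝ) * Y ^ 8 with hX
  have h8 : N X ≤ |C| * X ^ ((1 : ℝ) / 12) := by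
    have h9 : (c 0 - d 0) / 8 * X ^ ((1:ℝ)/8) ≤ 0 :=
      mul_nonpos_of_nonpos_of_nonneg hneg (by positivity)
    have h10 := (le_abs_self _).trans h1
    rw [norm_of_nonneg (by positivity : 0 ≤ X ^ ((1 : ℝ) / 12))] at h10
    have h11 : C * X ^ ((1 : ℝ) / 12) ≤ |C| * X ^ ((1 : ℝ) / 12) := by
      gcongr
      bound
    linarith
  have h9 : X ^ ((1 : ℝ) / 12) = (17 ^ 15 * D a : ℝ) ^ ((1 : ℝ) / 12) * Y ^ ((2 : ℝ) / 3) := by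
    rw [hX, mul_rpow (by bound) (by bound), ← rpow_natCast Y 8, ← rpow_mul hY0]
    norm_num
  have h10 : 1 ≤ Y ^ ((2 : ℝ) / 3) := one_le_rpow hY (by norm_num)
  rw [norm_of_nonneg (by bound), norm_of_nonneg (by bound)]
  rw [h9] at h8
  have h11 := h3.trans (h6.trans (h5.trans (mul_le_mul_of_nonneg_left h8 (by norm_num))))
  linarith

end FieldCountAsymptotic

section InertiaBound

variable {R G : Type*} [CommRing R] [Group G] [MulSemiringAction G R] {P : Ideal R}

lemma smul_mem_pow_of_forall_smul_mem {σ : G} (h : ∀ x ∈ P, σ • x ∈ P) (k : ℕ) {x : R}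
    (hx : x ∈ P ^ k) : σ • x ∈ P ^ k := by
  have h1 : (P ^ k).map (MulSemiringAction.toRingHom G R σ) ≤ P ^ k := by
    rw [Ideal.map_pow]
    exact Ideal.pow_right_mono (Ideal.map_le_iff_le_comap.2 fun y hy =>
      Ideal.mem_comap.2 (h y hy)) k
  exact h1 (Ideal.mem_map_of_mem _ hx)

lemma smul_mem_of_mem_inertia {σ : G} (hσ : σ ∈ P.inertia G) (x : R) (hx : x ∈ P) : σ • x ∈ P := by
  have h := P.add_mem (hσ x) hx
  simp_all

lemma smul_sub_mem_pow_succ {σ : G} (hσ : σ ∈ P.inertia G) (h1 : ∀ x ∈ P, σ • x - x ∈ P ^ 2)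
    (k : ℕ) : ∀ x ∈ P ^ k, σ • x - x ∈ P ^ (k + 1) := by
  induction k with
  | zero => simp_all
  | succ k ih =>
    intro x hx
    rw [pow_succ'] at hx
    refine Submodule.mul_induction_on hx (fun m hm n hn => ?_) fun x y hx hy => ?_
    · have e : σ • (m * n) - m * n = (σ • m - m) * (σ • n) + m * (σ • n - n) := by
        rw [smul_mul']; ring
      rw [e]
      refine add_mem _ ?_ ?_
      · have := Ideal.mul_mem_mul (h1 m hm)
          (smul_mem_pow_of_forall_smul_mem (smul_mem_of_mem_inertia hσ) k hn)
        rwa [← pow_add, show 2 + k = k + 1 + 1 by ring] at this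
      · have := Ideal.mul_mem_mul hm (ih n hn)
        rwa [← pow_succ'] at this
    · rw [smul_add, add_sub_add_comm]
      exact add_mem _ hx hy

variable [IsDedekindDomain R]

lemma smul_sub_mul_mem_sq [P.IsPrime] (hP : P ≠ ⊥) {σ : G} (hσ : σ ∈ P.inertia G) {ϖ a : R}
    (hϖ : ϖ ∈ P) (hϖ2 : ϖ ∉ P ^ 2) (ha : σ • ϖ - a * ϖ ∈ P ^ 2) {c : R} (hc : c ∈ P) :
    σ • c - a * c ∈ P ^ 2 := by
  obtain ⟨d, e, he, rfl⟩ := Ideal.exists_mul_add_mem_pow_succ (i := 1) hP ϖ c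
    (by grind) (by grind) (by grind)
  have e1 : σ • (ϖ * d + e) - a * (ϖ * d + e) =
      (σ • ϖ) * (σ • d - d) + d * (σ • ϖ - a * ϖ) + (σ • e - a * e) := by
    rw [smul_add, smul_mul']; ring
  rw [e1]
  refine add_mem _ (add_mem _ ?_ ((P ^ 2).mul_mem_left _ ha)) (Ideal.sub_mem _ ?_ ?_)
  · rw [pow_two]
    exact Ideal.mul_mem_mul (smul_mem_of_mem_inertia hσ ϖ hϖ) (hσ d)
  · exact smul_mem_pow_of_forall_smul_mem (smul_mem_of_mem_inertia hσ) 2 he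
  · exact (P ^ 2).mul_mem_left _ he

lemma eq_one_of_sq_eq_one_of_smul_sub_mem [FaithfulSMul G R] [P.IsPrime] (hP : P ≠ ⊥)
    (h2 : (2 : R) ∉ P) {τ : G} (hτ : τ ∈ P.inertia G) (h1 : ∀ x ∈ P, τ • x - x ∈ P ^ 2)
    (hτ2 : τ ^ 2 = 1) : τ = 1 := by
  by_contra hne
  obtain ⟨x, hx⟩ : ∃ x : R, τ • x ≠ x := by
    by_contra! H
    exact hne (FaithfulSMul.eq_of_smul_eq_smul (α := R) fun x => by simp_all)
  set y := τ • x - x with hy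
  have hy0 : y ≠ 0 := sub_ne_zero.2 hx
  have hτy : τ • y = -y := by rw [hy, smul_sub, ← mul_smul, ← pow_two, hτ2, one_smul]; ring
  have hex : ∃ n, y ∉ P ^ n := by
    by_contra! H
    have : y ∈ ⨅ n : ℕ, P ^ n := by simpa [Submodule.mem_iInf] using H
    rw [Ideal.iInf_pow_eq_bot_of_isDomain P (Ideal.IsPrime.ne_top inferInstance)] at this
    exact hy0 (by simpa using this)
  obtain ⟨k, hk⟩ : ∃ k, Nat.find hex = k + 1 := by norm_num
  have hyk : y ∈ P ^ k := by
    by_contra h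
    have := Nat.find_min' hex h
    omega
  have hyk1 : y ∉ P ^ (k + 1) := hk ▸ Nat.find_spec hex
  have h3 := smul_sub_mem_pow_succ hτ h1 k y hyk
  rw [hτy] at h3
  refine h2 (Ideal.mem_prime_of_mul_mem_pow hP hyk1 ?_)
  have := Ideal.neg_mem_iff _ |>.2 h3
  convert this using 1
  ring

lemma card_inertia_le [FaithfulSMul G R] [Finite G] [P.IsPrime] (hP : P ≠ ⊥)
    (h2 : (2 : R) ∉ P) (hcomm : ∀ σ τ : G, σ * τ = τ * σ) (hG : ∀ σ : G, σ ^ 16 = 1) {p : ℕ}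
    (hp : 1 ≤ p) (g : G) (hg : ∀ x : R, g • x - x ^ p ∈ P) :
    Nat.card (P.inertia G) ≤ Nat.gcd 16 (p - 1) := by
  obtain ⟨ϖ, hϖ, hϖ2⟩ :=
    Ideal.exists_mem_pow_notMem_pow_succ P hP (Ideal.IsPrime.ne_top inferInstance) 1
  simp only [pow_one, Nat.reduceAdd] at hϖ hϖ2
  have hex : ∀ σ : P.inertia G, ∃ a : R, (σ : G) • ϖ - a * ϖ ∈ P ^ 2 := fun σ => by
    obtain ⟨d, e, he, h⟩ := Ideal.exists_mul_add_mem_pow_succ (i := 1) hP ϖ ((σ : G) • ϖ)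
      (by grind) (by grind)
      (by simpa using smul_mem_of_mem_inertia σ.2 ϖ hϖ)
    refine ⟨d, ?_⟩
    grind
  choose a ha using hex
  have key : ∀ (σ : P.inertia G) (c : R), c ∈ P → (σ : G) • c - a σ * c ∈ P ^ 2 :=
    fun σ c hc => smul_sub_mul_mem_sq hP σ.2 hϖ hϖ2 (ha σ) hc
  have huniq : ∀ b b' c : R, c ∉ P ^ 2 → b * c - b' * c ∈ P ^ 2 →
      Ideal.Quotient.mk P b = Ideal.Quotient.mk P b' := fun b b' c hc h => by
    rw [Ideal.Quotient.eq]
    refine Ideal.mem_prime_of_mul_mem_pow (i := 1) hP hc ?_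
    convert h using 1
    ring
  let t : P.inertia G →* R ⧸ P :=
    { toFun := fun σ => Ideal.Quotient.mk P (a σ)
      map_one' := by
        rw [← map_one (Ideal.Quotient.mk P)]
        refine huniq _ _ ϖ hϖ2 ?_
        have := Ideal.neg_mem_iff _ |>.2 (ha 1)
        convert this using 1
        simp
      map_mul' := fun σ τ => by
        rw [← map_mul]
        refine huniq _ _ ϖ hϖ2 ?_
        have h1 := ha (σ * τ)
        have h2 := key σ _ (smul_mem_of_mem_inertia τ.2 ϖ hϖ)
        have h3 := (P ^ 2).mul_mem_left (a σ) (ha τ)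
        have h4 := Ideal.sub_mem _ (add_mem _ h2 h3) h1
        convert h4 using 1
        simp only [Subgroup.coe_mul, mul_smul]
        ring }
  have ht16 : ∀ σ, t σ ^ 16 = 1 := fun σ => by
    rw [← map_pow, show σ ^ 16 = 1 from Subtype.ext (hG σ), map_one]
  have hgP : ∀ x ∈ P, g • x ∈ P := fun x hx => by
    have := P.add_mem (hg x) (P.pow_mem_of_mem hx p hp)
    simpa using this
  have hgP' : ∀ n : ℕ, ∀ x ∈ P, (g ^ n) • x ∈ P := fun n => by
    induction n with
    | zero => simp
    | succ n ih => intro x hx; rw [pow_succ', mul_smul]; exact hgP _ (ih x hx)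
  have hgϖ2 : g • ϖ ∉ P ^ 2 := fun h => hϖ2 (by
    have := smul_mem_pow_of_forall_smul_mem (hgP' 15) 2 h
    rwa [← mul_smul, ← pow_succ, hG, one_smul] at this)
  have htp : ∀ σ, t σ ^ (p - 1) = 1 := fun σ => by
    have h1 : t σ ^ p = t σ := by
      change Ideal.Quotient.mk P (a σ) ^ p = Ideal.Quotient.mk P (a σ)
      rw [← map_pow]
      refine huniq _ _ (g • ϖ) hgϖ2 ?_
      have h1 := key σ _ (hgP ϖ hϖ)
      have h2 := smul_mem_pow_of_forall_smul_mem hgP 2 (ha σ)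
      have h3 : (g • a σ - a σ ^ p) * g • ϖ ∈ P ^ 2 := by
        rw [pow_two]; exact Ideal.mul_mem_mul (hg _) (hgP ϖ hϖ)
      have h4 := Ideal.sub_mem _ (Ideal.sub_mem _ h1 h2) h3
      convert h4 using 1
      rw [smul_sub, smul_mul', ← mul_smul, ← mul_smul, hcomm]
      ring
    have h0 : t σ ≠ 0 := fun h => by
      have := ht16 σ
      rw [h] at this
      simp at this
    refine mul_left_cancel₀ h0 ?_
    rw [mul_one, ← pow_succ', Nat.sub_add_cancel hp, h1]
  have htinv : ∀ σ, t σ = 1 → σ ^ 2 = 1 → σ = 1 := fun σ h hσ2 => by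
    refine Subtype.ext (eq_one_of_sq_eq_one_of_smul_sub_mem hP h2 σ.2 (fun x hx => ?_)
      (by simpa using congrArg Subtype.val hσ2))
    have ha1 : a σ - 1 ∈ P := by rw [← Ideal.Quotient.eq, map_one]; exact h
    have h3 : (a σ - 1) * x ∈ P ^ 2 := by rw [pow_two]; exact Ideal.mul_mem_mul ha1 hx
    have h4 := add_mem _ (key σ x hx) h3
    convert h4 using 1
    ring
  have hinj : Function.Injective t := by
    rw [injective_iff_map_eq_one]
    intro σ hσ
    have hpow : ∀ n, t (σ ^ n) = 1 := fun n => by rw [map_pow, hσ, one_pow]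
    have h16 : σ ^ 16 = 1 := Subtype.ext (hG σ)
    have h8 := htinv (σ ^ 8) (hpow _) (by rw [← pow_mul, h16])
    have h4 := htinv (σ ^ 4) (hpow _) (by rw [← pow_mul, h8])
    have h2 := htinv (σ ^ 2) (hpow _) (by rw [← pow_mul, h4])
    exact htinv σ hσ h2
  set n := Nat.gcd 16 (p - 1) with hn
  have hn0 : 0 < n := Nat.gcd_pos_of_pos_left _ (by norm_num)
  have htn : ∀ σ, t σ ∈ Polynomial.nthRootsFinset n (1 : R ⧸ P) := fun σ => by
    rw [Polynomial.mem_nthRootsFinset hn0]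
    exact pow_gcd_eq_one.2 ⟨ht16 σ, htp σ⟩
  have hcard : Nat.card (P.inertia G) ≤ Nat.card (Polynomial.nthRootsFinset n (1 : R ⧸ P)) :=
    Nat.card_le_card_of_injective (fun σ => ⟨t σ, htn σ⟩) fun σ τ h =>
      hinj (congrArg Subtype.val h)
  refine hcard.trans ?_
  rw [card_eq_fintype_card, Fintype.card_coe, Polynomial.nthRootsFinset]
  exact (Multiset.toFinset_card_le _).trans (Polynomial.card_nthRoots _ _)

end InertiaBound

section Ramification

open NumberField

lemma card_inertia_eq_one_iff {A B G : Type*} [CommRing A] [IsDedekindDomain A] [CommRing B]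
    [IsDedekindDomain B] [Algebra A B] [Module.Finite A B] [Module.Flat A B] [Group G] [Finite G]
    [MulSemiringAction G B] [IsGaloisGroup G A B] (P : Ideal B) [P.IsPrime]
    [PerfectField (P.under A).ResidueField] :
    Nat.card (P.inertia G) = 1 ↔ Algebra.IsUnramifiedAt A P := by
  rw [Ideal.card_inertia_eq_ramificationIdxIn (P.under A) P,
    Ideal.ramificationIdxIn_eq_ramificationIdx (P.under A) P G, Ideal.ramificationIdx_eq_one_iff]

variable {F E M : Type*} [Field F] [NumberField F] [Field E] [NumberField E] [Field M]
  [NumberField M] [Algebra F M] [Algebra E M] {p : ℕ}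

lemma card_inertia_le_gcd [IsGalois ℚ M] (hp : p.Prime) (hp2 : p ≠ 2)
    (hcomm : ∀ σ τ : Gal(M/ℚ), σ * τ = τ * σ) (hexp : ∀ σ : Gal(M/ℚ), σ ^ 16 = 1)
    (P : Ideal (𝓞 M)) [P.IsPrime] (hpP : (p : 𝓞 M) ∈ P) :
    Nat.card (P.inertia Gal(M/ℚ)) ≤ Nat.gcd 16 (p - 1) := by
  have hP : P ≠ ⊥ := by
    rintro rfl
    rw [Ideal.mem_bot, Nat.cast_eq_zero] at hpP
    exact hp.ne_zero hpP
  have h2 : (2 : 𝓞 M) ∉ P := fun h2 => by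
    have hco : IsCoprime (p : 𝓞 M) (2 : 𝓞 M) := by
      have := (Nat.isCoprime_iff_coprime.2 ((Nat.coprime_primes hp prime_two).2 hp2)).map
        (Int.castRingHom (𝓞 M))
      simp_all
    obtain ⟨a, b, hab⟩ := hco
    refine Ideal.IsPrime.ne_top (I := P) inferInstance ((Ideal.eq_top_iff_one _).2 ?_)
    rw [← hab]
    exact add_mem _ (P.mul_mem_left _ hpP) (P.mul_mem_left _ h2)
  have : Finite (𝓞 M ⧸ P) := Ideal.finiteQuotientOfFreeOfNeBot P hP
  obtain ⟨g, hg⟩ := IsArithFrobAt.exists_of_isInvariant ℤ Gal(M/ℚ) P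
  have hcard : Nat.card (ℤ ⧸ P.under ℤ) = p := by
    have : P.under ℤ = span {(p : ℤ)} :=
      ((liesOver_span_iff Ideal.IsPrime.ne_top' (prime_iff_prime_int.1 hp)).2
        (by simp_all)).over.symm
    rw [this, Int.card_ideal_quot]
  have : FaithfulSMul Gal(M/ℚ) (𝓞 M) := IsGaloisGroup.faithful ℤ
  exact card_inertia_le hP h2 hcomm hexp hp.one_le g fun x => by
    have := hg x
    rwa [hcard] at this

lemma not_dvd_absNorm_differentIdeal [IsGalois F M] [IsGalois ℚ E] (hp : p.Prime)
    (hE : ¬ (p : ℤ) ∣ discr E)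
    (hgen : ∀ σ : Gal(M/F), (∀ x : E, σ (algebraMap E M x) = algebraMap E M x) → σ = 1) :
    ¬ p ∣ absNorm (differentIdeal (𝓞 F) (𝓞 M)) := by
  intro hdvd
  have hpp : Prime (p : ℤ) := prime_iff_prime_int.1 hp
  obtain ⟨P, hPm, hPp, hPd⟩ := Ideal.exists_isMaximal_dvd_of_dvd_absNorm hpp _
    (Int.natCast_dvd_natCast.2 hdvd)
  have hpP : (p : 𝓞 M) ∈ P := by
    have : (p : ℤ) ∈ P.under ℤ := by simp_all
    simpa using Ideal.mem_comap.1 this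
  let := FractionRing.liftAlgebra (𝓞 F) (FractionRing (𝓞 M))
  refine not_dvd_differentIdeal_iff.2 ?_ hPd
  rw [← card_inertia_eq_one_iff (G := Gal(M/F)) P]
  set Q : Ideal (𝓞 E) := P.under (𝓞 E) with hQ
  have hQu : Algebra.IsUnramifiedAt ℤ Q := by
    refine (not_dvd_discr_iff_forall_mem E (𝓞 E) hpp).1 hE Q inferInstance ?_
    simp_all
  rw [← card_inertia_eq_one_iff (G := Gal(E/ℚ)) Q, Subgroup.card_eq_one] at hQu
  rw [Subgroup.card_eq_one, Subgroup.eq_bot_iff_forall]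
  intro σ hσ
  refine hgen σ ?_
  have h1 : (σ.restrictScalars ℚ).restrictNormal E ∈ Q.inertia Gal(E/ℚ) := fun x => by
    refine Ideal.mem_comap.2 ?_
    have e : algebraMap (𝓞 E) (𝓞 M) ((σ.restrictScalars ℚ).restrictNormal E • x) =
        σ • algebraMap (𝓞 E) (𝓞 M) x :=
      RingOfIntegers.ext (AlgEquiv.restrictNormal_commutes (σ.restrictScalars ℚ) E (x : E))
    rw [map_sub, e]
    exact hσ _
  rw [hQu, Subgroup.mem_bot] at h1
  intro x
  have h3 := AlgEquiv.restrictNormal_commutes (σ.restrictScalars ℚ) E x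
  rw [h1] at h3
  exact h3.symm

end Ramification

section Discriminant

open NumberField

lemma pow_ramificationIdx_sub_one_dvd_absNorm {A B : Type*} [CommRing A] [IsDedekindDomain A]
    [CommRing B] [IsDedekindDomain B] [Algebra A B] [Module.Finite A B]
    [Module.IsTorsionFree A B] [Module.Free ℤ B] [Module.Finite ℤ B] [CharZero A] {p : ℕ}
    (hp : p.Prime) (P : Ideal B) [P.IsPrime] (hpP : (p : B) ∈ P) (hpA : (p : A) ≠ 0) :
    p ^ (P.ramificationIdx A - 1) ∣ absNorm (differentIdeal A B) := by
  let := FractionRing.liftAlgebra A (FractionRing B)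
  have hinj := FaithfulSMul.algebraMap_injective A B
  have hmem : (p : A) ∈ P.under A := by simp_all
  have hbot : P.under A ≠ ⊥ := fun h => hpA (by simp_all)
  have hPbot : P ≠ ⊥ := by
    rintro rfl
    exact hpA (hinj (by simpa using hpP))
  have hPmax : P.IsMaximal := Ideal.IsPrime.isMaximal inferInstance hPbot
  have hAmax : (P.under A).IsMaximal := Ideal.IsPrime.isMaximal inferInstance hbot
  have hmap : (P.under A).map (algebraMap A B) ≠ ⊥ := fun h =>
    hbot ((Ideal.map_eq_bot_iff_of_injective hinj).1 h)
  have h1 : P ^ P.ramificationIdx A ∣ (P.under A).map (algebraMap A B) := by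
    rw [Ideal.IsDedekindDomain.ramificationIdx_eq_multiplicity (P.under A) P hmap]
    exact pow_multiplicity_dvd _ _
  have h2 := pow_sub_one_dvd_differentIdeal A P _ hbot h1
  have h3 : p ∣ absNorm P := by
    have h4 : absNorm P ∣ p ^ Module.finrank ℤ B := by
      have := Ideal.absNorm_dvd_absNorm_of_le ((Ideal.span_singleton_le_iff_mem P).2 hpP)
      rwa [Ideal.absNorm_span_singleton, ← map_natCast (algebraMap ℤ B), Algebra.norm_algebraMap,
        Int.natAbs_pow, Int.natAbs_natCast] at this
    obtain ⟨k, -, hk⟩ := (Nat.dvd_prime_pow hp).1 h4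
    rw [hk]
    refine dvd_pow_self _ ?_
    rintro rfl
    exact hPmax.ne_top (Ideal.absNorm_eq_one_iff.1 (by grind))
  exact (pow_dvd_pow_of_dvd h3 _).trans (by simpa using map_dvd absNorm h2)

variable {F E M : Type*} [Field F] [NumberField F] [Field M] [NumberField M] [Algebra F M] {p : ℕ}

lemma factorization_natAbs_discr_eq :
    (discr M).natAbs.factorization p = (absNorm (differentIdeal (𝓞 F) (𝓞 M))).factorization p
      + Module.finrank F M * (discr F).natAbs.factorization p := by
  have h := natAbs_discr_eq_absNorm_differentIdeal_mul_natAbs_discr_pow F (𝓞 F) M (𝓞 M)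
  have h0 : (discr M).natAbs ≠ 0 := Int.natAbs_ne_zero.2 (discr_ne_zero M)
  simp_all

lemma factorization_discr_of_isCyclotomicExtension [IsGalois ℚ F] (hp : p.Prime)
    [IsCyclotomicExtension {p} ℚ M] :
    (discr F).natAbs.factorization p = Module.finrank ℚ F - 1 := by
  have : Fact p.Prime := ⟨hp⟩
  have : IsGalois ℚ M := IsCyclotomicExtension.isGalois {p} ℚ M
  have : IsGalois F M := IsGalois.tower_top_of_isGalois ℚ F M
  have htop : Module.finrank ℚ M = p - 1 := by
    rw [IsCyclotomicExtension.finrank M (Polynomial.cyclotomic.irreducible_rat hp.pos),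
      Nat.totient_prime hp]
  have hmul : Module.finrank ℚ F * Module.finrank F M = Module.finrank ℚ M :=
    Module.finrank_mul_finrank ℚ F M
  obtain ⟨⟨P, hPp, hPo⟩⟩ := (inferInstance : Nonempty ((span {(p : ℤ)} : Ideal ℤ).primesOver (𝓞 M)))
  have hpM : (p : 𝓞 M) ∈ P := by
    simpa using (liesOver_span_iff hPp.ne_top (prime_iff_prime_int.1 hp)).1 hPo
  set Q : Ideal (𝓞 F) := P.under (𝓞 F) with hQ
  have hpF : (p : 𝓞 F) ∈ Q := by simp_all
  have hQp : Q.LiesOver (span {(p : ℤ)}) := (liesOver_span_iff (Ideal.IsPrime.ne_top inferInstance)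
      (prime_iff_prime_int.1 hp)).2 (by simp_all)
  have e1 : P.ramificationIdx ℤ = p - 1 := by
    rw [← Ideal.ramificationIdxIn_eq_ramificationIdx (span {(p : ℤ)}) P Gal(M/ℚ),
      IsCyclotomicExtension.Rat.ramificationIdxIn_eq_of_prime p M]
  have e2 : P.ramificationIdx ℤ = Q.ramificationIdx ℤ * P.ramificationIdx (𝓞 F) :=
    Ideal.ramificationIdx_tower Q P
  have e3 : Q.ramificationIdx ℤ ≤ Module.finrank ℚ F := by
    rw [← Ideal.ramificationIdxIn_eq_ramificationIdx (span {(p : ℤ)}) Q Gal(F/ℚ),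
      ← Ideal.card_inertia_eq_ramificationIdxIn (G := Gal(F/ℚ)) (span {(p : ℤ)}) Q,
      ← IsGalois.card_aut_eq_finrank]
    exact Subgroup.card_le_card_group _
  have e4 : P.ramificationIdx (𝓞 F) ≤ Module.finrank F M := by
    rw [← Ideal.ramificationIdxIn_eq_ramificationIdx Q P Gal(M/F),
      ← Ideal.card_inertia_eq_ramificationIdxIn (G := Gal(M/F)) Q P,
      ← IsGalois.card_aut_eq_finrank]
    exact Subgroup.card_le_card_group _
  have f1 := pow_ramificationIdx_sub_one_dvd_absNorm (A := ℤ) hp Q hpF (by simpa using hp.ne_zero)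
  have f2 := pow_ramificationIdx_sub_one_dvd_absNorm (A := 𝓞 F) hp P hpM (by simpa using hp.ne_zero)
  rw [absNorm_differentIdeal F, hp.pow_dvd_iff_le_factorization
    (Int.natAbs_ne_zero.2 (discr_ne_zero F))] at f1
  have hne : absNorm (differentIdeal (𝓞 F) (𝓞 M)) ≠ 0 := by
    have h := natAbs_discr_eq_absNorm_differentIdeal_mul_natAbs_discr_pow F (𝓞 F) M (𝓞 M)
    exact fun h0 => Int.natAbs_ne_zero.2 (discr_ne_zero M) (by rw [h, h0, zero_mul])
  rw [hp.pow_dvd_iff_le_factorization hne] at f2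
  have f3 := factorization_natAbs_discr_eq (F := F) (M := M) (p := p)
  have f4 : (discr M).natAbs.factorization p = p - 2 := by
    rw [IsCyclotomicExtension.Rat.discr_prime p M, Int.natAbs_mul, Int.natAbs_pow,
      Int.natAbs_pow, Int.natAbs_neg, Int.natAbs_one, one_pow, one_mul, Int.natAbs_natCast,
      hp.factorization_pow]
    simp
  have hF : 0 < Module.finrank ℚ F := finrank_pos
  have hM : 0 < Module.finrank F M := finrank_pos
  have g : Q.ramificationIdx ℤ * P.ramificationIdx (𝓞 F) =
      Module.finrank ℚ F * Module.finrank F M := by rw [← e2, e1, hmul, htop]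
  have g1 : Q.ramificationIdx ℤ = Module.finrank ℚ F := by
    refine le_antisymm e3 (Nat.le_of_mul_le_mul_right ?_ hM)
    rw [← g]
    exact Nat.mul_le_mul_left _ e4
  have g2 : P.ramificationIdx (𝓞 F) = Module.finrank F M := by
    rw [g1] at g
    exact Nat.eq_of_mul_eq_mul_left hF g
  rw [g1] at f1
  rw [g2] at f2
  refine le_antisymm (Nat.le_of_mul_le_mul_left ?_ hM) f1
  have h5 : Module.finrank F M * Module.finrank ℚ F = p - 1 := by rw [mul_comm, hmul, htop]
  rw [Nat.mul_sub, h5, mul_one]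
  omega

end Discriminant

section Compositum

open NumberField

instance isAlgClosure_rat : IsAlgClosure ℚ (AlgebraicClosure ℚ) := by
  have h (K : Type) [Field K] : IsAlgClosure K (AlgebraicClosure K) := inferInstance
  exact h ℚ

instance isGalois_algebraicClosure_rat : IsGalois ℚ (AlgebraicClosure ℚ) where
  to_isSeparable := by
    have := isAlgClosure_rat.isAlgebraic
    infer_instance
  to_normal := IsAlgClosure.normal ℚ (AlgebraicClosure ℚ)

lemma absDisc_eq_natAbs_discr (L : IntermediateField ℚ (AlgebraicClosure ℚ)) [NumberField L] :
    absDisc L = (discr L).natAbs :=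
  dif_pos NumberField.to_finiteDimensional

lemma absDisc_ne_zero (L : IntermediateField ℚ (AlgebraicClosure ℚ)) [NumberField L] :
    absDisc L ≠ 0 := by
  rw [absDisc_eq_natAbs_discr]
  exact Int.natAbs_ne_zero.2 (discr_ne_zero L)

variable {p : ℕ} {F F' E : IntermediateField ℚ (AlgebraicClosure ℚ)} [NumberField F]
  [NumberField F'] [NumberField E]

instance numberField_sup : NumberField ↥(F ⊔ E) where
  to_finiteDimensional := IntermediateField.finiteDimensional_sup F E

instance isGalois_sup [hF : IsGalois ℚ F] [hE : IsGalois ℚ E] : IsGalois ℚ ↥(F ⊔ E) := by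
  have h1 : @IsGalois ℚ _ F _ F.algebra' := hF
  have h2 : @IsGalois ℚ _ E _ E.algebra' := hE
  exact (inferInstance : @IsGalois ℚ _ ↥(F ⊔ E) _ (F ⊔ E).algebra')

lemma finrank_mul_factorization_absDisc_sup [IsGalois ℚ F] [IsGalois ℚ E] (hp : p.Prime)
    (hE : ¬ p ∣ absDisc E) :
    Module.finrank ℚ F * (absDisc (F ⊔ E)).factorization p =
      Module.finrank ℚ ↥(F ⊔ E) * (absDisc F).factorization p := by
  let _ : Algebra F ↥(F ⊔ E) :=
    (IntermediateField.inclusion (le_sup_left : F ≤ F ⊔ E)).toRingHom.toAlgebra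
  let _ : Algebra E ↥(F ⊔ E) :=
    (IntermediateField.inclusion (le_sup_right : E ≤ F ⊔ E)).toRingHom.toAlgebra
  have : IsGalois F ↥(F ⊔ E) := IsGalois.tower_top_of_isGalois ℚ F _
  rw [absDisc_eq_natAbs_discr, absDisc_eq_natAbs_discr, factorization_natAbs_discr_eq (F := F),
    Nat.factorization_eq_zero_of_not_dvd (not_dvd_absNorm_differentIdeal (E := E) hp ?_ ?_),
    zero_add, ← mul_assoc, Module.finrank_mul_finrank]
  · rwa [absDisc_eq_natAbs_discr, ← Int.natCast_dvd] at hE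
  · intro σ hσ
    set τ : Gal(AlgebraicClosure ℚ/ℚ) :=
      (σ.restrictScalars ℚ).liftNormal (AlgebraicClosure ℚ) with hτ
    have hτc : ∀ x : ↥(F ⊔ E), τ x = σ x := fun x =>
      AlgEquiv.liftNormal_commutes (σ.restrictScalars ℚ) (AlgebraicClosure ℚ) x
    have h1 : τ ∈ (F ⊔ E).fixingSubgroup := by
      rw [fixingSubgroup_sup]
      refine ⟨(mem_fixingSubgroup_iff _).2 fun x hx => ?_,
        (mem_fixingSubgroup_iff _).2 fun x hx => ?_⟩
      · exact (hτc ⟨x, le_sup_left (a := F) hx⟩).trans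
          (congrArg Subtype.val (σ.commutes (⟨x, hx⟩ : F)))
      · exact (hτc ⟨x, le_sup_right (b := E) hx⟩).trans (congrArg Subtype.val (hσ ⟨x, hx⟩))
    ext x
    rw [← hτc]
    exact (mem_fixingSubgroup_iff _).1 h1 x x.2

end Compositum

local notation "Qbar" => AlgebraicClosure ℚ
local notation "C16" => Multiplicative (ZMod 16)

section CyclotomicCharacter

open NumberField

/-- A chosen primitive root of unity in the algebraic closure of `ℚ`. -/
def algZeta (n : ℕ) [NeZero n] : Qbar := (HasEnoughRootsOfUnity.exists_primitiveRoot Qbar n).choose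

lemma isPrimitiveRoot_algZeta (n : ℕ) [NeZero n] : IsPrimitiveRoot (algZeta n) n :=
  (HasEnoughRootsOfUnity.exists_primitiveRoot Qbar n).choose_spec

/-- The cyclotomic field of level `n` inside the algebraic closure of `ℚ`. -/
def cycField (n : ℕ) [NeZero n] : IntermediateField ℚ Qbar := IntermediateField.adjoin ℚ {algZeta n}

instance isCyclotomicExtension_cycField (n : ℕ) [NeZero n] :
    IsCyclotomicExtension {n} ℚ (cycField n) :=
  (isPrimitiveRoot_algZeta n).intermediateField_adjoin_isCyclotomicExtension ℚ

instance numberField_cycField (n : ℕ) [NeZero n] : NumberField (cycField n) :=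
  IsCyclotomicExtension.numberField {n} ℚ _

instance isGalois_cycField (n : ℕ) [NeZero n] : IsGalois ℚ (cycField n) :=
  IsCyclotomicExtension.isGalois {n} ℚ _

/-- The mod `n` cyclotomic character of the absolute Galois group of `ℚ`. -/
def cycChar (n : ℕ) [NeZero n] : Gal(Qbar/ℚ) →* (ZMod n)ˣ :=
  (IsCyclotomicExtension.Rat.galEquivZMod n (cycField n)).toMonoidHom.comp
    (AlgEquiv.restrictNormalHom (cycField n))

lemma cycChar_surjective (n : ℕ) [NeZero n] : Function.Surjective (cycChar n) :=
  (IsCyclotomicExtension.Rat.galEquivZMod n (cycField n)).surjective.comp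
    (AlgEquiv.restrictNormalHom_surjective Qbar)

lemma ker_cycChar (n : ℕ) [NeZero n] : (cycChar n).ker = (cycField n).fixingSubgroup := by
  have : @Normal ℚ (cycField n) _ _ (cycField n).algebra' := (inferInstance : Normal ℚ (cycField n))
  refine Eq.trans ?_ (restrictNormalHom_ker (cycField n))
  ext σ
  exact (IsCyclotomicExtension.Rat.galEquivZMod n (cycField n)).map_eq_one_iff

lemma apply_eq_pow_cycChar {n : ℕ} [NeZero n] {x : Qbar} (hx : x ^ n = 1)
    (σ : Gal(Qbar/ℚ)) : σ x = x ^ (cycChar n σ).val.val := by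
  obtain ⟨i, -, rfl⟩ := (isPrimitiveRoot_algZeta n).eq_pow_of_pow_eq_one hx
  set y : cycField n := ⟨algZeta n ^ i, pow_mem (IntermediateField.mem_adjoin_simple_self _ _) i⟩
  have h := IsCyclotomicExtension.Rat.galEquivZMod_apply_of_pow_eq n (cycField n)
    (AlgEquiv.restrictNormalHom (cycField n) σ) (x := y) (Subtype.ext hx)
  exact (AlgEquiv.restrictNormal_commutes σ (cycField n) y).symm.trans (congrArg Subtype.val h)

lemma unitsMap_cycChar {m n : ℕ} [NeZero m] [NeZero n] (h : m ∣ n) (σ : Gal(Qbar/ℚ)) :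
    ZMod.unitsMap h (cycChar n σ) = cycChar m σ := by
  have hm := isPrimitiveRoot_algZeta m
  have h1 := apply_eq_pow_cycChar hm.pow_eq_one σ
  obtain ⟨k, rfl⟩ := h
  rw [apply_eq_pow_cycChar (n := m * k) (by rw [pow_mul, hm.pow_eq_one, one_pow]) σ] at h1
  rw [pow_eq_pow_mod _ hm.pow_eq_one] at h1
  have h2 := hm.pow_inj (Nat.mod_lt _ (NeZero.pos m)) (ZMod.val_lt _) h1
  ext
  rw [ZMod.unitsMap_val, ZMod.cast_eq_val, ← ZMod.natCast_mod, h2, ZMod.natCast_zmod_val]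

lemma pi_cycChar_surjective {ι : Type*} [Finite ι] (q : ι → ℕ) [∀ i, NeZero (q i)]
    (hq : Pairwise (Function.onFun Nat.Coprime q)) (u : ∀ i, (ZMod (q i))ˣ) :
    ∃ σ, ∀ i, cycChar (q i) σ = u i := by
  have := ofFinite ι
  have : NeZero (∏ i, q i) := ⟨Finset.prod_ne_zero_iff.2 fun i _ => NeZero.ne _⟩
  obtain ⟨σ, hσ⟩ := cycChar_surjective (∏ i, q i)
    (Units.map (ZMod.prodEquivPi q hq).symm.toMonoidHom (MulEquiv.piUnits.symm u))
  refine ⟨σ, fun i => ?_⟩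
  rw [← unitsMap_cycChar (Finset.dvd_prod_of_mem q (Finset.mem_univ i)), hσ]
  ext
  rw [ZMod.unitsMap_def, Units.coe_map, Units.coe_map]
  exact (ZMod.prodEquivPi_apply q hq _ i).symm.trans
    (congrFun ((ZMod.prodEquivPi q hq).apply_symm_apply fun i => (u i : ZMod (q i))) i)

lemma not_dvd_absDisc_cycField {p n : ℕ} [NeZero n] (hp : p.Prime) (hn : ¬ p ∣ n) :
    ¬ p ∣ absDisc (cycField n) := by
  have : Fact p.Prime := ⟨hp⟩
  rw [absDisc_eq_natAbs_discr, ← Int.natCast_dvd,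
    not_dvd_discr_iff_forall_mem (𝒪 := 𝓞 (cycField n)) _ (prime_iff_prime_int.1 hp)]
  intro P hP hpP
  have : P.LiesOver (span {(p : ℤ)}) :=
    (liesOver_span_iff hP.ne_top (prime_iff_prime_int.1 hp)).2 (by simp_all)
  rw [← Ideal.ramificationIdx_eq_one_iff]
  exact IsCyclotomicExtension.Rat.ramificationIdx_eq_of_not_dvd p _ P hn

end CyclotomicCharacter

section CharacterFields

open NumberField

lemma fixingSubgroup_fixedField_of_isOpen {H : Subgroup Gal(Qbar/ℚ)}
    (hH : IsOpen (H : Set Gal(Qbar/ℚ))) :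
    (fixedField H).fixingSubgroup = H :=
  InfiniteGalois.fixingSubgroup_fixedField ⟨H, H.isClosed_of_isOpen hH⟩

lemma numberField_fixedField {H : Subgroup Gal(Qbar/ℚ)}
    (hH : IsOpen (H : Set Gal(Qbar/ℚ))) : NumberField (fixedField H) where
  to_finiteDimensional := by
    rw [← InfiniteGalois.isOpen_iff_finite, fixingSubgroup_fixedField_of_isOpen hH]
    exact hH

lemma isGalois_fixedField {H : Subgroup Gal(Qbar/ℚ)} [H.Normal]
    (hH : IsOpen (H : Set Gal(Qbar/ℚ))) : IsGalois ℚ (fixedField H) := by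
  have := (InfiniteGalois.normal_iff_isGalois (fixedField H)).1
    (by rwa [fixingSubgroup_fixedField_of_isOpen hH])
  exact this

lemma not_dvd_absDisc_of_le {p : ℕ} {F E : IntermediateField ℚ Qbar} [NumberField F]
    [NumberField E] (h : F ≤ E) (hE : ¬ p ∣ absDisc E) : ¬ p ∣ absDisc F := by
  let _ : Algebra F E := (IntermediateField.inclusion h).toRingHom.toAlgebra
  rw [absDisc_eq_natAbs_discr] at hE ⊢
  refine fun h => hE (h.trans ?_)
  rw [natAbs_discr_eq_absNorm_differentIdeal_mul_natAbs_discr_pow F (𝓞 F) E (𝓞 E)]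
  exact (dvd_pow_self _ (finrank_pos (R := F) (M := E)).ne').mul_left _

lemma not_dvd_absDisc_sup {p : ℕ} (hp : p.Prime) {F E : IntermediateField ℚ Qbar}
    [NumberField F] [NumberField E] [IsGalois ℚ F] [IsGalois ℚ E] (hF : ¬ p ∣ absDisc F)
    (hE : ¬ p ∣ absDisc E) : ¬ p ∣ absDisc (F ⊔ E) := by
  have h := finrank_mul_factorization_absDisc_sup (F := F) hp hE
  rw [Nat.factorization_eq_zero_of_not_dvd hF, mul_zero, mul_eq_zero,
    Nat.factorization_eq_zero_iff] at h
  have h1 := (finrank_pos (R := ℚ) (M := F)).ne'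
  have h2 := absDisc_ne_zero (F ⊔ E)
  tauto

/-- The fixed field of the kernel of a homomorphism out of the absolute Galois group. -/
def kerField (f : Gal(Qbar/ℚ) →* C16) : IntermediateField ℚ Qbar := fixedField f.ker

variable {f g : Gal(Qbar/ℚ) →* C16}

lemma fixingSubgroup_kerField (hf : IsOpen (f.ker : Set Gal(Qbar/ℚ))) :
    (kerField f).fixingSubgroup = f.ker :=
  fixingSubgroup_fixedField_of_isOpen hf

lemma finrank_kerField (hf : IsOpen (f.ker : Set Gal(Qbar/ℚ))) :
    Module.finrank ℚ (kerField f) = Nat.card f.range := by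
  rw [← Subgroup.index_ker, ← fixingSubgroup_kerField hf]
  exact IntermediateField.finrank_eq_fixingSubgroup_index Qbar (kerField f)

lemma finrank_mul_factorization_absDisc_kerField {p m : ℕ} [NeZero m] (hp : p.Prime)
    (hm : ¬ p ∣ m) (hf : IsOpen (f.ker : Set Gal(Qbar/ℚ))) (hg : IsOpen (g.ker : Set Gal(Qbar/ℚ)))
    (hfg : ∀ σ ∈ (cycChar m).ker, f σ = g σ) :
    Module.finrank ℚ (kerField g) * (absDisc (kerField f)).factorization p =
      Module.finrank ℚ (kerField f) * (absDisc (kerField g)).factorization p := by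
  have : NumberField (kerField f) := numberField_fixedField hf
  have : NumberField (kerField g) := numberField_fixedField hg
  have : IsGalois ℚ (kerField f) := isGalois_fixedField hf
  have : IsGalois ℚ (kerField g) := isGalois_fixedField hg
  have h : kerField f ⊔ cycField m = kerField g ⊔ cycField m := by
    rw [← InfiniteGalois.fixedField_fixingSubgroup (kerField f ⊔ cycField m),
      ← InfiniteGalois.fixedField_fixingSubgroup (kerField g ⊔ cycField m),
      fixingSubgroup_sup, fixingSubgroup_sup,
      fixingSubgroup_kerField hf, fixingSubgroup_kerField hg, ← ker_cycChar]
    congr 1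
    ext σ
    simp only [Subgroup.mem_inf, MonoidHom.mem_ker]
    exact and_congr_left fun hσ => by rw [hfg σ hσ]
  have h1 := finrank_mul_factorization_absDisc_sup (F := kerField f) hp
    (not_dvd_absDisc_cycField hp hm)
  have h2 := finrank_mul_factorization_absDisc_sup (F := kerField g) hp
    (not_dvd_absDisc_cycField hp hm)
  rw [← h] at h2
  have h3 : 0 < Module.finrank ℚ ↥(kerField f ⊔ cycField m) := finrank_pos
  refine Nat.eq_of_mul_eq_mul_left h3 ?_
  rw [mul_left_comm, ← h1, mul_left_comm, mul_left_comm _ (Module.finrank ℚ (kerField f)), ← h2]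

lemma isOpen_ker_of_le {n : ℕ} [NeZero n] (hf : (cycChar n).ker ≤ f.ker) :
    IsOpen (f.ker : Set Gal(Qbar/ℚ)) := by
  refine Subgroup.isOpen_mono hf ?_
  rw [ker_cycChar]
  exact (cycField n).fixingSubgroup_isOpen

lemma kerField_le_cycField {n : ℕ} [NeZero n] (hf : (cycChar n).ker ≤ f.ker) :
    kerField f ≤ cycField n := by
  rw [← InfiniteGalois.fixedField_fixingSubgroup (cycField n), ← ker_cycChar]
  exact fixedField_antitone hf

lemma factorization_absDisc_kerField {p : ℕ} [NeZero p] (hp : p.Prime)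
    (hf : (cycChar p).ker ≤ f.ker) :
    (absDisc (kerField f)).factorization p = Module.finrank ℚ (kerField f) - 1 := by
  have hfo := isOpen_ker_of_le hf
  have : NumberField (kerField f) := numberField_fixedField hfo
  have : IsGalois ℚ (kerField f) := isGalois_fixedField hfo
  let _ : Algebra (kerField f) (cycField p) :=
    (IntermediateField.inclusion (kerField_le_cycField hf)).toRingHom.toAlgebra
  rw [absDisc_eq_natAbs_discr]
  exact factorization_discr_of_isCyclotomicExtension (M := cycField p) hp

lemma nonempty_mulEquiv_of_ker_eq {G A B : Type*} [Group G] [Group A] [Group B] {f : G →* A}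
    {g : G →* B} (hf : Function.Surjective f) (hg : Function.Surjective g) (h : f.ker = g.ker) :
    ∃ e : A ≃* B, ∀ x, e (f x) = g x :=
  ⟨(QuotientGroup.quotientKerEquivOfSurjective f hf).symm.trans
    ((QuotientGroup.quotientMulEquivOfEq h).trans
      (QuotientGroup.quotientKerEquivOfSurjective g hg)), fun x => by
    have : (QuotientGroup.quotientKerEquivOfSurjective f hf).symm (f x) = (x : G ⧸ f.ker) := by
      rw [MulEquiv.symm_apply_eq]
      rfl
    rw [MulEquiv.trans_apply, this]
    rfl⟩

lemma ker_restrictNormalHom (L : IntermediateField ℚ Qbar) [IsGalois ℚ L] :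
    (AlgEquiv.restrictNormalHom (F := ℚ) (K₁ := Qbar) L).ker = L.fixingSubgroup := by
  have : @Normal ℚ L _ _ L.algebra' := (inferInstance : Normal ℚ L)
  exact restrictNormalHom_ker L

lemma nonempty_gal_kerField_mulEquiv (hf : IsOpen (f.ker : Set Gal(Qbar/ℚ)))
    (hs : Function.Surjective f) : Nonempty (Gal(kerField f/ℚ) ≃* C16) := by
  have : IsGalois ℚ (kerField f) := isGalois_fixedField hf
  obtain ⟨e, -⟩ := nonempty_mulEquiv_of_ker_eq (AlgEquiv.restrictNormalHom_surjective Qbar) hs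
    ((ker_restrictNormalHom (kerField f)).trans (fixingSubgroup_kerField hf))
  exact ⟨e⟩

lemma exists_kerField_eq {L : IntermediateField ℚ Qbar} [NumberField L] [IsGalois ℚ L]
    (e : Gal(L/ℚ) ≃* C16) : ∃ f : Gal(Qbar/ℚ) →* C16, Function.Surjective f ∧
      IsOpen (f.ker : Set Gal(Qbar/ℚ)) ∧ kerField f = L := by
  have h : (e.toMonoidHom.comp (AlgEquiv.restrictNormalHom L)).ker = L.fixingSubgroup := by
    rw [← ker_restrictNormalHom]
    norm_num
  refine ⟨e.toMonoidHom.comp (AlgEquiv.restrictNormalHom L), e.surjective.comp (AlgEquiv.restrictNormalHom_surjective Qbar), ?_, ?_⟩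
  · rw [h]
    exact L.fixingSubgroup_isOpen
  · rw [kerField, h]
    exact InfiniteGalois.fixedField_fixingSubgroup L

end CharacterFields

section SquareRoots

open NumberField

variable {M : Type*} [Field M] [NumberField M] [IsGalois ℚ M]

lemma exists_mem_inertia_apply_ne {q d : ℕ} (hq : q.Prime) (hd : q ∣ d) (hd2 : ¬ q ^ 2 ∣ d)
    {y : M} (hy : y ^ 2 = d) (P : Ideal (𝓞 M)) [P.IsPrime] (hqP : (q : 𝓞 M) ∈ P) :
    ∃ σ ∈ P.inertia Gal(M/ℚ), σ y ≠ y := by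
  by_contra! hcon
  set F := fixedField (P.inertia Gal(M/ℚ)) with hF
  have hfix : F.fixingSubgroup = P.inertia Gal(M/ℚ) := IntermediateField.fixingSubgroup_fixedField _
  have hyF : y ∈ F := (IntermediateField.mem_fixedField_iff _ _).2 hcon
  have hyint : IsIntegral ℤ (⟨y, hyF⟩ : F) := by
    refine IsIntegral.of_pow two_pos ?_
    rw [show (⟨y, hyF⟩ : F) ^ 2 = (d : F) from Subtype.ext hy]
    exact map_natCast (algebraMap ℤ F) d ▸ isIntegral_algebraMap
  set b : 𝓞 F := ⟨⟨y, hyF⟩, hyint⟩ with hb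
  have hbd : b ^ 2 = d := RingOfIntegers.ext (Subtype.ext hy)
  set Q : Ideal (𝓞 F) := P.under (𝓞 F) with hQ
  have hqQ : (q : 𝓞 F) ∈ Q := by simp_all
  have hQbot : Q ≠ ⊥ := fun h => hq.ne_zero (by simpa [h] using hqQ)
  have hQmax : Q.IsMaximal := Ideal.IsPrime.isMaximal inferInstance hQbot
  have hcard : Nat.card (P.inertia Gal(M/ℚ)) ≤ Nat.card (P.inertia Gal(M/F)) := by
    rw [← hfix]
    refine Nat.card_le_card_of_injective
      (fun σ => ⟨fixingSubgroupEquiv F σ, fun x => ?_⟩) fun σ τ h => ?_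
    · have h1 : (σ : Gal(M/ℚ)) ∈ P.inertia Gal(M/ℚ) := hfix ▸ σ.2
      exact h1 x
    · exact (fixingSubgroupEquiv F).injective (congrArg Subtype.val h)
  have hspan : P.LiesOver (span {(q : ℤ)}) := (liesOver_span_iff
    (Ideal.IsPrime.ne_top inferInstance) (prime_iff_prime_int.1 hq)).2 (by simpa using hqP)
  have : Fact q.Prime := ⟨hq⟩
  rw [Ideal.card_inertia_eq_ramificationIdxIn (G := Gal(M/F)) Q P,
    Ideal.ramificationIdxIn_eq_ramificationIdx Q P Gal(M/F),
    Ideal.card_inertia_eq_ramificationIdxIn (G := Gal(M/ℚ)) (span {(q : ℤ)}) P,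
    Ideal.ramificationIdxIn_eq_ramificationIdx (span {(q : ℤ)}) P Gal(M/ℚ),
    Ideal.ramificationIdx_tower Q P] at hcard
  have hpos : 0 < Q.ramificationIdx ℤ * P.ramificationIdx (𝓞 F) := by
    rw [← Ideal.ramificationIdx_tower Q P,
      ← Ideal.ramificationIdxIn_eq_ramificationIdx (span {(q : ℤ)}) P Gal(M/ℚ),
      ← Ideal.card_inertia_eq_ramificationIdxIn (G := Gal(M/ℚ)) (span {(q : ℤ)}) P]
    exact Nat.card_pos
  have he : Q.ramificationIdx ℤ = 1 := by
    refine le_antisymm (Nat.le_of_mul_le_mul_right (by rwa [one_mul])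
      (Nat.pos_of_mul_pos_left hpos)) (Nat.pos_of_mul_pos_right hpos)
  rw [Ideal.ramificationIdx_eq_one_iff, ← not_dvd_differentIdeal_iff] at he
  obtain ⟨e, rfl⟩ := hd
  have heQ : (e : 𝓞 F) ∉ Q := by
    intro h
    have h1 : Nat.Coprime q e := (Nat.Prime.coprime_iff_not_dvd hq).2 fun h =>
      hd2 (by rw [sq]; exact mul_dvd_mul_left q h)
    refine hQmax.ne_top ((Ideal.eq_top_iff_one Q).2 ?_)
    obtain ⟨u, v, huv⟩ := (Nat.isCoprime_iff_coprime.2 h1 : IsCoprime (q : ℤ) e)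
    have h2 := congrArg (Int.cast : ℤ → 𝓞 F) huv
    push_cast at h2
    rw [← h2]
    exact Q.add_mem (Q.mul_mem_left _ hqQ) (Q.mul_mem_left _ h)
  have hbQ : b ∈ Q := Ideal.IsPrime.mem_of_pow_mem inferInstance 2 (by
    rw [hbd, Nat.cast_mul]
    exact Q.mul_mem_right _ hqQ)
  have hq2 : (q : 𝓞 F) ∈ Q ^ 2 := by
    have h := Ideal.pow_mem_pow hbQ 2
    rw [hbd, Nat.cast_mul, mul_comm] at h
    exact (Ideal.IsPrime.mul_mem_pow Q h).resolve_left heQ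
  have hmax : (span {(q : ℤ)}).IsMaximal := Int.ideal_span_isMaximal_of_prime q
  have h := pow_sub_one_dvd_differentIdeal ℤ (p := span {(q : ℤ)}) Q 2
    (by simpa using hq.ne_zero) (Ideal.dvd_iff_le.2 (by
      rw [Ideal.map_span, Set.image_singleton, Ideal.span_singleton_le_iff_mem]
      simpa using hq2))
  exact he (by simpa using h)

lemma exists_sq_eq_natCast_of_index_two {B : Subgroup Gal(M/ℚ)} (hB : B.index = 2)
    {φ : M →+* ℂ} {c : Gal(M/ℚ)} (hc : ComplexEmbedding.IsConj φ c) (hcB : c ∈ B) :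
    ∃ (d : ℕ) (y : M), Squarefree d ∧ y ^ 2 = d ∧ ∀ σ, σ ∈ B ↔ σ y = y := by
  obtain ⟨τ, hτ⟩ : ∃ τ, τ ∉ B := by
    by_contra! h
    rw [(eq_top_iff' B).2 h, index_top] at hB
    omega
  obtain ⟨x, hxB, hx⟩ : ∃ x, (∀ σ ∈ B, σ x = x) ∧ τ x ≠ x := by
    by_contra! h
    refine hτ ?_
    rw [← IntermediateField.fixingSubgroup_fixedField B]
    simp_all
  have hx1 : ∀ σ ∉ B, σ x = τ x := fun σ hσ => by
    have := hxB (τ⁻¹ * σ) ((Subgroup.mul_mem_iff_of_index_two hB).2 (by simp_all))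
    rwa [AlgEquiv.mul_apply, AlgEquiv.aut_inv, AlgEquiv.symm_apply_eq] at this
  have hx2 : ∀ σ ∈ B, σ (τ x) = τ x := fun σ hσ =>
    hx1 (σ * τ) (by rw [Subgroup.mul_mem_iff_of_index_two hB]; grind)
  have hx3 : ∀ σ ∉ B, σ (τ x) = x := fun σ hσ =>
    hxB (σ * τ) (by rw [Subgroup.mul_mem_iff_of_index_two hB]; grind)
  have hfix : ∀ σ : Gal(M/ℚ), σ ((x - τ x) ^ 2) = (x - τ x) ^ 2 := by
    intro σ
    rw [map_pow, map_sub]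
    by_cases hσ : σ ∈ B
    · grind
    grind
  obtain ⟨r, hr⟩ := (IsGalois.mem_range_algebraMap_iff_fixed _).2 hfix
  have hden : (r.den : M) ≠ 0 := Nat.cast_ne_zero.2 r.den_ne_zero
  have hz : (r.den * (x - τ x)) ^ 2 = ((r.num * r.den : ℤ) : M) := by
    have h : (r.num : M) = r * r.den := mod_cast (Rat.mul_den_eq_num r).symm
    rw [mul_pow, ← hr, eq_ratCast, Int.cast_mul, h]
    push_cast
    ring
  have hreal : (starRingEnd ℂ) (φ (r.den * (x - τ x))) = φ (r.den * (x - τ x)) := by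
    refine (hc.eq _).symm.trans ?_
    rw [map_mul, map_sub, hxB c hcB, hx2 c hcB, map_natCast]
  obtain ⟨t, ht⟩ := Complex.conj_eq_iff_real.1 hreal
  have hpos : 0 ≤ r.num * r.den := by
    have h := congrArg φ hz
    rw [map_pow, ht, map_intCast] at h
    have h1 : t ^ 2 = ((r.num * r.den : ℤ) : ℝ) := by exact_mod_cast h
    exact_mod_cast h1 ▸ sq_nonneg t
  obtain ⟨N, hN⟩ := Int.eq_ofNat_of_zero_le hpos
  obtain ⟨d, s, hds, hd⟩ := Nat.sq_mul_squarefree N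
  have hxx : x - τ x ≠ 0 := sub_ne_zero.2 hx.symm
  have hs : (s : M) ≠ 0 := by
    intro h
    rw [Nat.cast_eq_zero] at h
    rw [hN, ← hds, h] at hz
    grind
  refine ⟨d, r.den * (x - τ x) / s, hd, ?_, fun σ => ?_⟩
  · rw [div_pow, hz, hN, ← hds]
    push_cast
    field_simp
  · rw [map_div₀, map_mul, map_natCast, map_natCast, div_left_inj' hs, mul_right_inj' hden, map_sub]
    by_cases hσ : σ ∈ B
    · grind
    grind

lemma card_sup_le {G : Type*} [Group G] (hcomm : ∀ σ τ : G, σ * τ = τ * σ)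
    (H K : Subgroup G) : Nat.card ↥(H ⊔ K) ≤ Nat.card H * Nat.card K := by
  have : H.Normal := ⟨fun n hn g => by simp_all⟩
  refine le_trans (le_of_eq ?_) Set.natCard_mul_le
  rw [← Subgroup.normal_mul]
  rfl

lemma card_le_mul_card_of_index_two_unique {G : Type*} [Group G] [Finite G]
    (hcomm : ∀ σ τ : G, σ * τ = τ * σ) (hexp : ∀ σ : G, σ ^ 16 = 1) (H : Subgroup G)
    (hH : ∀ B B' : Subgroup G, B.index = 2 → B'.index = 2 → H ≤ B → H ≤ B' → B = B') :
    Nat.card G ≤ 16 * Nat.card H := by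
  have hp : IsPGroup 2 G := fun g => ⟨4, hexp g⟩
  obtain ⟨n, hn⟩ := IsPGroup.iff_card.1 hp
  have key : ∀ K : Subgroup G, K ≠ ⊤ → ∃ B : Subgroup G, B.index = 2 ∧ K ≤ B := by
    intro K hK
    obtain ⟨k, hk⟩ := IsPGroup.iff_card.1 (hp.to_subgroup K)
    have hkn : k < n := by
      by_contra! h
      refine hK (Subgroup.eq_top_of_le_card K ?_)
      rw [hn, hk]
      exact Nat.pow_le_pow_right two_pos h
    obtain ⟨B, hB, hKB⟩ := Sylow.exists_subgroup_card_pow_prime_le 2 (m := n - 1)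
      (hn ▸ pow_dvd_pow 2 (Nat.sub_le n 1)) K hk (by omega)
    refine ⟨B, ?_, hKB⟩
    have h := B.card_mul_index
    rw [hB, hn, ← Nat.sub_add_cancel (show 1 ≤ n by omega), pow_succ] at h
    exact Nat.eq_of_mul_eq_mul_left (by positivity) h
  obtain ⟨x, hx⟩ : ∃ x : G, H ⊔ zpowers x = ⊤ := by
    by_contra! h
    obtain ⟨B, hB, hHB⟩ := key H fun h1 => h 1 (by simp [h1])
    have hBt : B = ⊤ := (eq_top_iff' B).2 fun x => by
      obtain ⟨B', hB', hHB'⟩ := key _ (h x)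
      rw [hH B B' hB hB' hHB (le_sup_left.trans hHB')]
      exact hHB' (le_sup_right (a := H) (Subgroup.mem_zpowers x))
    rw [hBt, index_top] at hB
    omega
  have h1 := card_sup_le hcomm H (zpowers x)
  rw [hx, card_top, Nat.card_zpowers] at h1
  rw [mul_comm]
  exact h1.trans (Nat.mul_le_mul_left _ (Nat.le_of_dvd (by norm_num)
    (orderOf_dvd_of_pow_eq_one (hexp x))))

lemma finrank_le_of_unramified (hcomm : ∀ σ τ : Gal(M/ℚ), σ * τ = τ * σ)
    (hexp : ∀ σ : Gal(M/ℚ), σ ^ 16 = 1) (S : Finset ℕ) (hS : ∀ p ∈ S, p.Prime ∧ p ≠ 2)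
    (hM : ∀ p : ℕ, p.Prime → p ≠ 2 → p ∉ S → ¬ (p : ℤ) ∣ discr M) :
    Module.finrank ℚ M ≤ 32 * ∏ p ∈ S, Nat.gcd 16 (p - 1) := by
  have hP : ∀ p : ℕ, ∃ P : Ideal (𝓞 M), p.Prime → P.IsPrime ∧ (p : 𝓞 M) ∈ P := by
    intro p
    by_cases hp : p.Prime
    · have hp' : Prime (p : ℤ) := prime_iff_prime_int.1 hp
      have : (span {(p : ℤ)}).IsPrime := (Ideal.span_singleton_prime hp'.ne_zero).2 hp'
      obtain ⟨⟨P, hPp, hPo⟩⟩ := (inferInstance :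
        Nonempty ((span {(p : ℤ)} : Ideal ℤ).primesOver (𝓞 M)))
      exact ⟨P, fun _ => ⟨hPp, by simpa using (liesOver_span_iff hPp.ne_top hp').1 hPo⟩⟩
    · exact ⟨⊤, fun h => absurd h hp⟩
  choose P hP using hP
  obtain ⟨φ⟩ := (inferInstance : Nonempty (M →+* ℂ))
  obtain ⟨c, hc⟩ := ComplexEmbedding.exists_comp_symm_eq_of_comp_eq (k := ℚ) φ
    (ComplexEmbedding.conjugate φ) (Subsingleton.elim _ _)
  have hc' : ComplexEmbedding.IsConj φ c.symm := hc.symm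
  set I : ℕ → Subgroup Gal(M/ℚ) := fun p => (P p).inertia Gal(M/ℚ) with hI
  set H : Subgroup Gal(M/ℚ) := zpowers c.symm ⊔ S.sup I with hH
  have key : ∀ B : Subgroup Gal(M/ℚ), B.index = 2 → H ≤ B →
      ∃ y : M, y ^ 2 = 2 ∧ ∀ σ, σ ∈ B ↔ σ y = y := by
    intro B hB hHB
    obtain ⟨d, y, hd, hy, hyB⟩ := exists_sq_eq_natCast_of_index_two hB hc'
      (hHB (le_sup_left (b := S.sup I) (Subgroup.mem_zpowers _)))
    have h2 : ∀ q ∈ d.primeFactors, q = 2 := by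
      intro q hq
      by_contra hq2
      have hqp := Nat.prime_of_mem_primeFactors hq
      have := (hP q hqp).1
      obtain ⟨σ, hσ, hσy⟩ := exists_mem_inertia_apply_ne hqp (Nat.dvd_of_mem_primeFactors hq)
        (fun h => hqp.one_lt.ne' (Nat.isUnit_iff.1 (hd q (by rwa [← sq])))) hy (P q) (hP q hqp).2
      by_cases hqS : q ∈ S
      · exact hσy ((hyB σ).1 (hHB (le_sup_right (a := zpowers c.symm)
          (Finset.le_sup (f := I) hqS hσ))))
      · have h1 := (not_dvd_discr_iff_forall_mem (𝒪 := 𝓞 M) _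
          (prime_iff_prime_int.1 hqp)).1 (hM q hqp hq2 hqS) (P q) this
          (by simpa using (hP q hqp).2)
        rw [← card_inertia_eq_one_iff (G := Gal(M/ℚ)), Subgroup.card_eq_one] at h1
        rw [h1, Subgroup.mem_bot] at hσ
        exact hσy (by rw [hσ, AlgEquiv.one_apply])
    have hd2 : d ∣ 2 := by
      rw [← Nat.prod_primeFactors_of_squarefree hd]
      exact (Finset.prod_dvd_prod_of_subset _ {2} _ fun q hq =>
        Finset.mem_singleton.2 (h2 q hq)).trans (by simp)
    rcases (Nat.dvd_prime prime_two).1 hd2 with rfl | rfl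
    · have hBt : B = ⊤ := (eq_top_iff' B).2 fun σ => (hyB σ).2 (by
        rcases sq_eq_one_iff.1 (show y ^ 2 = 1 by grind) with rfl | rfl <;> simp)
      rw [hBt, index_top] at hB
      omega
    · exact ⟨y, by grind, hyB⟩
  have h1 := card_le_mul_card_of_index_two_unique hcomm hexp H fun B B' hB hB' hHB hHB' => by
    obtain ⟨y, hy, hyB⟩ := key B hB hHB
    obtain ⟨y', hy', hyB'⟩ := key B' hB' hHB'
    ext σ
    rw [hyB, hyB']
    rcases sq_eq_sq_iff_eq_or_eq_neg.1 (hy.trans hy'.symm) with rfl | rfl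
    · rfl
    norm_num
  have h2 : Nat.card (zpowers c.symm) ≤ 2 := by
    rw [Nat.card_zpowers]
    refine Nat.le_of_dvd two_pos (orderOf_dvd_of_pow_eq_one ?_)
    ext x
    rw [sq]
    exact ComplexEmbedding.isConj_apply_apply hc' x
  have h3 : ∀ T ⊆ S, Nat.card ↥(T.sup I) ≤ ∏ p ∈ T, Nat.gcd 16 (p - 1) := by
    intro T
    induction T using Finset.induction_on with
    | empty => simp
    | insert p T hpT ih =>
      intro hT
      rw [Finset.insert_subset_iff] at hT
      have := (hP p (hS p hT.1).1).1
      rw [Finset.sup_insert, Finset.prod_insert hpT]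
      exact (card_sup_le hcomm _ _).trans (Nat.mul_le_mul (card_inertia_le_gcd (hS p hT.1).1
        (hS p hT.1).2 hcomm hexp (P p) (hP p (hS p hT.1).1).2) (ih hT.2))
  rw [← IsGalois.card_aut_eq_finrank]
  calc _ ≤ 16 * Nat.card H := h1
    _ ≤ 16 * (2 * ∏ p ∈ S, Nat.gcd 16 (p - 1)) := Nat.mul_le_mul_left _
      ((card_sup_le hcomm _ _).trans (Nat.mul_le_mul h2 (h3 S subset_rfl)))
    _ = _ := by ring

end SquareRoots

section ProductCharacters

open NumberField

lemma ker_cycChar_le {m n : ℕ} [NeZero m] [NeZero n] (h : m ∣ n) :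
    (cycChar n).ker ≤ (cycChar m).ker := fun σ hσ => by
  rw [MonoidHom.mem_ker] at hσ ⊢
  rw [← unitsMap_cycChar h, hσ, map_one]

lemma card_range_eq_orderOf {G : Type*} [Group G] (ψ : G →* C16) :
    Nat.card ψ.range = orderOf ψ := by
  refine Nat.dvd_antisymm ?_ (orderOf_dvd_of_pow_eq_one (MonoidHom.ext fun x => ?_))
  · rw [← IsCyclic.exponent_eq_card]
    refine Monoid.exponent_dvd_of_forall_pow_eq_one ?_
    rintro ⟨_, x, rfl⟩
    exact Subtype.ext (DFunLike.congr_fun (pow_orderOf_eq_one ψ) x)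
  · exact congrArg Subtype.val (pow_card_eq_one' (x := (⟨ψ x, x, rfl⟩ : ψ.range)))

section Family

variable {ι : Type*} [Fintype ι] (q : ι → ℕ) [∀ i, NeZero (q i)]

/-- The family of cyclotomic characters with the given moduli. -/
def piCycChar : Gal(Qbar/ℚ) →* ∀ i, (ZMod (q i))ˣ := MonoidHom.pi fun i => cycChar (q i)

instance neZero_prod (T : Finset ι) : NeZero (∏ i ∈ T, q i) :=
  ⟨Finset.prod_ne_zero_iff.2 fun _ _ => NeZero.ne _⟩

lemma ker_cycChar_prod_le : (cycChar (∏ i, q i)).ker ≤ (piCycChar q).ker := fun _ hσ =>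
  funext fun i => ker_cycChar_le (Finset.dvd_prod_of_mem q (Finset.mem_univ i)) hσ

variable {q}

lemma ker_cycChar_prod_le_ker_comp (Ψ : (∀ i, (ZMod (q i))ˣ) →* C16) :
    (cycChar (∏ i, q i)).ker ≤ (Ψ.comp (piCycChar q)).ker := fun σ hσ => by
  rw [MonoidHom.mem_ker, MonoidHom.comp_apply, ker_cycChar_prod_le q hσ, map_one]

lemma isOpen_ker_comp (Ψ : (∀ i, (ZMod (q i))ˣ) →* C16) :
    IsOpen ((Ψ.comp (piCycChar q)).ker : Set Gal(Qbar/ℚ)) :=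
  isOpen_ker_of_le (ker_cycChar_prod_le_ker_comp Ψ)

lemma isOpen_ker_comp_cycChar {n : ℕ} [NeZero n] (ψ : (ZMod n)ˣ →* C16) :
    IsOpen ((ψ.comp (cycChar n)).ker : Set Gal(Qbar/ℚ)) :=
  isOpen_ker_of_le (n := n) fun σ hσ => by simp_all

lemma finrank_kerField_comp_cycChar {n : ℕ} [NeZero n] (ψ : (ZMod n)ˣ →* C16) :
    Module.finrank ℚ (kerField (ψ.comp (cycChar n))) = orderOf ψ := by
  rw [finrank_kerField (isOpen_ker_comp_cycChar ψ), ← card_range_eq_orderOf,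
    MonoidHom.range_comp, MonoidHom.range_eq_top.2 (cycChar_surjective n),
    ← MonoidHom.range_eq_map]

variable {Ψ : (∀ i, (ZMod (q i))ˣ) →* C16}

lemma orderOf_mul_factorization_absDisc_kerField [DecidableEq ι]
    (hΨ : Function.Surjective (Ψ.comp (piCycChar q))) {p : ℕ} (hp : p.Prime) (i : ι)
    (hi : ∀ j ≠ i, ¬ p ∣ q j) :
    orderOf (Pi.monoidHomMulEquiv _ _ Ψ i) *
        (absDisc (kerField (Ψ.comp (piCycChar q)))).factorization p =
      16 * (absDisc (kerField ((Pi.monoidHomMulEquiv _ _ Ψ i).comp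
        (cycChar (q i))))).factorization p := by
  have h := finrank_mul_factorization_absDisc_kerField (m := ∏ j ∈ Finset.univ.erase i, q j) hp (by
      rw [hp.prime.dvd_finsetProd_iff]
      grind) (isOpen_ker_comp Ψ)
    (isOpen_ker_comp_cycChar (Pi.monoidHomMulEquiv _ _ Ψ i)) fun σ hσ => by
      refine congrArg Ψ (funext fun j => ?_)
      by_cases hj : j = i
      · subst hj
        simp [piCycChar]
      · rw [MonoidHom.mulSingle_apply, Pi.mulSingle_eq_of_ne hj]
        exact ker_cycChar_le (Finset.dvd_prod_of_mem q
          (Finset.mem_erase.2 ⟨hj, Finset.mem_univ j⟩)) hσ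
  rwa [finrank_kerField_comp_cycChar, finrank_kerField (isOpen_ker_comp Ψ),
    MonoidHom.range_eq_top.2 hΨ, card_top, card_eq_fintype_card,
    show Fintype.card C16 = 16 from rfl] at h

lemma not_dvd_absDisc_kerField_comp {p : ℕ} (hp : p.Prime) (hq : ∀ i, ¬ p ∣ q i) :
    ¬ p ∣ absDisc (kerField (Ψ.comp (piCycChar q))) := by
  have : NumberField (kerField (Ψ.comp (piCycChar q))) := numberField_fixedField (isOpen_ker_comp Ψ)
  refine not_dvd_absDisc_of_le (F := kerField (Ψ.comp (piCycChar q)))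
    (kerField_le_cycField (ker_cycChar_prod_le_ker_comp Ψ)) (not_dvd_absDisc_cycField hp ?_)
  rw [hp.prime.dvd_finsetProd_iff]
  grind

lemma eq_comp_piCycChar (hq : Pairwise (Function.onFun Nat.Coprime q))
    {f : Gal(Qbar/ℚ) →* C16} (hf : (piCycChar q).ker ≤ f.ker) :
    ∃ Ψ : (∀ i, (ZMod (q i))ˣ) →* C16, Ψ.comp (piCycChar q) = f :=
  have hs : Function.Surjective (piCycChar q) := fun u =>
    (pi_cycChar_surjective q hq u).imp fun _ h => funext h
  ⟨(piCycChar q).liftOfSurjective hs ⟨f, hf⟩,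
    (piCycChar q).liftOfRightInverse_comp _ (Function.rightInverse_surjInv hs) ⟨f, hf⟩⟩

variable (q) in
/-- The automorphisms whose images under all the cyclotomic characters are `n`th powers. -/
def powSubgroup (n : ℕ) : Subgroup Gal(Qbar/ℚ) :=
  (powMonoidHom n : (∀ i, (ZMod (q i))ˣ) →* _).range.comap (piCycChar q)

lemma index_powSubgroup (hq : Pairwise (Function.onFun Nat.Coprime q)) (n : ℕ) :
    (powSubgroup q n).index = ∏ i, Nat.card (powMonoidHom n : (ZMod (q i))ˣ →* _).ker := by
  rw [powSubgroup, Subgroup.index_comap_of_surjective _ fun u =>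
    (pi_cycChar_surjective q hq u).imp fun _ h => funext h, Subgroup.index_range, ← Nat.card_pi]
  exact Nat.card_congr ((Equiv.subtypeEquivRight fun u => funext_iff).trans
    (Equiv.subtypePiEquivPi (p := fun i u => u ∈ (powMonoidHom n : (ZMod (q i))ˣ →* _).ker)))

lemma commutator_mem_ker {G A : Type*} [Group G] [CommGroup A] (f : G →* A) (σ τ : G) :
    (τ * σ)⁻¹ * (σ * τ) ∈ f.ker := by
  rw [MonoidHom.mem_ker, map_mul, map_inv, map_mul, map_mul, mul_comm (f τ), inv_mul_cancel]

lemma finrank_le_of_powSubgroup {f : Gal(Qbar/ℚ) →* C16}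
    (hf : IsOpen (f.ker : Set Gal(Qbar/ℚ))) (S : Finset ℕ) (hS : ∀ p ∈ S, p.Prime ∧ p ≠ 2)
    (hd : ∀ p : ℕ, p.Prime → p ≠ 2 → p ∉ S → ¬ p ∣ absDisc (kerField f) ∧ ∀ i, ¬ p ∣ q i) :
    (powSubgroup q 16 ⊓ f.ker).index ≤ 32 * ∏ p ∈ S, Nat.gcd 16 (p - 1) ∧
      (powSubgroup q 16 ⊓ f.ker).index ≠ 0 := by
  have : (powSubgroup q 16).Normal := by
    unfold powSubgroup
    infer_instance
  have : (powSubgroup q 16 ⊓ f.ker).Normal := inferInstance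
  set K := powSubgroup q 16 ⊓ f.ker
  have hle : (piCycChar q).ker ≤ powSubgroup q 16 := (piCycChar q).ker_le_comap _
  have hoq := (cycField (∏ i, q i)).fixingSubgroup_isOpen
  rw [← ker_cycChar] at hoq
  have ho : IsOpen (K : Set Gal(Qbar/ℚ)) :=
    (Subgroup.isOpen_mono ((ker_cycChar_prod_le q).trans hle) hoq).inter hf
  have hcomm (σ τ) : (τ * σ)⁻¹ * (σ * τ) ∈ K :=
    ⟨hle (commutator_mem_ker _ σ τ), commutator_mem_ker f σ τ⟩
  have hexp (σ) : σ ^ 16 ∈ K := ⟨⟨piCycChar q σ, (map_pow _ _ _).symm⟩, by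
    refine (map_pow f σ 16).trans ?_
    exact pow_card_eq_one (G := C16)⟩
  have hM := numberField_fixedField ho
  have hG := isGalois_fixedField ho
  set M := fixedField K
  have hMK : M.fixingSubgroup = K := fixingSubgroup_fixedField_of_isOpen ho
  have hs : Function.Surjective (AlgEquiv.restrictNormalHom (F := ℚ) (K₁ := Qbar) M) :=
    AlgEquiv.restrictNormalHom_surjective Qbar
  have hker := (ker_restrictNormalHom M).trans hMK
  have h := finrank_le_of_unramified (M := M) (fun σ τ => by
      obtain ⟨σ, rfl⟩ := hs σ
      obtain ⟨τ, rfl⟩ := hs τ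
      rw [← map_mul, ← map_mul, eq_comm, ← inv_mul_eq_one, ← map_inv, ← map_mul,
        ← MonoidHom.mem_ker, hker]
      exact hcomm σ τ)
    (fun σ => by
      obtain ⟨σ, rfl⟩ := hs σ
      rw [← map_pow, ← MonoidHom.mem_ker, hker]
      exact hexp σ) S hS fun p hp hp2 hpS => by
      have : NumberField (kerField f) := numberField_fixedField hf
      have : IsGalois ℚ (kerField f) := isGalois_fixedField hf
      rw [Int.natCast_dvd, ← absDisc_eq_natAbs_discr]
      refine not_dvd_absDisc_of_le (E := kerField f ⊔ cycField (∏ i, q i)) ?_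
        (not_dvd_absDisc_sup hp (hd p hp hp2 hpS).1 (not_dvd_absDisc_cycField hp ?_))
      · rw [← InfiniteGalois.fixedField_fixingSubgroup (kerField f ⊔ cycField (∏ i, q i)),
          fixingSubgroup_sup, fixingSubgroup_kerField hf, ← ker_cycChar]
        refine fixedField_antitone (le_inf ?_ inf_le_left)
        exact inf_le_right.trans ((ker_cycChar_prod_le q).trans hle)
      · rw [hp.prime.dvd_finsetProd_iff]
        simpa using (hd p hp hp2 hpS).2
  have h1 := IntermediateField.finrank_eq_fixingSubgroup_index Qbar M
  rw [hMK] at h1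
  exact ⟨h1 ▸ h, h1 ▸ (finrank_pos (R := ℚ) (M := M)).ne'⟩

end Family

end ProductCharacters

section CountByCharacters

open NumberField

/-- The odd primes up to `x`. -/
def oddPrimes (x : ℕ) : Finset ℕ := {p ∈ Finset.Icc 1 x | p.Prime ∧ p ≠ 2}

variable {x : ℕ}

lemma mem_oddPrimes {p : ℕ} : p ∈ oddPrimes x ↔ p ≤ x ∧ p.Prime ∧ p ≠ 2 := by
  rw [oddPrimes, Finset.mem_filter, Finset.mem_Icc]
  exact ⟨fun h => ⟨h.1.2, h.2⟩, fun h => ⟨⟨h.2.1.one_le, h.1⟩, h.2⟩⟩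

/-- The moduli `64` and the odd primes up to `x`. -/
def modulus (x : ℕ) (i : Option (oddPrimes x)) : ℕ := i.elim 64 (↑)

instance neZero_modulus (i : Option (oddPrimes x)) : NeZero (modulus x i) := match i with
  | none => ⟨show 64 ≠ 0 by simp⟩
  | some p => ⟨(mem_oddPrimes.1 p.2).2.1.ne_zero⟩

lemma not_dvd_modulus_some {p : ℕ} (hp : p.Prime) {r : oddPrimes x} (h : p ≠ r) :
    ¬ p ∣ modulus x (some r) := fun hd =>
  h ((Nat.prime_dvd_prime_iff_eq hp (mem_oddPrimes.1 r.2).2.1).1 hd)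

lemma not_dvd_modulus_none {p : ℕ} (hp : p.Prime) (h : p ≠ 2) : ¬ p ∣ modulus x none :=
  fun hd => h ((Nat.prime_dvd_prime_iff_eq hp prime_two).1 (hp.dvd_of_dvd_pow (n := 6) hd))

lemma pairwise_coprime_modulus : Pairwise (Function.onFun Nat.Coprime (modulus x)) := by
  have key (p : oddPrimes x) (j) (hj : j ≠ some p) : Nat.Coprime p (modulus x j) := by
    have hp := (mem_oddPrimes.1 p.2).2
    refine (Nat.Prime.coprime_iff_not_dvd hp.1).2 ?_
    rcases j with _ | r
    · exact not_dvd_modulus_none hp.1 hp.2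
    · exact not_dvd_modulus_some hp.1 fun h => hj (by grind)
  rintro (_ | p) j hj
  · rcases j with _ | r
    · grind
    · exact (key r none hj).symm
  · exact key p j hj.symm

lemma pow_sixteen_units_zmod_sixtyFour : ∀ u : (ZMod 64)ˣ, u ^ 16 = 1 := by decide +kernel

lemma card_ker_powMonoidHom_modulus :
    ∏ i, Nat.card (powMonoidHom 16 : (ZMod (modulus x i))ˣ →* _).ker =
      32 * ∏ p ∈ oddPrimes x, Nat.gcd 16 (p - 1) := by
  rw [Fintype.prod_option, ← prod_coe_sort (oddPrimes x)]
  refine congrArg₂ (· * ·) ?_ (Finset.prod_congr rfl fun p _ => ?_)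
  · change Nat.card (powMonoidHom 16 : (ZMod 64)ˣ →* (ZMod 64)ˣ).ker = _
    rw [(eq_top_iff' _).2 fun u => MonoidHom.mem_ker.2
      (pow_sixteen_units_zmod_sixtyFour u), card_top,
      card_eq_fintype_card, ZMod.card_units_eq_totient]
    decide +kernel
  · have hp := (mem_oddPrimes.1 p.2).2.1
    have : Fact (p : ℕ).Prime := ⟨hp⟩
    change Nat.card (powMonoidHom 16 : (ZMod p)ˣ →* (ZMod p)ˣ).ker = _
    rw [IsCyclic.card_powMonoidHom_ker, card_eq_fintype_card, ZMod.card_units_eq_totient,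
      Nat.totient_prime hp, Nat.gcd_comm]

lemma ker_piCycChar_modulus_le {f : Gal(Qbar/ℚ) →* C16}
    (hf : IsOpen (f.ker : Set Gal(Qbar/ℚ))) (hx : absDisc (kerField f) ≤ x) :
    (piCycChar (modulus x)).ker ≤ f.ker := by
  have hK : NumberField (kerField f) := numberField_fixedField hf
  obtain ⟨h1, h2⟩ := finrank_le_of_powSubgroup (q := modulus x) hf (oddPrimes x)
    (fun p hp => (mem_oddPrimes.1 hp).2) fun p hp hp2 hpS => by
      refine ⟨fun hd => hpS (mem_oddPrimes.2 ⟨(Nat.le_of_dvd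
        (Nat.pos_of_ne_zero (absDisc_ne_zero _)) hd).trans hx, hp, hp2⟩), ?_⟩
      rintro (_ | r)
      · exact not_dvd_modulus_none hp hp2
      · exact not_dvd_modulus_some hp fun h => hpS (h ▸ r.2)
  rw [← card_ker_powMonoidHom_modulus, ← index_powSubgroup pairwise_coprime_modulus,
    ← Subgroup.relIndex_mul_index inf_le_left] at h1
  rw [← Subgroup.relIndex_mul_index inf_le_left] at h2
  have h3 := Nat.le_of_mul_le_mul_right (h1.trans_eq (one_mul _).symm)
    (Nat.pos_of_ne_zero (right_ne_zero_of_mul h2))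
  have h4 := Subgroup.relIndex_eq_one.1
    (h3.antisymm (Nat.one_le_iff_ne_zero.2 (left_ne_zero_of_mul h2)))
  exact ((piCycChar _).ker_le_comap _).trans (h4.trans inf_le_right)

/-- The exponent of `p` in the discriminant of a cyclic field of degree `16` with tame inertia
group of order `d` at `p`. -/
def tameExp (d : ℕ) : ℕ := 16 - 16 / d

/-- The exponent of `2` in the discriminant of a cyclic field of degree `16` whose component at
`2` is the given character. -/
def wildExp (a : (ZMod 64)ˣ →* C16) : ℕ :=
  16 * (absDisc (kerField (a.comp (cycChar 64)))).factorization 2 / orderOf a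

/-- The odd part of the discriminant of the field cut out by a surjective family of characters. -/
def tameDisc (ψ : ∀ p : oddPrimes x, (ZMod (modulus x (some p)))ˣ →* C16) : ℕ :=
  ∏ p : oddPrimes x, (p : ℕ) ^ tameExp (orderOf (ψ p))

/-- The discriminant of the field cut out by a surjective family of characters. -/
def charDisc (χ : ∀ i, (ZMod (modulus x i))ˣ →* C16) : ℕ :=
  2 ^ wildExp (χ none) * tameDisc fun p => χ (some p)

lemma pow_sixteen_eq_one {G : Type*} [Group G] (ψ : G →* C16) : ψ ^ 16 = 1 :=
  MonoidHom.ext fun _ => pow_card_eq_one (G := C16)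

lemma orderOf_pos_character {G : Type*} [Group G] (ψ : G →* C16) : 0 < orderOf ψ :=
  (isOfFinOrder_iff_pow_eq_one.2 ⟨16, by simp, pow_sixteen_eq_one ψ⟩).orderOf_pos

variable {Ψ : (∀ i, (ZMod (modulus x i))ˣ) →* C16}

lemma piCycChar_modulus_surjective : Function.Surjective (piCycChar (modulus x)) := fun u =>
  (pi_cycChar_surjective _ pairwise_coprime_modulus u).imp fun _ h => funext h

lemma absDisc_kerField_comp (hΨ : Function.Surjective Ψ) :
    absDisc (kerField (Ψ.comp (piCycChar (modulus x)))) =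
      charDisc (Pi.monoidHomMulEquiv _ _ Ψ) := by
  have hs : Function.Surjective (Ψ.comp (piCycChar (modulus x))) :=
    hΨ.comp piCycChar_modulus_surjective
  have : NumberField (kerField (Ψ.comp (piCycChar (modulus x)))) :=
    numberField_fixedField (isOpen_ker_comp Ψ)
  have h2 : 2 ∉ oddPrimes x := fun h => (mem_oddPrimes.1 h).2.2 rfl
  set n := absDisc (kerField (Ψ.comp (piCycChar (modulus x)))) with hn
  have hn0 : n ≠ 0 := absDisc_ne_zero _
  have hsub : n.factorization.support ⊆ insert 2 (oddPrimes x) := fun p hp => by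
    have hpp := Nat.prime_of_mem_primeFactors hp
    by_contra! h
    rw [Finset.mem_insert, not_or] at h
    refine not_dvd_absDisc_kerField_comp (Ψ := Ψ) hpp ?_ (Nat.dvd_of_mem_primeFactors hp)
    rintro (_ | r)
    · exact not_dvd_modulus_none hpp h.1
    · exact not_dvd_modulus_some hpp fun hr => h.2 (hr ▸ r.2)
  rw [← Nat.prod_factorization_pow_eq_self hn0, Finsupp.prod_of_support_subset _ hsub _
    fun _ _ => pow_zero _, Finset.prod_insert h2, ← prod_coe_sort, charDisc,
    tameDisc]
  congr 1
  · congr 1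
    refine (Nat.div_eq_of_eq_mul_right (orderOf_pos_character _) ?_).symm
    refine (orderOf_mul_factorization_absDisc_kerField hs prime_two none ?_).symm
    rintro (_ | r) hr
    · grind
    · exact not_dvd_modulus_some prime_two fun h => h2 (h ▸ r.2)
  · refine Finset.prod_congr rfl fun p _ => ?_
    congr 1
    have hp := (mem_oddPrimes.1 p.2).2
    have h := orderOf_mul_factorization_absDisc_kerField hs hp.1 (some p) (by
      rintro (_ | r) hr
      · exact not_dvd_modulus_none hp.1 hp.2
      · exact not_dvd_modulus_some hp.1 fun h => hr (by grind))
    have : NeZero (p : ℕ) := ⟨hp.1.ne_zero⟩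
    have h1 : (absDisc (kerField ((Pi.monoidHomMulEquiv _ _ Ψ (some p)).comp
        (cycChar (modulus x (some p)))))).factorization p = _ :=
      factorization_absDisc_kerField (p := p) hp.1 fun σ hσ =>
        (congrArg (Pi.monoidHomMulEquiv _ _ Ψ (some p)) hσ).trans (map_one _)
    rw [h1, finrank_kerField_comp_cycChar] at h
    set d := orderOf (Pi.monoidHomMulEquiv _ _ Ψ (some p)) with hd
    have hd0 : 0 < d := orderOf_pos_character _
    obtain ⟨k, hk⟩ : d ∣ 16 := orderOf_dvd_of_pow_eq_one (pow_sixteen_eq_one _)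
    rw [tameExp, hk, Nat.mul_div_cancel_left _ hd0]
    refine Nat.eq_of_mul_eq_mul_left hd0 ?_
    rw [h, Nat.mul_sub, Nat.mul_sub, ← hk, mul_one, mul_comm]

lemma eight_mul_galoisCount (X : ℝ) :
    8 * galoisCount C16 X = Nat.card {Ψ : (∀ i, (ZMod (modulus ⌊X⌋₊ i))ˣ) →* C16 //
      Function.Surjective Ψ ∧ (charDisc (Pi.monoidHomMulEquiv _ _ Ψ) : ℝ) ≤ X} := by
  have key : ∀ L : {L : IntermediateField ℚ Qbar // FiniteDimensional ℚ L ∧ IsGalois ℚ L ∧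
      Nonempty ((L ≃ₐ[ℚ] L) ≃* C16) ∧ (absDisc L : ℝ) ≤ X},
      ∃ Ψ : (∀ i, (ZMod (modulus ⌊X⌋₊ i))ˣ) →* C16,
        Function.Surjective Ψ ∧ kerField (Ψ.comp (piCycChar _)) = L.1 := by
    rintro ⟨L, h1, h2, ⟨e⟩, hL⟩
    have : NumberField L := ⟨⟩
    obtain ⟨f, hs, ho, rfl⟩ := exists_kerField_eq e
    obtain ⟨Ψ, rfl⟩ := eq_comp_piCycChar pairwise_coprime_modulus
      (ker_piCycChar_modulus_le ho (Nat.le_floor hL))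
    exact ⟨Ψ, Function.Surjective.of_comp (f := Ψ) (g := piCycChar _) hs, rfl⟩
  choose Θ hΘs hΘ using key
  have hcard : Nat.card (MulAut C16) = 8 := by
    rw [IsCyclic.card_mulAut, card_eq_fintype_card]
    decide
  rw [galoisCount, ← hcard, ← Nat.card_prod]
  have hker (e : MulAut C16) (Ψ : (∀ i, (ZMod (modulus ⌊X⌋₊ i))ˣ) →* C16) :
      kerField ((e.toMonoidHom.comp Ψ).comp (piCycChar _)) = kerField (Ψ.comp (piCycChar _)) := by
    have : ((e.toMonoidHom.comp Ψ).comp (piCycChar _)).ker = (Ψ.comp (piCycChar _)).ker := by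
      ext σ
      norm_num
    rw [kerField, this, kerField]
  refine Nat.card_congr (Equiv.ofBijective
    (fun y => ⟨y.1.toMonoidHom.comp (Θ y.2), y.1.surjective.comp (hΘs _), ?_⟩) ⟨?_, ?_⟩)
  · rw [← absDisc_kerField_comp (y.1.surjective.comp (hΘs _)), hker, hΘ]
    exact y.2.2.2.2.2
  · rintro ⟨e, L⟩ ⟨e', L'⟩ h
    have h1 : e.toMonoidHom.comp (Θ L) = e'.toMonoidHom.comp (Θ L') := congrArg Subtype.val h
    have h2 : L = L' := Subtype.ext (by rw [← hΘ, ← hΘ, ← hker e, h1, hker])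
    subst h2
    refine Prod.ext (MulEquiv.ext fun c => ?_) rfl
    obtain ⟨u, rfl⟩ := hΘs L c
    exact DFunLike.congr_fun h1 u
  · rintro ⟨Ψ, hΨ, hD⟩
    have hs := hΨ.comp piCycChar_modulus_surjective
    rw [← absDisc_kerField_comp hΨ] at hD
    have hn : NumberField (kerField (Ψ.comp (piCycChar _))) :=
      numberField_fixedField (isOpen_ker_comp Ψ)
    let L : {L : IntermediateField ℚ Qbar // FiniteDimensional ℚ L ∧ IsGalois ℚ L ∧
      Nonempty ((L ≃ₐ[ℚ] L) ≃* C16) ∧ (absDisc L : ℝ) ≤ X} :=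
      ⟨kerField (Ψ.comp (piCycChar _)), hn.to_finiteDimensional,
        isGalois_fixedField (isOpen_ker_comp Ψ),
        nonempty_gal_kerField_mulEquiv (isOpen_ker_comp Ψ) hs, hD⟩
    obtain ⟨e, he⟩ := nonempty_mulEquiv_of_ker_eq
      (f := (Θ L).comp (piCycChar _)) (g := Ψ.comp (piCycChar _))
      ((hΘs L).comp piCycChar_modulus_surjective) hs (by
        rw [← fixingSubgroup_kerField (isOpen_ker_comp Ψ),
          ← fixingSubgroup_kerField (isOpen_ker_comp (Θ L)), hΘ])
    refine ⟨(e, L), Subtype.ext (MonoidHom.ext fun u => ?_)⟩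
    obtain ⟨σ, rfl⟩ := piCycChar_modulus_surjective u
    exact he σ

end CountByCharacters

section CharacterCount

instance fintype_character (n : ℕ) [NeZero n] : Fintype ((ZMod n)ˣ →* C16) :=
  have := Finite.of_injective _ (DFunLike.coe_injective (F := (ZMod n)ˣ →* C16))
  ofFinite _

lemma isCyclic_and_card_character {G : Type*} [CommGroup G] [IsCyclic G] :
    IsCyclic (G →* C16) ∧ Nat.card (G →* C16) = Nat.gcd 16 (Nat.card G) := by
  obtain ⟨e⟩ := IsCyclic.monoidHom_mulEquiv_rootsOfUnity G C16
  have : IsCyclic C16ˣ := isCyclic_of_surjective toUnits.toMonoidHom toUnits.surjective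
  refine ⟨isCyclic_of_surjective e.symm.toMonoidHom e.symm.surjective, ?_⟩
  rw [Nat.card_congr e.toEquiv, show rootsOfUnity (Nat.card G) C16 =
    (powMonoidHom (Nat.card G)).ker from rfl, IsCyclic.card_powMonoidHom_ker,
    ← Nat.card_congr (toUnits (G := C16)).toEquiv, card_eq_fintype_card]
  rfl

lemma card_orderOf_character {p : ℕ} (hp : p.Prime) [NeZero p] {j : ℕ} (hj : j < 4) :
    Finset.card {ψ : (ZMod p)ˣ →* C16 | orderOf ψ = 2 ^ (j + 1)} =
      if p % 2 ^ (j + 1) = 1 then 2 ^ j else 0 := by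
  have : Fact p.Prime := ⟨hp⟩
  obtain ⟨hc, hcard⟩ := isCyclic_and_card_character (G := (ZMod p)ˣ)
  rw [card_eq_fintype_card (α := (ZMod p)ˣ), ZMod.card_units_eq_totient,
    Nat.totient_prime hp, card_eq_fintype_card] at hcard
  have hiff : p % 2 ^ (j + 1) = 1 ↔ 2 ^ (j + 1) ∣ Nat.gcd 16 (p - 1) := by
    have h2 := hp.two_le
    rw [Nat.dvd_gcd_iff, and_iff_right (show 2 ^ (j + 1) ∣ 16 from pow_dvd_pow 2 (n := 4) (by omega))]
    interval_cases j <;> omega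
  split_ifs with h
  · rw [IsCyclic.card_orderOf_eq_totient (by grind), Nat.totient_prime_pow_succ prime_two]
    grind
  · rw [Finset.card_eq_zero, Finset.filter_eq_empty_iff]
    intro ψ _ hψ
    rw [hiff, ← hcard, ← hψ] at h
    exact h (orderOf_dvd_card)

lemma card_filter_tameExp {J : ℕ} (hJ : J = 3 ∨ J = 4) {p : ℕ} (hp : p.Prime) [NeZero p]
    (k : ℕ) : Finset.card {ψ : (ZMod p)ˣ →* C16 | ψ ^ 2 ^ J = 1 ∧ tameExp (orderOf ψ) = k} =
      localCount J p k := by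
  have hd (ψ : (ZMod p)ˣ →* C16) : ∃ m ≤ 4, orderOf ψ = 2 ^ m :=
    (Nat.dvd_prime_pow prime_two).1 (orderOf_dvd_of_pow_eq_one (pow_sixteen_eq_one ψ))
  rw [localCount]
  split_ifs with hk
  · rw [Finset.card_eq_one]
    refine ⟨1, Finset.ext fun ψ => ?_⟩
    rw [Finset.mem_filter, and_iff_right (Finset.mem_univ ψ), Finset.mem_singleton, hk,
      ← orderOf_eq_one_iff (x := ψ), ← orderOf_dvd_iff_pow_eq_one]
    obtain ⟨m, hm, hψ⟩ := hd ψ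
    rw [hψ]
    rcases hJ with rfl | rfl <;> interval_cases m <;> simp [tameExp]
  · have h (j) (hj : j ∈ Finset.range J) :
        (if discExp j = k ∧ p % 2 ^ (j + 1) = 1 then 2 ^ j else 0) =
          ∑ ψ : (ZMod p)ˣ →* C16, if discExp j = k ∧ orderOf ψ = 2 ^ (j + 1) then 1 else 0 := by
      have hj4 : j < 4 := by grind
      rw [Finset.sum_boole, ite_and, ← card_orderOf_character hp hj4]
      split_ifs with h1 <;> simp [h1]
    rw [Finset.sum_congr rfl h, Finset.sum_comm, Finset.card_filter]
    refine Finset.sum_congr rfl fun ψ _ => ?_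
    obtain ⟨m, hm, hψ⟩ := hd ψ
    simp only [← orderOf_dvd_iff_pow_eq_one, hψ]
    clear h hψ
    rcases hJ with rfl | rfl <;> interval_cases m <;>
      simp only [Finset.sum_range_succ, Finset.sum_range_zero] <;>
      simp [tameExp, discExp, Ne.symm hk]

variable {x : ℕ}

lemma factorization_prod_pow_coe {S : Finset ℕ} (hS : ∀ p ∈ S, p.Prime) (t : S → ℕ) (r : S) :
    (∏ p : S, (p : ℕ) ^ t p).factorization r = t r := by
  rw [Nat.factorization_prod_apply fun (p : S) _ => pow_ne_zero _ (hS p p.2).ne_zero,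
    Finset.sum_eq_single r _ fun h => absurd (Finset.mem_univ r) h,
    (hS r r.2).factorization_pow, Finsupp.single_eq_same]
  intro p _ hpr
  rw [(hS p p.2).factorization_pow, Finsupp.single_eq_of_ne fun h => hpr (Subtype.ext h.symm)]

lemma card_filter_prod_eq {J : ℕ} (hJ : J = 3 ∨ J = 4) {n : ℕ} (hn : n ≠ 0) (hnx : n ≤ x) :
    Finset.card {ψ : ∀ p : oddPrimes x, (ZMod (modulus x (some p)))ˣ →* C16 |
      (∀ p, ψ p ^ 2 ^ J = 1) ∧ tameDisc ψ = n} =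
      fieldCount J n := by
  have hS : ∀ p ∈ oddPrimes x, p.Prime := fun p hp => (mem_oddPrimes.1 hp).2.1
  rw [fieldCount, if_neg hn]
  by_cases h2 : 2 ∣ n
  · rw [Finsupp.prod, Finset.prod_eq_zero (i := 2), Finset.card_eq_zero, Finset.filter_eq_empty_iff]
    · rintro ψ - ⟨-, h⟩
      rw [← h, tameDisc, prime_two.prime.dvd_finsetProd_iff] at h2
      obtain ⟨p, -, hp⟩ := h2
      exact not_dvd_modulus_some (r := p) prime_two
        (fun h => (mem_oddPrimes.1 p.2).2.2 h.symm) (prime_two.dvd_of_dvd_pow hp)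
    · exact Nat.mem_primeFactors.2 ⟨prime_two, h2, hn⟩
    · have : n.factorization 2 ≠ 0 := (prime_two.factorization_pos_of_dvd hn h2).ne'
      rw [localCount, if_neg this]
      refine Finset.sum_eq_zero fun j _ => if_neg fun h => ?_
      have h1 := Nat.mod_mod_of_dvd 2 (dvd_pow_self 2 j.succ_ne_zero)
      grind
  · have hsub : n.factorization.support ⊆ oddPrimes x := fun p hp => by
      have hd := Nat.dvd_of_mem_primeFactors hp
      exact mem_oddPrimes.2 ⟨(Nat.le_of_dvd (Nat.pos_of_ne_zero hn) hd).trans hnx,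
        Nat.prime_of_mem_primeFactors hp, fun h => h2 (h ▸ hd)⟩
    rw [Finsupp.prod_of_support_subset _ hsub (localCount J) fun _ _ => if_pos rfl,
      ← prod_coe_sort (oddPrimes x)]
    have (p : oddPrimes x) := card_filter_tameExp hJ (p := modulus x (some p))
      (hS p p.2) (n.factorization p)
    refine Eq.trans ?_ (Finset.prod_congr rfl fun p _ => this p)
    rw [← Fintype.card_piFinset]
    congr 1
    ext ψ
    rw [Finset.mem_filter, mem_piFinset, and_iff_right (Finset.mem_univ _)]
    simp only [Finset.mem_filter, Finset.mem_univ, true_and]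
    rw [forall_and]
    refine and_congr_right fun _ => ⟨fun h p => ?_, fun h => ?_⟩
    · rw [← h, tameDisc, factorization_prod_pow_coe hS]
    · rw [tameDisc, ← Nat.prod_factorization_pow_eq_self hn, Finsupp.prod_of_support_subset _ hsub _
        fun _ _ => pow_zero _, ← prod_coe_sort (oddPrimes x)]
      exact Finset.prod_congr rfl fun p _ => by rw [h]

lemma card_filter_charDisc_le {J : ℕ} (hJ : J = 3 ∨ J = 4) (X : ℝ) :
    (Finset.card {χ : ∀ i, (ZMod (modulus ⌊X⌋₊ i))ˣ →* C16 |
      χ ^ 2 ^ J = 1 ∧ (charDisc χ : ℝ) ≤ X} : ℝ) =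
      ∑ a : (ZMod 64)ˣ →* C16 with a ^ 2 ^ J = 1, fieldCountSum J (X / (2 ^ wildExp a : ℕ)) := by
  have hS : ∀ p ∈ oddPrimes ⌊X⌋₊, p.Prime := fun p hp => (mem_oddPrimes.1 hp).2.1
  have key (a : (ZMod 64)ˣ →* C16) :
      Finset.card {ψ : ∀ p : oddPrimes ⌊X⌋₊, (ZMod (modulus ⌊X⌋₊ (some p)))ˣ →* C16 |
        (∀ p, ψ p ^ 2 ^ J = 1) ∧ ((2 ^ wildExp a * tameDisc ψ : ℕ) : ℝ) ≤ X} =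
      ∑ n ∈ Finset.Icc 1 ⌊X / (2 ^ wildExp a : ℕ)⌋₊, fieldCount J n := by
    have h2 : (0 : ℝ) < (2 ^ wildExp a : ℕ) := by positivity
    have hle : ⌊X / (2 ^ wildExp a : ℕ)⌋₊ ≤ ⌊X⌋₊ := by
      rw [Nat.floor_div_natCast]
      exact Nat.div_le_self _ _
    have hp0 (ψ : ∀ p : oddPrimes ⌊X⌋₊, (ZMod (modulus ⌊X⌋₊ (some p)))ˣ →* C16) : tameDisc ψ ≠ 0 :=
      Finset.prod_ne_zero_iff.2 fun (p : oddPrimes _) _ => pow_ne_zero _ (hS p p.2).ne_zero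
    have hiff (ψ : ∀ p : oddPrimes ⌊X⌋₊, (ZMod (modulus ⌊X⌋₊ (some p)))ˣ →* C16) :
        ((2 ^ wildExp a * tameDisc ψ : ℕ) : ℝ) ≤ X ↔
        tameDisc ψ ≤ ⌊X / (2 ^ wildExp a : ℕ)⌋₊ := by
      rw [Nat.le_floor_iff' (hp0 ψ), le_div_iff₀ h2, mul_comm, Nat.cast_mul]
    rw [Finset.card_eq_sum_card_fiberwise (t := Finset.Icc 1 ⌊X / (2 ^ wildExp a : ℕ)⌋₊)
      (f := tameDisc)]
    · refine Finset.sum_congr rfl fun n hn => ?_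
      rw [Finset.mem_Icc] at hn
      rw [← card_filter_prod_eq hJ (Nat.one_le_iff_ne_zero.1 hn.1) (hn.2.trans hle),
        Finset.filter_filter]
      congr 1
      refine Finset.filter_congr fun ψ _ => ?_
      grind
    · intro ψ hψ
      grind
  simp only [fieldCountSum, ← Nat.cast_sum, ← key]
  rw [Nat.cast_inj, Finset.sum_filter, Finset.card_filter,
    Fintype.sum_equiv Equiv.piOptionEquivProd _ (fun y => if (y.1 ^ 2 ^ J = 1 ∧
      ∀ p, y.2 p ^ 2 ^ J = 1) ∧ ((2 ^ wildExp y.1 * tameDisc y.2 : ℕ) : ℝ) ≤ X then 1 else 0),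
    Fintype.sum_prod_type]
  · refine Finset.sum_congr rfl fun a _ => ?_
    rw [Finset.card_filter]
    split_ifs with h
    · exact Finset.sum_congr rfl fun ψ _ => if_congr (and_congr_left' (and_iff_right h)) rfl rfl
    · exact Finset.sum_eq_zero fun ψ _ => if_neg fun h1 => h h1.1.1
  · intro χ
    congr 1
    rw [funext_iff, Option.forall]
    rfl

lemma surjective_iff_pow_eight_ne_one {G : Type*} [Group G] (Ψ : G →* C16) :
    Function.Surjective Ψ ↔ Ψ ^ 8 ≠ 1 := by
  have h16 : ∀ c : C16, c ^ 8 ≠ 1 → ∀ d, ∃ k < 16, c ^ k = d := by decide +kernel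
  refine ⟨fun h h8 => ?_, fun h => ?_⟩
  · obtain ⟨u, hu⟩ := h (Multiplicative.ofAdd 1)
    have := DFunLike.congr_fun h8 u
    rw [MonoidHom.pow_apply, hu] at this
    exact (show Multiplicative.ofAdd (1 : ZMod 16) ^ 8 ≠ 1 by decide) this
  · obtain ⟨u, hu⟩ : ∃ u, Ψ u ^ 8 ≠ 1 := by
      by_contra! h1
      exact h (MonoidHom.ext h1)
    intro d
    obtain ⟨k, -, hk⟩ := h16 _ hu d
    exact ⟨u ^ k, by grind⟩

lemma eight_mul_galoisCount_eq (X : ℝ) : 8 * (galoisCount C16 X : ℝ) =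
      ∑ a : (ZMod 64)ˣ →* C16, fieldCountSum 4 (X / (2 ^ wildExp a : ℕ)) -
      ∑ a : (ZMod 64)ˣ →* C16 with a ^ 8 = 1, fieldCountSum 3 (X / (2 ^ wildExp a : ℕ)) := by
  have h3 := card_filter_charDisc_le (Or.inl rfl) X
  have h4 := card_filter_charDisc_le (Or.inr rfl) X
  have hs (χ : ∀ i, (ZMod (modulus ⌊X⌋₊ i))ˣ →* C16) : χ ^ 2 ^ 4 = 1 :=
    funext fun i => pow_sixteen_eq_one (χ i)
  have hs' (a : (ZMod 64)ˣ →* C16) : a ^ 2 ^ 4 = 1 := pow_sixteen_eq_one a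
  simp only [hs, hs', true_and, Finset.filter_true] at h4
  rw [show (8 : ℕ) = 2 ^ 3 by norm_num, ← h3, ← h4, eq_sub_iff_add_eq]
  have h := eight_mul_galoisCount X
  rw [Nat.card_congr ((Pi.monoidHomMulEquiv _ _).toEquiv.subtypeEquiv (q := fun χ =>
    χ ^ 2 ^ 3 ≠ 1 ∧ (charDisc χ : ℝ) ≤ X) fun Ψ => by
      rw [surjective_iff_pow_eight_ne_one, show (Pi.monoidHomMulEquiv _ _).toEquiv Ψ = Pi.monoidHomMulEquiv _ _ Ψ from rfl,
        ← map_pow, Ne, Ne,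
        EmbeddingLike.map_eq_one_iff]
      rfl), card_eq_fintype_card, Fintype.card_subtype] at h
  have h' : (8 : ℝ) * galoisCount C16 X = (8 * galoisCount C16 X : ℕ) := by grind
  rw [h', h, ← Nat.cast_add, Nat.cast_inj]
  rw [add_comm, ← Finset.card_filter_add_card_filter_not (s := {χ | (charDisc χ : ℝ) ≤ X}) (fun χ : ∀ i, (ZMod (modulus ⌊X⌋₊ i))ˣ →* C16 => χ ^ 2 ^ 3 = 1),
    Finset.filter_filter, Finset.filter_filter]
  simp only [and_comm]

end CharacterCount

end

/-- asymptotic count of C₁₆-extensions of ℚ with square-root saving error. -/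
theorem count_C16_fields :
    ∃ c₈ c₁₂ c₁₄ c₁₅ : ℝ, 0 < c₈ ∧
      (fun X : ℝ => (galoisCount (Multiplicative (ZMod 16)) X : ℝ)
          - c₈ * X ^ ((1:ℝ)/8) - c₁₂ * X ^ ((1:ℝ)/12) - c₁₄ * X ^ ((1:ℝ)/14)
          - c₁₅ * X ^ ((1:ℝ)/15))
        =O[Filter.atTop] fun X : ℝ => X ^ ((1:ℝ)/16) * Real.log X ^ 17 :=
  exists_asymptotic_of_eq_fieldCountSum (Finset.filter_subset _ _) ⟨1, by simp⟩
    (fun a => 2 ^ wildExp a) (fun _ _ => Nat.one_le_two_pow) fun X _ => eight_mul_galoisCount_eq X
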